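/- (Hölder continuity of the gradient of the heat kernel in the backward variable.) Assume σ satisfies hypothesis (H^σ_α) for some α ∈ (0,1] and b satisfies hypothesis (H^b_β) for some β ∈ [0,1]. Fix T > 0, γ₁ ∈ (0,1) and (s,t) ∈ 𝔻^T_0. Let (ℙ_{s,x})_{x∈ℝ^d} be a family of solutions of the martingale problem for (b,σ) started at (s,x), and let p(s,·,t,·) : ℝ^d×ℝ^d → ℝ be jointly continuous, continuously differentiable in x, and such that for every x, p(s,x,t,·) is a density of the law of X_t under ℙ_{s,x}. Then there exist constants C, λ > 0 depending only on Θ = (T,α,β,κ₀,κ₁,d) and γ₁ such that for all x, x', y ∈ ℝ^d: |∇_x p(s,x,t,y) − ∇_x p(s,x',t,y)| ≤ C·|x−x'|^{γ₁}·(t−s)^{−(1+γ₁)/2}·( g_λ(t−s, θ^{(1)}_{t,s}(x)−y) + g_λ(t−s, θ^{(1)}_{t,s}(x')−y) ). -/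

import Mathlib

noncomputable section

open MeasureTheory Matrix Set

/-- The state space `ℝ^d`. -/
abbrev Vec (d : ℕ) := EuclideanSpace ℝ (Fin d)

/-- Hypothesis (H^b_β): `b` is measurable, bounded at the origin uniformly in time
and Hölder/Lipschitz in space uniformly in time. -/
def HolderDrift (d : ℕ) (b : ℝ → Vec d → Vec d) (κ₁ β : ℝ) : Prop :=
  Measurable (Function.uncurry b) ∧
  (∀ t : ℝ, 0 ≤ t → ‖b t 0‖ ≤ κ₁) ∧
  (∀ t : ℝ, 0 ≤ t → ∀ x y : Vec d, ‖b t x - b t y‖ ≤ κ₁ * max (‖x - y‖ ^ β) ‖x - y‖)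

/-- A smooth nonnegative mollifier supported in the closed unit ball with total mass one. -/
structure IsMollifier (d : ℕ) (ρ : Vec d → ℝ) : Prop where
  smooth : ContDiff ℝ (⊤ : ℕ∞) ρ
  nonneg : ∀ x, 0 ≤ ρ x
  support_subset : Function.support ρ ⊆ Metric.closedBall 0 1
  integral_eq_one : ∫ x, ρ x = 1

/-- The spatially mollified drift `b_ε(t,x) = ∫ b(t,y) ρ_ε(x-y) dy`. -/
def mollifiedDrift (d : ℕ) (ρ : Vec d → ℝ) (ε : ℝ) (b : ℝ → Vec d → Vec d)
    (t : ℝ) (x : Vec d) : Vec d :=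
  ∫ y : Vec d, (ε ^ (-(d : ℝ)) * ρ (ε⁻¹ • (x - y))) • b t y

/-- `θ` is the flow of the (time-dependent) vector field `f`:
`θ t s x = x + ∫_s^t f(r, θ r s x) dr` for all nonnegative times. -/
def IsFlow (d : ℕ) (f : ℝ → Vec d → Vec d) (θ : ℝ → ℝ → Vec d → Vec d) : Prop :=
  ∀ s t : ℝ, 0 ≤ s → 0 ≤ t → ∀ x : Vec d,
    θ t s x = x + ∫ r in s..t, f r (θ r s x)

/-- The Gaussian kernel `g_λ(t,x) = t^{-d/2} exp(-λ |x|²/t)`. -/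
def gaussk (d : ℕ) (l t : ℝ) (x : Vec d) : ℝ :=
  t ^ (-(d : ℝ) / 2) * Real.exp (-l * ‖x‖ ^ 2 / t)

/-- A drift which is measurable, bounded at the origin uniformly in time, and Lipschitz in
space with constant `κ` uniformly in time. -/
def LipschitzDrift (d : ℕ) (b : ℝ → Vec d → Vec d) (κ : ℝ) : Prop :=
  Measurable (Function.uncurry b) ∧
  (∃ M : ℝ, ∀ t : ℝ, 0 ≤ t → ‖b t 0‖ ≤ M) ∧
  (∀ t : ℝ, 0 ≤ t → ∀ x y : Vec d, ‖b t x - b t y‖ ≤ κ * ‖x - y‖)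

/-- The diffusion matrix `σσ*`. -/
def sqMat (d : ℕ) (σ : ℝ → Vec d → Matrix (Fin d) (Fin d) ℝ) (t : ℝ) (x : Vec d) :
    Matrix (Fin d) (Fin d) ℝ :=
  σ t x * (σ t x)ᵀ

/-- Hypothesis (H^σ_α): measurability, uniform ellipticity with constant `κ₀`
and spatial α-Hölder continuity with constant `κ₀`. -/
def EllipticHolder (d : ℕ) (σ : ℝ → Vec d → Matrix (Fin d) (Fin d) ℝ) (κ₀ α : ℝ) : Prop :=
  (∀ i j : Fin d, Measurable fun p : ℝ × Vec d => σ p.1 p.2 i j) ∧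
  (∀ t : ℝ, 0 ≤ t → ∀ x : Vec d, ∀ ξ : Fin d → ℝ,
    κ₀⁻¹ * (ξ ⬝ᵥ ξ) ≤ (sqMat d σ t x).mulVec ξ ⬝ᵥ ξ ∧
      (sqMat d σ t x).mulVec ξ ⬝ᵥ ξ ≤ κ₀ * (ξ ⬝ᵥ ξ)) ∧
  (∀ t : ℝ, 0 ≤ t → ∀ x y : Vec d, ∀ i j : Fin d,
    |σ t x i j - σ t y i j| ≤ κ₀ * ‖x - y‖ ^ α)

/-- `b` is smooth in the space variable, with spatial derivatives of every order
bounded uniformly in time and space. -/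
def SmoothVecBounded (d : ℕ) (b : ℝ → Vec d → Vec d) : Prop :=
  (∀ t : ℝ, ContDiff ℝ (⊤ : ℕ∞) (b t)) ∧
  ∀ n : ℕ, 1 ≤ n → ∃ M : ℝ, ∀ t : ℝ, 0 ≤ t → ∀ x : Vec d,
    ‖iteratedFDeriv ℝ n (b t) x‖ ≤ M

/-- `σ` is smooth in the space variable, with spatial derivatives of every order
bounded uniformly in time and space. -/
def SmoothMatBounded (d : ℕ) (σ : ℝ → Vec d → Matrix (Fin d) (Fin d) ℝ) : Prop :=
  (∀ t : ℝ, ∀ i j : Fin d, ContDiff ℝ (⊤ : ℕ∞) fun x => σ t x i j) ∧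
  ∀ n : ℕ, 1 ≤ n → ∃ M : ℝ, ∀ t : ℝ, 0 ≤ t → ∀ x : Vec d, ∀ i j : Fin d,
    ‖iteratedFDeriv ℝ n (fun z => σ t z i j) x‖ ≤ M

/-- The mean shift `ϑ^{(τ,ξ)}_{t,s} = ∫_s^t b(r, θ_{r,τ}(ξ)) dr` of the frozen process. -/
def freezeMean (d : ℕ) (b : ℝ → Vec d → Vec d) (θ : ℝ → ℝ → Vec d → Vec d)
    (τ : ℝ) (ξ : Vec d) (s t : ℝ) : Vec d :=
  ∫ r in s..t, b r (θ r τ ξ)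

/-- The covariance `𝒞^{(τ,ξ)}_{t,s} = ∫_s^t (σσ*)(r, θ_{r,τ}(ξ)) dr` of the frozen process. -/
def freezeCov (d : ℕ) (σ : ℝ → Vec d → Matrix (Fin d) (Fin d) ℝ)
    (θ : ℝ → ℝ → Vec d → Vec d) (τ : ℝ) (ξ : Vec d) (s t : ℝ) :
    Matrix (Fin d) (Fin d) ℝ :=
  Matrix.of fun i j => ∫ r in s..t, sqMat d σ r (θ r τ ξ) i j

/-- The frozen Gaussian density
`p̃^{(τ,ξ)}(s,x,t,y) = ((2π)^d det 𝒞)^{-1/2} exp(−½ ⟨𝒞⁻¹ m, m⟩)`, `m = ϑ + x − y`. -/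
def frozenDensity (d : ℕ) (b : ℝ → Vec d → Vec d)
    (σ : ℝ → Vec d → Matrix (Fin d) (Fin d) ℝ) (θ : ℝ → ℝ → Vec d → Vec d)
    (τ : ℝ) (ξ : Vec d) (s : ℝ) (x : Vec d) (t : ℝ) (y : Vec d) : ℝ :=
  (Real.sqrt ((2 * Real.pi) ^ d * (freezeCov d σ θ τ ξ s t).det))⁻¹ *
    Real.exp (-(1 / 2) *
      ((freezeCov d σ θ τ ξ s t)⁻¹.mulVec (fun i => (freezeMean d b θ τ ξ s t + x - y) i) ⬝ᵥ
        fun i => (freezeMean d b θ τ ξ s t + x - y) i))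

/-- The generator `L_{r} f(z) = ⟨b(r,z), ∇f(z)⟩ + ½ tr(σσ*(r,z) ∇²f(z))`. -/
def genApply (d : ℕ) (b : ℝ → Vec d → Vec d)
    (σ : ℝ → Vec d → Matrix (Fin d) (Fin d) ℝ) (r : ℝ) (f : Vec d → ℝ) (z : Vec d) : ℝ :=
  (∑ i, b r z i * fderiv ℝ f z (EuclideanSpace.single i (1 : ℝ))) +
    (1 / 2) * ∑ i, ∑ j, sqMat d σ r z i j *
      iteratedFDeriv ℝ 2 f z
        ![EuclideanSpace.single i (1 : ℝ), EuclideanSpace.single j (1 : ℝ)]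

/-- The natural σ-algebra of the process `X` on the time interval `[s,u]`. -/
def pathSigma (d : ℕ) {Ω : Type*} [MeasurableSpace Ω] (X : ℝ → Ω → Vec d)
    (s u : ℝ) : MeasurableSpace Ω :=
  ⨆ r ∈ Set.Icc s u, MeasurableSpace.comap (X r) inferInstance

/-- A solution of the martingale problem for `(b,σ)` started at `(s,x)`:
a probability measure `P` together with a process `X` with continuous paths on `[s,∞)`,
`X_s = x` a.s., such that for every `f ∈ C_c^∞(ℝ^d)` the process
`t ↦ f(X_t) − ∫_s^t (L_r f)(X_r) dr` is a martingale w.r.t. the natural filtration. -/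
structure MartingaleProblemSolution (d : ℕ) (b : ℝ → Vec d → Vec d)
    (σ : ℝ → Vec d → Matrix (Fin d) (Fin d) ℝ) (s : ℝ) (x : Vec d)
    {Ω : Type*} [MeasurableSpace Ω] (P : MeasureTheory.Measure Ω)
    (X : ℝ → Ω → Vec d) : Prop where
  isProb : MeasureTheory.IsProbabilityMeasure P
  measurable_X : ∀ t : ℝ, Measurable (X t)
  cont_paths : ∀ ω : Ω, ContinuousOn (fun t => X t ω) (Set.Ici s)
  start : ∀ᵐ ω ∂P, X s ω = x
  integrable : ∀ f : Vec d → ℝ, ContDiff ℝ (⊤ : ℕ∞) f → HasCompactSupport f →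
    ∀ t : ℝ, s ≤ t →
      MeasureTheory.Integrable
        (fun ω => f (X t ω) - ∫ r in s..t, genApply d b σ r f (X r ω)) P
  martingale : ∀ f : Vec d → ℝ, ContDiff ℝ (⊤ : ℕ∞) f → HasCompactSupport f →
    ∀ u v : ℝ, s ≤ u → u ≤ v → ∀ A : Set Ω, MeasurableSet[pathSigma d X s u] A →
      ∫ ω in A, (f (X v ω) - ∫ r in s..v, genApply d b σ r f (X r ω)) ∂P =
      ∫ ω in A, (f (X u ω) - ∫ r in s..u, genApply d b σ r f (X r ω)) ∂P

open scoped ENNReal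

/-- The polynomially decaying profile `√τ / (√τ + D)^(d+1)`. -/
def omg (d : ℕ) (τ D : ℝ) : ℝ := √τ / (√τ + D) ^ (d + 1)

/-- The polynomial profile with a Gaussian factor. -/
def Wk (d : ℕ) (l τ D : ℝ) : ℝ := omg d τ D * Real.exp (-l * D ^ 2 / τ)

lemma omg_pos {d : ℕ} {τ D : ℝ} (hτ : 0 < τ) (hD : 0 ≤ D) : 0 < omg d τ D := by
  have := Real.sqrt_pos.2 hτ
  unfold omg; positivity

lemma Wk_pos {d : ℕ} {l τ D : ℝ} (hτ : 0 < τ) (hD : 0 ≤ D) : 0 < Wk d l τ D :=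
  mul_pos (omg_pos hτ hD) (Real.exp_pos _)

lemma omg_mul {d : ℕ} {τ₁ τ₂ D₁ D₂ D : ℝ} (h₁ : 0 < τ₁) (h₂ : 0 < τ₂) (hD₁ : 0 ≤ D₁)
    (hD₂ : 0 ≤ D₂) (hD : 0 ≤ D) (h : D ≤ D₁ + D₂) :
    omg d τ₁ D₁ * omg d τ₂ D₂ ≤
      2 ^ (d + 1) * omg d (τ₁ + τ₂) D * (omg d τ₁ D₁ + omg d τ₂ D₂) := by
  have p₁ := omg_pos (d := d) h₁ hD₁
  have p₂ := omg_pos (d := d) h₂ hD₂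
  have s₁ := Real.sqrt_pos.2 h₁
  have s₂ := Real.sqrt_pos.2 h₂
  have s := Real.sqrt_pos.2 (add_pos h₁ h₂)
  have hs : √(τ₁ + τ₂) ≤ √τ₁ + √τ₂ := by
    rw [Real.sqrt_le_left (by positivity)]
    nlinarith [Real.sq_sqrt h₁.le, Real.sq_sqrt h₂.le]
  have key : ∀ τ D', 0 < τ → τ ≤ τ₁ + τ₂ → 0 ≤ D' → √(τ₁ + τ₂) + D ≤ 2 * (√τ + D') →
      omg d τ D' ≤ 2 ^ (d + 1) * omg d (τ₁ + τ₂) D := by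
    intro τ D' hτ hle hD' hh
    have s' := Real.sqrt_pos.2 hτ
    unfold omg
    rw [← mul_div_assoc, div_le_div_iff₀ (by positivity) (by positivity)]
    calc √τ * (√(τ₁ + τ₂) + D) ^ (d + 1) ≤ √(τ₁ + τ₂) * (2 * (√τ + D')) ^ (d + 1) := by
          gcongr
      _ = _ := by rw [mul_pow]; ring
  have pD := omg_pos (d := d) (add_pos h₁ h₂) hD
  rcases le_total (√τ₁ + D₁) (√τ₂ + D₂) with hc | hc
  · have := key τ₂ D₂ h₂ (by linarith) hD₂ (by linarith)
    nlinarith [mul_le_mul_of_nonneg_left this p₁.le, mul_pos (mul_pos (pow_pos two_pos (d+1)) pD) p₂]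
  · have := key τ₁ D₁ h₁ (by linarith) hD₁ (by linarith)
    nlinarith [mul_le_mul_of_nonneg_left this p₂.le, mul_pos (mul_pos (pow_pos two_pos (d+1)) pD) p₁]

lemma Wk_mul {d : ℕ} {l τ₁ τ₂ D₁ D₂ D : ℝ} (hl : 0 ≤ l) (h₁ : 0 < τ₁) (h₂ : 0 < τ₂)
    (hD₁ : 0 ≤ D₁) (hD₂ : 0 ≤ D₂) (hD : 0 ≤ D) (h : D ≤ D₁ + D₂) :
    Wk d l τ₁ D₁ * Wk d l τ₂ D₂ ≤
      2 ^ (d + 1) * Wk d l (τ₁ + τ₂) D * (omg d τ₁ D₁ + omg d τ₂ D₂) := by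
  have p₁ := omg_pos (d := d) h₁ hD₁
  have p₂ := omg_pos (d := d) h₂ hD₂
  have pD := omg_pos (d := d) (add_pos h₁ h₂) hD
  have hq : D ^ 2 / (τ₁ + τ₂) ≤ D₁ ^ 2 / τ₁ + D₂ ^ 2 / τ₂ := by
    have e : D ^ 2 ≤ (D₁ + D₂) ^ 2 := by gcongr
    rw [div_add_div _ _ h₁.ne' h₂.ne', div_le_div_iff₀ (by positivity) (by positivity)]
    have : (D₁ + D₂) ^ 2 * (τ₁ * τ₂) ≤ (D₁ ^ 2 * τ₂ + τ₁ * D₂ ^ 2) * (τ₁ + τ₂) := by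
      nlinarith [sq_nonneg (D₁ * τ₂ - D₂ * τ₁)]
    nlinarith [mul_pos h₁ h₂]
  have he : Real.exp (-l * D₁ ^ 2 / τ₁) * Real.exp (-l * D₂ ^ 2 / τ₂) ≤
      Real.exp (-l * D ^ 2 / (τ₁ + τ₂)) := by
    rw [← Real.exp_add, Real.exp_le_exp]
    have := mul_le_mul_of_nonneg_left hq hl
    have e1 : -l * D₁ ^ 2 / τ₁ + -l * D₂ ^ 2 / τ₂ = -(l * (D₁ ^ 2 / τ₁ + D₂ ^ 2 / τ₂)) := by ring
    have e2 : -l * D ^ 2 / (τ₁ + τ₂) = -(l * (D ^ 2 / (τ₁ + τ₂))) := by ring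
    rw [e1, e2]; linarith
  unfold Wk
  calc _ = (omg d τ₁ D₁ * omg d τ₂ D₂) *
        (Real.exp (-l * D₁ ^ 2 / τ₁) * Real.exp (-l * D₂ ^ 2 / τ₂)) := by ring
    _ ≤ (2 ^ (d + 1) * omg d (τ₁ + τ₂) D * (omg d τ₁ D₁ + omg d τ₂ D₂)) *
        Real.exp (-l * D ^ 2 / (τ₁ + τ₂)) :=
        mul_le_mul (omg_mul h₁ h₂ hD₁ hD₂ hD h) he (by positivity) (by positivity)
    _ = _ := by ring

lemma omg_eq_scaled (d : ℕ) {τ : ℝ} (hτ : 0 < τ) (z : Vec d) :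
    omg d τ ‖z‖ = (√τ ^ d)⁻¹ * (1 + ‖(√τ)⁻¹ • z‖) ^ (-((d : ℝ) + 1)) := by
  have s := Real.sqrt_pos.2 hτ
  have e : (1 + ‖(√τ)⁻¹ • z‖) = (√τ + ‖z‖) / √τ := by
    rw [norm_smul, Real.norm_of_nonneg (by positivity)]; field_simp
  rw [e, Real.rpow_neg (by positivity),
    show ((d : ℝ) + 1) = ((d + 1 : ℕ) : ℝ) by push_cast; ring, Real.rpow_natCast]
  unfold omg
  rw [div_pow, inv_div, pow_succ (√τ) d]
  field_simp

lemma lintegral_omg (d : ℕ) : ∃ C > (0 : ℝ), ∀ τ > (0 : ℝ), ∀ w : Vec d,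
    ∫⁻ z, ENNReal.ofReal (omg d τ ‖z - w‖) ≤ ENNReal.ofReal C := by
  have integ : Integrable (fun x : Vec d => (1 + ‖x‖) ^ (-((d : ℝ) + 1))) :=
    integrable_one_add_norm (by simp)
  refine ⟨∫ x : Vec d, (1 + ‖x‖) ^ (-((d : ℝ) + 1)), ?_, ?_⟩
  · rw [gt_iff_lt, integral_pos_iff_support_of_nonneg (fun x => by positivity) integ]
    have : Function.support (fun x : Vec d => (1 + ‖x‖) ^ (-((d : ℝ) + 1))) = univ := by
      ext x; simp only [Function.mem_support, mem_univ, iff_true]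
      positivity
    rw [this]; exact isOpen_univ.measure_pos volume univ_nonempty
  · intro τ hτ w
    have s := Real.sqrt_pos.2 hτ
    rw [lintegral_sub_right_eq_self (fun z => ENNReal.ofReal (omg d τ ‖z‖)) w]
    have h2 : Integrable (fun z : Vec d => omg d τ ‖z‖) := by
      simp_rw [omg_eq_scaled d hτ]
      exact (integ.comp_smul (R := (√τ)⁻¹) (by positivity)).const_mul _
    rw [← ofReal_integral_eq_lintegral_ofReal h2
      (Filter.Eventually.of_forall fun z => (omg_pos hτ (norm_nonneg z)).le)]
    apply ENNReal.ofReal_le_ofReal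
    simp_rw [omg_eq_scaled d hτ]
    rw [integral_const_mul, Measure.integral_comp_inv_smul volume
      (fun x : Vec d => (1 + ‖x‖) ^ (-((d : ℝ) + 1)))]
    simp only [finrank_euclideanSpace, Fintype.card_fin, smul_eq_mul]
    rw [abs_of_pos (by positivity), ← mul_assoc, inv_mul_cancel₀ (by positivity), one_mul]

lemma lintegral_rpow_left {p : ℝ} (hp : 0 < p) {s t : ℝ} (hst : s < t) :
    ∫⁻ r in Ioo s t, ENNReal.ofReal ((r - s) ^ (p - 1)) = ENNReal.ofReal ((t - s) ^ p / p) := by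
  have h1 : IntervalIntegrable (fun r : ℝ => (r - s) ^ (p - 1)) volume s t := by
    have := (intervalIntegral.intervalIntegrable_rpow' (a := 0) (b := t - s)
      (r := p - 1) (by linarith)).comp_sub_right s
    simpa using this
  rw [← ofReal_integral_eq_lintegral_ofReal]
  · rw [← integral_Ioc_eq_integral_Ioo, ← intervalIntegral.integral_of_le hst.le,
      intervalIntegral.integral_comp_sub_right (fun r => r ^ (p - 1)) s, sub_self,
      integral_rpow (Or.inl (by linarith))]
    simp [hp.ne']
  · exact ((intervalIntegrable_iff_integrableOn_Ioo_of_le hst.le).1 h1)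
  · refine (ae_restrict_iff' measurableSet_Ioo).2 (Filter.Eventually.of_forall fun r hr => ?_)
    exact Real.rpow_nonneg (by linarith [hr.1]) _

lemma lintegral_rpow_right {p : ℝ} (hp : 0 < p) {s t : ℝ} (hst : s < t) :
    ∫⁻ r in Ioo s t, ENNReal.ofReal ((t - r) ^ (p - 1)) = ENNReal.ofReal ((t - s) ^ p / p) := by
  have h1 : IntervalIntegrable (fun r : ℝ => (t - r) ^ (p - 1)) volume s t := by
    have := (intervalIntegral.intervalIntegrable_rpow' (a := t - s) (b := 0)
      (r := p - 1) (by linarith)).comp_sub_left t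
    simpa using this
  rw [← ofReal_integral_eq_lintegral_ofReal]
  · rw [← integral_Ioc_eq_integral_Ioo, ← intervalIntegral.integral_of_le hst.le,
      intervalIntegral.integral_comp_sub_left (fun r => r ^ (p - 1)) t, sub_self,
      integral_rpow (Or.inl (by linarith))]
    simp [hp.ne']
  · exact ((intervalIntegrable_iff_integrableOn_Ioo_of_le hst.le).1 h1)
  · refine (ae_restrict_iff' measurableSet_Ioo).2 (Filter.Eventually.of_forall fun r hr => ?_)
    exact Real.rpow_nonneg (by linarith [hr.2]) _

lemma rpow_half_le {p x τ : ℝ} (hp : 0 < p) (hp1 : p ≤ 1) (hτ : 0 < τ) (hx : τ / 2 ≤ x) :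
    x ^ (p - 1) ≤ 2 * τ ^ (p - 1) := by
  calc x ^ (p - 1) ≤ (τ / 2) ^ (p - 1) :=
        Real.rpow_le_rpow_of_nonpos (by positivity) hx (by linarith)
    _ = (2 : ℝ) ^ (1 - p) * τ ^ (p - 1) := by
        rw [Real.div_rpow hτ.le (by norm_num), show (1 - p) = -(p - 1) by ring,
          Real.rpow_neg (by norm_num)]
        field_simp
    _ ≤ 2 * τ ^ (p - 1) := by
        gcongr
        calc (2 : ℝ) ^ (1 - p) ≤ 2 ^ (1 : ℝ) :=
              Real.rpow_le_rpow_of_exponent_le (by norm_num) (by linarith)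
          _ = 2 := by simp

lemma lintegral_beta {p q : ℝ} (hp : 0 < p) (hp1 : p ≤ 1) (hq : 0 < q) (hq1 : q ≤ 1) :
    ∃ C > (0 : ℝ), ∀ s t : ℝ, s < t →
    ∫⁻ r in Ioo s t, ENNReal.ofReal ((r - s) ^ (p - 1) * (t - r) ^ (q - 1)) ≤
      ENNReal.ofReal (C * (t - s) ^ (p + q - 1)) := by
  refine ⟨2 / p + 2 / q, by positivity, fun s t hst => ?_⟩
  have hτ : 0 < t - s := by linarith
  calc ∫⁻ r in Ioo s t, ENNReal.ofReal ((r - s) ^ (p - 1) * (t - r) ^ (q - 1))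
      ≤ ∫⁻ r in Ioo s t, (ENNReal.ofReal (2 * (t - s) ^ (q - 1)) * ENNReal.ofReal ((r - s) ^ (p - 1))
        + ENNReal.ofReal (2 * (t - s) ^ (p - 1)) * ENNReal.ofReal ((t - r) ^ (q - 1))) := by
        refine setLIntegral_mono' measurableSet_Ioo fun r hr => ?_
        have a1 : 0 < r - s := by linarith [hr.1]
        have a2 : 0 < t - r := by linarith [hr.2]
        rw [← ENNReal.ofReal_mul (by positivity), ← ENNReal.ofReal_mul (by positivity),
          ← ENNReal.ofReal_add (by positivity) (by positivity)]
        apply ENNReal.ofReal_le_ofReal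
        rcases le_total (r - s) (t - r) with h | h
        · have := rpow_half_le hq hq1 hτ (x := t - r) (by linarith)
          have h3 : 0 ≤ 2 * (t - s) ^ (p - 1) * (t - r) ^ (q - 1) := by positivity
          nlinarith [mul_le_mul_of_nonneg_left this (Real.rpow_nonneg a1.le (p - 1))]
        · have := rpow_half_le hp hp1 hτ (x := r - s) (by linarith)
          have h3 : 0 ≤ 2 * (t - s) ^ (q - 1) * (r - s) ^ (p - 1) := by positivity
          nlinarith [mul_le_mul_of_nonneg_left this (Real.rpow_nonneg a2.le (q - 1))]
    _ = ENNReal.ofReal (2 * (t - s) ^ (q - 1)) * ENNReal.ofReal ((t - s) ^ p / p) +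
        ENNReal.ofReal (2 * (t - s) ^ (p - 1)) * ENNReal.ofReal ((t - s) ^ q / q) := by
        rw [lintegral_add_left (by fun_prop), lintegral_const_mul _ (by fun_prop),
          lintegral_const_mul _ (by fun_prop), lintegral_rpow_left hp hst,
          lintegral_rpow_right hq hst]
    _ = ENNReal.ofReal ((2 / p + 2 / q) * (t - s) ^ (p + q - 1)) := by
        rw [← ENNReal.ofReal_mul (by positivity), ← ENNReal.ofReal_mul (by positivity),
          ← ENNReal.ofReal_add (by positivity) (by positivity)]
        congr 1
        have e1 : (t - s) ^ (p + q - 1) = (t - s) ^ (q - 1) * (t - s) ^ p := by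
          rw [← Real.rpow_add hτ]; ring_nf
        have e2 : (t - s) ^ (p + q - 1) = (t - s) ^ (p - 1) * (t - s) ^ q := by
          rw [← Real.rpow_add hτ]; ring_nf
        rw [add_mul]
        nth_rewrite 1 [e1]
        rw [e2]; ring
    _ ≤ _ := le_rfl

/-- Symmetric matrices whose quadratic form is comparable to `t`. -/
structure QB {d : ℕ} (M t : ℝ) (C : Matrix (Fin d) (Fin d) ℝ) : Prop where
  symm : C.IsSymm
  lo : ∀ ξ : Fin d → ℝ, M⁻¹ * t * (ξ ⬝ᵥ ξ) ≤ C.mulVec ξ ⬝ᵥ ξ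
  hi : ∀ ξ : Fin d → ℝ, C.mulVec ξ ⬝ᵥ ξ ≤ M * t * (ξ ⬝ᵥ ξ)

lemma dot_self_eq {d : ℕ} (v : Vec d) : v.ofLp ⬝ᵥ v.ofLp = ‖v‖ ^ 2 := by
  rw [EuclideanSpace.real_norm_sq_eq]
  simp [dotProduct, sq]

lemma dot_self_nonneg' {d : ℕ} (ξ : Fin d → ℝ) : 0 ≤ ξ ⬝ᵥ ξ :=
  Finset.sum_nonneg fun _ _ => mul_self_nonneg _

lemma abs_dot_le {d : ℕ} (v w : Vec d) : |v.ofLp ⬝ᵥ w.ofLp| ≤ ‖v‖ * ‖w‖ := by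
  have := abs_real_inner_le_norm w v
  rw [EuclideanSpace.inner_eq_star_dotProduct] at this
  simpa [mul_comm] using this

lemma abs_coord_le {d : ℕ} (v : Vec d) (i : Fin d) : |v i| ≤ ‖v‖ := by
  simpa using PiLp.norm_apply_le v i

namespace QB

variable {d : ℕ} {M t : ℝ} {C : Matrix (Fin d) (Fin d) ℝ}

lemma posDef (h : QB M t C) (hM : 0 < M) (ht : 0 < t) : C.PosDef := by
  refine Matrix.PosDef.of_dotProduct_mulVec_pos ?_ fun ξ hξ => ?_
  · have := h.symm
    rwa [Matrix.IsHermitian, conjTranspose_eq_transpose_of_trivial]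
  · have h1 := h.lo ξ
    have h2 : 0 < ξ ⬝ᵥ ξ := lt_of_le_of_ne (dot_self_nonneg' ξ)
      (fun e => hξ (dotProduct_self_eq_zero.1 e.symm))
    have h3 : 0 < M⁻¹ * t * (ξ ⬝ᵥ ξ) := by positivity
    rw [star_trivial, dotProduct_comm]; linarith

lemma det_pos (h : QB M t C) (hM : 0 < M) (ht : 0 < t) : 0 < C.det := (h.posDef hM ht).det_pos

lemma mul_inv (h : QB M t C) (hM : 0 < M) (ht : 0 < t) : C * C⁻¹ = 1 :=
  Matrix.mul_nonsing_inv _ (h.det_pos hM ht).ne'.isUnit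

lemma eig (h : QB M t C) (hC : C.IsHermitian) (i : Fin d) :
    M⁻¹ * t ≤ hC.eigenvalues i ∧ hC.eigenvalues i ≤ M * t := by
  have e := hC.mulVec_eigenvectorBasis i
  have n : ((hC.eigenvectorBasis i).ofLp) ⬝ᵥ ((hC.eigenvectorBasis i).ofLp) = 1 := by
    rw [dot_self_eq, hC.eigenvectorBasis.norm_eq_one]; norm_num
  have l := h.lo (hC.eigenvectorBasis i).ofLp
  have u := h.hi (hC.eigenvectorBasis i).ofLp
  rw [e, smul_dotProduct, n] at l u
  constructor
  · simpa using l
  · simpa using u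

lemma det_bounds (h : QB M t C) (hM : 0 < M) (ht : 0 < t) :
    (M⁻¹ * t) ^ d ≤ C.det ∧ C.det ≤ (M * t) ^ d := by
  have hC : C.IsHermitian := (h.posDef hM ht).1
  have e := hC.det_eq_prod_eigenvalues
  simp only [RCLike.ofReal_real_eq_id, id] at e
  rw [e]
  constructor
  · calc (M⁻¹ * t) ^ d = ∏ _i : Fin d, (M⁻¹ * t) := by simp
      _ ≤ _ := Finset.prod_le_prod (fun i _ => by positivity) fun i _ => (h.eig hC i).1
  · calc _ ≤ ∏ _i : Fin d, (M * t) := Finset.prod_le_prod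
          (fun i _ => le_trans (by positivity) (h.eig hC i).1) fun i _ => (h.eig hC i).2
      _ = _ := by simp

/-- The vector `C⁻¹ v`. -/
def _root_.cinv (C : Matrix (Fin d) (Fin d) ℝ) (v : Vec d) : Vec d :=
  WithLp.toLp 2 (C⁻¹.mulVec v.ofLp)

lemma mulVec_cinv (h : QB M t C) (hM : 0 < M) (ht : 0 < t) (v : Vec d) :
    C.mulVec (cinv C v).ofLp = v.ofLp := by
  simp [cinv, Matrix.mulVec_mulVec, h.mul_inv hM ht]

lemma norm_cinv_le (h : QB M t C) (hM : 0 < M) (ht : 0 < t) (v : Vec d) :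
    ‖cinv C v‖ ≤ M / t * ‖v‖ := by
  have h1 := h.lo (cinv C v).ofLp
  rw [h.mulVec_cinv hM ht, dot_self_eq] at h1
  have h2 := (le_abs_self _).trans (abs_dot_le v (cinv C v))
  rcases (norm_nonneg (cinv C v)).eq_or_lt with h0 | h0
  · rw [← h0]; positivity
  · have h3 : M⁻¹ * t * ‖cinv C v‖ ≤ ‖v‖ := by
      by_contra hc
      push Not at hc
      nlinarith
    calc ‖cinv C v‖ = M / t * (M⁻¹ * t * ‖cinv C v‖) := by field_simp
      _ ≤ _ := by gcongr

lemma abs_inv_le (h : QB M t C) (hM : 0 < M) (ht : 0 < t) (i j : Fin d) :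
    |C⁻¹ i j| ≤ M / t := by
  have h1 := h.norm_cinv_le hM ht (EuclideanSpace.single j 1)
  have h2 := (abs_coord_le (cinv C (EuclideanSpace.single j 1)) i).trans h1
  simpa [cinv] using h2

lemma quad_le (h : QB M t C) (hM : 0 < M) (ht : 0 < t) (v : Vec d) :
    (C⁻¹.mulVec v.ofLp) ⬝ᵥ v.ofLp ≤ M / t * ‖v‖ ^ 2 := by
  have h1 := (le_abs_self _).trans (abs_dot_le (cinv C v) v)
  have h2 := h.norm_cinv_le hM ht v
  calc _ ≤ ‖cinv C v‖ * ‖v‖ := h1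
    _ ≤ (M / t * ‖v‖) * ‖v‖ := by gcongr
    _ = _ := by ring

lemma le_quad (h : QB M t C) (hM : 0 < M) (ht : 0 < t) (v : Vec d) :
    ‖v‖ ^ 2 / (M * t) ≤ (C⁻¹.mulVec v.ofLp) ⬝ᵥ v.ofLp := by
  have hs : 0 < M * t := by positivity
  set w := (cinv C v).ofLp with hw
  have ew : C.mulVec w = v.ofLp := h.mulVec_cinv hM ht v
  set s : ℝ := (M * t)⁻¹
  have key : 0 ≤ C.mulVec (w - s • v.ofLp) ⬝ᵥ (w - s • v.ofLp) := by
    refine le_trans ?_ (h.lo _)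
    have := dot_self_nonneg' (w - s • v.ofLp)
    positivity
  have hv := h.hi v.ofLp
  have sy : C.mulVec v.ofLp ⬝ᵥ w = v.ofLp ⬝ᵥ v.ofLp := by
    rw [dotProduct_comm, Matrix.dotProduct_mulVec, ← Matrix.mulVec_transpose, h.symm, ew]
  rw [Matrix.mulVec_sub, Matrix.mulVec_smul, ew, sub_dotProduct, dotProduct_sub, dotProduct_sub,
    smul_dotProduct, smul_dotProduct, dotProduct_smul, dotProduct_smul, sy, dot_self_eq] at key
  rw [dot_self_eq] at hv
  have e : (C⁻¹.mulVec v.ofLp) ⬝ᵥ v.ofLp = v.ofLp ⬝ᵥ w := by rw [dotProduct_comm]; rfl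
  rw [e, div_eq_mul_inv]
  change ‖v‖ ^ 2 * s ≤ _
  have h3 : s * (s * (C.mulVec v.ofLp ⬝ᵥ v.ofLp)) ≤ s * ‖v‖ ^ 2 := by
    have : s * (C.mulVec v.ofLp ⬝ᵥ v.ofLp) ≤ ‖v‖ ^ 2 := by
      calc _ ≤ s * (M * t * ‖v‖ ^ 2) := by gcongr
        _ = _ := by simp only [s]; field_simp
    have hs' : 0 ≤ s := by positivity
    gcongr
  simp only [smul_eq_mul] at key
  linarith

end QB

/-- The centred Gaussian density with covariance `C`. -/
def ga {d : ℕ} (C : Matrix (Fin d) (Fin d) ℝ) (v : Vec d) : ℝ :=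
  (√((2 * Real.pi) ^ d * C.det))⁻¹ * Real.exp (-(1 / 2) * ((C⁻¹.mulVec v.ofLp) ⬝ᵥ v.ofLp))

/-- First derivatives of `ga`. -/
def ga1 {d : ℕ} (C : Matrix (Fin d) (Fin d) ℝ) (i : Fin d) (v : Vec d) : ℝ :=
  -(cinv C v i) * ga C v

/-- Second derivatives of `ga`. -/
def ga2 {d : ℕ} (C : Matrix (Fin d) (Fin d) ℝ) (i j : Fin d) (v : Vec d) : ℝ :=
  (cinv C v i * cinv C v j - C⁻¹ i j) * ga C v

lemma ga_nonneg {d : ℕ} (C : Matrix (Fin d) (Fin d) ℝ) (v : Vec d) : 0 ≤ ga C v := by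
  unfold ga; positivity

lemma exists_pow_le_exp (n : ℕ) {l : ℝ} (hl : 0 < l) :
    ∃ K ≥ (1 : ℝ), ∀ x : ℝ, 0 ≤ x → (1 + x) ^ n ≤ K * Real.exp (l * x ^ 2) := by
  refine ⟨n.factorial * Real.exp (1 + 1 / (4 * l)), ?_, fun x hx => ?_⟩
  · have h1 : (1 : ℝ) ≤ n.factorial := by exact_mod_cast n.factorial_pos
    have h2 : (1 : ℝ) ≤ Real.exp (1 + 1 / (4 * l)) := Real.one_le_exp (by positivity)
    nlinarith
  · have h1 := Real.pow_div_factorial_le_exp (1 + x) (by positivity) n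
    rw [div_le_iff₀ (by positivity)] at h1
    have h2 : 1 + x ≤ 1 + 1 / (4 * l) + l * x ^ 2 := by
      have : 0 ≤ (2 * l * x - 1) ^ 2 / (4 * l) := by positivity
      have e : (2 * l * x - 1) ^ 2 / (4 * l) = l * x ^ 2 - x + 1 / (4 * l) := by
        field_simp; ring
      linarith
    calc (1 + x) ^ n ≤ Real.exp (1 + x) * n.factorial := h1
      _ ≤ Real.exp (1 + 1 / (4 * l) + l * x ^ 2) * n.factorial := by gcongr
      _ = _ := by rw [Real.exp_add]; ring

/-- Gaussians with polynomial weights are dominated by `Wk`. -/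
lemma exists_weighted_le_Wk (d n : ℕ) {l l' : ℝ} (hl : l' < l) :
    ∃ K ≥ (1 : ℝ), ∀ t > (0 : ℝ), ∀ D ≥ (0 : ℝ),
      (1 + D / √t) ^ n * ((√t) ^ d)⁻¹ * Real.exp (-l * D ^ 2 / t) ≤ K * Wk d l' t D := by
  obtain ⟨K, hK, h⟩ := exists_pow_le_exp (n + d + 1) (sub_pos.2 hl)
  refine ⟨K, hK, fun t ht D hD => ?_⟩
  have s := Real.sqrt_pos.2 ht
  have h1 := h (D / √t) (by positivity)
  rw [div_pow, Real.sq_sqrt ht.le] at h1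
  have e : Wk d l' t D = ((1 + D / √t) ^ (d + 1))⁻¹ * ((√t) ^ d)⁻¹ *
      Real.exp (-l' * D ^ 2 / t) := by
    unfold Wk omg
    have : √t + D = √t * (1 + D / √t) := by field_simp
    rw [this, mul_pow, pow_succ (√t) d]
    field_simp
  rw [e]
  have p : 0 < 1 + D / √t := by positivity
  have e2 : Real.exp (-l' * D ^ 2 / t) =
      Real.exp ((l - l') * (D ^ 2 / t)) * Real.exp (-l * D ^ 2 / t) := by
    rw [← Real.exp_add]; congr 1; ring
  rw [e2]
  calc (1 + D / √t) ^ n * ((√t) ^ d)⁻¹ * Real.exp (-l * D ^ 2 / t)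
      = (1 + D / √t) ^ (n + d + 1) * (((1 + D / √t) ^ (d + 1))⁻¹ * ((√t) ^ d)⁻¹ *
        Real.exp (-l * D ^ 2 / t)) := by
        rw [add_assoc, pow_add]; field_simp
    _ ≤ (K * Real.exp ((l - l') * (D ^ 2 / t))) * (((1 + D / √t) ^ (d + 1))⁻¹ * ((√t) ^ d)⁻¹ *
        Real.exp (-l * D ^ 2 / t)) := by gcongr
    _ = _ := by ring

section GaussianDerivatives

variable {d : ℕ} {C Δ : Matrix (Fin d) (Fin d) ℝ}

lemma hasDerivAt_mul_self_zero {h : ℝ → ℝ} (hh : ContinuousAt h 0) :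
    HasDerivAt (fun θ => θ * h θ) (h 0) 0 := by
  rw [hasDerivAt_iff_tendsto_slope_zero]
  simp only [zero_add, zero_mul, sub_zero, smul_eq_mul]
  refine (hh.tendsto.mono_left nhdsWithin_le_nhds).congr' ?_
  filter_upwards [self_mem_nhdsWithin] with θ hθ
  have : θ ≠ 0 := hθ
  field_simp

lemma hasDerivAt_det (hC : C.det ≠ 0) :
    HasDerivAt (fun θ : ℝ => (C + θ • Δ).det) (C.det * (C⁻¹ * Δ).trace) 0 := by
  have e : (fun θ : ℝ => (C + θ • Δ).det) = fun θ => C.det * (1 + (C⁻¹ * Δ).trace * θ +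
      θ * (θ * (det (1 + (Polynomial.X : Polynomial ℝ) • (C⁻¹ * Δ).map Polynomial.C)).divX.divX.eval θ)) := by
    ext θ
    have h1 := Matrix.det_one_add_smul θ (C⁻¹ * Δ)
    have h2 : C + θ • Δ = C * (1 + θ • (C⁻¹ * Δ)) := by
      rw [mul_add, mul_one, Matrix.mul_smul, ← Matrix.mul_assoc,
        Matrix.mul_nonsing_inv _ hC.isUnit, Matrix.one_mul]
    rw [h2, det_mul, h1]; ring
  rw [e]
  have h3 := hasDerivAt_mul_self_zero (h := fun θ => θ * (det (1 + (Polynomial.X : Polynomial ℝ) •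
    (C⁻¹ * Δ).map Polynomial.C)).divX.divX.eval θ) (by fun_prop)
  have h4 := (((hasDerivAt_id (0 : ℝ)).const_mul (C⁻¹ * Δ).trace).const_add 1).add h3
  simpa using h4.const_mul C.det

lemma hasDerivAt_inv_entry (hC : C.det ≠ 0) (i j : Fin d) :
    HasDerivAt (fun θ : ℝ => (C + θ • Δ)⁻¹ i j) (-(C⁻¹ * Δ * C⁻¹) i j) 0 := by
  have c0 : Continuous fun θ : ℝ => C + θ • Δ := by fun_prop
  have hu : (C + (0 : ℝ) • Δ).det ≠ 0 := by simpa using hC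
  have c1 : ContinuousAt (fun θ : ℝ => (C + θ • Δ)⁻¹) 0 := by
    refine ContinuousAt.comp (f := fun θ : ℝ => C + θ • Δ) (g := fun A => A⁻¹) ?_ c0.continuousAt
    refine continuousAt_matrix_inv _ ?_
    rw [Ring.inverse_eq_inv']
    exact continuousAt_inv₀ hu
  have c2 : ContinuousAt (fun θ : ℝ => -((C + θ • Δ)⁻¹ * Δ * C⁻¹) i j) 0 := by
    have : ContinuousAt (fun θ : ℝ => (C + θ • Δ)⁻¹ * Δ * C⁻¹) 0 :=
      ContinuousAt.comp (f := fun θ : ℝ => (C + θ • Δ)⁻¹) (g := fun A => A * Δ * C⁻¹)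
        (by fun_prop) c1
    exact ((continuous_apply_apply i j).continuousAt.comp this).neg
  have h1 := (hasDerivAt_mul_self_zero c2).const_add (C⁻¹ i j)
  simp only [zero_smul, add_zero] at h1
  refine h1.congr_of_eventuallyEq ?_
  have c3 : Continuous fun θ : ℝ => (C + θ • Δ).det := by fun_prop
  filter_upwards [c3.continuousAt.eventually_ne hu] with θ hθ
  have e : (C + θ • Δ)⁻¹ = C⁻¹ - θ • ((C + θ • Δ)⁻¹ * Δ * C⁻¹) := by
    have e1 : (C + θ • Δ)⁻¹ * (C + θ • Δ) = 1 := Matrix.nonsing_inv_mul _ hθ.isUnit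
    have e2 : C * C⁻¹ = 1 := Matrix.mul_nonsing_inv _ hC.isUnit
    have e3 : (C + θ • Δ)⁻¹ * C = 1 - θ • ((C + θ • Δ)⁻¹ * Δ) := by
      rw [← e1, mul_add, Matrix.mul_smul]; abel
    calc (C + θ • Δ)⁻¹ = (C + θ • Δ)⁻¹ * C * C⁻¹ := by rw [Matrix.mul_assoc, e2, Matrix.mul_one]
      _ = _ := by rw [e3, Matrix.sub_mul, Matrix.one_mul, Matrix.smul_mul]
  conv_lhs => rw [e]
  simp [sub_eq_add_neg]

lemma hasDerivAt_quad (hC : C.det ≠ 0) (hs : C.IsSymm) (v m : Vec d) :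
    HasDerivAt (fun θ : ℝ => ((C + θ • Δ)⁻¹.mulVec (v + θ • m).ofLp) ⬝ᵥ (v + θ • m).ofLp)
      (2 * ∑ i, m i * cinv C v i - ∑ i, ∑ j, Δ i j * (cinv C v i * cinv C v j)) 0 := by
  have hv : ∀ i, HasDerivAt (fun θ : ℝ => (v + θ • m) i) (m i) 0 := fun i => by
    have := ((hasDerivAt_id (0 : ℝ)).mul_const (m i)).const_add (v i)
    simpa using this
  have h : HasDerivAt (fun θ : ℝ => ∑ i, (∑ j, (C + θ • Δ)⁻¹ i j * (v + θ • m) j) * (v + θ • m) i)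
      (∑ i, ((∑ j, (-(C⁻¹ * Δ * C⁻¹) i j * v j + C⁻¹ i j * m j)) * v i
        + (∑ j, C⁻¹ i j * v j) * m i)) 0 := by
    have := HasDerivAt.fun_sum (u := Finset.univ) fun i _ =>
      (HasDerivAt.fun_sum (u := Finset.univ) fun j _ =>
        (hasDerivAt_inv_entry (Δ := Δ) hC i j).mul (hv j)).mul (hv i)
    simpa using this
  have hsS : (C⁻¹)ᵀ = C⁻¹ := by rw [Matrix.transpose_nonsing_inv, hs]
  refine (h.congr_deriv ?_)
  have a1 : ∑ i, (∑ j, C⁻¹ i j * v j) * m i = ∑ i, m i * cinv C v i :=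
    Finset.sum_congr rfl fun i _ => mul_comm _ _
  have a2 : ∑ i, (∑ j, C⁻¹ i j * m j) * v i = ∑ i, m i * cinv C v i := by
    change (C⁻¹.mulVec m.ofLp) ⬝ᵥ v.ofLp = m.ofLp ⬝ᵥ C⁻¹.mulVec v.ofLp
    rw [Matrix.dotProduct_mulVec, ← Matrix.mulVec_transpose, hsS]
  have a3 : ∑ i, (∑ j, (C⁻¹ * Δ * C⁻¹) i j * v j) * v i =
      ∑ i, ∑ j, Δ i j * (cinv C v i * cinv C v j) := by
    have : ∑ i, ∑ j, Δ i j * (cinv C v i * cinv C v j) =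
        (cinv C v).ofLp ⬝ᵥ Δ.mulVec (cinv C v).ofLp := by
      simp only [dotProduct, mulVec, Finset.mul_sum]
      exact Finset.sum_congr rfl fun i _ => Finset.sum_congr rfl fun j _ => by ring
    rw [this]
    change ((C⁻¹ * Δ * C⁻¹).mulVec v.ofLp) ⬝ᵥ v.ofLp = _
    simp only [cinv]
    rw [← Matrix.mulVec_mulVec, ← Matrix.mulVec_mulVec, dotProduct_comm, Matrix.dotProduct_mulVec,
      ← Matrix.mulVec_transpose, hsS]
  simp only [Finset.sum_add_distrib, neg_mul, Finset.sum_neg_distrib, add_mul, neg_mul]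
  rw [a1, a2, a3]; ring

lemma hasDerivAt_ga (hC : 0 < C.det) (hs : C.IsSymm) (v m : Vec d) :
    HasDerivAt (fun θ : ℝ => ga (C + θ • Δ) (v + θ • m))
      (1 / 2 * ∑ i, ∑ j, Δ i j * ga2 C i j v + ∑ i, m i * ga1 C i v) 0 := by
  have h1 := hasDerivAt_quad (Δ := Δ) hC.ne' hs v m
  have h2 := (hasDerivAt_det (Δ := Δ) hC.ne').const_mul ((2 * Real.pi) ^ d)
  have p : 0 < (2 * Real.pi) ^ d * C.det := by positivity
  have h3 := (h2.sqrt (by simpa using p.ne')).inv (by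
    simpa using (Real.sqrt_pos.2 p).ne')
  have h4 := h3.mul (h1.const_mul (-(1 / 2))).exp
  refine h4.congr_deriv ?_
  have hsS : (C⁻¹)ᵀ = C⁻¹ := by rw [Matrix.transpose_nonsing_inv, hs]
  have tr : (C⁻¹ * Δ).trace = ∑ i, ∑ j, Δ i j * C⁻¹ i j := by
    simp only [Matrix.trace, Matrix.diag, Matrix.mul_apply]
    refine Finset.sum_comm.trans (Finset.sum_congr rfl fun i _ => Finset.sum_congr rfl fun j _ => ?_)
    rw [mul_comm, ← hsS, Matrix.transpose_apply, hsS]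
  have e1 : ∑ i, ∑ j, Δ i j * ga2 C i j v = ((∑ i, ∑ j, Δ i j * (cinv C v i * cinv C v j)) -
      ∑ i, ∑ j, Δ i j * C⁻¹ i j) * ga C v := by
    simp only [ga2, sub_mul, Finset.sum_mul, ← Finset.sum_sub_distrib]
    exact Finset.sum_congr rfl fun i _ => Finset.sum_congr rfl fun j _ => by ring
  have e2 : ∑ i, m i * ga1 C i v = -(∑ i, m i * cinv C v i) * ga C v := by
    simp only [ga1, Finset.sum_mul, ← Finset.sum_neg_distrib]
    exact Finset.sum_congr rfl fun i _ => by ring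
  rw [e1, e2, ← tr]
  simp only [Pi.inv_apply, zero_smul, add_zero, ga]
  have q := Real.sq_sqrt p.le
  have q0 := (Real.sqrt_pos.2 p).ne'
  set S := √((2 * Real.pi) ^ d * C.det)
  have e3 : (2 * Real.pi) ^ d * (C.det * (C⁻¹ * Δ).trace) = S ^ 2 * (C⁻¹ * Δ).trace := by
    rw [q]; ring
  rw [e3]
  field_simp
  ring

lemma contDiff_ga (C : Matrix (Fin d) (Fin d) ℝ) {n : WithTop ℕ∞} : ContDiff ℝ n (ga C) := by
  unfold ga
  simp only [dotProduct, mulVec]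
  fun_prop

lemma contDiff_ga1 (C : Matrix (Fin d) (Fin d) ℝ) (i : Fin d) {n : WithTop ℕ∞} :
    ContDiff ℝ n (ga1 C i) := by
  have := contDiff_ga C (n := n)
  unfold ga1 cinv
  simp only [mulVec, dotProduct]
  fun_prop

lemma hasDerivAt_ga_space (hC : 0 < C.det) (hs : C.IsSymm) (v m : Vec d) :
    HasDerivAt (fun θ : ℝ => ga C (v + θ • m)) (∑ i, m i * ga1 C i v) 0 := by
  simpa using hasDerivAt_ga (Δ := 0) hC hs v m

lemma hasDerivAt_ga1_space (hC : 0 < C.det) (hs : C.IsSymm) (i : Fin d) (v m : Vec d) :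
    HasDerivAt (fun θ : ℝ => ga1 C i (v + θ • m)) (∑ j, m j * ga2 C i j v) 0 := by
  have h1 : HasDerivAt (fun θ : ℝ => cinv C (v + θ • m) i) (∑ j, C⁻¹ i j * m j) 0 := by
    have e : (fun θ : ℝ => cinv C (v + θ • m) i) = fun θ => cinv C v i + θ * ∑ j, C⁻¹ i j * m j := by
      ext θ
      simp [cinv, mulVec, dotProduct, mul_add, Finset.sum_add_distrib, Finset.mul_sum, mul_left_comm]
    rw [e]
    have := ((hasDerivAt_id (0 : ℝ)).mul_const (∑ j, C⁻¹ i j * m j)).const_add (cinv C v i)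
    simpa using this
  refine (h1.neg.mul (hasDerivAt_ga_space hC hs v m)).congr_deriv ?_
  simp only [zero_smul, add_zero, ga2, ga1, Pi.neg_apply]
  rw [Finset.mul_sum, ← Finset.sum_neg_distrib, Finset.sum_mul, ← Finset.sum_add_distrib]
  exact Finset.sum_congr rfl fun j _ => by ring

lemma fderiv_ga (hC : 0 < C.det) (hs : C.IsSymm) (v m : Vec d) :
    fderiv ℝ (ga C) v m = ∑ i, m i * ga1 C i v := by
  have h := ((contDiff_ga C (n := 1)).differentiable (by simp) v).hasFDerivAt.hasLineDerivAt m
  exact HasDerivAt.unique h (hasDerivAt_ga_space hC hs v m)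

lemma fderiv_ga1 (hC : 0 < C.det) (hs : C.IsSymm) (i : Fin d) (v m : Vec d) :
    fderiv ℝ (ga1 C i) v m = ∑ j, m j * ga2 C i j v := by
  have h := ((contDiff_ga1 C i (n := 1)).differentiable (by simp) v).hasFDerivAt.hasLineDerivAt m
  exact HasDerivAt.unique h (hasDerivAt_ga1_space hC hs i v m)

end GaussianDerivatives

section GaussianBounds

lemma Wk_mono_rate {d : ℕ} {l l' t D : ℝ} (h : l' ≤ l) (ht : 0 < t) (hD : 0 ≤ D) :
    Wk d l t D ≤ Wk d l' t D := by
  have := (omg_pos (d := d) ht hD).le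
  unfold Wk
  gcongr

lemma ga_le_prefactor {d : ℕ} {M t : ℝ} {C : Matrix (Fin d) (Fin d) ℝ} (hM : 1 ≤ M) (ht : 0 < t)
    (h : QB M t C) (v : Vec d) :
    ga C v ≤ M ^ d * ((√t ^ d)⁻¹ * Real.exp (-(1 / (2 * M)) * ‖v‖ ^ 2 / t)) := by
  have hM0 : 0 < M := by linarith
  have h1 := (h.det_bounds hM0 ht).1
  have h2 := h.le_quad hM0 ht v
  have s := Real.sqrt_pos.2 ht
  have e1 : (M ^ d)⁻¹ * √t ^ d ≤ √((2 * Real.pi) ^ d * C.det) := by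
    apply Real.le_sqrt_of_sq_le
    have p1 : (1 : ℝ) ≤ (2 * Real.pi) ^ d := one_le_pow₀ (by linarith [Real.pi_gt_three])
    have p2 : (M ^ d)⁻¹ ≤ 1 := inv_le_one_of_one_le₀ (one_le_pow₀ hM)
    have hd := h.det_pos hM0 ht
    calc ((M ^ d)⁻¹ * √t ^ d) ^ 2 = (M ^ d)⁻¹ * ((M ^ d)⁻¹ * (√t ^ 2) ^ d) := by ring
      _ ≤ 1 * ((M ^ d)⁻¹ * (√t ^ 2) ^ d) := by gcongr
      _ = (M⁻¹ * t) ^ d := by rw [Real.sq_sqrt ht.le, one_mul, mul_pow, inv_pow]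
      _ ≤ 1 * C.det := by linarith
      _ ≤ _ := by gcongr
  calc ga C v ≤ ((M ^ d)⁻¹ * √t ^ d)⁻¹ * Real.exp (-(1 / (2 * M)) * ‖v‖ ^ 2 / t) := by
        unfold ga
        gcongr
        have : -(1 / (2 * M)) * ‖v‖ ^ 2 / t = -(1 / 2) * (‖v‖ ^ 2 / (M * t)) := by
          field_simp
        rw [this]; linarith
    _ = _ := by rw [mul_inv, inv_inv]; ring

lemma exists_ga_weighted (d : ℕ) {M : ℝ} (hM : 1 ≤ M) : ∃ K ≥ (1 : ℝ), ∀ t > (0 : ℝ),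
    ∀ C : Matrix (Fin d) (Fin d) ℝ, QB M t C → ∀ v : Vec d,
    (1 + ‖v‖ / √t) ^ 3 * ga C v ≤ K * Wk d (1 / (4 * M)) t ‖v‖ := by
  have hM0 : 0 < M := by linarith
  obtain ⟨K, hK, h⟩ := exists_weighted_le_Wk d 3 (l := 1 / (2 * M)) (l' := 1 / (4 * M))
    (one_div_lt_one_div_of_lt (by positivity) (by linarith))
  refine ⟨M ^ d * K, by nlinarith [one_le_pow₀ hM (n := d)], fun t ht C hC v => ?_⟩
  have s := Real.sqrt_pos.2 ht
  calc (1 + ‖v‖ / √t) ^ 3 * ga C v ≤ (1 + ‖v‖ / √t) ^ 3 *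
        (M ^ d * ((√t ^ d)⁻¹ * Real.exp (-(1 / (2 * M)) * ‖v‖ ^ 2 / t))) := by
        gcongr; exact ga_le_prefactor hM ht hC v
    _ = M ^ d * ((1 + ‖v‖ / √t) ^ 3 * (√t ^ d)⁻¹ * Real.exp (-(1 / (2 * M)) * ‖v‖ ^ 2 / t)) := by
        ring
    _ ≤ M ^ d * (K * Wk d (1 / (4 * M)) t ‖v‖) := by
        exact mul_le_mul_of_nonneg_left (h t ht ‖v‖ (norm_nonneg v)) (by positivity)
    _ = _ := by ring

lemma abs_ga1_le {d : ℕ} {M t : ℝ} {C : Matrix (Fin d) (Fin d) ℝ} (hM : 1 ≤ M) (ht : 0 < t)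
    (h : QB M t C) (i : Fin d) (v : Vec d) :
    |ga1 C i v| ≤ M * (√t)⁻¹ * ((1 + ‖v‖ / √t) * ga C v) := by
  have hM0 : 0 < M := by linarith
  have s := Real.sqrt_pos.2 ht
  have g := ga_nonneg C v
  have h1 := (abs_coord_le (cinv C v) i).trans (h.norm_cinv_le hM0 ht v)
  rw [ga1, abs_mul, abs_neg, abs_of_nonneg g]
  calc |cinv C v i| * ga C v ≤ (M / t * ‖v‖) * ga C v := by gcongr
    _ = M * (√t)⁻¹ * (‖v‖ / √t * ga C v) := by
        conv_lhs => rw [← Real.sq_sqrt ht.le]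
        field_simp
    _ ≤ _ := by gcongr; linarith

lemma abs_ga2_le {d : ℕ} {M t : ℝ} {C : Matrix (Fin d) (Fin d) ℝ} (hM : 1 ≤ M) (ht : 0 < t)
    (h : QB M t C) (i j : Fin d) (v : Vec d) :
    |ga2 C i j v| ≤ M ^ 2 * t⁻¹ * ((1 + ‖v‖ / √t) ^ 2 * ga C v) := by
  have hM0 : 0 < M := by linarith
  have s := Real.sqrt_pos.2 ht
  have g := ga_nonneg C v
  have h1 := (abs_coord_le (cinv C v) i).trans (h.norm_cinv_le hM0 ht v)
  have h2 := (abs_coord_le (cinv C v) j).trans (h.norm_cinv_le hM0 ht v)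
  have h3 := h.abs_inv_le hM0 ht i j
  rw [ga2, abs_mul, abs_of_nonneg g]
  calc |cinv C v i * cinv C v j - C⁻¹ i j| * ga C v
      ≤ ((M / t * ‖v‖) * (M / t * ‖v‖) + M / t) * ga C v := by
        gcongr
        refine (abs_sub _ _).trans ?_
        rw [abs_mul]; gcongr
    _ = M ^ 2 * t⁻¹ * (((‖v‖ / √t) ^ 2 + M⁻¹) * ga C v) := by
        rw [div_pow, Real.sq_sqrt ht.le]
        field_simp
    _ ≤ _ := by
        gcongr
        have : M⁻¹ ≤ 1 := inv_le_one_of_one_le₀ hM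
        have : 0 ≤ ‖v‖ / √t := by positivity
        nlinarith

/-- All pointwise bounds for the Gaussian kernel and its derivatives. -/
lemma exists_gauss_bounds (d : ℕ) {M α : ℝ} (hM : 1 ≤ M) (hα : α ∈ Ioc (0 : ℝ) 1) :
    ∃ K ≥ (1 : ℝ), ∀ t > (0 : ℝ), ∀ C : Matrix (Fin d) (Fin d) ℝ, QB M t C → ∀ v : Vec d,
    ga C v ≤ K * Wk d (1 / (4 * M)) t ‖v‖ ∧
    (∀ i, |ga1 C i v| ≤ K * (√t)⁻¹ * Wk d (1 / (4 * M)) t ‖v‖) ∧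
    (∀ i, ‖v‖ * |ga1 C i v| ≤ K * Wk d (1 / (4 * M)) t ‖v‖) ∧
    (∀ i j, |ga2 C i j v| ≤ K * t⁻¹ * Wk d (1 / (4 * M)) t ‖v‖) ∧
    (∀ i j, ‖v‖ ^ α * |ga2 C i j v| ≤ K * t ^ (α / 2 - 1) * Wk d (1 / (4 * M)) t ‖v‖) := by
  obtain ⟨K, hK, h⟩ := exists_ga_weighted d hM
  refine ⟨M ^ 2 * K, by nlinarith [one_le_pow₀ hM (n := 2)], fun t ht C hC v => ?_⟩
  have hM0 : 0 < M := by linarith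
  have s := Real.sqrt_pos.2 ht
  have g := ga_nonneg C v
  have hh := h t ht C hC v
  set W := Wk d (1 / (4 * M)) t ‖v‖
  have hW : 0 < W := Wk_pos ht (norm_nonneg _)
  set X := 1 + ‖v‖ / √t with hX
  have hX1 : 1 ≤ X := by
    have : 0 ≤ ‖v‖ / √t := by positivity
    linarith
  have hv : ‖v‖ ≤ √t * X := by rw [hX]; field_simp; linarith
  have b0 : ga C v ≤ K * W := by nlinarith [one_le_pow₀ hX1 (n := 3)]
  have b1 : X * ga C v ≤ K * W := by
    refine le_trans ?_ hh
    gcongr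
    exact le_self_pow₀ hX1 (by norm_num)
  have b2 : X ^ 2 * ga C v ≤ K * W := by
    refine le_trans ?_ hh
    gcongr
    norm_num
  have hMM : M ≤ M ^ 2 := le_self_pow₀ hM (by norm_num)
  have hM2 : (1 : ℝ) ≤ M ^ 2 := one_le_pow₀ hM
  refine ⟨?_, fun i => ?_, fun i => ?_, fun i j => ?_, fun i j => ?_⟩
  · calc ga C v ≤ 1 * (K * W) := by linarith
      _ ≤ M ^ 2 * (K * W) := by gcongr
      _ = _ := by ring
  · calc _ ≤ M * (√t)⁻¹ * (X * ga C v) := abs_ga1_le hM ht hC i v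
      _ ≤ M ^ 2 * (√t)⁻¹ * (K * W) := by gcongr
      _ = _ := by ring
  · calc _ ≤ (√t * X) * (M * (√t)⁻¹ * (X * ga C v)) := by
          gcongr; exact abs_ga1_le hM ht hC i v
      _ = M * (X ^ 2 * ga C v) := by field_simp
      _ ≤ M ^ 2 * (K * W) := by gcongr
      _ = _ := by ring
  · calc _ ≤ M ^ 2 * t⁻¹ * (X ^ 2 * ga C v) := abs_ga2_le hM ht hC i j v
      _ ≤ M ^ 2 * t⁻¹ * (K * W) := by gcongr
      _ = _ := by ring
  · have hva : ‖v‖ ^ α ≤ t ^ (α / 2) * X := by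
      calc ‖v‖ ^ α ≤ (√t * X) ^ α := Real.rpow_le_rpow (norm_nonneg _) hv hα.1.le
        _ = t ^ (α / 2) * X ^ α := by
            rw [Real.mul_rpow s.le (by linarith), Real.sqrt_eq_rpow, ← Real.rpow_mul ht.le]
            congr 2; ring
        _ ≤ t ^ (α / 2) * X ^ (1 : ℝ) := by
            gcongr
            exact hα.2
        _ = _ := by rw [Real.rpow_one]
    calc _ ≤ (t ^ (α / 2) * X) * (M ^ 2 * t⁻¹ * (X ^ 2 * ga C v)) := by
          gcongr; exact abs_ga2_le hM ht hC i j v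
      _ = M ^ 2 * t ^ (α / 2 - 1) * (X ^ 3 * ga C v) := by
          rw [Real.rpow_sub ht, Real.rpow_one]; ring
      _ ≤ M ^ 2 * t ^ (α / 2 - 1) * (K * W) := by gcongr
      _ = _ := by ring

lemma Wk_near {d : ℕ} {l t D D' : ℝ} (hl : 0 ≤ l) (ht : 0 < t) (hD : 0 ≤ D) (hD' : 0 ≤ D')
    (h : D' ≤ D + √t) : Wk d l t D ≤ 2 ^ (d + 1) * Real.exp l * Wk d (l / 2) t D' := by
  have s := Real.sqrt_pos.2 ht
  have e1 : omg d t D ≤ 2 ^ (d + 1) * omg d t D' := by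
    unfold omg
    rw [← mul_div_assoc, div_le_div_iff₀ (by positivity) (by positivity)]
    calc √t * (√t + D') ^ (d + 1) ≤ √t * (2 * (√t + D)) ^ (d + 1) := by gcongr; linarith
      _ = _ := by rw [mul_pow]; ring
  have e2 : Real.exp (-l * D ^ 2 / t) ≤ Real.exp l * Real.exp (-(l / 2) * D' ^ 2 / t) := by
    rw [← Real.exp_add, Real.exp_le_exp]
    have h1 : D' ^ 2 ≤ 2 * D ^ 2 + 2 * t := by
      nlinarith [Real.sq_sqrt ht.le, sq_nonneg (D - √t)]
    have h2 : l / 2 * (D' ^ 2 / t) ≤ l / 2 * ((2 * D ^ 2 + 2 * t) / t) := by gcongr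
    have h3 : (2 * D ^ 2 + 2 * t) / t = 2 * (D ^ 2 / t) + 2 := by field_simp
    rw [h3] at h2
    have h4 : -l * D ^ 2 / t = -(l * (D ^ 2 / t)) := by ring
    have h5 : -(l / 2) * D' ^ 2 / t = -(l / 2 * (D' ^ 2 / t)) := by ring
    rw [h4, h5]; linarith
  have p := (omg_pos (d := d) ht hD').le
  unfold Wk
  calc _ ≤ (2 ^ (d + 1) * omg d t D') * (Real.exp l * Real.exp (-(l / 2) * D' ^ 2 / t)) := by
        gcongr
    _ = _ := by ring

/-- Hölder continuity of the first derivatives of the Gaussian kernel. -/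
lemma exists_ga1_holder (d : ℕ) {M γ : ℝ} (hM : 1 ≤ M) (hγ : γ ∈ Ioo (0 : ℝ) 1) :
    ∃ K ≥ (1 : ℝ), ∀ t > (0 : ℝ), ∀ C : Matrix (Fin d) (Fin d) ℝ, QB M t C → ∀ v v' : Vec d,
    ∀ i, |ga1 C i v - ga1 C i v'| ≤ K * ‖v - v'‖ ^ γ * t ^ (-(1 + γ) / 2) *
      (Wk d (1 / (8 * M)) t ‖v‖ + Wk d (1 / (8 * M)) t ‖v'‖) := by
  obtain ⟨K, hK, h⟩ := exists_gauss_bounds d hM (α := 1) ⟨one_pos, le_rfl⟩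
  have hM0 : 0 < M := by linarith
  set L := 2 ^ (d + 1) * Real.exp (1 / (4 * M)) with hL
  have hL1 : 1 ≤ L := by
    have h1 : (1 : ℝ) ≤ 2 ^ (d + 1) := one_le_pow₀ (by norm_num)
    have h2 : 1 ≤ Real.exp (1 / (4 * M)) := Real.one_le_exp (by positivity)
    nlinarith
  refine ⟨(d + 1) * K * L, ?_, fun t ht C hC v v' i => ?_⟩
  · have : (0 : ℝ) ≤ d := Nat.cast_nonneg d
    have h3 : 1 ≤ K * L := by nlinarith
    nlinarith
  have s := Real.sqrt_pos.2 ht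
  have hW := Wk_pos (d := d) (l := 1 / (8 * M)) ht (norm_nonneg v)
  have hW' := Wk_pos (d := d) (l := 1 / (8 * M)) ht (norm_nonneg v')
  have rate : (1 : ℝ) / (8 * M) ≤ 1 / (4 * M) := by gcongr; norm_num
  have hd := hC.det_pos hM0 ht
  have et : t ^ (-(1 + γ) / 2) = (√t)⁻¹ * (√t ^ γ)⁻¹ := by
    rw [Real.sqrt_eq_rpow, ← Real.rpow_mul ht.le, ← Real.rpow_neg ht.le, ← Real.rpow_neg ht.le,
      ← Real.rpow_add ht]
    congr 1; ring
  rcases le_total ‖v - v'‖ √t with hc | hc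
  · have hb : ∀ w ∈ segment ℝ v v', ‖fderiv ℝ (ga1 C i) w‖ ≤
        d * (K * t⁻¹ * (L * Wk d (1 / (8 * M)) t ‖v‖)) := by
      intro w hw
      have hwv : ‖v - w‖ ≤ √t := by
        have := norm_sub_le_of_mem_segment hw
        rw [norm_sub_rev]; exact this.trans (by rwa [norm_sub_rev])
      have hWw : Wk d (1 / (4 * M)) t ‖w‖ ≤ L * Wk d (1 / (8 * M)) t ‖v‖ := by
        have := Wk_near (d := d) (l := 1 / (4 * M)) (by positivity) ht (norm_nonneg w)
          (norm_nonneg v) (by linarith [norm_le_norm_add_norm_sub' v w])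
        rwa [show (1 : ℝ) / (4 * M) / 2 = 1 / (8 * M) by field_simp; norm_num] at this
      refine ContinuousLinearMap.opNorm_le_bound _ (by positivity) fun m => ?_
      rw [fderiv_ga1 hd hC.symm, Real.norm_eq_abs]
      refine (Finset.abs_sum_le_sum_abs _ _).trans ?_
      calc ∑ j, |m j * ga2 C i j w| ≤ ∑ _j : Fin d, ‖m‖ *
            (K * t⁻¹ * (L * Wk d (1 / (8 * M)) t ‖v‖)) := by
            gcongr with j
            rw [abs_mul]
            have h1 := (h t ht C hC w).2.2.2.1 i j
            gcongr
            · exact abs_coord_le m j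
            · exact h1.trans (by gcongr)
        _ = _ := by simp; ring
    have mv := (convex_segment v v').norm_image_sub_le_of_norm_fderiv_le
      (fun w _ => (contDiff_ga1 C i (n := 1)).differentiable (by simp) w) hb
      (right_mem_segment ℝ v v') (left_mem_segment ℝ v v')
    rw [Real.norm_eq_abs] at mv
    have hpow : ‖v - v'‖ ≤ ‖v - v'‖ ^ γ * (√t / √t ^ γ) := by
      rcases (norm_nonneg (v - v')).eq_or_lt with h0 | h0
      · rw [← h0]; positivity
      · calc ‖v - v'‖ = ‖v - v'‖ ^ γ * ‖v - v'‖ ^ (1 - γ) := by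
              rw [← Real.rpow_add h0]; simp
          _ ≤ ‖v - v'‖ ^ γ * √t ^ (1 - γ) := by
              gcongr
              linarith [hγ.2]
          _ = _ := by rw [Real.rpow_sub s, Real.rpow_one]
    calc _ ≤ d * (K * t⁻¹ * (L * Wk d (1 / (8 * M)) t ‖v‖)) * ‖v - v'‖ := mv
      _ ≤ d * (K * t⁻¹ * (L * Wk d (1 / (8 * M)) t ‖v‖)) * (‖v - v'‖ ^ γ * (√t / √t ^ γ)) := by
          gcongr
      _ = d * K * L * ‖v - v'‖ ^ γ * ((√t)⁻¹ * (√t ^ γ)⁻¹) * Wk d (1 / (8 * M)) t ‖v‖ := by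
          have : t⁻¹ = (√t)⁻¹ * (√t)⁻¹ := by rw [← mul_inv, Real.mul_self_sqrt ht.le]
          rw [this]; field_simp
      _ ≤ (d + 1) * K * L * ‖v - v'‖ ^ γ * ((√t)⁻¹ * (√t ^ γ)⁻¹) *
          (Wk d (1 / (8 * M)) t ‖v‖ + Wk d (1 / (8 * M)) t ‖v'‖) := by
          gcongr <;> linarith
      _ = _ := by rw [et]
  · have h1 := ((h t ht C hC v).2.1 i).trans
      (mul_le_mul_of_nonneg_left (Wk_mono_rate rate ht (norm_nonneg v)) (by positivity))
    have h2 := ((h t ht C hC v').2.1 i).trans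
      (mul_le_mul_of_nonneg_left (Wk_mono_rate rate ht (norm_nonneg v')) (by positivity))
    have hone : 1 ≤ ‖v - v'‖ ^ γ * (√t ^ γ)⁻¹ := by
      rw [← div_eq_mul_inv, one_le_div (by positivity)]
      exact Real.rpow_le_rpow s.le hc hγ.1.le
    calc |ga1 C i v - ga1 C i v'| ≤ |ga1 C i v| + |ga1 C i v'| := abs_sub _ _
      _ ≤ K * (√t)⁻¹ * (Wk d (1 / (8 * M)) t ‖v‖ + Wk d (1 / (8 * M)) t ‖v'‖) := by linarith
      _ ≤ (K * (√t)⁻¹ * (Wk d (1 / (8 * M)) t ‖v‖ + Wk d (1 / (8 * M)) t ‖v'‖)) *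
          (‖v - v'‖ ^ γ * (√t ^ γ)⁻¹) := le_mul_of_one_le_right (by positivity) hone
      _ = 1 * K * 1 * ‖v - v'‖ ^ γ * t ^ (-(1 + γ) / 2) *
          (Wk d (1 / (8 * M)) t ‖v‖ + Wk d (1 / (8 * M)) t ‖v'‖) := by rw [et]; ring
      _ ≤ _ := by
          gcongr
          linarith [(Nat.cast_nonneg d : (0 : ℝ) ≤ d)]

/-- Lower bound of the Gaussian kernel near its centre. -/
lemma exists_ga_lower (d : ℕ) {M R : ℝ} (hM : 1 ≤ M) :
    ∃ c > (0 : ℝ), ∀ t > (0 : ℝ), ∀ C : Matrix (Fin d) (Fin d) ℝ, QB M t C → ∀ v : Vec d,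
    ‖v‖ ≤ R * √t → c * (√t ^ d)⁻¹ ≤ ga C v := by
  have hM0 : 0 < M := by linarith
  refine ⟨(√((2 * Real.pi * M) ^ d))⁻¹ * Real.exp (-(1 / 2) * (M * R ^ 2)), by positivity,
    fun t ht C hC v hv => ?_⟩
  have s := Real.sqrt_pos.2 ht
  have h1 := (hC.det_bounds hM0 ht).2
  have h2 := hC.quad_le hM0 ht v
  have hd := hC.det_pos hM0 ht
  have h3 : √((2 * Real.pi) ^ d * C.det) ≤ √((2 * Real.pi * M) ^ d) * √t ^ d := by
    apply Real.sqrt_le_iff.2 ⟨by positivity, ?_⟩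
    rw [mul_pow (√((2 * Real.pi * M) ^ d)), Real.sq_sqrt (by positivity)]
    calc (2 * Real.pi) ^ d * C.det ≤ (2 * Real.pi) ^ d * (M * t) ^ d := by gcongr
      _ = (2 * Real.pi * M) ^ d * (√t ^ 2) ^ d := by
          rw [Real.sq_sqrt ht.le, ← mul_pow, ← mul_pow]; ring
      _ = _ := by ring
  have h4 : M / t * ‖v‖ ^ 2 ≤ M * R ^ 2 := by
    calc M / t * ‖v‖ ^ 2 ≤ M / t * (R * √t) ^ 2 := by gcongr
      _ = _ := by rw [mul_pow, Real.sq_sqrt ht.le]; field_simp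
  calc _ = (√((2 * Real.pi * M) ^ d) * √t ^ d)⁻¹ * Real.exp (-(1 / 2) * (M * R ^ 2)) := by
        rw [mul_inv]; ring
    _ ≤ _ := by
        unfold ga
        have : 0 < √((2 * Real.pi) ^ d * C.det) := Real.sqrt_pos.2 (by positivity)
        exact mul_le_mul (inv_anti₀ this h3) (Real.exp_le_exp.2 (by linarith)) (by positivity)
          (by positivity)

end GaussianBounds

section GaussianRegularity

variable {d : ℕ}

lemma continuousAt_cinv {q : Matrix (Fin d) (Fin d) ℝ × Vec d} (h : q.1.det ≠ 0) :
    ContinuousAt (fun q : Matrix (Fin d) (Fin d) ℝ × Vec d => cinv q.1 q.2) q := by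
  have h1 : ContinuousAt (fun q : Matrix (Fin d) (Fin d) ℝ × Vec d => q.1⁻¹) q := by
    refine ContinuousAt.comp (g := fun A : Matrix (Fin d) (Fin d) ℝ => A⁻¹) (f := Prod.fst) ?_
      continuousAt_fst
    refine continuousAt_matrix_inv _ ?_
    rw [Ring.inverse_eq_inv']
    exact continuousAt_inv₀ h
  have h2 : Continuous fun q : Matrix (Fin d) (Fin d) ℝ × Vec d =>
      (WithLp.toLp 2 (q.1.mulVec q.2.ofLp) : Vec d) := by fun_prop
  exact ContinuousAt.comp (g := fun q : Matrix (Fin d) (Fin d) ℝ × Vec d =>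
      (WithLp.toLp 2 (q.1.mulVec q.2.ofLp) : Vec d))
    (f := fun q : Matrix (Fin d) (Fin d) ℝ × Vec d => (q.1⁻¹, q.2)) h2.continuousAt
    (h1.prodMk continuousAt_snd)

lemma continuousAt_cinv_apply {q : Matrix (Fin d) (Fin d) ℝ × Vec d} (h : q.1.det ≠ 0)
    (i : Fin d) :
    ContinuousAt (fun q : Matrix (Fin d) (Fin d) ℝ × Vec d => cinv q.1 q.2 i) q :=
  ContinuousAt.comp (g := fun v : Vec d => v i) (by fun_prop) (continuousAt_cinv h)

lemma continuousAt_inv_apply {q : Matrix (Fin d) (Fin d) ℝ × Vec d} (h : q.1.det ≠ 0)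
    (i j : Fin d) :
    ContinuousAt (fun q : Matrix (Fin d) (Fin d) ℝ × Vec d => q.1⁻¹ i j) q := by
  have := ContinuousAt.comp (g := fun q : Matrix (Fin d) (Fin d) ℝ × Vec d => cinv q.1 q.2 i)
    (f := fun q : Matrix (Fin d) (Fin d) ℝ × Vec d => (q.1, (EuclideanSpace.single j 1 : Vec d)))
    (x := q) (continuousAt_cinv_apply (q := (q.1, EuclideanSpace.single j 1)) h i) (by fun_prop)
  simpa [cinv, Function.comp_def] using this

lemma continuousAt_ga {q : Matrix (Fin d) (Fin d) ℝ × Vec d} (h : 0 < q.1.det) :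
    ContinuousAt (fun q : Matrix (Fin d) (Fin d) ℝ × Vec d => ga q.1 q.2) q := by
  have e : (fun q : Matrix (Fin d) (Fin d) ℝ × Vec d => ga q.1 q.2) = fun q =>
      (√((2 * Real.pi) ^ d * q.1.det))⁻¹ *
        Real.exp (-(1 / 2) * ∑ i, cinv q.1 q.2 i * q.2 i) := by
    ext q; rfl
  rw [e]
  have h0 : √((2 * Real.pi) ^ d * q.1.det) ≠ 0 := (Real.sqrt_pos.2 (by positivity)).ne'
  refine ContinuousAt.mul (ContinuousAt.inv₀ (by fun_prop) h0) ?_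
  refine Real.continuous_exp.continuousAt.comp (continuousAt_const.mul ?_)
  refine tendsto_finsetSum _ fun i _ => ?_
  exact (continuousAt_cinv_apply h.ne' i).mul (by fun_prop)

lemma continuousAt_ga1 {q : Matrix (Fin d) (Fin d) ℝ × Vec d} (h : 0 < q.1.det) (i : Fin d) :
    ContinuousAt (fun q : Matrix (Fin d) (Fin d) ℝ × Vec d => ga1 q.1 i q.2) q :=
  (continuousAt_cinv_apply h.ne' i).neg.mul (continuousAt_ga h)

lemma continuousAt_ga2 {q : Matrix (Fin d) (Fin d) ℝ × Vec d} (h : 0 < q.1.det) (i j : Fin d) :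
    ContinuousAt (fun q : Matrix (Fin d) (Fin d) ℝ × Vec d => ga2 q.1 i j q.2) q :=
  (((continuousAt_cinv_apply h.ne' i).mul (continuousAt_cinv_apply h.ne' j)).sub
    (continuousAt_inv_apply h.ne' i j)).mul (continuousAt_ga h)

variable {Z : Type*} [MeasurableSpace Z] {f : Z → Matrix (Fin d) (Fin d) ℝ} {g : Z → Vec d}

lemma measurable_det_comp (hf : ∀ i j, Measurable fun z => f z i j) :
    Measurable fun z => (f z).det := by
  simp only [Matrix.det_apply]
  exact Finset.measurable_sum _ fun σ _ => Measurable.const_smul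
    (Finset.measurable_prod _ fun i _ => hf _ _) _

lemma measurable_inv_comp (hf : ∀ i j, Measurable fun z => f z i j) (i j : Fin d) :
    Measurable fun z => (f z)⁻¹ i j := by
  have e : (fun z => (f z)⁻¹ i j) = fun z => ((f z).det)⁻¹ * ((f z).updateRow j (Pi.single i 1)).det := by
    ext z
    rw [Matrix.inv_def, Ring.inverse_eq_inv', Matrix.smul_apply, Matrix.adjugate_apply, smul_eq_mul]
  rw [e]
  refine (measurable_det_comp hf).inv.mul (measurable_det_comp fun k l => ?_)
  by_cases h : k = j
  · subst h; simp
  · simpa [Matrix.updateRow_ne h] using hf k l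

lemma measurable_cinv_comp (hf : ∀ i j, Measurable fun z => f z i j) (hg : Measurable g)
    (i : Fin d) : Measurable fun z => cinv (f z) (g z) i := by
  change Measurable fun z => ∑ j, (f z)⁻¹ i j * g z j
  exact Finset.measurable_sum _ fun j _ => (measurable_inv_comp hf i j).mul (by fun_prop)

lemma measurable_ga_comp (hf : ∀ i j, Measurable fun z => f z i j) (hg : Measurable g) :
    Measurable fun z => ga (f z) (g z) := by
  change Measurable fun z => (√((2 * Real.pi) ^ d * (f z).det))⁻¹ *
        Real.exp (-(1 / 2) * ∑ i, cinv (f z) (g z) i * g z i)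
  refine ((measurable_det_comp hf).const_mul _).sqrt.inv.mul (Measurable.exp (Measurable.const_mul
    (Finset.measurable_sum _ fun i _ => (measurable_cinv_comp hf hg i).mul (by fun_prop)) _))

lemma measurable_ga1_comp (hf : ∀ i j, Measurable fun z => f z i j) (hg : Measurable g)
    (i : Fin d) : Measurable fun z => ga1 (f z) i (g z) :=
  (measurable_cinv_comp hf hg i).neg.mul (measurable_ga_comp hf hg)

lemma measurable_ga2_comp (hf : ∀ i j, Measurable fun z => f z i j) (hg : Measurable g)
    (i j : Fin d) : Measurable fun z => ga2 (f z) i j (g z) :=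
  (((measurable_cinv_comp hf hg i).mul (measurable_cinv_comp hf hg j)).sub
    (measurable_inv_comp hf i j)).mul (measurable_ga_comp hf hg)

lemma ga_smul_one {ε : ℝ} (v : Vec d) :
    ga (ε • (1 : Matrix (Fin d) (Fin d) ℝ)) v =
      (√((2 * Real.pi) ^ d * ε ^ d))⁻¹ * Real.exp (-(1 / 2) * (ε⁻¹ * ‖v‖ ^ 2)) := by
  unfold ga
  congr 2
  · simp
  · have : (ε • (1 : Matrix (Fin d) (Fin d) ℝ))⁻¹ = ε⁻¹ • 1 := by
      rcases eq_or_ne ε 0 with rfl | h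
      · simp
      · apply Matrix.inv_eq_left_inv
        simp [smul_smul, h]
    rw [this, Matrix.smul_mulVec, Matrix.one_mulVec, smul_dotProduct, dot_self_eq, smul_eq_mul]

lemma integrable_ga_one : Integrable (ga (1 : Matrix (Fin d) (Fin d) ℝ)) := by
  have h := GaussianFourier.integrable_cexp_neg_mul_sq_norm_add (V := Vec d) (b := 1 / 2)
    (by norm_num) 0 0
  have h2 := h.re
  have e : ga (1 : Matrix (Fin d) (Fin d) ℝ) = fun v => (√((2 * Real.pi) ^ d))⁻¹ *
      Real.exp (-(1 / 2) * ‖v‖ ^ 2) := by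
    ext v; simpa using ga_smul_one (ε := 1) v
  rw [e]
  refine (h2.congr (Filter.Eventually.of_forall fun v => ?_)).const_mul _
  have : -(1 / 2 : ℂ) * (‖v‖ : ℂ) ^ 2 + 0 * (inner ℝ 0 v : ℂ) =
      ((-(1 / 2) * ‖v‖ ^ 2 : ℝ) : ℂ) := by push_cast; simp
  simp only [this]
  exact Complex.exp_ofReal_re _

lemma integral_ga_one : ∫ v, ga (1 : Matrix (Fin d) (Fin d) ℝ) v = 1 := by
  have e : ga (1 : Matrix (Fin d) (Fin d) ℝ) = fun v => (√((2 * Real.pi) ^ d))⁻¹ *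
      Real.exp (-(1 / 2) * ‖v‖ ^ 2) := by
    ext v; simpa using ga_smul_one (ε := 1) v
  have h := GaussianFourier.integral_rexp_neg_mul_sq_norm (V := Vec d) (b := 1 / 2) (by norm_num)
  rw [e, integral_const_mul, h]
  simp only [finrank_euclideanSpace, Fintype.card_fin]
  have : (Real.pi / (1 / 2)) ^ ((d : ℝ) / 2) = √((2 * Real.pi) ^ d) := by
    rw [Real.sqrt_eq_rpow, ← Real.rpow_natCast, ← Real.rpow_mul (by positivity)]
    congr 1 <;> ring
  rw [this, inv_mul_cancel₀ (Real.sqrt_pos.2 (by positivity)).ne']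

/-- Rescaling of the Gaussian mollifier. -/
lemma integral_ga_smul_one {ε : ℝ} (hε : 0 < ε) (x : Vec d) (φ : Vec d → ℝ) :
    ∫ y, ga (ε • (1 : Matrix (Fin d) (Fin d) ℝ)) (x - y) * φ y =
      ∫ w, ga (1 : Matrix (Fin d) (Fin d) ℝ) w * φ (x - √ε • w) := by
  have s := Real.sqrt_pos.2 hε
  have h1 := integral_sub_left_eq_self
    (fun y => ga (ε • (1 : Matrix (Fin d) (Fin d) ℝ)) (x - y) * φ y) volume x
  rw [← h1]
  simp only [sub_sub_cancel]
  have h2 := Measure.integral_comp_smul volume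
    (fun y => ga (ε • (1 : Matrix (Fin d) (Fin d) ℝ)) y * φ (x - y)) (√ε)
  simp only [finrank_euclideanSpace, Fintype.card_fin, smul_eq_mul] at h2
  have h3 : ∀ w : Vec d, ga (1 : Matrix (Fin d) (Fin d) ℝ) w =
      √ε ^ d * ga (ε • (1 : Matrix (Fin d) (Fin d) ℝ)) (√ε • w) := fun w => by
    have h4 : √((2 * Real.pi) ^ d * ε ^ d) = √((2 * Real.pi) ^ d) * √ε ^ d := by
      rw [Real.sqrt_mul (by positivity)]
      congr 1
      rw [Real.sqrt_eq_iff_mul_self_eq (by positivity) (by positivity), ← mul_pow,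
        Real.mul_self_sqrt hε.le]
    have h5 := ga_smul_one (ε := 1) w
    rw [one_smul] at h5
    rw [h5, ga_smul_one, h4, norm_smul, mul_pow ‖√ε‖, Real.norm_of_nonneg s.le, Real.sq_sqrt hε.le]
    have : ε⁻¹ * (ε * ‖w‖ ^ 2) = 1⁻¹ * ‖w‖ ^ 2 := by field_simp
    rw [this, one_pow, mul_one, mul_inv]
    field_simp
  simp_rw [h3, mul_assoc]
  rw [integral_const_mul, h2, abs_of_pos (by positivity), ← mul_assoc, mul_inv_cancel₀ (by positivity),
    one_mul]

end GaussianRegularity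

/-- Coefficients of a diffusion together with a reference flow (drift `c`, flow map `ζ r` with
inverse `π r`) around which the parametrix expansion is performed. -/
structure Setup (d : ℕ) (α M T : ℝ) where
  s0 : ℝ
  a : ℝ → Vec d → Matrix (Fin d) (Fin d) ℝ
  b : ℝ → Vec d → Vec d
  c : ℝ → Vec d → Vec d
  ζ : ℝ → Vec d → Vec d
  π : ℝ → Vec d → Vec d
  hα : α ∈ Ioc (0 : ℝ) 1
  hM : 1 ≤ M
  hT : 0 < T
  a_meas : ∀ i j, Measurable fun p : ℝ × Vec d => a p.1 p.2 i j
  b_meas : Measurable fun p : ℝ × Vec d => b p.1 p.2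
  c_meas : Measurable fun p : ℝ × Vec d => c p.1 p.2
  ζ_meas : Measurable fun p : ℝ × Vec d => ζ p.1 p.2
  π_meas : Measurable fun p : ℝ × Vec d => π p.1 p.2
  a_qb : ∀ r z, QB M 1 (a r z)
  a_bdd : ∀ r z i j, |a r z i j| ≤ M
  a_holder : ∀ r z z' i j, |a r z i j - a r z' i j| ≤ M * ‖z - z'‖ ^ α
  bc : ∀ r z z', ‖b r z - c r z'‖ ≤ M * (1 + ‖z - z'‖)
  ζπ : ∀ r z, ζ r (π r z) = z
  πζ : ∀ r w, π r (ζ r w) = w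
  ζ_lip : ∀ r w w', ‖ζ r w - ζ r w'‖ ≤ M * ‖w - w'‖
  π_lip : ∀ r z z', ‖π r z - π r z'‖ ≤ M * ‖z - z'‖
  c_loc : ∀ w, ∃ B, ∀ r, ‖c r (ζ r w)‖ ≤ B
  ode : ∀ w r r', ζ r' w - ζ r w = ∫ ρ in r..r', c ρ (ζ ρ w)
  growth : ∃ B, ∀ r z, ‖b r z‖ ≤ B * (1 + ‖z‖)

namespace Setup

variable {d : ℕ} {α M T : ℝ} (S : Setup d α M T)

lemma M_pos (S : Setup d α M T) : 0 < M := one_pos.trans_le S.hM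

/-- The (regularised) covariance of the Gaussian process frozen along the flow line of `w`. -/
def Cov (ε r u : ℝ) (w : Vec d) : Matrix (Fin d) (Fin d) ℝ :=
  Matrix.of (fun i j => ∫ ρ in Ioc r u, S.a ρ (S.ζ ρ w) i j) + ε • 1

/-- The frozen Gaussian density. -/
def pt (ε r : ℝ) (z : Vec d) (u : ℝ) (w : Vec d) : ℝ := ga (S.Cov ε r u w) (z - S.ζ r w)

/-- The parametrix kernel. -/
def Hk (ε r : ℝ) (z : Vec d) (u : ℝ) (w : Vec d) : ℝ :=
  1 / 2 * ∑ i, ∑ j, (S.a r z i j - S.a r (S.ζ r w) i j) * ga2 (S.Cov ε r u w) i j (z - S.ζ r w) +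
    ∑ i, (S.b r z - S.c r (S.ζ r w)) i * ga1 (S.Cov ε r u w) i (z - S.ζ r w)

lemma ζ_meas_right (w : Vec d) : Measurable fun r => S.ζ r w :=
  S.ζ_meas.comp (measurable_id.prodMk measurable_const)

lemma a_flow_meas (w : Vec d) (i j : Fin d) : Measurable fun r => S.a r (S.ζ r w) i j :=
  (S.a_meas i j).comp (measurable_id.prodMk (S.ζ_meas_right w))

lemma a_flow_integrable (r u : ℝ) (w : Vec d) (i j : Fin d) :
    IntegrableOn (fun ρ => S.a ρ (S.ζ ρ w) i j) (Ioc r u) :=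
  Measure.integrableOn_of_bounded (M := M) (by simp) (S.a_flow_meas w i j).aestronglyMeasurable
    (Filter.Eventually.of_forall fun _ => S.a_bdd _ _ _ _)

lemma Cov_apply (ε r u : ℝ) (w : Vec d) (i j : Fin d) : S.Cov ε r u w i j =
    (∫ ρ in Ioc r u, S.a ρ (S.ζ ρ w) i j) + ε * (1 : Matrix (Fin d) (Fin d) ℝ) i j := by
  simp [Cov]

lemma Cov_measurable {γ : Type*} [MeasurableSpace γ] {ε r u : γ → ℝ} {w : γ → Vec d}
    (hε : Measurable ε) (hr : Measurable r) (hu : Measurable u) (hw : Measurable w)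
    (i j : Fin d) : Measurable fun x => S.Cov (ε x) (r x) (u x) (w x) i j := by
  simp only [Cov_apply]
  refine Measurable.add ?_ (hε.mul_const _)
  have : ∀ x, ∫ ρ in Ioc (r x) (u x), S.a ρ (S.ζ ρ (w x)) i j =
      ∫ ρ, {q : γ × ℝ | r q.1 < q.2 ∧ q.2 ≤ u q.1}.indicator
        (fun q => S.a q.2 (S.ζ q.2 (w q.1)) i j) (x, ρ) := fun x => by
    rw [← integral_indicator measurableSet_Ioc]
    rfl
  simp only [this]
  refine (StronglyMeasurable.integral_prod_right' (Measurable.stronglyMeasurable ?_)).measurable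
  refine Measurable.indicator ?_ ?_
  · exact (S.a_meas i j).comp (measurable_snd.prodMk
      (S.ζ_meas.comp (measurable_snd.prodMk (hw.comp measurable_fst))))
  · exact (measurableSet_lt (hr.comp measurable_fst) measurable_snd).inter
      (measurableSet_le measurable_snd (hu.comp measurable_fst))

lemma pt_measurable {γ : Type*} [MeasurableSpace γ] {ε r u : γ → ℝ} {z w : γ → Vec d}
    (hε : Measurable ε) (hr : Measurable r) (hz : Measurable z) (hu : Measurable u)
    (hw : Measurable w) : Measurable fun x => S.pt (ε x) (r x) (z x) (u x) (w x) :=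
  measurable_ga_comp (S.Cov_measurable hε hr hu hw) (hz.sub (S.ζ_meas.comp (hr.prodMk hw)))

lemma _root_.measurable_vec_apply {d : ℕ} {γ : Type*} [MeasurableSpace γ] {f : γ → Vec d}
    (hf : Measurable f) (i : Fin d) : Measurable fun x => f x i :=
  (by fun_prop : Continuous fun v : Vec d => v i).measurable.comp hf

lemma Hk_measurable {γ : Type*} [MeasurableSpace γ] {ε r u : γ → ℝ} {z w : γ → Vec d}
    (hε : Measurable ε) (hr : Measurable r) (hz : Measurable z) (hu : Measurable u)
    (hw : Measurable w) : Measurable fun x => S.Hk (ε x) (r x) (z x) (u x) (w x) := by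
  have hζ : Measurable fun x => S.ζ (r x) (w x) := S.ζ_meas.comp (hr.prodMk hw)
  have hC := fun i j => S.Cov_measurable hε hr hu hw i j
  unfold Hk
  refine Measurable.add (Measurable.const_mul (Finset.measurable_fun_sum _ fun i _ =>
    Finset.measurable_fun_sum _ fun j _ => ?_) _) (Finset.measurable_fun_sum _ fun i _ => ?_)
  · exact (((S.a_meas i j).comp (hr.prodMk hz)).sub ((S.a_meas i j).comp (hr.prodMk hζ))).mul
      (measurable_ga2_comp hC (hz.sub hζ) i j)
  · exact (measurable_vec_apply ((S.b_meas.comp (hr.prodMk hz)).sub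
      (S.c_meas.comp (hr.prodMk hζ))) i).mul (measurable_ga1_comp hC (hz.sub hζ) i)

lemma Cov_qb {ε r u : ℝ} (hε : 0 ≤ ε) (hr : r ≤ u) (w : Vec d) :
    QB M (u - r + ε) (S.Cov ε r u w) := by
  have hM := S.hM
  have hM0 := S.M_pos
  have key : ∀ ξ : Fin d → ℝ, (S.Cov ε r u w).mulVec ξ ⬝ᵥ ξ =
      (∫ ρ in Ioc r u, (S.a ρ (S.ζ ρ w)).mulVec ξ ⬝ᵥ ξ) + ε * (ξ ⬝ᵥ ξ) := fun ξ => by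
    simp only [Cov, Matrix.add_mulVec, add_dotProduct, Matrix.smul_mulVec, Matrix.one_mulVec,
      smul_dotProduct, smul_eq_mul]
    congr 1
    simp only [dotProduct, Matrix.mulVec, Matrix.of_apply]
    have hi : ∀ i j, Integrable (fun ρ => S.a ρ (S.ζ ρ w) i j * ξ j)
        (volume.restrict (Ioc r u)) := fun i j => (S.a_flow_integrable r u w i j).mul_const _
    rw [integral_finsetSum _ fun i _ => (integrable_finsetSum _ fun j _ => hi i j).mul_const _]
    refine Finset.sum_congr rfl fun i _ => ?_
    rw [integral_mul_const, integral_finsetSum _ fun j _ => hi i j]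
    simp only [integral_mul_const]
  have integ : ∀ ξ : Fin d → ℝ, IntegrableOn
      (fun ρ => (S.a ρ (S.ζ ρ w)).mulVec ξ ⬝ᵥ ξ) (Ioc r u) := fun ξ => by
    simp only [dotProduct, Matrix.mulVec]
    exact integrable_finsetSum _ fun i _ => (integrable_finsetSum _ fun j _ =>
      (S.a_flow_integrable r u w i j).mul_const _).mul_const _
  have hv : (volume : Measure ℝ).real (Ioc r u) = u - r := by simp [hr]
  have hc : ∀ k : ℝ, ∫ _ in Ioc r u, k = (u - r) * k := fun k => by simp [hr]
  have hfin : ∀ k : ℝ, IntegrableOn (fun _ : ℝ => k) (Ioc r u) := fun k => by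
    simp
  refine ⟨?_, fun ξ => ?_, fun ξ => ?_⟩
  · ext i j
    simp only [Matrix.transpose_apply, Cov_apply]
    congr 1
    · refine integral_congr_ae (Filter.Eventually.of_forall fun ρ => ?_)
      exact (S.a_qb ρ (S.ζ ρ w)).symm.apply i j
    · rw [Matrix.one_apply, Matrix.one_apply]; simp [eq_comm]
  · have h0 := dot_self_nonneg' ξ
    have h1 := setIntegral_mono (hfin (M⁻¹ * 1 * (ξ ⬝ᵥ ξ))) (integ ξ)
      fun ρ => (S.a_qb ρ (S.ζ ρ w)).lo ξ
    rw [hc] at h1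
    rw [key]
    have h2 : M⁻¹ * (ε * (ξ ⬝ᵥ ξ)) ≤ ε * (ξ ⬝ᵥ ξ) :=
      mul_le_of_le_one_left (by positivity) (inv_le_one_of_one_le₀ hM)
    linarith
  · have h0 := dot_self_nonneg' ξ
    have h1 := setIntegral_mono (integ ξ) (hfin (M * 1 * (ξ ⬝ᵥ ξ)))
      fun ρ => (S.a_qb ρ (S.ζ ρ w)).hi ξ
    rw [hc] at h1
    rw [key]
    have h2 : ε * (ξ ⬝ᵥ ξ) ≤ M * (ε * (ξ ⬝ᵥ ξ)) :=
      le_mul_of_one_le_left (by positivity) hM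
    linarith

lemma Cov_det_pos {ε r u : ℝ} (hε : 0 ≤ ε) (hr : r ≤ u) (h : 0 < u - r + ε) (w : Vec d) :
    0 < (S.Cov ε r u w).det := (S.Cov_qb hε hr w).det_pos S.M_pos h

lemma exists_Hk_bound (d : ℕ) {α M T : ℝ} (hα : α ∈ Ioc (0 : ℝ) 1) (hM : 1 ≤ M) :
    ∃ K ≥ (1 : ℝ), ∀ S : Setup d α M T, ∀ ε r u : ℝ, 0 ≤ ε → r ≤ u → 0 < u - r + ε →
      u - r + ε ≤ T → ∀ z w : Vec d,
      |S.pt ε r z u w| ≤ K * Wk d (1 / (8 * M)) (u - r + ε) ‖z - S.ζ r w‖ ∧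
      |S.Hk ε r z u w| ≤ K * (u - r + ε) ^ (α / 2 - 1) *
        Wk d (1 / (8 * M)) (u - r + ε) ‖z - S.ζ r w‖ := by
  obtain ⟨K, hK, h⟩ := exists_gauss_bounds d hM hα
  set K1 := 1 / 2 * (d * (d * (M * K))) + d * (M * (K * (max T 1 + max T 1))) with hK1
  have hM0 : 0 < M := by linarith
  have hT1 : 1 ≤ max T 1 := le_max_right _ _
  refine ⟨max K K1, hK.trans (le_max_left _ _), fun S ε r u hε hr hτ hτT z w => ?_⟩
  set τ := u - r + ε
  set v := z - S.ζ r w with hv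
  have hrate : Wk d (1 / (4 * M)) τ ‖v‖ ≤ Wk d (1 / (8 * M)) τ ‖v‖ :=
    Wk_mono_rate (by gcongr; norm_num) hτ (norm_nonneg _)
  obtain ⟨h0, h1, h2, -, h4⟩ := h τ hτ _ (S.Cov_qb hε hr w) v
  set W := Wk d (1 / (4 * M)) τ ‖v‖
  have hW : 0 < W := Wk_pos hτ (norm_nonneg _)
  have hp : 0 < τ ^ (α / 2 - 1) := Real.rpow_pos_of_pos hτ _
  have e1 : (√τ)⁻¹ ≤ max T 1 * τ ^ (α / 2 - 1) := by
    rw [Real.sqrt_eq_rpow, ← Real.rpow_neg hτ.le]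
    have : τ ^ (-(1 / 2) : ℝ) = τ ^ ((1 - α) / 2) * τ ^ (α / 2 - 1) := by
      rw [← Real.rpow_add hτ]; congr 1; ring
    rw [this]
    gcongr
    calc τ ^ ((1 - α) / 2) ≤ (max T 1) ^ ((1 - α) / 2) :=
          Real.rpow_le_rpow hτ.le (hτT.trans (le_max_left _ _)) (by linarith [hα.2])
      _ ≤ (max T 1) ^ (1 : ℝ) := Real.rpow_le_rpow_of_exponent_le hT1 (by linarith [hα.1])
      _ = _ := Real.rpow_one _
  have e2 : 1 ≤ max T 1 * τ ^ (α / 2 - 1) := by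
    have : (1 : ℝ) = τ ^ (1 - α / 2) * τ ^ (α / 2 - 1) := by
      rw [← Real.rpow_add hτ]; simp
    refine this.le.trans (mul_le_mul_of_nonneg_right ?_ hp.le)
    calc τ ^ (1 - α / 2) ≤ (max T 1) ^ (1 - α / 2) :=
          Real.rpow_le_rpow hτ.le (hτT.trans (le_max_left _ _)) (by linarith [hα.2])
      _ ≤ (max T 1) ^ (1 : ℝ) := Real.rpow_le_rpow_of_exponent_le hT1 (by linarith [hα.1])
      _ = _ := Real.rpow_one _
  constructor
  · rw [pt, abs_of_nonneg (ga_nonneg _ _)]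
    exact h0.trans (by gcongr; exact le_max_left _ _)
  · have b1 : |∑ i, ∑ j, (S.a r z i j - S.a r (S.ζ r w) i j) * ga2 (S.Cov ε r u w) i j v| ≤
        d * (d * (M * K)) * τ ^ (α / 2 - 1) * W := by
      calc _ ≤ ∑ _i : Fin d, ∑ _j : Fin d, M * K * τ ^ (α / 2 - 1) * W := by
            refine (Finset.abs_sum_le_sum_abs _ _).trans (Finset.sum_le_sum fun i _ =>
              (Finset.abs_sum_le_sum_abs _ _).trans (Finset.sum_le_sum fun j _ => ?_))
            rw [abs_mul]
            calc _ ≤ M * ‖v‖ ^ α * |ga2 (S.Cov ε r u w) i j v| := by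
                  gcongr; exact S.a_holder r z _ i j
              _ = M * (‖v‖ ^ α * |ga2 (S.Cov ε r u w) i j v|) := by ring
              _ ≤ M * (K * τ ^ (α / 2 - 1) * W) := mul_le_mul_of_nonneg_left (h4 i j) hM0.le
              _ = _ := by ring
        _ = _ := by simp; ring
    have b2 : |∑ i, (S.b r z - S.c r (S.ζ r w)) i * ga1 (S.Cov ε r u w) i v| ≤
        d * (M * (K * (max T 1 + max T 1))) * τ ^ (α / 2 - 1) * W := by
      calc _ ≤ ∑ _i : Fin d, M * (K * (max T 1 + max T 1)) * τ ^ (α / 2 - 1) * W := by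
            refine (Finset.abs_sum_le_sum_abs _ _).trans (Finset.sum_le_sum fun i _ => ?_)
            rw [abs_mul]
            calc _ ≤ M * (1 + ‖v‖) * |ga1 (S.Cov ε r u w) i v| := by
                  gcongr; exact (abs_coord_le _ i).trans (S.bc r z _)
              _ = M * (|ga1 (S.Cov ε r u w) i v| + ‖v‖ * |ga1 (S.Cov ε r u w) i v|) := by ring
              _ ≤ M * (K * (max T 1 * τ ^ (α / 2 - 1)) * W +
                    K * (max T 1 * τ ^ (α / 2 - 1)) * W) := by
                  refine mul_le_mul_of_nonneg_left (add_le_add ?_ ?_) hM0.le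
                  · exact (h1 i).trans (by gcongr)
                  · refine (h2 i).trans ?_
                    gcongr
                    exact le_mul_of_one_le_right (by linarith) e2
              _ = _ := by ring
        _ = _ := by simp; ring
    calc |S.Hk ε r z u w| ≤ 1 / 2 * (d * (d * (M * K)) * τ ^ (α / 2 - 1) * W) +
          d * (M * (K * (max T 1 + max T 1))) * τ ^ (α / 2 - 1) * W := by
          unfold Hk
          refine (abs_add_le _ _).trans (add_le_add ?_ b2)
          rw [abs_mul, abs_of_pos (by norm_num : (0 : ℝ) < 1 / 2)]
          gcongr
      _ = K1 * τ ^ (α / 2 - 1) * W := by rw [hK1]; ring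
      _ ≤ _ := by gcongr; exact le_max_right _ _

end Setup

namespace Setup

variable {d : ℕ} {α M T : ℝ} (S : Setup d α M T)

/-- Admissible pairs of space-time points. -/
def Ok (e e' : ℝ × Vec d) : Prop := S.s0 ≤ e.1 ∧ e.1 < e'.1 ∧ e'.1 ≤ S.s0 + T

/-- Distance of two space-time points after transport to the reference time. -/
def Dm (e e' : ℝ × Vec d) : ℝ := ‖S.π e.1 e.2 - S.π e'.1 e'.2‖

/-- The Gaussian decay rate of the dominating kernels. -/
def _root_.rt (M : ℝ) : ℝ := 1 / (8 * M) / M ^ 2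

open Classical in
/-- The dominating kernel with time singularity `p - 1`. -/
def kk (p : ℝ) (e e' : ℝ × Vec d) : ℝ≥0∞ :=
  if S.Ok e e' then
    ENNReal.ofReal ((e'.1 - e.1) ^ (p - 1) * Wk d (rt M) (e'.1 - e.1) (S.Dm e e')) else 0

open Classical in
/-- The frozen density as a kernel on space-time. -/
def pk (e e' : ℝ × Vec d) : ℝ :=
  if S.Ok e e' then S.pt 0 e.1 e.2 e'.1 (S.π e'.1 e'.2) else 0

open Classical in
/-- The parametrix kernel on space-time. -/
def hk (e e' : ℝ × Vec d) : ℝ :=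
  if S.Ok e e' then S.Hk 0 e.1 e.2 e'.1 (S.π e'.1 e'.2) else 0

lemma Dm_nonneg (e e' : ℝ × Vec d) : 0 ≤ S.Dm e e' := norm_nonneg _

lemma Dm_triangle (e e'' e' : ℝ × Vec d) : S.Dm e e' ≤ S.Dm e e'' + S.Dm e'' e' :=
  norm_sub_le_norm_sub_add_norm_sub _ _ _

lemma rt_pos (S : Setup d α M T) : 0 < rt M := by
  have := S.M_pos
  unfold rt; positivity

lemma Dm_le (e e' : ℝ × Vec d) : S.Dm e e' ≤ M * ‖e.2 - S.ζ e.1 (S.π e'.1 e'.2)‖ := by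
  have := S.π_lip e.1 e.2 (S.ζ e.1 (S.π e'.1 e'.2))
  rwa [S.πζ] at this

lemma le_Dm (e e' : ℝ × Vec d) : ‖e.2 - S.ζ e.1 (S.π e'.1 e'.2)‖ ≤ M * S.Dm e e' := by
  have := S.ζ_lip e.1 (S.π e.1 e.2) (S.π e'.1 e'.2)
  rwa [S.ζπ] at this

lemma _root_.omg_scale {d : ℕ} {M τ D D' : ℝ} (hM : 1 ≤ M) (hτ : 0 < τ) (hD : 0 ≤ D)
    (hD' : 0 ≤ D') (h : D' ≤ M * D) : omg d τ D ≤ M ^ (d + 1) * omg d τ D' := by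
  have s := Real.sqrt_pos.2 hτ
  unfold omg
  rw [← mul_div_assoc, div_le_div_iff₀ (by positivity) (by positivity), mul_comm (M ^ (d + 1)),
    mul_assoc, ← mul_pow]
  gcongr
  nlinarith

lemma _root_.Wk_scale {d : ℕ} {M l τ D D' : ℝ} (hM : 1 ≤ M) (hl : 0 ≤ l) (hτ : 0 < τ)
    (hD : 0 ≤ D) (hD' : 0 ≤ D') (h : D' ≤ M * D) :
    Wk d l τ D ≤ M ^ (d + 1) * Wk d (l / M ^ 2) τ D' := by
  have hM0 : 0 < M := by linarith
  unfold Wk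
  rw [← mul_assoc]
  refine mul_le_mul (omg_scale hM hτ hD hD' h) ?_ (Real.exp_pos _).le
    (mul_nonneg (by positivity) (omg_pos hτ hD').le)
  rw [Real.exp_le_exp]
  have : (D' / M) ^ 2 ≤ D ^ 2 := by
    gcongr; rw [div_le_iff₀ hM0]; linarith
  have e : -(l / M ^ 2) * D' ^ 2 / τ = -(l * (D' / M) ^ 2 / τ) := by field_simp
  rw [e, neg_mul, neg_div]
  gcongr

lemma Wk_le_Dm {τ : ℝ} (hτ : 0 < τ) (e e' : ℝ × Vec d) :
    Wk d (1 / (8 * M)) τ ‖e.2 - S.ζ e.1 (S.π e'.1 e'.2)‖ ≤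
      M ^ (d + 1) * Wk d (rt M) τ (S.Dm e e') := by
  have := S.M_pos
  exact Wk_scale S.hM (by positivity) hτ (norm_nonneg _) (S.Dm_nonneg _ _) (S.Dm_le _ _)

lemma exists_kernel_bounds (d : ℕ) {α M : ℝ} (T : ℝ) (hα : α ∈ Ioc (0 : ℝ) 1) (hM : 1 ≤ M) :
    ∃ K ≥ (1 : ℝ), ∀ S : Setup d α M T, ∀ e e' : ℝ × Vec d,
      ‖S.pk e e'‖ₑ ≤ ENNReal.ofReal K * S.kk 1 e e' ∧
      ‖S.hk e e'‖ₑ ≤ ENNReal.ofReal K * S.kk (α / 2) e e' := by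
  obtain ⟨K, hK, h⟩ := exists_Hk_bound d (T := T) hα hM
  have hM0 : 0 < M := by linarith
  refine ⟨K * M ^ (d + 1), one_le_mul_of_one_le_of_one_le hK (one_le_pow₀ hM), fun S e e' => ?_⟩
  by_cases ho : S.Ok e e'
  · have hτ : 0 < e'.1 - e.1 := by linarith [ho.2.1]
    obtain ⟨h1, h2⟩ := h S 0 e.1 e'.1 le_rfl ho.2.1.le (by linarith) (by linarith [ho.1, ho.2.2])
      e.2 (S.π e'.1 e'.2)
    rw [add_zero] at h1 h2
    have hw := S.Wk_le_Dm hτ e e'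
    simp only [pk, hk, kk, if_pos ho, Real.enorm_eq_ofReal_abs]
    rw [← ENNReal.ofReal_mul (by positivity), ← ENNReal.ofReal_mul (by positivity)]
    have hp : 0 < (e'.1 - e.1) ^ (α / 2 - 1) := Real.rpow_pos_of_pos hτ _
    constructor
    · apply ENNReal.ofReal_le_ofReal
      rw [sub_self, Real.rpow_zero, one_mul, mul_assoc]
      exact h1.trans (by gcongr)
    · apply ENNReal.ofReal_le_ofReal
      refine h2.trans ?_
      calc _ ≤ K * (e'.1 - e.1) ^ (α / 2 - 1) *
            (M ^ (d + 1) * Wk d (rt M) (e'.1 - e.1) (S.Dm e e')) := by gcongr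
        _ = _ := by ring
  · simp [pk, hk, kk, if_neg ho]

section Measurability

variable {γ : Type*} [MeasurableSpace γ] {f g : γ → ℝ × Vec d}

lemma Dm_measurable (hf : Measurable f) (hg : Measurable g) :
    Measurable fun x => S.Dm (f x) (g x) :=
  ((S.π_meas.comp hf).sub (S.π_meas.comp hg)).norm

lemma measurableSet_Ok (hf : Measurable f) (hg : Measurable g) :
    MeasurableSet {x | S.Ok (f x) (g x)} :=
  (measurableSet_le measurable_const hf.fst).inter
    ((measurableSet_lt hf.fst hg.fst).inter (measurableSet_le hg.fst measurable_const))

lemma _root_.Wk_measurable {d : ℕ} {l : ℝ} {τ D : γ → ℝ} (hτ : Measurable τ)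
    (hD : Measurable D) : Measurable fun x => Wk d l (τ x) (D x) := by
  unfold Wk omg
  fun_prop

lemma kk_measurable (p : ℝ) (hf : Measurable f) (hg : Measurable g) :
    Measurable fun x => S.kk p (f x) (g x) := by
  refine Measurable.ite (S.measurableSet_Ok hf hg) ?_ measurable_const
  have hτ := hg.fst.sub hf.fst
  exact ((hτ.pow_const _).mul (Wk_measurable hτ (S.Dm_measurable hf hg))).ennreal_ofReal

lemma pk_measurable (hf : Measurable f) (hg : Measurable g) :
    Measurable fun x => S.pk (f x) (g x) :=
  Measurable.ite (S.measurableSet_Ok hf hg)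
    (S.pt_measurable measurable_const hf.fst hf.snd hg.fst (S.π_meas.comp hg)) measurable_const

lemma hk_measurable (hf : Measurable f) (hg : Measurable g) :
    Measurable fun x => S.hk (f x) (g x) :=
  Measurable.ite (S.measurableSet_Ok hf hg)
    (S.Hk_measurable measurable_const hf.fst hf.snd hg.fst (S.π_meas.comp hg)) measurable_const

end Measurability

lemma exists_lintegral_omg (d : ℕ) {M : ℝ} (hM : 1 ≤ M) : ∃ C > (0 : ℝ), ∀ {α T : ℝ},
    ∀ S : Setup d α M T, ∀ τ > (0 : ℝ), ∀ (r : ℝ) (e : ℝ × Vec d),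
      ∫⁻ z, ENNReal.ofReal (omg d τ (S.Dm (r, z) e)) ≤ ENNReal.ofReal C := by
  obtain ⟨C, hC, h⟩ := lintegral_omg d
  have hM0 : 0 < M := by linarith
  refine ⟨M ^ (d + 1) * C, by positivity, fun S τ hτ r e => ?_⟩
  calc _ ≤ ∫⁻ z, ENNReal.ofReal (M ^ (d + 1)) *
        ENNReal.ofReal (omg d τ ‖z - S.ζ r (S.π e.1 e.2)‖) := by
        refine lintegral_mono fun z => ?_
        rw [← ENNReal.ofReal_mul (by positivity)]
        exact ENNReal.ofReal_le_ofReal (omg_scale hM hτ (S.Dm_nonneg _ _) (norm_nonneg _)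
          (S.le_Dm (r, z) e))
    _ = ENNReal.ofReal (M ^ (d + 1)) *
        ∫⁻ z, ENNReal.ofReal (omg d τ ‖z - S.ζ r (S.π e.1 e.2)‖) :=
        lintegral_const_mul' _ _ ENNReal.ofReal_ne_top
    _ ≤ _ := by
        rw [ENNReal.ofReal_mul (by positivity)]
        gcongr
        exact h τ hτ _

lemma Dm_comm (e e' : ℝ × Vec d) : S.Dm e e' = S.Dm e' e := norm_sub_rev _ _

lemma _root_.Wk_le_omg {d : ℕ} {l τ D : ℝ} (hl : 0 ≤ l) (hτ : 0 < τ) (hD : 0 ≤ D) :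
    Wk d l τ D ≤ omg d τ D := by
  refine mul_le_of_le_one_right (omg_pos hτ hD).le (Real.exp_le_one_iff.2 ?_)
  rw [neg_mul, neg_div]
  have : 0 ≤ l * D ^ 2 / τ := by positivity
  linarith

/-- Integrating the dominating kernel over space. -/
lemma exists_lintegral_kk (d : ℕ) {M : ℝ} (hM : 1 ≤ M) : ∃ C > (0 : ℝ), ∀ {α T : ℝ},
    ∀ S : Setup d α M T, ∀ (p r : ℝ) (e : ℝ × Vec d),
      ∫⁻ z, S.kk p e (r, z) ≤ ENNReal.ofReal (C * (r - e.1) ^ (p - 1)) := by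
  obtain ⟨C, hC, h⟩ := exists_lintegral_omg d hM
  refine ⟨C, hC, fun S p r e => ?_⟩
  by_cases hr : e.1 < r
  · have hτ : 0 < r - e.1 := by linarith
    have hp : 0 < (r - e.1) ^ (p - 1) := Real.rpow_pos_of_pos hτ _
    calc _ ≤ ∫⁻ z, ENNReal.ofReal ((r - e.1) ^ (p - 1)) *
          ENNReal.ofReal (omg d (r - e.1) (S.Dm (r, z) e)) := by
          refine lintegral_mono fun z => ?_
          rw [← ENNReal.ofReal_mul hp.le]
          unfold kk
          split_ifs with ho
          · refine ENNReal.ofReal_le_ofReal (mul_le_mul_of_nonneg_left ?_ hp.le)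
            rw [S.Dm_comm]
            exact Wk_le_omg S.rt_pos.le hτ (S.Dm_nonneg _ _)
          · simp
      _ = ENNReal.ofReal ((r - e.1) ^ (p - 1)) *
          ∫⁻ z, ENNReal.ofReal (omg d (r - e.1) (S.Dm (r, z) e)) :=
          lintegral_const_mul' _ _ ENNReal.ofReal_ne_top
      _ ≤ _ := by
          rw [mul_comm C, ENNReal.ofReal_mul hp.le]
          gcongr
          exact h S _ hτ _ _
  · have : ∀ z, S.kk p e (r, z) = 0 := fun z => by
      unfold kk
      rw [if_neg fun ho => hr ho.2.1]
    simp [this]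

/-- Space-time convolution of the dominating kernels. -/
lemma exists_kk_conv (d : ℕ) {M p q : ℝ} (hM : 1 ≤ M) (hp : 0 < p) (hp1 : p ≤ 1) (hq : 0 < q)
    (hq1 : q ≤ 1) : ∃ C > (0 : ℝ), ∀ {α T : ℝ}, ∀ S : Setup d α M T, ∀ e e' : ℝ × Vec d,
      ∫⁻ e'', S.kk p e e'' * S.kk q e'' e' ≤ ENNReal.ofReal C * S.kk (p + q) e e' := by
  obtain ⟨C, hC, h⟩ := exists_lintegral_omg d hM
  obtain ⟨B, hB, hb⟩ := lintegral_beta hp hp1 hq hq1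
  refine ⟨2 ^ (d + 1) * (C + C) * B, by positivity, fun S e e' => ?_⟩
  by_cases ho : S.Ok e e'
  swap
  · have : ∀ e'', S.kk p e e'' * S.kk q e'' e' = 0 := fun e'' => by
      unfold kk
      by_cases h1 : S.Ok e e''
      · rw [if_neg (c := S.Ok e'' e') fun h2 => ho ⟨h1.1, h1.2.1.trans h2.2.1, h2.2.2⟩, mul_zero]
      · rw [if_neg h1, zero_mul]
    simp [this]
  set W := Wk d (rt M) (e'.1 - e.1) (S.Dm e e') with hW
  have hτ : 0 < e'.1 - e.1 := by linarith [ho.2.1]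
  have hW0 : 0 < W := Wk_pos hτ (S.Dm_nonneg _ _)
  have h1 : ∀ r z, S.kk p e (r, z) * S.kk q (r, z) e' ≤
      (Ioo e.1 e'.1).indicator (fun r =>
        ENNReal.ofReal ((r - e.1) ^ (p - 1) * (e'.1 - r) ^ (q - 1))) r *
      (ENNReal.ofReal (2 ^ (d + 1) * W) * (ENNReal.ofReal (omg d (r - e.1) (S.Dm (r, z) e)) +
        ENNReal.ofReal (omg d (e'.1 - r) (S.Dm (r, z) e')))) := fun r z => by
    unfold kk
    by_cases h1 : S.Ok e (r, z)
    swap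
    · rw [if_neg h1, zero_mul]; exact zero_le
    by_cases h2 : S.Ok (r, z) e'
    swap
    · rw [if_neg h2, mul_zero]; exact zero_le
    have hr1 : 0 < r - e.1 := by linarith [h1.2.1]
    have hr2 : 0 < e'.1 - r := by linarith [h2.2.1]
    have hp1 := Real.rpow_pos_of_pos hr1 (p - 1)
    have hp2 := Real.rpow_pos_of_pos hr2 (q - 1)
    have o1 := omg_pos (d := d) hr1 (S.Dm_nonneg (r, z) e)
    have o2 := omg_pos (d := d) hr2 (S.Dm_nonneg (r, z) e')
    have w1 := Wk_pos (l := rt M) (d := d) hr1 (S.Dm_nonneg e (r, z))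
    rw [if_pos h1, if_pos h2, indicator_of_mem (show r ∈ Ioo e.1 e'.1 from ⟨h1.2.1, h2.2.1⟩),
      ← ENNReal.ofReal_add o1.le o2.le, ← ENNReal.ofReal_mul (mul_nonneg hp1.le w1.le),
      ← ENNReal.ofReal_mul (p := 2 ^ (d + 1) * W) (by positivity),
      ← ENNReal.ofReal_mul (p := (r - e.1) ^ (p - 1) * (e'.1 - r) ^ (q - 1)) (by positivity)]
    apply ENNReal.ofReal_le_ofReal
    have := Wk_mul (d := d) S.rt_pos.le hr1 hr2 (S.Dm_nonneg e (r, z)) (S.Dm_nonneg (r, z) e')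
      (S.Dm_nonneg e e') (S.Dm_triangle e (r, z) e')
    rw [show r - e.1 + (e'.1 - r) = e'.1 - e.1 by ring, ← hW] at this
    calc _ = (r - e.1) ^ (p - 1) * (e'.1 - r) ^ (q - 1) *
          (Wk d (rt M) (r - e.1) (S.Dm e (r, z)) * Wk d (rt M) (e'.1 - r) (S.Dm (r, z) e')) := by
          ring
      _ ≤ _ := by
          refine mul_le_mul_of_nonneg_left ?_ (by positivity)
          rwa [S.Dm_comm (r, z) e]
  have h2 : ∀ r, ∫⁻ z, S.kk p e (r, z) * S.kk q (r, z) e' ≤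
      (Ioo e.1 e'.1).indicator (fun r =>
        ENNReal.ofReal ((r - e.1) ^ (p - 1) * (e'.1 - r) ^ (q - 1))) r *
      (ENNReal.ofReal (2 ^ (d + 1) * W) * ENNReal.ofReal (C + C)) := fun r => by
    by_cases hr : r ∈ Ioo e.1 e'.1
    · refine (lintegral_mono (h1 r)).trans ?_
      rw [lintegral_const_mul' _ _ (by rw [indicator_of_mem hr]; exact ENNReal.ofReal_ne_top),
        lintegral_const_mul' _ _ ENNReal.ofReal_ne_top,
        lintegral_add_left (by
          have := S.Dm_measurable (f := fun z : Vec d => (r, z)) (g := fun _ => e)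
            (by fun_prop) measurable_const
          unfold omg
          fun_prop), ENNReal.ofReal_add hC.le hC.le]
      gcongr
      · exact h S _ (by linarith [hr.1]) _ _
      · exact h S _ (by linarith [hr.2]) _ _
    · refine (lintegral_mono (h1 r)).trans ?_
      simp [indicator_of_notMem hr]
  calc _ ≤ ∫⁻ r, ∫⁻ z, S.kk p e (r, z) * S.kk q (r, z) e' := by
        rw [Measure.volume_eq_prod]; exact lintegral_prod_le _
    _ ≤ _ := lintegral_mono h2
    _ ≤ ENNReal.ofReal (B * (e'.1 - e.1) ^ (p + q - 1)) *
        (ENNReal.ofReal (2 ^ (d + 1) * W) * ENNReal.ofReal (C + C)) := by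
        rw [lintegral_mul_const' _ _ (ENNReal.mul_ne_top ENNReal.ofReal_ne_top
          ENNReal.ofReal_ne_top), lintegral_indicator measurableSet_Ioo]
        gcongr
        exact hb _ _ ho.2.1
    _ = _ := by
        have hp3 := Real.rpow_pos_of_pos hτ (p + q - 1)
        unfold kk
        rw [if_pos ho, ← ENNReal.ofReal_mul (by positivity), ← ENNReal.ofReal_mul (by positivity),
          ← ENNReal.ofReal_mul (by positivity)]
        congr 1
        ring

end Setup

namespace Setup

variable {d : ℕ} {α M T : ℝ} (S : Setup d α M T)

/-- The iterated parametrix kernels applied to the indicator of `A` at time `t`. -/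
def G (t : ℝ) (A : Set (Vec d)) : ℕ → ℝ × Vec d → ℝ
  | 0 => fun e => ∫ y in A, S.hk e (t, y)
  | n + 1 => fun e => ∫ e'', S.hk e e'' * G t A n e''

/-- The weighted majorant of the iterated kernels. -/
def Jw (Λ t : ℝ) (A : Set (Vec d)) (e : ℝ × Vec d) : ℝ≥0∞ :=
  ∫⁻ y in A, ENNReal.ofReal (Real.exp (Λ * (t - e.1))) * S.kk (α / 2) e (t, y)

lemma G_measurable (t : ℝ) (A : Set (Vec d)) (n : ℕ) : Measurable (S.G t A n) := by
  induction n with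
  | zero =>
    exact (StronglyMeasurable.integral_prod_right' (f := fun q : (ℝ × Vec d) × Vec d =>
      S.hk q.1 (t, q.2)) (S.hk_measurable measurable_fst
        (measurable_const.prodMk measurable_snd)).stronglyMeasurable).measurable
  | succ n ih =>
    exact (StronglyMeasurable.integral_prod_right' (f := fun q : (ℝ × Vec d) × (ℝ × Vec d) =>
      S.hk q.1 q.2 * S.G t A n q.2) ((S.hk_measurable measurable_fst measurable_snd).mul
        (ih.comp measurable_snd)).stronglyMeasurable).measurable

lemma G_eq_zero {t : ℝ} (A : Set (Vec d)) (n : ℕ) {e : ℝ × Vec d} (h : t ≤ e.1) :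
    S.G t A n e = 0 := by
  induction n generalizing e with
  | zero =>
    have : ∀ y, S.hk e (t, y) = 0 := fun y => if_neg fun ho => absurd ho.2.1 (not_lt.2 h)
    simp [G, this]
  | succ n ih =>
    have : ∀ e'', S.hk e e'' * S.G t A n e'' = 0 := fun e'' => by
      by_cases h1 : e.1 < e''.1
      · rw [ih (h.trans h1.le), mul_zero]
      · rw [hk, if_neg fun ho => h1 ho.2.1, zero_mul]
    simp [G, this]

lemma kk_mono {p p' : ℝ} (h : p' ≤ p) (e e' : ℝ × Vec d) :
    S.kk p e e' ≤ ENNReal.ofReal (T ^ (p - p')) * S.kk p' e e' := by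
  unfold kk
  split_ifs with ho
  · have hτ : 0 < e'.1 - e.1 := by linarith [ho.2.1]
    have hT := S.hT
    rw [← ENNReal.ofReal_mul (by positivity), ← mul_assoc]
    refine ENNReal.ofReal_le_ofReal (mul_le_mul_of_nonneg_right ?_
      (Wk_pos hτ (S.Dm_nonneg _ _)).le)
    rw [show p - 1 = (p - p') + (p' - 1) by ring, Real.rpow_add hτ]
    have : e'.1 - e.1 ≤ T := by linarith [ho.1, ho.2.2]
    gcongr
  · simp

lemma kk_exp {p η Λ : ℝ} (hη : 0 < η) (hη1 : η ≤ 1) (hΛ : 0 < Λ) (t : ℝ) (e e' : ℝ × Vec d) :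
    S.kk p e e' * ENNReal.ofReal (Real.exp (Λ * (t - e'.1))) ≤
      ENNReal.ofReal (Λ ^ (-η)) * ENNReal.ofReal (Real.exp (Λ * (t - e.1))) *
        S.kk (p - η) e e' := by
  unfold kk
  split_ifs with ho
  · set τ := e'.1 - e.1 with hτd
    have hτ : 0 < τ := by simp only [hτd]; linarith [ho.2.1]
    have hp := Real.rpow_pos_of_pos hτ (p - 1)
    have hW := Wk_pos (d := d) (l := rt M) hτ (S.Dm_nonneg e e')
    rw [← ENNReal.ofReal_mul (by positivity), ← ENNReal.ofReal_mul (by positivity),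
      ← ENNReal.ofReal_mul (by positivity)]
    apply ENNReal.ofReal_le_ofReal
    have hx : 0 < Λ * τ := by positivity
    have h1 : (Λ * τ) ^ η ≤ Real.exp (Λ * τ) := by
      calc (Λ * τ) ^ η ≤ (1 + Λ * τ) ^ η := by gcongr; linarith
        _ ≤ (1 + Λ * τ) ^ (1 : ℝ) := Real.rpow_le_rpow_of_exponent_le (by linarith) hη1
        _ = Λ * τ + 1 := by rw [Real.rpow_one]; ring
        _ ≤ _ := Real.add_one_le_exp _
    have h2 : Real.exp (Λ * (t - e.1)) = Real.exp (Λ * τ) * Real.exp (Λ * (t - e'.1)) := by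
      rw [← Real.exp_add]; congr 1; simp only [hτd]; ring
    have h3 : τ ^ (p - 1) = Λ ^ (-η) * (Λ * τ) ^ η * τ ^ (p - η - 1) := by
      rw [Real.mul_rpow hΛ.le hτ.le, ← mul_assoc, ← Real.rpow_add hΛ, neg_add_cancel,
        Real.rpow_zero, one_mul, ← Real.rpow_add hτ]
      congr 1; ring
    have hΛη := Real.rpow_pos_of_pos hΛ (-η)
    have hpη := Real.rpow_pos_of_pos hτ (p - η - 1)
    rw [h2, h3]
    calc _ = Λ ^ (-η) * τ ^ (p - η - 1) * Wk d (rt M) τ (S.Dm e e') *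
          Real.exp (Λ * (t - e'.1)) * (Λ * τ) ^ η := by ring
      _ ≤ Λ ^ (-η) * τ ^ (p - η - 1) * Wk d (rt M) τ (S.Dm e e') *
          Real.exp (Λ * (t - e'.1)) * Real.exp (Λ * τ) := by gcongr
      _ = _ := by ring
  · simp

lemma lintegral_kk_mul_Jw (p Λ t : ℝ) (A : Set (Vec d)) (e : ℝ × Vec d) :
    ∫⁻ e'', S.kk p e e'' * S.Jw Λ t A e'' =
      ∫⁻ y in A, ∫⁻ e'', S.kk p e e'' * ENNReal.ofReal (Real.exp (Λ * (t - e''.1))) *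
        S.kk (α / 2) e'' (t, y) := by
  rw [← lintegral_lintegral_swap (f := fun e'' y => S.kk p e e'' *
    ENNReal.ofReal (Real.exp (Λ * (t - e''.1))) * S.kk (α / 2) e'' (t, y))]
  · refine lintegral_congr fun e'' => ?_
    unfold Jw
    rw [← lintegral_const_mul]
    · simp only [mul_assoc]
    · exact (S.kk_measurable _ measurable_const
        (measurable_const.prodMk measurable_id)).const_mul _
  · refine Measurable.aemeasurable ?_
    refine Measurable.mul (Measurable.mul ?_ ?_) ?_
    · exact S.kk_measurable _ measurable_const measurable_fst
    · show Measurable fun q : (ℝ × Vec d) × Vec d => ENNReal.ofReal (Real.exp (Λ * (t - q.1.1)))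
      fun_prop
    · exact S.kk_measurable _ measurable_fst (measurable_const.prodMk measurable_snd)

lemma exists_G_bound (d : ℕ) {α M T : ℝ} (hα : α ∈ Ioc (0 : ℝ) 1) (hM : 1 ≤ M) :
    ∃ K ≥ (1 : ℝ), ∃ Λ > (0 : ℝ), ∀ S : Setup d α M T, ∀ (t : ℝ) (A : Set (Vec d)) (n : ℕ)
      (e : ℝ × Vec d),
      ‖S.G t A n e‖ₑ ≤ ENNReal.ofReal (K * (1 / 2) ^ n) * S.Jw Λ t A e ∧
      ∫⁻ e'', ‖S.hk e e'' * S.G t A n e''‖ₑ ≤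
        ENNReal.ofReal (K * (1 / 2) ^ (n + 1)) * S.Jw Λ t A e := by
  obtain ⟨K, hK, hk⟩ := exists_kernel_bounds d T hα hM
  obtain ⟨C, hC, hc⟩ := exists_kk_conv d (p := α / 2 - α / 4) (q := α / 2) hM
    (by linarith [hα.1]) (by linarith [hα.2]) (by linarith [hα.1]) (by linarith [hα.2])
  have hα0 := hα.1
  set B := K * C * (max T 1) ^ (α / 4) with hB
  have hT1 : 0 < max T 1 := lt_max_of_lt_right one_pos
  have hB0 : 0 < B := by positivity
  set Λ := (2 * B) ^ (4 / α) with hΛ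
  have hΛ0 : 0 < Λ := by positivity
  have hΛB : Λ ^ (-(α / 4)) = (2 * B)⁻¹ := by
    rw [hΛ, ← Real.rpow_mul (by positivity), ← Real.rpow_neg_one]
    congr 1; field_simp
  refine ⟨K, hK, Λ, hΛ0, fun S t A n e => ?_⟩
  have hK0 : 0 < K := by linarith
  have step : ∀ n, (∀ e, ‖S.G t A n e‖ₑ ≤ ENNReal.ofReal (K * (1 / 2) ^ n) * S.Jw Λ t A e) → ∀ e,
      ∫⁻ e'', ‖S.hk e e'' * S.G t A n e''‖ₑ ≤
        ENNReal.ofReal (K * (1 / 2) ^ (n + 1)) * S.Jw Λ t A e := fun n ih e => by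
    calc _ ≤ ∫⁻ e'', ENNReal.ofReal (K * (K * (1 / 2) ^ n)) *
          (S.kk (α / 2) e e'' * S.Jw Λ t A e'') := by
          refine lintegral_mono fun e'' => ?_
          rw [enorm_mul, ENNReal.ofReal_mul hK0.le]
          calc _ ≤ ENNReal.ofReal K * S.kk (α / 2) e e'' *
                (ENNReal.ofReal (K * (1 / 2) ^ n) * S.Jw Λ t A e'') := by
                gcongr
                · exact (hk S e e'').2
                · exact ih e''
            _ = _ := by ring
      _ = ENNReal.ofReal (K * (K * (1 / 2) ^ n)) * ∫⁻ y in A, ∫⁻ e'', S.kk (α / 2) e e'' *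
          ENNReal.ofReal (Real.exp (Λ * (t - e''.1))) * S.kk (α / 2) e'' (t, y) := by
          rw [lintegral_const_mul' _ _ ENNReal.ofReal_ne_top, lintegral_kk_mul_Jw]
      _ ≤ ENNReal.ofReal (K * (K * (1 / 2) ^ n)) * ∫⁻ y in A,
          ENNReal.ofReal (C * Λ ^ (-(α / 4)) * (max T 1) ^ (α / 4)) *
            (ENNReal.ofReal (Real.exp (Λ * (t - e.1))) * S.kk (α / 2) e (t, y)) := by
          gcongr with y
          calc _ ≤ ∫⁻ e'', ENNReal.ofReal (Λ ^ (-(α / 4))) *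
                ENNReal.ofReal (Real.exp (Λ * (t - e.1))) *
                (S.kk (α / 2 - α / 4) e e'' * S.kk (α / 2) e'' (t, y)) := by
                refine lintegral_mono fun e'' => ?_
                rw [← mul_assoc]
                exact mul_le_mul'
                  (S.kk_exp (η := α / 4) (by linarith) (by linarith [hα.2]) hΛ0 t e e'') le_rfl
            _ ≤ ENNReal.ofReal (Λ ^ (-(α / 4))) *
                ENNReal.ofReal (Real.exp (Λ * (t - e.1))) *
                (ENNReal.ofReal C * (ENNReal.ofReal ((max T 1) ^ (α / 4)) *
                  S.kk (α / 2) e (t, y))) := by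
                rw [lintegral_const_mul' _ _ (ENNReal.mul_ne_top ENNReal.ofReal_ne_top
                  ENNReal.ofReal_ne_top)]
                gcongr
                refine (hc S e (t, y)).trans ?_
                gcongr
                refine (S.kk_mono (p' := α / 2) (by linarith) _ _).trans ?_
                gcongr
                rw [show α / 2 - α / 4 + α / 2 - α / 2 = α / 4 by ring]
                have := S.hT
                gcongr
                exact le_max_left _ _
            _ = _ := by
                rw [ENNReal.ofReal_mul (by positivity), ENNReal.ofReal_mul (by positivity)]
                ring
      _ = ENNReal.ofReal (K * (1 / 2) ^ (n + 1)) * S.Jw Λ t A e := by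
          rw [lintegral_const_mul' _ _ ENNReal.ofReal_ne_top, ← mul_assoc,
            ← ENNReal.ofReal_mul (by positivity), hΛB]
          congr 2
          rw [hB]
          field_simp
          ring
  have main : ∀ n e, ‖S.G t A n e‖ₑ ≤ ENNReal.ofReal (K * (1 / 2) ^ n) * S.Jw Λ t A e := by
    intro n
    induction n with
    | zero =>
      intro e
      simp only [G, pow_zero, mul_one]
      refine (enorm_integral_le_lintegral_enorm _).trans ?_
      unfold Jw
      rw [← lintegral_const_mul' _ _ ENNReal.ofReal_ne_top]
      refine lintegral_mono fun y => ((hk S e (t, y)).2).trans ?_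
      gcongr
      unfold kk
      split_ifs with ho
      · refine le_mul_of_one_le_left zero_le ?_
        rw [ENNReal.one_le_ofReal, Real.one_le_exp_iff]
        have := ho.2.1
        have : 0 ≤ t - e.1 := by simp only at this; linarith
        positivity
      · simp
    | succ n ih =>
      intro e
      simp only [G]
      exact (enorm_integral_le_lintegral_enorm _).trans (step n ih e)
  exact ⟨main n e, step n (main n) e⟩

end Setup

theorem integral_space_time_swap {X : Type*} [MeasurableSpace X] {μ : Measure X} [SFinite μ]
    {d : ℕ} {f : X → ℝ × Vec d → ℝ} (hf : Measurable fun q : X × (ℝ × Vec d) => f q.1 q.2)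
    (hfin : ∫⁻ x, (∫⁻ e, ‖f x e‖ₑ) ∂μ < ⊤) :
    Integrable (fun v => ∫ x, (∫ y, f x (v, y)) ∂μ) ∧
      ∫ v, ∫ x, (∫ y, f x (v, y)) ∂μ = ∫ x, (∫ e, f x e) ∂μ := by
  have hi : Integrable (fun q : X × (ℝ × Vec d) => f q.1 q.2) (μ.prod volume) := by
    refine ⟨hf.aestronglyMeasurable, ?_⟩
    unfold HasFiniteIntegral
    rw [lintegral_prod _ hf.enorm.aemeasurable]
    exact hfin
  have hi2 : Integrable (fun q : (X × ℝ) × Vec d => f q.1.1 (q.1.2, q.2))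
      ((μ.prod volume).prod volume) :=
    ((measurePreserving_prodAssoc μ (volume : Measure ℝ) (volume : Measure (Vec d))).integrable_comp
      (g := fun q : X × (ℝ × Vec d) => f q.1 q.2) hf.aestronglyMeasurable).2 hi
  have hg : Integrable (fun q : X × ℝ => ∫ y, f q.1 (q.2, y)) (μ.prod volume) :=
    hi2.integral_prod_left
  refine ⟨hg.integral_prod_right, ?_⟩
  rw [← integral_integral_swap (f := fun x v => ∫ y, f x (v, y)) hg]
  refine integral_congr_ae ?_
  filter_upwards [hi.prod_right_ae] with x hx
  exact (integral_prod _ hx).symm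

namespace Setup

variable {d : ℕ} {α M T : ℝ} (S : Setup d α M T)

lemma exists_kk_Jw (d : ℕ) {α M T p : ℝ} (hα : α ∈ Ioc (0 : ℝ) 1) (hM : 1 ≤ M) (hp : 0 < p)
    (hp1 : p ≤ 1) {Λ : ℝ} (hΛ : 0 < Λ) :
    ∃ C > (0 : ℝ), ∀ S : Setup d α M T, ∀ (t : ℝ) (A : Set (Vec d)) (e : ℝ × Vec d),
      ∫⁻ e'', S.kk p e e'' * S.Jw Λ t A e'' ≤
        ENNReal.ofReal C * ∫⁻ y in A, S.kk (p + α / 2) e (t, y) := by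
  have hα0 := hα.1
  obtain ⟨C, hC, hc⟩ := exists_kk_conv d (p := p) (q := α / 2) hM hp hp1
    (by linarith [hα.1]) (by linarith [hα.2])
  refine ⟨Real.exp (Λ * T) * C, by positivity, fun S t A e => ?_⟩
  rw [lintegral_kk_mul_Jw, ← lintegral_const_mul' _ _ ENNReal.ofReal_ne_top]
  refine lintegral_mono fun y => ?_
  calc _ ≤ ∫⁻ e'', ENNReal.ofReal (Real.exp (Λ * T)) * (S.kk p e e'' * S.kk (α / 2) e'' (t, y)) := by
        refine lintegral_mono fun e'' => ?_
        by_cases ho : S.Ok e'' (t, y)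
        · have h1 : Real.exp (Λ * (t - e''.1)) ≤ Real.exp (Λ * T) := by
            rw [Real.exp_le_exp]
            have := ho.1; have := ho.2.2
            simp only at this
            exact mul_le_mul_of_nonneg_left (by linarith) hΛ.le
          calc _ = ENNReal.ofReal (Real.exp (Λ * (t - e''.1))) *
                (S.kk p e e'' * S.kk (α / 2) e'' (t, y)) := by ring
            _ ≤ _ := mul_le_mul' (ENNReal.ofReal_le_ofReal h1) le_rfl
        · have : S.kk (α / 2) e'' (t, y) = 0 := if_neg ho
          simp [this]
    _ ≤ _ := by
        rw [lintegral_const_mul' _ _ ENNReal.ofReal_ne_top, ENNReal.ofReal_mul (by positivity),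
          mul_assoc]
        exact mul_le_mul' le_rfl (hc S e (t, y))

lemma Jw_eq_zero {Λ t : ℝ} (A : Set (Vec d)) {e : ℝ × Vec d} (h : t ≤ e.1 ∨ e.1 < S.s0) :
    S.Jw Λ t A e = 0 := by
  have : ∀ y, S.kk (α / 2) e (t, y) = 0 := fun y => if_neg fun ho => by
    rcases h with h | h
    · exact absurd ho.2.1 (not_lt.2 h)
    · exact absurd ho.1 (not_le.2 h)
  simp [Jw, this]

lemma exists_Jw_le (S : Setup d α M T) {Λ : ℝ} (hΛ : 0 < Λ) : ∃ C > (0 : ℝ),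
    ∀ (t : ℝ) (A : Set (Vec d)) (e : ℝ × Vec d),
    t ≤ S.s0 + T → S.Jw Λ t A e ≤ ENNReal.ofReal (C * (t - e.1) ^ (α / 2 - 1)) := by
  obtain ⟨C, hC, hc⟩ := exists_lintegral_kk d S.hM
  refine ⟨Real.exp (Λ * T) * C, by positivity, fun t A e htT => ?_⟩
  by_cases h : t ≤ e.1 ∨ e.1 < S.s0
  · rw [S.Jw_eq_zero A h]; exact zero_le
  push Not at h
  unfold Jw
  rw [lintegral_const_mul' _ _ ENNReal.ofReal_ne_top, mul_assoc, ENNReal.ofReal_mul (by positivity)]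
  refine mul_le_mul' (ENNReal.ofReal_le_ofReal (Real.exp_le_exp.2
    (mul_le_mul_of_nonneg_left (by linarith) hΛ.le)))
    ((setLIntegral_le_lintegral _ _).trans (hc S (α / 2) t e))

/-- The Duhamel (parametrix) identity for the marginals of a process `Y` under a finite
measure `P` on the time interval `[u,t]`. -/
structure Duh {Ω : Type*} [MeasurableSpace Ω] (P : Measure Ω) (u t : ℝ)
    (Y : ℝ → Ω → Vec d) : Prop where
  fin : IsFiniteMeasure P
  meas : Measurable fun q : ℝ × Ω => Y q.1 q.2
  su : S.s0 ≤ u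
  ut : u < t
  tT : t ≤ S.s0 + T
  eq : ∀ v ∈ Ioc u t, ∀ φ : Vec d → ℝ, Measurable φ → (∃ B, ∀ y, |φ y| ≤ B) →
    ∫ ω, φ (Y v ω) ∂P = ∫ ω, (∫ y, S.pk (u, Y u ω) (v, y) * φ y) ∂P +
      ∫ q, (∫ y, S.hk (q.1, Y q.1 q.2) (v, y) * φ y) ∂((volume.restrict (Ioo u t)).prod P)

namespace Duh

variable {S} {Ω : Type*} [MeasurableSpace Ω] {P : Measure Ω} {u t : ℝ} {Y : ℝ → Ω → Vec d}

lemma measq (h : S.Duh P u t Y) : Measurable fun q : ℝ × Ω => (q.1, Y q.1 q.2) :=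
  measurable_fst.prodMk h.meas

lemma Jw_fin (h : S.Duh P u t Y) {Λ : ℝ} (hΛ : 0 < Λ) (A : Set (Vec d)) :
    ∫⁻ q, S.Jw Λ t A (q.1, Y q.1 q.2) ∂((volume.restrict (Ioo u t)).prod P) < ⊤ := by
  have := h.fin
  obtain ⟨C, hC, hc⟩ := S.exists_Jw_le hΛ
  have hα := S.hα.1
  calc _ ≤ ∫⁻ q : ℝ × Ω, ENNReal.ofReal C * ENNReal.ofReal ((t - q.1) ^ (α / 2 - 1))
        ∂((volume.restrict (Ioo u t)).prod P) := by
        refine lintegral_mono fun q => (hc t A _ h.tT).trans ?_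
        rw [ENNReal.ofReal_mul hC.le]
    _ ≤ ∫⁻ r in Ioo u t, (∫⁻ _ω : Ω, ENNReal.ofReal C * ENNReal.ofReal ((t - r) ^ (α / 2 - 1)) ∂P) :=
        lintegral_prod_le _
    _ = ENNReal.ofReal C * ENNReal.ofReal ((t - u) ^ (α / 2) / (α / 2)) * P univ := by
        simp only [lintegral_const]
        rw [lintegral_mul_const' _ _ (measure_ne_top P _), lintegral_const_mul' _ _
          ENNReal.ofReal_ne_top, lintegral_rpow_right (by linarith) h.ut]
    _ < ⊤ := ENNReal.mul_lt_top (ENNReal.mul_lt_top ENNReal.ofReal_lt_top ENNReal.ofReal_lt_top)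
        (measure_lt_top P _)

lemma pk_mul_G_fin (h : S.Duh P u t Y) (A : Set (Vec d)) (n : ℕ) :
    ∫⁻ ω, (∫⁻ e, ‖S.pk (u, Y u ω) e * S.G t A n e‖ₑ) ∂P < ⊤ := by
  have := h.fin
  obtain ⟨K, hK, Λ, hΛ, hG⟩ := exists_G_bound d S.hα S.hM (T := T)
  obtain ⟨K', hK', hk⟩ := exists_kernel_bounds d T S.hα S.hM
  obtain ⟨C, hC, hc⟩ := exists_kk_Jw d (T := T) (p := 1) S.hα S.hM one_pos le_rfl hΛ
  obtain ⟨C', hC', hc'⟩ := exists_lintegral_kk d S.hM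
  have hα := S.hα.1
  have hut := h.ut
  calc _ ≤ ∫⁻ _ω : Ω, ENNReal.ofReal (K' * (K * (1 / 2) ^ n)) * (ENNReal.ofReal C *
        ENNReal.ofReal (C' * (t - u) ^ (1 + α / 2 - 1))) ∂P := by
        refine lintegral_mono fun ω => ?_
        calc _ ≤ ∫⁻ e, ENNReal.ofReal (K' * (K * (1 / 2) ^ n)) *
              (S.kk 1 (u, Y u ω) e * S.Jw Λ t A e) := by
              refine lintegral_mono fun e => ?_
              rw [enorm_mul, ENNReal.ofReal_mul (by linarith)]
              calc _ ≤ ENNReal.ofReal K' * S.kk 1 (u, Y u ω) e *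
                    (ENNReal.ofReal (K * (1 / 2) ^ n) * S.Jw Λ t A e) :=
                    mul_le_mul' (hk S _ e).1 (hG S t A n e).1
                _ = _ := by ring
          _ ≤ _ := by
              rw [lintegral_const_mul' _ _ ENNReal.ofReal_ne_top]
              refine mul_le_mul' le_rfl ((hc S t A _).trans (mul_le_mul' le_rfl ?_))
              exact (setLIntegral_le_lintegral _ _).trans (hc' S _ t (u, Y u ω))
    _ < ⊤ := by
        rw [lintegral_const]
        exact ENNReal.mul_lt_top (ENNReal.mul_lt_top ENNReal.ofReal_lt_top
          (ENNReal.mul_lt_top ENNReal.ofReal_lt_top ENNReal.ofReal_lt_top)) (measure_lt_top P _)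

lemma hk_mul_G_fin (h : S.Duh P u t Y) (A : Set (Vec d)) (n : ℕ) :
    ∫⁻ q : ℝ × Ω, (∫⁻ e, ‖S.hk (q.1, Y q.1 q.2) e * S.G t A n e‖ₑ)
      ∂((volume.restrict (Ioo u t)).prod P) < ⊤ := by
  obtain ⟨K, hK, Λ, hΛ, hG⟩ := exists_G_bound d S.hα S.hM (T := T)
  refine (lintegral_mono fun q : ℝ × Ω => (hG S t A n (q.1, Y q.1 q.2)).2).trans_lt ?_
  rw [lintegral_const_mul' _ _ ENNReal.ofReal_ne_top]
  exact ENNReal.mul_lt_top ENNReal.ofReal_lt_top (h.Jw_fin hΛ A)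

lemma G_integrable (h : S.Duh P u t Y) (A : Set (Vec d)) (n : ℕ) :
    Integrable (fun q : ℝ × Ω => S.G t A n (q.1, Y q.1 q.2))
      ((volume.restrict (Ioo u t)).prod P) := by
  obtain ⟨K, hK, Λ, hΛ, hG⟩ := exists_G_bound d S.hα S.hM (T := T)
  refine ⟨((S.G_measurable t A n).comp h.measq).aestronglyMeasurable, ?_⟩
  refine (lintegral_mono fun q : ℝ × Ω => (hG S t A n (q.1, Y q.1 q.2)).1).trans_lt ?_
  rw [lintegral_const_mul' _ _ ENNReal.ofReal_ne_top]
  exact ENNReal.mul_lt_top ENNReal.ofReal_lt_top (h.Jw_fin hΛ A)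

lemma integral_G (h : S.Duh P u t Y) (A : Set (Vec d)) (n : ℕ) :
    ∫ q : ℝ × Ω, S.G t A n (q.1, Y q.1 q.2) ∂((volume.restrict (Ioo u t)).prod P) =
      ∫ ω, (∫ e, S.pk (u, Y u ω) e * S.G t A n e) ∂P +
      ∫ q : ℝ × Ω, S.G t A (n + 1) (q.1, Y q.1 q.2) ∂((volume.restrict (Ioo u t)).prod P) := by
  have := h.fin
  obtain ⟨K, hK, Λ, hΛ, hG⟩ := exists_G_bound d S.hα S.hM (T := T)
  obtain ⟨C, hC, hc⟩ := S.exists_Jw_le hΛ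
  have hYu : Measurable fun ω => (u, Y u ω) :=
    measurable_const.prodMk (h.meas.comp (measurable_const.prodMk measurable_id))
  have hm1 : Measurable fun q : Ω × (ℝ × Vec d) => S.pk (u, Y u q.1) q.2 * S.G t A n q.2 :=
    (S.pk_measurable (hYu.comp measurable_fst) measurable_snd).mul
      ((S.G_measurable t A n).comp measurable_snd)
  have hm2 : Measurable fun q : (ℝ × Ω) × (ℝ × Vec d) =>
      S.hk (q.1.1, Y q.1.1 q.1.2) q.2 * S.G t A n q.2 :=
    (S.hk_measurable (h.measq.comp measurable_fst) measurable_snd).mul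
      ((S.G_measurable t A n).comp measurable_snd)
  obtain ⟨i1, e1⟩ := integral_space_time_swap hm1 (h.pk_mul_G_fin A n)
  obtain ⟨i2, e2⟩ := integral_space_time_swap hm2 (h.hk_mul_G_fin A n)
  rw [← e1]
  simp only [G]
  rw [← e2, integral_prod _ (h.G_integrable A n), ← integral_add i1 i2,
    ← integral_indicator measurableSet_Ioo]
  refine integral_congr_ae (Filter.Eventually.of_forall fun v => ?_)
  simp only [indicator]
  split_ifs with hv
  · refine h.eq v ⟨hv.1, hv.2.le⟩ (fun y => S.G t A n (v, y))
      ((S.G_measurable t A n).comp (measurable_const.prodMk measurable_id))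
      ⟨K * (1 / 2) ^ n * (C * (t - v) ^ (α / 2 - 1)), fun y => ?_⟩
    have hp := Real.rpow_pos_of_pos (sub_pos.2 hv.2) (α / 2 - 1)
    have h1 := (hG S t A n (v, y)).1.trans (mul_le_mul' le_rfl (hc t A (v, y) h.tT))
    rw [← ENNReal.ofReal_mul (by positivity), Real.enorm_eq_ofReal_abs] at h1
    exact (ENNReal.ofReal_le_ofReal_iff (by positivity)).1 h1
  · have hz : ∀ e : ℝ × Vec d, u ≤ e.1 → ∀ y, S.G t A n (v, y) = 0 ∨ ¬ S.Ok e (v, y) :=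
      fun e hue y => by
        by_cases hv' : t ≤ v
        · exact Or.inl (S.G_eq_zero A n hv')
        · exact Or.inr fun ho => hv ⟨hue.trans_lt ho.2.1, not_le.1 hv'⟩
    have z1 : ∀ ω, ∫ y, S.pk (u, Y u ω) (v, y) * S.G t A n (v, y) = 0 := fun ω => by
      rw [← integral_zero (Vec d) ℝ]
      refine integral_congr_ae (Filter.Eventually.of_forall fun y => ?_)
      rcases hz (u, Y u ω) le_rfl y with h0 | h0
      · simp [h0]
      · simp [pk, h0]
    have z2 : ∫ q : ℝ × Ω, (∫ y, S.hk (q.1, Y q.1 q.2) (v, y) * S.G t A n (v, y))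
        ∂((volume.restrict (Ioo u t)).prod P) = 0 := by
      rw [← integral_zero (ℝ × Ω) ℝ]
      refine integral_congr_ae ?_
      filter_upwards [Measure.quasiMeasurePreserving_fst.ae
        (ae_restrict_mem (measurableSet_Ioo (a := u) (b := t)))] with q hq
      rw [← integral_zero (Vec d) ℝ]
      refine integral_congr_ae (Filter.Eventually.of_forall fun y => ?_)
      rcases hz (q.1, Y q.1 q.2) hq.1.le y with h0 | h0
      · simp [h0]
      · simp [hk, h0]
    rw [z2]
    simp [z1]

theorem tendsto_series (h : S.Duh P u t Y) {A : Set (Vec d)} (hA : MeasurableSet A) :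
    Filter.Tendsto (fun N => ∫ ω, (∫ y in A, S.pk (u, Y u ω) (t, y)) ∂P +
      ∑ n ∈ Finset.range N, ∫ ω, (∫ e, S.pk (u, Y u ω) e * S.G t A n e) ∂P) Filter.atTop
      (nhds (P.real (Y t ⁻¹' A))) := by
  have := h.fin
  obtain ⟨K, hK, Λ, hΛ, hG⟩ := exists_G_bound d S.hα S.hM (T := T)
  set I : ℕ → ℝ := fun n => ∫ q : ℝ × Ω, S.G t A n (q.1, Y q.1 q.2)
    ∂((volume.restrict (Ioo u t)).prod P) with hI
  have h0 : P.real (Y t ⁻¹' A) = ∫ ω, (∫ y in A, S.pk (u, Y u ω) (t, y)) ∂P + I 0 := by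
    have := h.eq t ⟨h.ut, le_rfl⟩ (A.indicator 1) (measurable_one.indicator hA)
      ⟨1, fun y => by by_cases hy : y ∈ A <;> simp [hy]⟩
    have hYt : Measurable (Y t) := h.meas.comp (measurable_const.prodMk measurable_id)
    have h1 : ∀ k : Vec d → ℝ, ∫ y, k y * A.indicator 1 y = ∫ y in A, k y :=
      fun k => by
        rw [← integral_indicator hA]
        congr 1 with y
        by_cases hy : y ∈ A <;> simp [hy]
    simp only [h1] at this
    refine Eq.trans ?_ this
    rw [← integral_indicator_one (hYt hA)]
    rfl
  have hs : ∀ N, ∫ ω, (∫ y in A, S.pk (u, Y u ω) (t, y)) ∂P +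
      ∑ n ∈ Finset.range N, ∫ ω, (∫ e, S.pk (u, Y u ω) e * S.G t A n e) ∂P =
      P.real (Y t ⁻¹' A) - I N := fun N => by
    induction N with
    | zero => rw [h0]; simp
    | succ N ih =>
      rw [Finset.sum_range_succ, ← add_assoc, ih, hI]
      simp only
      rw [h.integral_G A N]
      ring
  simp only [hs]
  set B := (∫⁻ q, S.Jw Λ t A (q.1, Y q.1 q.2) ∂((volume.restrict (Ioo u t)).prod P)).toReal with hB
  have hIb : ∀ n, |I n| ≤ K * (1 / 2) ^ n * B := fun n => by
    have h1 : ‖I n‖ₑ ≤ ENNReal.ofReal (K * (1 / 2) ^ n) * ENNReal.ofReal B := by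
      rw [hB, ENNReal.ofReal_toReal (h.Jw_fin hΛ A).ne,
        ← lintegral_const_mul' _ _ ENNReal.ofReal_ne_top]
      exact (enorm_integral_le_lintegral_enorm _).trans
        (lintegral_mono fun q => (hG S t A n (q.1, Y q.1 q.2)).1)
    have hB0 : 0 ≤ B := ENNReal.toReal_nonneg
    rw [← ENNReal.ofReal_mul (by positivity), Real.enorm_eq_ofReal_abs] at h1
    exact (ENNReal.ofReal_le_ofReal_iff (by positivity)).1 h1
  have hlim : Filter.Tendsto I Filter.atTop (nhds 0) := by
    refine squeeze_zero_norm (a := fun n => K * (1 / 2) ^ n * B) hIb ?_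
    have := (tendsto_pow_atTop_nhds_zero_of_lt_one (r := (1 / 2 : ℝ)) (by norm_num)
      (by norm_num)).const_mul K |>.mul_const B
    simpa using this
  simpa using hlim.const_sub (P.real (Y t ⁻¹' A))

end Duh
end Setup

namespace Setup

variable {d : ℕ} {α M T : ℝ} (S : Setup d α M T)

lemma exists_lintegral_kk_G (d : ℕ) {α M T p : ℝ} (hα : α ∈ Ioc (0 : ℝ) 1) (hM : 1 ≤ M)
    (hp : 0 < p) (hp1 : p ≤ 1) :
    ∃ C > (0 : ℝ), ∀ S : Setup d α M T, ∀ (t : ℝ) (A : Set (Vec d)) (n : ℕ) (e : ℝ × Vec d),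
      ∫⁻ e'', S.kk p e e'' * ‖S.G t A n e''‖ₑ ≤
        ENNReal.ofReal (C * (1 / 2) ^ n) * ∫⁻ y in A, S.kk (p + α / 2) e (t, y) := by
  obtain ⟨K, hK, Λ, hΛ, hG⟩ := exists_G_bound d hα hM (T := T)
  obtain ⟨C, hC, hc⟩ := exists_kk_Jw d (T := T) hα hM hp hp1 hΛ
  refine ⟨K * C, by positivity, fun S t A n e => ?_⟩
  calc _ ≤ ∫⁻ e'', ENNReal.ofReal (K * (1 / 2) ^ n) * (S.kk p e e'' * S.Jw Λ t A e'') := by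
        refine lintegral_mono fun e'' => ?_
        calc _ ≤ S.kk p e e'' * (ENNReal.ofReal (K * (1 / 2) ^ n) * S.Jw Λ t A e'') :=
              mul_le_mul' le_rfl (hG S t A n e'').1
          _ = _ := by ring
    _ ≤ _ := by
        rw [lintegral_const_mul' _ _ ENNReal.ofReal_ne_top]
        refine (mul_le_mul' le_rfl (hc S t A e)).trans_eq ?_
        rw [← mul_assoc, ← ENNReal.ofReal_mul (by positivity)]
        congr 2
        ring

lemma exists_pk_second_difference (d : ℕ) {M γ : ℝ} (hM : 1 ≤ M) (hγ : γ ∈ Ioo (0 : ℝ) 1) :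
    ∃ K > (0 : ℝ), ∀ {α T : ℝ}, ∀ S : Setup d α M T, ∀ (u h : ℝ) (x x' v : Vec d)
      (e : ℝ × Vec d), 0 ≤ h →
      ‖(S.pk (u, x + h • v) e - S.pk (u, x) e) - (S.pk (u, x' + h • v) e - S.pk (u, x') e)‖ₑ ≤
        ENNReal.ofReal (K * ‖v‖ * ‖x - x'‖ ^ γ) * ∫⁻ a in Ioc 0 h,
          (S.kk ((1 - γ) / 2) (u, x + a • v) e + S.kk ((1 - γ) / 2) (u, x' + a • v) e) := by
  obtain ⟨K, hK, hk⟩ := exists_ga1_holder d hM hγ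
  have hM0 : 0 < M := by linarith
  refine ⟨(d + 1) * K * M ^ (d + 1), by positivity, fun S u h x x' v e hh => ?_⟩
  by_cases ho : S.Ok (u, x) e
  swap
  · have : ∀ z, S.pk (u, z) e = 0 := fun z => if_neg ho
    simp [this]
  have ho' : ∀ z, S.Ok (u, z) e := fun z => ho
  have hτ : 0 < e.1 - u := sub_pos.2 ho.2.1
  set C := S.Cov 0 u e.1 (S.π e.1 e.2) with hC
  set q := S.ζ u (S.π e.1 e.2) with hq
  have hQ : QB M (e.1 - u) C := by
    have := S.Cov_qb le_rfl ho.2.1.le (S.π e.1 e.2)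
    rwa [add_zero] at this
  have hpk : ∀ z, S.pk (u, z) e = ga C (z - q) := fun z => if_pos (ho' z)
  have hd : ∀ z : Vec d, ∀ a : ℝ, HasDerivAt (fun a : ℝ => ga C (z + a • v - q))
      (∑ i, v i * ga1 C i (z + a • v - q)) a := fun z a => by
    have h0 := hasDerivAt_ga_space (hQ.det_pos hM0 hτ) hQ.symm (z + a • v - q) v
    have h1 : HasDerivAt (fun b : ℝ => b - a) 1 a := (hasDerivAt_id a).sub_const a
    have h2 := HasDerivAt.scomp_of_eq a h0 h1 (by simp)
    rw [one_smul] at h2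
    refine h2.congr_of_eventuallyEq (Filter.Eventually.of_forall fun b => ?_)
    simp only [Function.comp]
    congr 1
    rw [sub_smul]
    abel
  have hcont : ∀ z : Vec d, Continuous fun a : ℝ => ∑ i, v i * ga1 C i (z + a • v - q) := fun z =>
    continuous_finsetSum _ fun i _ => continuous_const.mul
      ((contDiff_ga1 C i (n := 0)).continuous.comp (by fun_prop))
  have integ : ∀ z : Vec d, S.pk (u, z + h • v) e - S.pk (u, z) e =
      ∫ a in (0 : ℝ)..h, ∑ i, v i * ga1 C i (z + a • v - q) := fun z => by
    rw [intervalIntegral.integral_eq_sub_of_hasDerivAt (fun a _ => hd z a)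
      ((hcont z).intervalIntegrable _ _), hpk, hpk]
    simp
  rw [integ, integ, ← intervalIntegral.integral_sub ((hcont x).intervalIntegrable _ _)
    ((hcont x').intervalIntegrable _ _), intervalIntegral.integral_of_le hh,
    ← lintegral_const_mul' _ _ ENNReal.ofReal_ne_top]
  refine (enorm_integral_le_lintegral_enorm _).trans (lintegral_mono fun a => ?_)
  have hkk : ∀ z, S.kk ((1 - γ) / 2) (u, z) e = ENNReal.ofReal ((e.1 - u) ^ (-(1 + γ) / 2) *
      Wk d (rt M) (e.1 - u) (S.Dm (u, z) e)) := fun z => by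
    simp only [kk, if_pos (ho' z)]
    congr 3
    ring
  have hw := fun z => S.Wk_le_Dm hτ (u, z) e
  simp only at hw
  have hpos := Real.rpow_pos_of_pos hτ (-(1 + γ) / 2)
  have hWp : ∀ z, 0 < Wk d (rt M) (e.1 - u) (S.Dm (u, z) e) := fun z => Wk_pos hτ (S.Dm_nonneg _ _)
  have hN : 0 ≤ ‖x - x'‖ ^ γ := by positivity
  rw [hkk, hkk, ← ENNReal.ofReal_add (mul_pos hpos (hWp _)).le (mul_pos hpos (hWp _)).le,
    ← ENNReal.ofReal_mul (by positivity), Real.enorm_eq_ofReal_abs]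
  apply ENNReal.ofReal_le_ofReal
  rw [← Finset.sum_sub_distrib]
  set R := K * ‖x - x'‖ ^ γ * (e.1 - u) ^ (-(1 + γ) / 2) *
      (M ^ (d + 1) * Wk d (rt M) (e.1 - u) (S.Dm (u, x + a • v) e) +
        M ^ (d + 1) * Wk d (rt M) (e.1 - u) (S.Dm (u, x' + a • v) e)) with hR
  have hR0 : 0 ≤ R := by
    have := hWp (x + a • v); have := hWp (x' + a • v)
    positivity
  calc _ ≤ ∑ i, |v i * ga1 C i (x + a • v - q) - v i * ga1 C i (x' + a • v - q)| :=
        Finset.abs_sum_le_sum_abs _ _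
    _ ≤ ∑ _i : Fin d, ‖v‖ * R := by
        refine Finset.sum_le_sum fun i _ => ?_
        rw [← mul_sub, abs_mul]
        refine mul_le_mul ?_ ?_ (abs_nonneg _) (norm_nonneg _)
        · rw [← Real.norm_eq_abs]
          exact PiLp.norm_apply_le v i
        · refine (hk _ hτ C hQ _ _ i).trans ?_
          rw [show x + a • v - q - (x' + a • v - q) = x - x' by abel, hR]
          exact mul_le_mul_of_nonneg_left (add_le_add (hw _) (hw _)) (by positivity)
    _ = d * (‖v‖ * R) := by simp
    _ ≤ (d + 1) * (‖v‖ * R) := by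
        have : 0 ≤ ‖v‖ * R := by positivity
        linarith
    _ = _ := by rw [hR]; ring

end Setup

theorem integral_second_difference {X : Type*} [MeasurableSpace X] {μ : Measure X}
    {f g f' g' : X → ℝ} (hf : Integrable f μ) (hg : Integrable g μ) (hf' : Integrable f' μ)
    (hg' : Integrable g' μ) : ∫ x, (f x - g x) - (f' x - g' x) ∂μ =
      ((∫ x, f x ∂μ) - ∫ x, g x ∂μ) - ((∫ x, f' x ∂μ) - ∫ x, g' x ∂μ) := by
  rw [← integral_sub hf hg, ← integral_sub hf' hg']
  exact integral_sub (hf.sub hg) (hf'.sub hg')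

namespace Setup

variable {d : ℕ} {α M T : ℝ} (S : Setup d α M T)

/-- The partial sums of the parametrix series of the transition probability into `A`. -/
def partialSeries (u t : ℝ) (A : Set (Vec d)) (N : ℕ) (x : Vec d) : ℝ :=
  (∫ y in A, S.pk (u, x) (t, y)) +
    ∑ n ∈ Finset.range N, ∫ e, S.pk (u, x) e * S.G t A n e

lemma pk_integrable (u t : ℝ) (x : Vec d) : Integrable fun y => S.pk (u, x) (t, y) := by
  obtain ⟨K, hK, hk⟩ := exists_kernel_bounds d T S.hα S.hM
  obtain ⟨C, hC, hc⟩ := exists_lintegral_kk d S.hM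
  refine ⟨(S.pk_measurable measurable_const
    (measurable_const.prodMk measurable_id)).aestronglyMeasurable, ?_⟩
  refine (lintegral_mono fun y => (hk S (u, x) (t, y)).1).trans_lt ?_
  rw [lintegral_const_mul' _ _ ENNReal.ofReal_ne_top]
  exact ENNReal.mul_lt_top ENNReal.ofReal_lt_top ((hc S _ _ _).trans_lt ENNReal.ofReal_lt_top)

lemma pk_mul_G_integrable (u t : ℝ) (A : Set (Vec d)) (n : ℕ) (x : Vec d) :
    Integrable fun e => S.pk (u, x) e * S.G t A n e := by
  obtain ⟨K, hK, hk⟩ := exists_kernel_bounds d T S.hα S.hM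
  obtain ⟨C, hC, hc⟩ := exists_lintegral_kk d S.hM
  obtain ⟨C', hC', hc'⟩ := exists_lintegral_kk_G d (T := T) S.hα S.hM one_pos le_rfl
  refine ⟨((S.pk_measurable measurable_const measurable_id).mul
    (S.G_measurable t A n)).aestronglyMeasurable, ?_⟩
  calc _ ≤ ∫⁻ e, ENNReal.ofReal K * (S.kk 1 (u, x) e * ‖S.G t A n e‖ₑ) := by
        refine lintegral_mono fun e => ?_
        rw [enorm_mul, ← mul_assoc]
        exact mul_le_mul' (hk S _ e).1 le_rfl
    _ < ⊤ := by
        rw [lintegral_const_mul' _ _ ENNReal.ofReal_ne_top]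
        refine ENNReal.mul_lt_top ENNReal.ofReal_lt_top ((hc' S t A n _).trans_lt ?_)
        exact ENNReal.mul_lt_top ENNReal.ofReal_lt_top
          ((setLIntegral_le_lintegral _ _).trans_lt ((hc S _ _ _).trans_lt ENNReal.ofReal_lt_top))

lemma exists_partialSeries_second_difference (d : ℕ) {α M T γ : ℝ} (hα : α ∈ Ioc (0 : ℝ) 1)
    (hM : 1 ≤ M) (hT : 0 < T) (hγ : γ ∈ Ioo (0 : ℝ) 1) :
    ∃ C > (0 : ℝ), ∀ S : Setup d α M T, ∀ (u t h : ℝ) (x x' v : Vec d) (A : Set (Vec d)) (N : ℕ),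
      0 ≤ h →
      ‖(S.partialSeries u t A N (x + h • v) - S.partialSeries u t A N x) -
        (S.partialSeries u t A N (x' + h • v) - S.partialSeries u t A N x')‖ₑ ≤
        ENNReal.ofReal (C * ‖v‖ * ‖x - x'‖ ^ γ) * ∫⁻ a in Ioc 0 h, ∫⁻ y in A,
          (S.kk ((1 - γ) / 2) (u, x + a • v) (t, y) +
            S.kk ((1 - γ) / 2) (u, x' + a • v) (t, y)) := by
  obtain ⟨K, hK, hk⟩ := exists_pk_second_difference d hM hγ
  obtain ⟨C, hC, hc⟩ := exists_lintegral_kk_G d (T := T) (p := (1 - γ) / 2) hα hM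
    (by linarith [hγ.2]) (by linarith [hγ.1])
  have hTα : 0 < T ^ (α / 2) := Real.rpow_pos_of_pos hT _
  refine ⟨K * (1 + 2 * (C * T ^ (α / 2))), by positivity, fun S u t h x x' v A N hh => ?_⟩
  set p := (1 - γ) / 2 with hp
  set Z := ‖v‖ * ‖x - x'‖ ^ γ with hZ
  have hZ0 : 0 ≤ Z := by positivity
  set D : ℝ × Vec d → ℝ := fun e =>
    (S.pk (u, x + h • v) e - S.pk (u, x) e) - (S.pk (u, x' + h • v) e - S.pk (u, x') e) with hD
  set I := ∫⁻ a in Ioc 0 h, ∫⁻ y in A,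
    (S.kk p (u, x + a • v) (t, y) + S.kk p (u, x' + a • v) (t, y)) with hI
  have hDb : ∀ e, ‖D e‖ₑ ≤ ENNReal.ofReal (K * Z) * ∫⁻ a in Ioc 0 h,
      (S.kk p (u, x + a • v) e + S.kk p (u, x' + a • v) e) := fun e => by
    rw [hZ, ← mul_assoc]
    exact hk S u h x x' v e hh
  have hm : ∀ w : Vec d, Measurable fun q : (ℝ × Vec d) × ℝ => S.kk p (u, w + q.2 • v) q.1 :=
    fun w => S.kk_measurable p (measurable_const.prodMk (by fun_prop)) measurable_fst
  have hm2 : ∀ w : Vec d, Measurable fun q : ℝ × Vec d => S.kk p (u, w + q.1 • v) (t, q.2) :=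
    fun w => S.kk_measurable p (measurable_const.prodMk (by fun_prop))
      (measurable_const.prodMk measurable_snd)
  have heq : (S.partialSeries u t A N (x + h • v) - S.partialSeries u t A N x) -
      (S.partialSeries u t A N (x' + h • v) - S.partialSeries u t A N x') =
      (∫ y in A, D (t, y)) + ∑ n ∈ Finset.range N, ∫ e, D e * S.G t A n e := by
    have i1 := fun w => (S.pk_integrable u t w).integrableOn (s := A)
    have i2 := fun w n => S.pk_mul_G_integrable u t A n w
    have e1 : ∫ y in A, D (t, y) = ((∫ y in A, S.pk (u, x + h • v) (t, y)) -
        (∫ y in A, S.pk (u, x) (t, y))) - ((∫ y in A, S.pk (u, x' + h • v) (t, y)) -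
        (∫ y in A, S.pk (u, x') (t, y))) := by
      exact integral_second_difference (i1 _) (i1 _) (i1 _) (i1 _)
    have e2 : ∀ n, ∫ e, D e * S.G t A n e = ((∫ e, S.pk (u, x + h • v) e * S.G t A n e) -
        (∫ e, S.pk (u, x) e * S.G t A n e)) - ((∫ e, S.pk (u, x' + h • v) e * S.G t A n e) -
        (∫ e, S.pk (u, x') e * S.G t A n e)) := fun n => by
      rw [← integral_second_difference (i2 _ n) (i2 _ n) (i2 _ n) (i2 _ n)]
      simp only [hD, sub_mul]
    simp only [e1, e2, partialSeries, Finset.sum_sub_distrib]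
    ring
  have b1 : ‖∫ y in A, D (t, y)‖ₑ ≤ ENNReal.ofReal (K * Z) * I := by
    refine (enorm_integral_le_lintegral_enorm _).trans
      ((lintegral_mono fun y => hDb (t, y)).trans_eq ?_)
    rw [lintegral_const_mul' _ _ ENNReal.ofReal_ne_top, hI]
    congr 1
    refine lintegral_lintegral_swap (f := fun y a => S.kk p (u, x + a • v) (t, y) +
      S.kk p (u, x' + a • v) (t, y)) ?_
    exact (((hm2 x).add (hm2 x')).comp measurable_swap).aemeasurable
  have b2 : ∀ n, ‖∫ e, D e * S.G t A n e‖ₑ ≤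
      ENNReal.ofReal (K * Z) * (ENNReal.ofReal (C * T ^ (α / 2) * (1 / 2) ^ n) * I) := fun n => by
    refine (enorm_integral_le_lintegral_enorm _).trans ?_
    calc _ ≤ ∫⁻ e, ENNReal.ofReal (K * Z) * ∫⁻ a in Ioc 0 h,
          (S.kk p (u, x + a • v) e + S.kk p (u, x' + a • v) e) * ‖S.G t A n e‖ₑ := by
          refine lintegral_mono fun e => ?_
          rw [lintegral_mul_const' _ _ enorm_ne_top, ← mul_assoc, enorm_mul]
          exact mul_le_mul' (hDb e) le_rfl
      _ = ENNReal.ofReal (K * Z) * ∫⁻ a in Ioc 0 h, ∫⁻ e,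
          (S.kk p (u, x + a • v) e + S.kk p (u, x' + a • v) e) * ‖S.G t A n e‖ₑ := by
          rw [lintegral_const_mul' _ _ ENNReal.ofReal_ne_top]
          congr 1
          refine lintegral_lintegral_swap (f := fun e a => (S.kk p (u, x + a • v) e +
            S.kk p (u, x' + a • v) e) * ‖S.G t A n e‖ₑ) ?_
          exact (((hm x).add (hm x')).mul
            ((S.G_measurable t A n).comp measurable_fst).enorm).aemeasurable
      _ ≤ _ := by
          refine mul_le_mul' le_rfl ?_
          rw [hI, ← lintegral_const_mul' _ _ ENNReal.ofReal_ne_top]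
          refine lintegral_mono fun a => ?_
          have hkm : ∀ w : Vec d, ∫⁻ e, S.kk p (u, w) e * ‖S.G t A n e‖ₑ ≤
              ENNReal.ofReal (C * T ^ (α / 2) * (1 / 2) ^ n) * ∫⁻ y in A, S.kk p (u, w) (t, y) :=
            fun w => by
              refine (hc S t A n (u, w)).trans ?_
              have : ∫⁻ y in A, S.kk (p + α / 2) (u, w) (t, y) ≤
                  ENNReal.ofReal (T ^ (α / 2)) * ∫⁻ y in A, S.kk p (u, w) (t, y) := by
                rw [← lintegral_const_mul' _ _ ENNReal.ofReal_ne_top]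
                refine lintegral_mono fun y => ?_
                have := S.kk_mono (p := p + α / 2) (p' := p) (by linarith [hα.1]) (u, w) (t, y)
                rwa [add_sub_cancel_left] at this
              refine (mul_le_mul' le_rfl this).trans_eq ?_
              rw [← mul_assoc, ← ENNReal.ofReal_mul (by positivity)]
              congr 2
              ring
          have hk1 : ∀ w : Vec d, Measurable fun e : ℝ × Vec d =>
              S.kk p (u, w) e * ‖S.G t A n e‖ₑ := fun w =>
            (S.kk_measurable p measurable_const measurable_id).mul (S.G_measurable t A n).enorm
          have hk2 : ∀ w : Vec d, Measurable fun y : Vec d => S.kk p (u, w) (t, y) := fun w =>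
            S.kk_measurable p measurable_const (measurable_const.prodMk measurable_id)
          simp only [add_mul]
          rw [lintegral_add_left (hk1 _),
            lintegral_add_left (hk2 _), mul_add]
          exact add_le_add (hkm _) (hkm _)
  rw [heq]
  have hgeo : ∑ n ∈ Finset.range N, (1 / 2 : ℝ) ^ n ≤ 2 := by
    have := Summable.sum_le_tsum (f := fun n : ℕ => (1 / 2 : ℝ) ^ n) (Finset.range N)
      (fun n _ => by positivity) summable_geometric_two
    rwa [tsum_geometric_two] at this
  calc _ ≤ ENNReal.ofReal (K * Z) * I + ∑ n ∈ Finset.range N, ENNReal.ofReal (K * Z) *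
        (ENNReal.ofReal (C * T ^ (α / 2) * (1 / 2) ^ n) * I) := by
        refine (enorm_add_le _ _).trans (add_le_add b1 ((enorm_sum_le _ _).trans ?_))
        exact Finset.sum_le_sum fun n _ => b2 n
    _ = ENNReal.ofReal (K * Z * (1 + C * T ^ (α / 2) * ∑ n ∈ Finset.range N, (1 / 2 : ℝ) ^ n)) *
          I := by
        rw [← Finset.mul_sum, ← Finset.sum_mul, ← ENNReal.ofReal_sum_of_nonneg
          (fun n _ => by positivity), ← Finset.mul_sum, ← mul_add,
          ENNReal.ofReal_mul (p := K * Z) (by positivity), ENNReal.ofReal_add (by positivity) (by positivity)]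
        simp only [ENNReal.ofReal_one]
        ring
    _ ≤ _ := by
        refine mul_le_mul' (ENNReal.ofReal_le_ofReal ?_) le_rfl
        calc _ ≤ K * Z * (1 + C * T ^ (α / 2) * 2) := by gcongr
          _ = _ := by rw [hZ]; ring

end Setup

namespace Setup

variable {d : ℕ} {α M T : ℝ} (S : Setup d α M T)

lemma π_cont (S : Setup d α M T) (r : ℝ) : Continuous (S.π r) :=
  (LipschitzWith.of_dist_le_mul (K := M.toNNReal) fun z z' => by
    rw [dist_eq_norm, dist_eq_norm, Real.coe_toNNReal _ S.M_pos.le]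
    exact S.π_lip r z z').continuous

lemma Wk_continuous {l τ : ℝ} (hτ : 0 < τ) {X : Type*} [TopologicalSpace X] {D : X → ℝ}
    (hD : Continuous D) (hD0 : ∀ x, 0 ≤ D x) : Continuous fun x => Wk d l τ (D x) := by
  unfold Wk omg
  refine Continuous.mul (continuous_const.div (by fun_prop) fun x => ?_) (by fun_prop)
  have := Real.sqrt_pos.2 hτ
  have := hD0 x
  positivity

theorem exists_fderiv_holder (d : ℕ) {α M T γ : ℝ} (hα : α ∈ Ioc (0 : ℝ) 1)
    (hM : 1 ≤ M) (hT : 0 < T) (hγ : γ ∈ Ioo (0 : ℝ) 1) :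
    ∃ C > (0 : ℝ), ∀ S : Setup d α M T, ∀ u t : ℝ, S.s0 ≤ u → u < t → t ≤ S.s0 + T →
      ∀ p : Vec d → Vec d → ℝ, Continuous (fun q : Vec d × Vec d => p q.1 q.2) →
      (∀ y, Differentiable ℝ fun x => p x y) →
      (∀ x (A : Set (Vec d)), MeasurableSet A → Filter.Tendsto
        (fun N => S.partialSeries u t A N x) Filter.atTop (nhds (∫ y in A, p x y))) →
      ∀ x x' y, ‖fderiv ℝ (fun z => p z y) x - fderiv ℝ (fun z => p z y) x'‖ ≤
        C * ‖x - x'‖ ^ γ * (t - u) ^ (-(1 + γ) / 2) *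
          (Wk d (rt M) (t - u) (S.Dm (u, x) (t, y)) + Wk d (rt M) (t - u) (S.Dm (u, x') (t, y))) := by
  obtain ⟨C, hC, hc⟩ := exists_partialSeries_second_difference d hα hM hT hγ
  refine ⟨C, hC, fun S u t hu hut ht p hp hpd hser x x' y => ?_⟩
  have hτ : 0 < t - u := sub_pos.2 hut
  set Fr : Vec d → ℝ × Vec d → ℝ := fun v q => (t - u) ^ (-(1 + γ) / 2) *
    (Wk d (rt M) (t - u) (S.Dm (u, x + q.1 • v) (t, q.2)) +
      Wk d (rt M) (t - u) (S.Dm (u, x' + q.1 • v) (t, q.2))) with hFr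
  have hτp := Real.rpow_pos_of_pos hτ (-(1 + γ) / 2)
  have hWp : ∀ e e', 0 < Wk d (rt M) (t - u) (S.Dm e e') := fun e e' => Wk_pos hτ (S.Dm_nonneg _ _)
  have hFr0 : ∀ v q, 0 < Fr v q := fun v q => mul_pos hτp (add_pos (hWp _ _) (hWp _ _))
  have hFc : ∀ v, Continuous (Fr v) := fun v => by
    have h1 : ∀ w : Vec d, Continuous fun q : ℝ × Vec d =>
        Wk d (rt M) (t - u) (S.Dm (u, w + q.1 • v) (t, q.2)) := fun w => by
      refine Wk_continuous hτ ?_ fun q => S.Dm_nonneg _ _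
      unfold Dm
      exact (((S.π_cont u).comp (by fun_prop)).sub ((S.π_cont t).comp continuous_snd)).norm
    exact continuous_const.mul ((h1 x).add (h1 x'))
  have hkkF : ∀ v q, S.kk ((1 - γ) / 2) (u, x + q.1 • v) (t, q.2) +
      S.kk ((1 - γ) / 2) (u, x' + q.1 • v) (t, q.2) = ENNReal.ofReal (Fr v q) := fun v q => by
    have ho : ∀ z z', S.Ok (u, z) (t, z') := fun z z' => ⟨hu, hut, ht⟩
    simp only [kk, if_pos (ho _ _)]
    rw [show (1 - γ) / 2 - 1 = -(1 + γ) / 2 by ring, ← ENNReal.ofReal_add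
      (mul_pos hτp (hWp _ _)).le (mul_pos hτp (hWp _ _)).le, ← mul_add]
  set D : Vec d → ℝ := fun v =>
    fderiv ℝ (fun z => p z y) x v - fderiv ℝ (fun z => p z y) x' v with hD
  have hpc : ∀ z, Continuous (p z) := fun z =>
    hp.comp (continuous_const.prodMk continuous_id)
  have key : ∀ v : Vec d, ∀ δ > (0 : ℝ),
      D v ≤ C * ‖v‖ * ‖x - x'‖ ^ γ * (Fr v (0, y) + δ) := fun v δ hδ => by
    set L := C * ‖v‖ * ‖x - x'‖ ^ γ with hL
    have hL0 : 0 ≤ L := by positivity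
    set ψ : ℝ → Vec d → ℝ := fun h z =>
      (p (x + h • v) z - p x z) - (p (x' + h • v) z - p x' z) with hψ
    have hψc : ∀ h, Continuous (ψ h) := fun h =>
      ((hpc _).sub (hpc _)).sub ((hpc _).sub (hpc _))
    obtain ⟨r, hr, hball⟩ := Metric.eventually_nhds_iff.1
      ((hFc v).continuousAt.eventually_lt (x₀ := (0, y)) (g := fun _ => Fr v (0, y) + δ)
        continuousAt_const (by linarith))
    have hev : ∀ h ∈ Ioo 0 r, ψ h y ≤ h * (L * (Fr v (0, y) + δ)) := fun h hh => by
      by_contra! hcon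
      set R := h * (L * (Fr v (0, y) + δ)) with hR
      have hRm : (R + ψ h y) / 2 < ψ h y := by linarith
      obtain ⟨r', hr', hball'⟩ := Metric.eventually_nhds_iff.1
        (((hψc h).continuousAt (x := y)).eventually_const_lt hRm)
      set A := Metric.ball y (min r r') with hA
      have hAm : MeasurableSet A := Metric.isOpen_ball.measurableSet
      have hAf : volume A < ⊤ := measure_ball_lt_top
      have hA0 : 0 < volume.real A :=
        ENNReal.toReal_pos (Metric.measure_ball_pos _ _ (lt_min hr hr')).ne' hAf.ne
      have hio : ∀ f : Vec d → ℝ, Continuous f → IntegrableOn f A := fun f hf =>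
        (hf.continuousOn.integrableOn_compact (isCompact_closedBall y (min r r'))).mono_set
          Metric.ball_subset_closedBall
      have h1 : (R + ψ h y) / 2 * volume.real A ≤ ∫ z in A, ψ h z := by
        have := setIntegral_mono_on (f := fun _ => (R + ψ h y) / 2) (integrableOn_const hAf.ne)
          (hio _ (hψc h)) hAm fun z hz => (hball' (hz.trans_le (min_le_right _ _))).le
        rw [setIntegral_const, smul_eq_mul, mul_comm] at this
        exact this
      have h2 : ‖∫ z in A, ψ h z‖ₑ ≤ ENNReal.ofReal (R * volume.real A) := by
        have hlim : Filter.Tendsto (fun N =>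
            ‖(S.partialSeries u t A N (x + h • v) - S.partialSeries u t A N x) -
              (S.partialSeries u t A N (x' + h • v) - S.partialSeries u t A N x')‖ₑ)
            Filter.atTop (nhds ‖∫ z in A, ψ h z‖ₑ) := by
          refine Filter.Tendsto.enorm ?_
          rw [hψ]
          simp only
          rw [integral_second_difference (hio _ (hpc _)) (hio _ (hpc _)) (hio _ (hpc _))
            (hio _ (hpc _))]
          exact ((hser _ A hAm).sub (hser _ A hAm)).sub ((hser _ A hAm).sub (hser _ A hAm))
        refine le_of_tendsto hlim (Filter.Eventually.of_forall fun N => ?_)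
        refine (hc S u t h x x' v A N hh.1.le).trans ?_
        have hF0 := hFr0 v (0, y)
        calc _ ≤ ENNReal.ofReal L * ∫⁻ _a in Ioc 0 h, ∫⁻ _z in A,
              ENNReal.ofReal (Fr v (0, y) + δ) := by
              refine mul_le_mul' le_rfl (setLIntegral_mono' measurableSet_Ioc fun a ha =>
                setLIntegral_mono' hAm fun z hz => ?_)
              rw [hkkF v (a, z)]
              refine ENNReal.ofReal_le_ofReal (hball ?_).le
              rw [Prod.dist_eq, max_lt_iff]
              refine ⟨?_, hz.trans_le (min_le_left _ _)⟩
              simp only [Real.dist_eq, sub_zero, abs_of_pos ha.1]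
              exact ha.2.trans_lt hh.2
          _ = _ := by
              simp only [lintegral_const, Measure.restrict_apply, MeasurableSet.univ, univ_inter,
                Real.volume_Ioc, sub_zero]
              rw [show volume A = ENNReal.ofReal (volume.real A) from
                (ENNReal.ofReal_toReal hAf.ne).symm, ← ENNReal.ofReal_mul (by positivity),
                ← ENNReal.ofReal_mul (by positivity), ← ENNReal.ofReal_mul (by positivity)]
              congr 1
              rw [hR]; ring
      have hR0 : 0 ≤ R := by
        have := (hFr0 v (0, y)).le; have := hh.1.le
        positivity
      rw [Real.enorm_eq_ofReal_abs] at h2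
      have h3 := (ENNReal.ofReal_le_ofReal_iff (by positivity)).1 h2
      have h4 := (h1.trans (le_abs_self _)).trans h3
      have := le_of_mul_le_mul_right h4 hA0
      linarith
    have hder : HasDerivAt (fun h : ℝ => ψ h y) (D v) 0 := by
      have h1 : ∀ z : Vec d, HasDerivAt (fun h : ℝ => p (z + h • v) y)
          (fderiv ℝ (fun z => p z y) z v) 0 := fun z =>
        (hpd y z).hasFDerivAt.hasLineDerivAt v
      exact ((h1 x).sub_const _).sub ((h1 x').sub_const _)
    have hsl := hder.tendsto_slope_zero_right
    refine le_of_tendsto hsl ?_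
    filter_upwards [Ioo_mem_nhdsGT hr] with h hh
    have h0 : ψ 0 y = 0 := by simp [hψ]
    rw [zero_add, h0, sub_zero, smul_eq_mul, inv_mul_le_iff₀ hh.1]
    exact hev h hh
  have key2 : ∀ v : Vec d, D v ≤ C * ‖v‖ * ‖x - x'‖ ^ γ * Fr 0 (0, y) := fun v => by
    have h1 : Fr v (0, y) = Fr 0 (0, y) := by simp [hFr]
    have hlim : Filter.Tendsto (fun δ : ℝ => C * ‖v‖ * ‖x - x'‖ ^ γ * (Fr v (0, y) + δ))
        (nhdsWithin 0 (Ioi 0)) (nhds (C * ‖v‖ * ‖x - x'‖ ^ γ * (Fr v (0, y) + 0))) :=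
      ((by fun_prop : Continuous fun δ : ℝ =>
        C * ‖v‖ * ‖x - x'‖ ^ γ * (Fr v (0, y) + δ)).tendsto 0).mono_left nhdsWithin_le_nhds
    rw [add_zero, h1] at hlim
    refine ge_of_tendsto hlim ?_
    filter_upwards [self_mem_nhdsWithin] with δ hδ
    rw [← h1]
    exact key v δ hδ
  have hF : Fr 0 (0, y) = (t - u) ^ (-(1 + γ) / 2) * (Wk d (rt M) (t - u) (S.Dm (u, x) (t, y)) +
      Wk d (rt M) (t - u) (S.Dm (u, x') (t, y))) := by simp [hFr]
  have hF0 := (hFr0 0 (0, y)).le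
  rw [mul_assoc, ← hF]
  refine ContinuousLinearMap.opNorm_le_bound _ (by positivity) fun v => ?_
  rw [Real.norm_eq_abs, abs_le]
  have k1 := key2 v
  have k2 := key2 (-v)
  simp only [hD, norm_neg, map_neg] at k1 k2
  simp only [_root_.sub_apply]
  have e : C * ‖v‖ * ‖x - x'‖ ^ γ * Fr 0 (0, y) = C * ‖x - x'‖ ^ γ * Fr 0 (0, y) * ‖v‖ := by ring
  constructor <;> linarith

end Setup

/-- The `i`-th partial derivative. -/
def pd {d : ℕ} (i : Fin d) (f : Vec d → ℝ) (z : Vec d) : ℝ :=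
  fderiv ℝ f z (EuclideanSpace.single i 1)

section pd
variable {d : ℕ}

lemma pd_contDiff (i : Fin d) {f : Vec d → ℝ} (hf : ContDiff ℝ (⊤ : ℕ∞) f) :
    ContDiff ℝ (⊤ : ℕ∞) (pd i f) :=
  (hf.fderiv_right (m := (⊤ : ℕ∞)) (by simp)).clm_apply contDiff_const

lemma pd_mul (i : Fin d) {f g : Vec d → ℝ} (hf : ContDiff ℝ (⊤ : ℕ∞) f)
    (hg : ContDiff ℝ (⊤ : ℕ∞) g) :
    pd i (fun z => f z * g z) = fun z => f z * pd i g z + pd i f z * g z := by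
  ext z
  unfold pd
  rw [fderiv_fun_mul (hf.differentiable (by simp) z) (hg.differentiable (by simp) z)]
  simp [mul_comm]

lemma pd_comp_smul (i : Fin d) {f : Vec d → ℝ} (hf : ContDiff ℝ (⊤ : ℕ∞) f) (c : ℝ) :
    pd i (fun z => f (c • z)) = fun z => c * pd i f (c • z) := by
  ext z
  unfold pd
  have := ((hf.differentiable (by simp) (c • z)).hasFDerivAt.comp z
    ((hasFDerivAt_id z).const_smul c)).fderiv
  simp only [Function.comp_def] at this
  rw [this]
  simp

lemma pd_const_mul (i : Fin d) {f : Vec d → ℝ} (hf : ContDiff ℝ (⊤ : ℕ∞) f) (c : ℝ) :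
    pd i (fun z => c * f z) = fun z => c * pd i f z := by
  ext z
  unfold pd
  rw [fderiv_const_mul (hf.differentiable (by simp) z)]
  simp

lemma pd_add (i : Fin d) {f g : Vec d → ℝ} (hf : ContDiff ℝ (⊤ : ℕ∞) f)
    (hg : ContDiff ℝ (⊤ : ℕ∞) g) :
    pd i (fun z => f z + g z) = fun z => pd i f z + pd i g z := by
  ext z
  unfold pd
  rw [fderiv_fun_add (hf.differentiable (by simp) z) (hg.differentiable (by simp) z)]
  simp

lemma pd_pd_mul (i j : Fin d) {f g : Vec d → ℝ} (hf : ContDiff ℝ (⊤ : ℕ∞) f)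
    (hg : ContDiff ℝ (⊤ : ℕ∞) g) (z : Vec d) :
    pd i (pd j (fun z => f z * g z)) z =
      (f z * pd i (pd j g) z + pd i f z * pd j g z) +
        (pd j f z * pd i g z + pd i (pd j f) z * g z) := by
  have h1 := pd_contDiff j hf
  have h2 := pd_contDiff j hg
  rw [pd_mul j hf hg, pd_add i (hf.mul h2) (h1.mul hg), pd_mul i hf h2, pd_mul i h1 hg]

/-- A smooth cutoff function equal to one on the unit ball. -/
lemma exists_cutoff (d : ℕ) : ∃ χ : Vec d → ℝ, ContDiff ℝ (⊤ : ℕ∞) χ ∧ HasCompactSupport χ ∧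
    (∀ z, ‖z‖ ≤ 1 → χ z = 1) ∧ ∀ z, |χ z| ≤ 1 := by
  let c : ContDiffBump (0 : Vec d) := ⟨1, 2, one_pos, one_lt_two⟩
  refine ⟨c, c.contDiff, c.hasCompactSupport, fun z hz => c.one_of_mem_closedBall (by simpa using hz),
    fun z => ?_⟩
  rw [abs_of_nonneg c.nonneg]
  exact c.le_one

lemma exists_bound_of_cs {f : Vec d → ℝ} (hf : Continuous f) (hc : HasCompactSupport f) :
    ∃ B, ∀ z, (1 + ‖z‖) * |f z| ≤ B := by
  obtain ⟨B, hB⟩ := hc.mul_left (f := fun z => (1 + ‖z‖)) |>.exists_bound_of_continuous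
    (by fun_prop)
  refine ⟨B, fun z => ?_⟩
  have := hB z
  rwa [Pi.mul_apply, norm_mul, Real.norm_of_nonneg (by positivity), Real.norm_eq_abs] at this

lemma pd_hasCompactSupport (i : Fin d) {f : Vec d → ℝ} (hf : HasCompactSupport f) :
    HasCompactSupport (pd i f) := by
  refine (hf.fderiv (𝕜 := ℝ)).comp_left (g := fun L : Vec d →L[ℝ] ℝ => L (EuclideanSpace.single i 1)) ?_
  simp

end pd

namespace Setup
variable {d : ℕ} {α M T : ℝ} (S : Setup d α M T)

/-- The generator. -/
def gen (r : ℝ) (f : Vec d → ℝ) (z : Vec d) : ℝ :=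
  (∑ i, S.b r z i * pd i f z) + 1 / 2 * ∑ i, ∑ j, S.a r z i j * pd i (pd j f) z

/-- `Y` satisfies Dynkin's formula on `[u,t]` under the finite measure `P`. -/
structure Dynkin (S : Setup d α M T) {Ω : Type*} [MeasurableSpace Ω] (P : Measure Ω) (u t : ℝ)
    (Y : ℝ → Ω → Vec d) : Prop where
  fin : IsFiniteMeasure P
  meas : Measurable fun q : ℝ × Ω => Y q.1 q.2
  cont : ∀ ω, Continuous fun r => Y r ω
  eq : ∀ f : Vec d → ℝ, ContDiff ℝ (⊤ : ℕ∞) f → HasCompactSupport f → ∀ v w, u ≤ v → v ≤ w →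
    w ≤ t → (∫ ω, f (Y w ω) ∂P) - ∫ ω, f (Y v ω) ∂P = ∫ r in v..w, (∫ ω, S.gen r f (Y r ω) ∂P)

lemma gen_measurable (S : Setup d α M T) {f : Vec d → ℝ} (hf : ContDiff ℝ (⊤ : ℕ∞) f) :
    Measurable fun q : ℝ × Vec d => S.gen q.1 f q.2 := by
  unfold gen
  refine Measurable.add (Finset.measurable_fun_sum _ fun i _ => ?_) (Measurable.const_mul
    (Finset.measurable_fun_sum _ fun i _ => Finset.measurable_fun_sum _ fun j _ => ?_) _)
  · exact (measurable_vec_apply S.b_meas i).mul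
      ((pd_contDiff i hf).continuous.measurable.comp measurable_snd)
  · exact (S.a_meas i j).mul
      ((pd_contDiff i (pd_contDiff j hf)).continuous.measurable.comp measurable_snd)

lemma gen_bound (S : Setup d α M T) {B0 : ℝ} (hB0 : ∀ r z, ‖S.b r z‖ ≤ B0 * (1 + ‖z‖))
    {f : Vec d → ℝ} {B1 B2 : ℝ} (h1 : ∀ z i, (1 + ‖z‖) * |pd i f z| ≤ B1)
    (h2 : ∀ z i j, |pd i (pd j f) z| ≤ B2) (r : ℝ) (z : Vec d) :
    |S.gen r f z| ≤ d * (|B0| * B1) + 1 / 2 * (d * (d * (M * B2))) := by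
  unfold gen
  refine (abs_add_le _ _).trans (add_le_add ?_ ?_)
  · refine (Finset.abs_sum_le_sum_abs _ _).trans ?_
    calc ∑ i, |S.b r z i * pd i f z| ≤ ∑ _i : Fin d, |B0| * B1 := by
          gcongr with i
          rw [abs_mul]
          calc |S.b r z i| * |pd i f z| ≤ (|B0| * (1 + ‖z‖)) * |pd i f z| := by
                gcongr
                refine (abs_coord_le _ i).trans ((hB0 r z).trans ?_)
                gcongr
                exact le_abs_self _
            _ = |B0| * ((1 + ‖z‖) * |pd i f z|) := by ring
            _ ≤ _ := by gcongr; exact h1 z i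
      _ = _ := by simp
  · rw [abs_mul, abs_of_pos (by norm_num : (0 : ℝ) < 1 / 2)]
    gcongr
    refine (Finset.abs_sum_le_sum_abs _ _).trans ?_
    calc ∑ i, |∑ j, S.a r z i j * pd i (pd j f) z| ≤ ∑ _i : Fin d, ∑ _j : Fin d, M * B2 := by
          gcongr with i
          refine (Finset.abs_sum_le_sum_abs _ _).trans ?_
          gcongr with j
          rw [abs_mul]
          have := S.M_pos
          gcongr
          · exact S.a_bdd _ _ _ _
          · exact h2 _ _ _
      _ = _ := by simp

/-- Dynkin's formula extends to functions that are not compactly supported. -/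
lemma Dynkin.extend {Ω : Type*} [MeasurableSpace Ω] {P : Measure Ω} {u t : ℝ}
    {Y : ℝ → Ω → Vec d} {S : Setup d α M T} (h : S.Dynkin P u t Y) {f : Vec d → ℝ}
    (hf : ContDiff ℝ (⊤ : ℕ∞) f)
    {B : ℝ} (h0 : ∀ z, |f z| ≤ B) (h1 : ∀ z i, (1 + ‖z‖) * |pd i f z| ≤ B)
    (h2 : ∀ z i j, |pd i (pd j f) z| ≤ B) {v w : ℝ} (hv : u ≤ v) (hvw : v ≤ w) (hw : w ≤ t) :
    (∫ ω, f (Y w ω) ∂P) - ∫ ω, f (Y v ω) ∂P = ∫ r in v..w, (∫ ω, S.gen r f (Y r ω) ∂P) := by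
  have := h.fin
  obtain ⟨χ, χs, χc, χ1, χb⟩ := exists_cutoff d
  obtain ⟨B0, hB0⟩ := S.growth
  have e1 : ∀ i, ∃ K, ∀ z, (1 + ‖z‖) * |pd i χ z| ≤ K := fun i =>
    exists_bound_of_cs (pd_contDiff i χs).continuous (pd_hasCompactSupport i χc)
  have e2 : ∀ i j, ∃ K, ∀ z, (1 + ‖z‖) * |pd i (pd j χ) z| ≤ K := fun i j =>
    exists_bound_of_cs (pd_contDiff i (pd_contDiff j χs)).continuous
      (pd_hasCompactSupport i (pd_hasCompactSupport j χc))
  choose K1 hK1 using e1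
  choose K2 hK2 using e2
  obtain ⟨K, hK0, hKK1, hKK2⟩ : ∃ K, 0 ≤ K ∧ (∀ z i, (1 + ‖z‖) * |pd i χ z| ≤ K) ∧
      (∀ z i j, |pd i (pd j χ) z| ≤ K) := by
    refine ⟨∑ i, |K1 i| + ∑ i, ∑ j, |K2 i j|, by positivity, fun z i => ?_, fun z i j => ?_⟩
    · have a1 := Finset.single_le_sum (f := fun i => |K1 i|) (fun i _ => abs_nonneg _)
        (Finset.mem_univ i)
      have a2 : 0 ≤ ∑ i, ∑ j, |K2 i j| := by positivity
      linarith [hK1 i z, le_abs_self (K1 i)]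
    · have a1 := Finset.single_le_sum (f := fun i => ∑ j, |K2 i j|)
        (fun i _ => Finset.sum_nonneg fun j _ => abs_nonneg _) (Finset.mem_univ i)
      have a2 := Finset.single_le_sum (f := fun j => |K2 i j|)
        (fun j _ => abs_nonneg _) (Finset.mem_univ j)
      have a3 : 0 ≤ ∑ i, |K1 i| := by positivity
      have a4 := hK2 i j z
      have a5 : |pd i (pd j χ) z| ≤ (1 + ‖z‖) * |pd i (pd j χ) z| :=
        le_mul_of_one_le_left (abs_nonneg _) (by linarith [norm_nonneg z])
      linarith [le_abs_self (K2 i j)]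
  have hB : 0 ≤ B := (abs_nonneg _).trans (h0 0)
  -- the truncated functions
  set c : ℕ → ℝ := fun n => ((n : ℝ) + 1)⁻¹ with hc
  have hc0 : ∀ n, 0 < c n := fun n => by positivity
  have hc1 : ∀ n, c n ≤ 1 := fun n => inv_le_one_of_one_le₀ (by linarith [n.cast_nonneg (α := ℝ)])
  set g : ℕ → Vec d → ℝ := fun n z => χ (c n • z) with hg
  have gs : ∀ n, ContDiff ℝ (⊤ : ℕ∞) (g n) := fun n => χs.comp (contDiff_id.const_smul _)
  have gc : ∀ n, HasCompactSupport (g n) := fun n => by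
    refine χc.comp_homeomorph (Homeomorph.smulOfNeZero (c n) (hc0 n).ne')
  have g1 : ∀ n i z, pd i (g n) z = c n * pd i χ (c n • z) := fun n i z => by
    rw [hg]; simp only [pd_comp_smul i χs]
  have g2 : ∀ n i j z, pd i (pd j (g n)) z = c n * (c n * pd i (pd j χ) (c n • z)) :=
    fun n i j z => by
      have e : pd j (g n) = fun z => c n * pd j χ (c n • z) := by ext z; exact g1 n j z
      rw [e, pd_const_mul i (f := fun z => pd j χ (c n • z))
          ((pd_contDiff j χs).comp (contDiff_id.const_smul _)),
        pd_comp_smul i (pd_contDiff j χs)]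
  have gb1 : ∀ n i z, (1 + ‖z‖) * |pd i (g n) z| ≤ K := fun n i z => by
    rw [g1, abs_mul, abs_of_pos (hc0 n)]
    refine le_trans ?_ (hKK1 (c n • z) i)
    rw [norm_smul, Real.norm_of_nonneg (hc0 n).le, ← mul_assoc]
    gcongr
    nlinarith [hc1 n, norm_nonneg z]
  have gb1' : ∀ n i z, |pd i (g n) z| ≤ c n * K := fun n i z => by
    rw [g1, abs_mul, abs_of_pos (hc0 n)]
    gcongr
    · refine le_trans ?_ (hKK1 (c n • z) i)
      exact le_mul_of_one_le_left (abs_nonneg _) (by linarith [norm_nonneg (c n • z)])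
  have gb2 : ∀ n i j z, |pd i (pd j (g n)) z| ≤ c n * K := fun n i j z => by
    rw [g2, abs_mul, abs_mul, abs_of_pos (hc0 n)]
    have := hKK2 (c n • z) i j
    gcongr
    · exact (mul_le_of_le_one_left (abs_nonneg _) (hc1 n)).trans this
  have glim : ∀ z, ∀ᶠ n in Filter.atTop, g n z = 1 := fun z => by
    obtain ⟨n0, hn0⟩ := exists_nat_gt ‖z‖
    filter_upwards [Filter.eventually_ge_atTop n0] with n hn
    refine χ1 _ ?_
    rw [norm_smul, Real.norm_of_nonneg (hc0 n).le, hc, inv_mul_le_iff₀ (by positivity)]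
    have : (n0 : ℝ) ≤ n := by exact_mod_cast hn
    linarith
  have clim : Filter.Tendsto c Filter.atTop (nhds 0) := tendsto_one_div_add_atTop_nhds_zero_nat.congr
    fun n => by simp [hc]
  have pd1lim : ∀ i z, Filter.Tendsto (fun n => pd i (g n) z) Filter.atTop (nhds 0) := fun i z =>
    squeeze_zero_norm (fun n => gb1' n i z) (by simpa using clim.mul_const K)
  have pd2lim : ∀ i j z, Filter.Tendsto (fun n => pd i (pd j (g n)) z) Filter.atTop (nhds 0) :=
    fun i j z => squeeze_zero_norm (fun n => gb2 n i j z) (by simpa using clim.mul_const K)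
  have gl : ∀ z, Filter.Tendsto (fun n => g n z) Filter.atTop (nhds 1) := fun z =>
    (Filter.tendsto_congr' (glim z)).2 tendsto_const_nhds
  set F : ℕ → Vec d → ℝ := fun n z => f z * g n z with hF
  have Fs : ∀ n, ContDiff ℝ (⊤ : ℕ∞) (F n) := fun n => hf.mul (gs n)
  have Fc : ∀ n, HasCompactSupport (F n) := fun n => (gc n).mul_left
  have gb0 : ∀ n z, |g n z| ≤ 1 := fun n z => χb _
  have Fb0 : ∀ n z, |F n z| ≤ B := fun n z => by
    rw [hF]
    simp only [abs_mul]
    nlinarith [h0 z, gb0 n z, abs_nonneg (f z), abs_nonneg (g n z)]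
  have F1 : ∀ n i z, pd i (F n) z = f z * pd i (g n) z + pd i f z * g n z := fun n i z => by
    rw [hF]; simp only [pd_mul i hf (gs n)]
  have Fb1 : ∀ n z i, (1 + ‖z‖) * |pd i (F n) z| ≤ B * K + B := fun n z i => by
    rw [F1]
    have hz : 0 ≤ 1 + ‖z‖ := by positivity
    calc (1 + ‖z‖) * |f z * pd i (g n) z + pd i f z * g n z| ≤
        (1 + ‖z‖) * (|f z| * |pd i (g n) z| + |pd i f z| * |g n z|) := by
          gcongr
          exact (abs_add_le _ _).trans (by rw [abs_mul, abs_mul])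
      _ = |f z| * ((1 + ‖z‖) * |pd i (g n) z|) + ((1 + ‖z‖) * |pd i f z|) * |g n z| := by ring
      _ ≤ B * K + B * 1 := by
          gcongr
          · exact h0 z
          · exact gb1 n i z
          · exact h1 z i
          · exact gb0 n z
      _ = _ := by ring
  have h1' : ∀ z i, |pd i f z| ≤ B := fun z i => le_trans
    (le_mul_of_one_le_left (abs_nonneg _) (by linarith [norm_nonneg z])) (h1 z i)
  have gb1'' : ∀ n i z, |pd i (g n) z| ≤ K := fun n i z => (gb1' n i z).trans
    (mul_le_of_le_one_left hK0 (hc1 n))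
  have gb2'' : ∀ n i j z, |pd i (pd j (g n)) z| ≤ K := fun n i j z => (gb2 n i j z).trans
    (mul_le_of_le_one_left hK0 (hc1 n))
  have Fb2 : ∀ n z i j, |pd i (pd j (F n)) z| ≤ (B * K + B * K) + (B * K + B * 1) :=
    fun n z i j => by
      rw [hF, pd_pd_mul i j hf (gs n)]
      refine (abs_add_le _ _).trans (add_le_add ((abs_add_le _ _).trans (add_le_add ?_ ?_))
        ((abs_add_le _ _).trans (add_le_add ?_ ?_))) <;> rw [abs_mul]
      · exact mul_le_mul (h0 z) (gb2'' _ _ _ _) (abs_nonneg _) hB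
      · exact mul_le_mul (h1' z i) (gb1'' _ _ _) (abs_nonneg _) hB
      · exact mul_le_mul (h1' z j) (gb1'' _ _ _) (abs_nonneg _) hB
      · exact mul_le_mul (h2 z i j) (gb0 _ _) (abs_nonneg _) hB
  have Flim : ∀ z, Filter.Tendsto (fun n => F n z) Filter.atTop (nhds (f z)) := fun z => by
    simpa using (gl z).const_mul (f z)
  have genlim : ∀ r z, Filter.Tendsto (fun n => S.gen r (F n) z) Filter.atTop
      (nhds (S.gen r f z)) := fun r z => by
    unfold gen
    refine Filter.Tendsto.add (tendsto_finsetSum _ fun i _ => Filter.Tendsto.const_mul _ ?_)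
      (Filter.Tendsto.const_mul _ (tendsto_finsetSum _ fun i _ => tendsto_finsetSum _ fun j _ =>
        Filter.Tendsto.const_mul _ ?_))
    · simp only [F1]
      simpa using ((pd1lim i z).const_mul (f z)).add ((gl z).const_mul (pd i f z))
    · have e : ∀ n, pd i (pd j (F n)) z = _ := fun n => pd_pd_mul i j hf (gs n) z
      simp only [e]
      simpa using (((pd2lim i j z).const_mul (f z)).add ((pd1lim j z).const_mul (pd i f z))).add
        (((pd1lim i z).const_mul (pd j f z)).add ((gl z).const_mul (pd i (pd j f) z)))
  set Q := d * (|B0| * (B * K + B)) + 1 / 2 * (d * (d * (M * ((B * K + B * K) + (B * K + B * 1)))))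
    with hQ
  have Gb : ∀ n r z, |S.gen r (F n) z| ≤ Q := fun n r z => S.gen_bound hB0 (Fb1 n) (Fb2 n) r z
  have Ym : ∀ r, Measurable (Y r) := fun r => h.meas.comp (measurable_const.prodMk measurable_id)
  have lim1 : ∀ r, Filter.Tendsto (fun n => ∫ ω, F n (Y r ω) ∂P) Filter.atTop
      (nhds (∫ ω, f (Y r ω) ∂P)) := fun r => by
    refine tendsto_integral_of_dominated_convergence (fun _ => B) (fun n =>
      ((Fs n).continuous.measurable.comp (Ym r)).aestronglyMeasurable) (integrable_const _)
      (fun n => Filter.Eventually.of_forall fun ω => Fb0 n _)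
      (Filter.Eventually.of_forall fun ω => Flim _)
  have gm : ∀ n, Measurable fun q : ℝ × Ω => S.gen q.1 (F n) (Y q.1 q.2) := fun n =>
    (S.gen_measurable (Fs n)).comp (measurable_fst.prodMk h.meas)
  have lim2 : ∀ r, Filter.Tendsto (fun n => ∫ ω, S.gen r (F n) (Y r ω) ∂P) Filter.atTop
      (nhds (∫ ω, S.gen r f (Y r ω) ∂P)) := fun r => by
    refine tendsto_integral_of_dominated_convergence (fun _ => Q) (fun n =>
      ((gm n).comp (measurable_const.prodMk measurable_id)).aestronglyMeasurable)
      (integrable_const _)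
      (fun n => Filter.Eventually.of_forall fun ω => Gb n _ _)
      (Filter.Eventually.of_forall fun ω => genlim _ _)
  have lim3 : Filter.Tendsto (fun n => ∫ r in v..w, (∫ ω, S.gen r (F n) (Y r ω) ∂P)) Filter.atTop
      (nhds (∫ r in v..w, (∫ ω, S.gen r f (Y r ω) ∂P))) := by
    refine intervalIntegral.tendsto_integral_filter_of_dominated_convergence
      (fun _ => Q * P.real univ) ?_ ?_ (by simp) ?_
    · exact Filter.Eventually.of_forall fun n =>
        ((gm n).stronglyMeasurable.integral_prod_right').aestronglyMeasurable
    · refine Filter.Eventually.of_forall fun n => Filter.Eventually.of_forall fun r _ => ?_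
      exact norm_integral_le_of_norm_le_const (Filter.Eventually.of_forall fun ω => Gb n _ _)
    · exact Filter.Eventually.of_forall fun r _ => lim2 r
  have heq := fun n => h.eq (F n) (Fs n) (Fc n) v w hv hvw hw
  refine tendsto_nhds_unique ((lim1 w).sub (lim1 v)) ?_
  simp only [heq]
  exact lim3

end Setup

lemma eq_of_local_small {F : ℝ → ℝ} {u v : ℝ} (huv : u ≤ v)
    (h : ∀ r0 ∈ Icc u v, ∀ ε > (0 : ℝ), ∃ δ > (0 : ℝ), ∀ r ∈ Icc u v, ∀ r' ∈ Icc u v, r ≤ r' →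
      |r - r0| < δ → |r' - r0| < δ → |F r' - F r| ≤ ε * (r' - r)) : F v = F u := by
  have hd : ∀ r0 ∈ Icc u v, HasDerivWithinAt F 0 (Icc u v) r0 := fun r0 hr0 => by
    rw [hasDerivWithinAt_iff_isLittleO, Asymptotics.isLittleO_iff]
    intro ε hε
    obtain ⟨δ, hδ, hh⟩ := h r0 hr0 ε hε
    filter_upwards [self_mem_nhdsWithin, mem_nhdsWithin_of_mem_nhds (Metric.ball_mem_nhds r0 hδ)]
      with r hr hrb
    have hrb' : |r - r0| < δ := by simpa [Real.dist_eq] using hrb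
    simp only [smul_zero, sub_zero, Real.norm_eq_abs]
    rcases le_total r0 r with h1 | h1
    · rw [abs_of_nonneg (sub_nonneg.2 h1)]
      exact hh r0 hr0 r hr h1 (by simpa) hrb'
    · rw [abs_sub_comm, abs_sub_comm r, abs_of_nonneg (sub_nonneg.2 h1)]
      exact hh r hr r0 hr0 h1 hrb' (by simpa)
  have := (convex_Icc u v).norm_image_sub_le_of_norm_hasDerivWithin_le (C := 0) hd
    (fun _ _ => by simp) (left_mem_Icc.2 huv) (right_mem_Icc.2 huv)
  rw [zero_mul] at this
  exact sub_eq_zero.1 (norm_le_zero_iff.1 this)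

section
variable {Ω : Type*} [MeasurableSpace Ω] {P : Measure Ω} [IsFiniteMeasure P]

lemma intervalIntegrable_integral_of_bdd {h : ℝ × Ω → ℝ} (hm : Measurable h) {K : ℝ}
    (hK : ∀ q, |h q| ≤ K) (r r' : ℝ) :
    IntervalIntegrable (fun ρ => ∫ ω, h (ρ, ω) ∂P) volume r r' := by
  refine (intervalIntegrable_const (c := K * P.real univ)).mono_fun'
    (hm.stronglyMeasurable.integral_prod_right').aestronglyMeasurable
    (Filter.Eventually.of_forall fun ρ => ?_)
  exact norm_integral_le_of_norm_le_const (Filter.Eventually.of_forall fun ω => hK _)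

lemma intervalIntegral_swap_of_bdd {h : ℝ × Ω → ℝ} (hm : Measurable h) {K : ℝ}
    (hK : ∀ q, |h q| ≤ K) {r r' : ℝ} (hr : r ≤ r') :
    ∫ ω, (∫ ρ in r..r', h (ρ, ω)) ∂P = ∫ ρ in r..r', (∫ ω, h (ρ, ω) ∂P) := by
  simp only [intervalIntegral.integral_of_le hr]
  refine integral_integral_swap (f := fun ω ρ => h (ρ, ω)) ?_
  refine (integrable_const K).mono' (hm.comp measurable_swap).aestronglyMeasurable
    (Filter.Eventually.of_forall fun q => hK _)

lemma integrable_section_of_bdd {h : ℝ × Ω → ℝ} (hm : Measurable h) {K : ℝ}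
    (hK : ∀ q, |h q| ≤ K) (r : ℝ) : Integrable (fun ω => h (r, ω)) P :=
  (integrable_const K).mono' (hm.comp (measurable_const.prodMk measurable_id)).aestronglyMeasurable
    (Filter.Eventually.of_forall fun _ => hK _)

/-- A time-dependent Dynkin formula deduced from the formula for frozen functions. -/
lemma dynkin_time_dependent {E : Type*} [TopologicalSpace E] [MeasurableSpace E] [BorelSpace E]
    [SecondCountableTopology E]
    {ι : Type*} [Fintype ι] {Y : ℝ → Ω → E} (hYm : Measurable fun q : ℝ × Ω => Y q.1 q.2)
    (hYc : ∀ ω, Continuous fun r => Y r ω) {u v : ℝ} (huv : u ≤ v) {B : ℝ} (hB : 0 ≤ B)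
    {G0 : ℝ → E → ℝ} (hG0m : ∀ r, Measurable (G0 r)) (hG0b : ∀ r z, |G0 r z| ≤ B)
    {G : ι → ℝ → E → ℝ} (hGc : ∀ k, Continuous fun q : ℝ × E => G k q.1 q.2)
    {W : ι → E → ℝ} (hWc : ∀ k, Continuous (W k)) (hW1 : ∀ k z, 1 ≤ W k z)
    (hGW : ∀ k r z, W k z * |G k r z| ≤ B)
    {β : ι → ℝ → E → ℝ} (hβm : ∀ k, Measurable fun q : ℝ × E => β k q.1 q.2)
    (hβ : ∀ k r z, |β k r z| ≤ B * W k z)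
    {η : ι → ℝ → ℝ} (hηm : ∀ k, Measurable (η k)) (hη : ∀ k r, |η k r| ≤ B)
    (h1 : ∀ r r', u ≤ r → r ≤ r' → r' ≤ v → (∫ ω, G0 r' (Y r' ω) ∂P) - ∫ ω, G0 r' (Y r ω) ∂P =
      ∫ ρ in r..r', (∫ ω, ∑ k, β k ρ (Y ρ ω) * G k r' (Y ρ ω) ∂P))
    (h2 : ∀ z r r', u ≤ r → r ≤ r' → r' ≤ v → G0 r' z - G0 r z =
      -∫ ρ in r..r', ∑ k, η k ρ * G k ρ z) :
    (∫ ω, G0 v (Y v ω) ∂P) - ∫ ω, G0 u (Y u ω) ∂P =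
      ∫ ρ in u..v, (∫ ω, ∑ k, (β k ρ (Y ρ ω) - η k ρ) * G k ρ (Y ρ ω) ∂P) := by
  have hGm : ∀ k, Measurable fun q : ℝ × E => G k q.1 q.2 := fun k => (hGc k).measurable
  have hGb : ∀ k r z, |G k r z| ≤ B := fun k r z =>
    (le_mul_of_one_le_left (abs_nonneg _) (hW1 k z)).trans (hGW k r z)
  have Ym : ∀ r, Measurable (Y r) := fun r => hYm.comp (measurable_const.prodMk measurable_id)
  have hW0 : ∀ k z, 0 ≤ W k z := fun k z => zero_le_one.trans (hW1 k z)
  have βG : ∀ k ρ r z, |β k ρ z * G k r z| ≤ B * B := fun k ρ r z => by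
    rw [abs_mul]
    calc |β k ρ z| * |G k r z| ≤ B * W k z * |G k r z| := by gcongr; exact hβ k ρ z
      _ = B * (W k z * |G k r z|) := by ring
      _ ≤ _ := by gcongr; exact hGW k r z
  have ηG : ∀ k ρ r z, |η k ρ * G k r z| ≤ B * B := fun k ρ r z => by
    rw [abs_mul]
    exact mul_le_mul (hη k ρ) (hGb k r z) (abs_nonneg _) hB
  -- the three integrands
  set a : ℝ → ℝ × Ω → ℝ := fun r' q => ∑ k, β k q.1 (Y q.1 q.2) * G k r' (Y q.1 q.2) with ha
  set c : ℝ → ℝ × Ω → ℝ := fun r q => ∑ k, η k q.1 * G k q.1 (Y r q.2) with hc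
  set e : ℝ × Ω → ℝ := fun q => ∑ k, (β k q.1 (Y q.1 q.2) - η k q.1) * G k q.1 (Y q.1 q.2) with he
  have am : ∀ r', Measurable (a r') := fun r' => Finset.measurable_fun_sum _ fun k _ =>
    ((hβm k).comp (measurable_fst.prodMk hYm)).mul ((hGm k).comp (measurable_const.prodMk hYm))
  have cm : ∀ r, Measurable (c r) := fun r => Finset.measurable_fun_sum _ fun k _ =>
    ((hηm k).comp measurable_fst).mul
      ((hGm k).comp (measurable_fst.prodMk ((Ym r).comp measurable_snd)))
  have em : Measurable e := Finset.measurable_fun_sum _ fun k _ =>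
    (((hβm k).comp (measurable_fst.prodMk hYm)).sub ((hηm k).comp measurable_fst)).mul
      ((hGm k).comp (measurable_fst.prodMk hYm))
  set K := ∑ _k : ι, (B * B + B * B) with hK
  have B2 : 0 ≤ B * B := mul_nonneg hB hB
  have ab : ∀ r' q, |a r' q| ≤ K := fun r' q => (Finset.abs_sum_le_sum_abs _ _).trans
    (Finset.sum_le_sum fun k _ => (βG _ _ _ _).trans (by linarith))
  have cb : ∀ r' q, |c r' q| ≤ K := fun r' q => (Finset.abs_sum_le_sum_abs _ _).trans
    (Finset.sum_le_sum fun k _ => (ηG _ _ _ _).trans (by linarith))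
  have eb : ∀ q, |e q| ≤ K := fun q => (Finset.abs_sum_le_sum_abs _ _).trans
    (Finset.sum_le_sum fun k _ => by
      rw [sub_mul]
      exact (abs_sub _ _).trans (add_le_add (βG _ _ _ _) (ηG _ _ _ _)))
  -- the error term
  set Ξ : (ℝ × ℝ × ℝ) → Ω → ℝ := fun q ω => ∑ k,
    (B * (W k (Y q.2.2 ω) * |G k q.2.1 (Y q.2.2 ω) - G k q.2.2 (Y q.2.2 ω)|) +
      B * |G k q.2.2 (Y q.1 ω) - G k q.2.2 (Y q.2.2 ω)|) with hΞ
  have Gd : ∀ k r r' z, W k z * |G k r z - G k r' z| ≤ B + B := fun k r r' z => by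
    calc W k z * |G k r z - G k r' z| ≤ W k z * (|G k r z| + |G k r' z|) := by
          gcongr
          · exact hW0 k z
          · exact abs_sub _ _
      _ ≤ _ := by rw [mul_add]; exact add_le_add (hGW _ _ _) (hGW _ _ _)
  have Ξb : ∀ q ω, |Ξ q ω| ≤ ∑ _k : ι, (B * (B + B) + B * (B + B)) := fun q ω => by
    refine (Finset.abs_sum_le_sum_abs _ _).trans (Finset.sum_le_sum fun k _ => ?_)
    have := hW0 k (Y q.2.2 ω)
    rw [abs_of_nonneg (by positivity)]
    gcongr
    · exact Gd _ _ _ _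
    · exact (abs_sub _ _).trans (add_le_add (hGb _ _ _) (hGb _ _ _))
  have Ξm : ∀ q, Measurable (Ξ q) := fun q => by
    refine Finset.measurable_fun_sum _ fun k _ => Measurable.add (Measurable.const_mul
      (Measurable.mul ((hWc k).measurable.comp (Ym _)) (Measurable.abs (Measurable.sub ?_ ?_))) _)
      (Measurable.const_mul (Measurable.abs (Measurable.sub ?_ ?_)) _) <;>
    exact (hGm k).comp (measurable_const.prodMk (Ym _))
  have Ξc : ∀ ω, Continuous fun q => Ξ q ω := fun ω => by
    have y1 : Continuous fun q : ℝ × ℝ × ℝ => Y q.1 ω := (hYc ω).comp continuous_fst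
    have y3 : Continuous fun q : ℝ × ℝ × ℝ => Y q.2.2 ω :=
      (hYc ω).comp (continuous_snd.comp continuous_snd)
    have t2 : Continuous fun q : ℝ × ℝ × ℝ => q.2.1 := by fun_prop
    have t3 : Continuous fun q : ℝ × ℝ × ℝ => q.2.2 := by fun_prop
    refine continuous_finsetSum _ fun k _ => Continuous.add (continuous_const.mul
      (((hWc k).comp y3).mul (Continuous.abs (Continuous.sub ?_ ?_))))
      (continuous_const.mul (Continuous.abs (Continuous.sub ?_ ?_)))
    · exact (hGc k).comp (t2.prodMk y3)
    · exact (hGc k).comp (t3.prodMk y3)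
    · exact (hGc k).comp (t3.prodMk y1)
    · exact (hGc k).comp (t3.prodMk y3)
  set err : ℝ × ℝ × ℝ → ℝ := fun q => ∫ ω, Ξ q ω ∂P with herr
  have errc : Continuous err := continuous_of_dominated
    (fun q => (Ξm q).aestronglyMeasurable)
    (fun q => Filter.Eventually.of_forall fun ω => Ξb q ω) (integrable_const _)
    (Filter.Eventually.of_forall Ξc)
  have err0 : ∀ r, err (r, r, r) = 0 := fun r => by simp [herr, hΞ]
  have Ξi : ∀ q, Integrable (Ξ q) P := fun q => (integrable_const _).mono'
    (Ξm q).aestronglyMeasurable (Filter.Eventually.of_forall fun ω => Ξb q ω)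
  set F : ℝ → ℝ := fun r => (∫ ω, G0 r (Y r ω) ∂P) - ∫ ρ in u..r, (∫ ω, e (ρ, ω) ∂P) with hF
  suffices h : F v = F u by
    simp only [hF, intervalIntegral.integral_same, sub_zero] at h
    linarith
  refine eq_of_local_small huv fun r0 hr0 ε hε => ?_
  have hev : ∀ᶠ q in nhds (r0, r0, r0), err q < ε :=
    errc.continuousAt.eventually_lt continuousAt_const (by rw [err0]; exact hε)
  obtain ⟨δ, hδ, hb⟩ := Metric.eventually_nhds_iff.1 hev
  refine ⟨δ, hδ, fun r hr r' hr' hrr h3 h4 => ?_⟩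
  have ei := fun x y => intervalIntegrable_integral_of_bdd (P := P) em eb x y
  have ai := intervalIntegrable_integral_of_bdd (P := P) (am r') (ab r') r r'
  have ci := intervalIntegrable_integral_of_bdd (P := P) (cm r) (cb r) r r'
  have G0i : ∀ x y, Integrable (fun ω => G0 x (Y y ω)) P := fun x y => (integrable_const B).mono'
    ((hG0m x).comp (Ym y)).aestronglyMeasurable (Filter.Eventually.of_forall fun ω => hG0b _ _)
  have s1 := h1 r r' hr.1 hrr hr'.2
  have s2 : (∫ ω, G0 r' (Y r ω) ∂P) - ∫ ω, G0 r (Y r ω) ∂P =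
      - ∫ ρ in r..r', (∫ ω, c r (ρ, ω) ∂P) := by
    rw [← integral_sub (G0i _ _) (G0i _ _), ← intervalIntegral_swap_of_bdd (cm r) (cb r) hrr,
      ← integral_neg]
    exact integral_congr_ae (Filter.Eventually.of_forall fun ω => h2 (Y r ω) r r' hr.1 hrr hr'.2)
  have s3 : F r' - F r = ∫ ρ in r..r', ((∫ ω, a r' (ρ, ω) ∂P) - (∫ ω, c r (ρ, ω) ∂P) -
      ∫ ω, e (ρ, ω) ∂P) := by
    rw [intervalIntegral.integral_sub (ai.sub ci) (ei _ _), intervalIntegral.integral_sub ai ci]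
    have s4 := intervalIntegral.integral_interval_sub_left (ei u r') (ei u r)
    simp only [hF]
    rw [show (∫ ρ in r..r', (∫ ω, a r' (ρ, ω) ∂P)) = _ from s1.symm, ← s4]
    linarith
  rw [s3]
  have := intervalIntegral.norm_integral_le_of_norm_le_const (a := r) (b := r') (C := ε)
    (f := fun ρ => (∫ ω, a r' (ρ, ω) ∂P) - (∫ ω, c r (ρ, ω) ∂P) - ∫ ω, e (ρ, ω) ∂P) ?_
  · rwa [abs_of_nonneg (sub_nonneg.2 hrr), Real.norm_eq_abs] at this
  intro ρ hρ
  rw [uIoc_of_le hrr] at hρ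
  have ia := integrable_section_of_bdd (P := P) (am r') (ab r') ρ
  have ic := integrable_section_of_bdd (P := P) (cm r) (cb r) ρ
  have ie := integrable_section_of_bdd (P := P) em eb ρ
  have iac : Integrable (fun ω => a r' (ρ, ω) - c r (ρ, ω)) P := ia.sub ic
  rw [← integral_sub ia ic, ← integral_sub iac ie]
  have hq : err (r, r', ρ) < ε := by
    refine hb ?_
    simp only [Prod.dist_eq, Real.dist_eq, max_lt_iff]
    refine ⟨h3, h4, ?_⟩
    rw [abs_lt] at h3 h4 ⊢
    constructor <;> linarith [hρ.1, hρ.2, h3.1, h4.2]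
  refine le_trans (norm_integral_le_of_norm_le (Ξi (r, r', ρ))
    (Filter.Eventually.of_forall fun ω => ?_)) hq.le
  simp only [ha, hc, he, hΞ, Real.norm_eq_abs]
  rw [← Finset.sum_sub_distrib, ← Finset.sum_sub_distrib]
  refine (Finset.abs_sum_le_sum_abs _ _).trans (Finset.sum_le_sum fun k _ => ?_)
  have e1 : β k ρ (Y ρ ω) * G k r' (Y ρ ω) - η k ρ * G k ρ (Y r ω) -
      (β k ρ (Y ρ ω) - η k ρ) * G k ρ (Y ρ ω) =
      β k ρ (Y ρ ω) * (G k r' (Y ρ ω) - G k ρ (Y ρ ω)) -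
        η k ρ * (G k ρ (Y r ω) - G k ρ (Y ρ ω)) := by ring
  rw [e1]
  refine (abs_sub _ _).trans (add_le_add ?_ ?_)
  · rw [abs_mul, ← mul_assoc]
    gcongr
    exact hβ _ _ _
  · rw [abs_mul]
    gcongr
    exact hη _ _

end

section gk
variable {d : ℕ}

/-- The derivatives of the Gaussian density entering its heat equation. -/
def gk (k : Fin d ⊕ Fin d × Fin d) (C : Matrix (Fin d) (Fin d) ℝ) (v : Vec d) : ℝ :=
  Sum.elim (fun i => ga1 C i v) (fun q => 1 / 2 * ga2 C q.1 q.2 v) k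

lemma sum_gk (C : Matrix (Fin d) (Fin d) ℝ) (v : Vec d) (δ : Fin d ⊕ Fin d × Fin d → ℝ) :
    ∑ k, δ k * gk k C v = (∑ i, δ (Sum.inl i) * ga1 C i v) +
      1 / 2 * ∑ i, ∑ j, δ (Sum.inr (i, j)) * ga2 C i j v := by
  simp only [Fintype.sum_sum_type, Fintype.sum_prod_type, gk, Sum.elim_inl, Sum.elim_inr,
    Finset.mul_sum]
  congr 1
  exact Finset.sum_congr rfl fun i _ => Finset.sum_congr rfl fun j _ => by ring

lemma continuousAt_gk {q : Matrix (Fin d) (Fin d) ℝ × Vec d} (h : 0 < q.1.det)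
    (k : Fin d ⊕ Fin d × Fin d) :
    ContinuousAt (fun q : Matrix (Fin d) (Fin d) ℝ × Vec d => gk k q.1 q.2) q := by
  rcases k with i | ⟨i, j⟩
  · exact continuousAt_ga1 h i
  · exact (continuousAt_ga2 h i j).const_mul _

lemma ga_segment {C C' : Matrix (Fin d) (Fin d) ℝ} (hC : C.IsSymm) (hC' : C'.IsSymm) (x x' : Vec d)
    (hdet : ∀ θ ∈ Icc (0 : ℝ) 1, 0 < (C + θ • (C' - C)).det) :
    ∃ θ ∈ Icc (0 : ℝ) 1, ga C' x' - ga C x = ∑ k, (Sum.elim (fun i => (x' - x) i)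
      (fun q => (C' - C) q.1 q.2) k) * gk k (C + θ • (C' - C)) (x + θ • (x' - x)) := by
  set φ : ℝ → ℝ := fun θ => ga (C + θ • (C' - C)) (x + θ • (x' - x)) with hφ
  have hd : ∀ θ ∈ Icc (0 : ℝ) 1, HasDerivAt φ (∑ k, (Sum.elim (fun i => (x' - x) i)
      (fun q => (C' - C) q.1 q.2) k) * gk k (C + θ • (C' - C)) (x + θ • (x' - x))) θ :=
    fun θ hθ => by
      have hs : (C + θ • (C' - C)).IsSymm := hC.add ((hC'.sub hC).smul θ)
      have h := hasDerivAt_ga (Δ := C' - C) (hdet θ hθ) hs (x + θ • (x' - x)) (x' - x)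
      rw [sum_gk]
      have h2 := HasDerivAt.comp_sub_const (f := fun h : ℝ => ga (C + θ • (C' - C) + h • (C' - C))
        (x + θ • (x' - x) + h • (x' - x))) θ θ (by rw [sub_self]; exact h)
      refine (h2.congr_deriv (by simp only [Sum.elim_inl, Sum.elim_inr]; ring)).congr_of_eventuallyEq
        (Filter.Eventually.of_forall fun θ' => ?_)
      simp only [hφ]
      congr 1
      · rw [add_assoc, ← add_smul]; congr 2; ring
      · rw [add_assoc, ← add_smul]; congr 2; ring
  obtain ⟨θ, hθ, h⟩ := exists_hasDerivAt_eq_slope φ _ zero_lt_one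
    (fun θ hθ => (hd θ hθ).continuousAt.continuousWithinAt)
    (fun θ hθ => hd θ (Ioo_subset_Icc_self hθ))
  refine ⟨θ, Ioo_subset_Icc_self hθ, ?_⟩
  rw [h]
  simp [hφ]

lemma pd_ga {C : Matrix (Fin d) (Fin d) ℝ} (hC : 0 < C.det) (hs : C.IsSymm) (ξ : Vec d) (i : Fin d) :
    pd i (fun z => ga C (z - ξ)) = fun z => ga1 C i (z - ξ) := by
  ext z
  unfold pd
  rw [fderiv_comp_sub (a := ξ), fderiv_ga hC hs]
  simp

lemma pd_ga1 {C : Matrix (Fin d) (Fin d) ℝ} (hC : 0 < C.det) (hs : C.IsSymm) (ξ : Vec d)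
    (i j : Fin d) : pd j (fun z => ga1 C i (z - ξ)) = fun z => ga2 C i j (z - ξ) := by
  ext z
  unfold pd
  rw [fderiv_comp_sub (a := ξ), fderiv_ga1 hC hs]
  simp 

end gk

namespace Setup
variable {d : ℕ} {α M T : ℝ} (S : Setup d α M T)

/-- The coefficients of the generator. -/
def bet (k : Fin d ⊕ Fin d × Fin d) (r : ℝ) (z : Vec d) : ℝ :=
  Sum.elim (fun i => S.b r z i) (fun q => S.a r z q.1 q.2) k

/-- The coefficients of the frozen generator. -/
def eta (w : Vec d) (k : Fin d ⊕ Fin d × Fin d) (r : ℝ) : ℝ :=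
  Sum.elim (fun i => S.c r (S.ζ r w) i) (fun q => S.a r (S.ζ r w) q.1 q.2) k

lemma bet_measurable (k : Fin d ⊕ Fin d × Fin d) :
    Measurable fun q : ℝ × Vec d => S.bet k q.1 q.2 := by
  rcases k with i | ⟨i, j⟩
  · exact measurable_vec_apply S.b_meas i
  · exact S.a_meas i j

lemma eta_measurable (w : Vec d) (k : Fin d ⊕ Fin d × Fin d) : Measurable (S.eta w k) := by
  rcases k with i | ⟨i, j⟩
  · exact measurable_vec_apply (S.c_meas.comp (measurable_id.prodMk (S.ζ_meas_right w))) i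
  · exact S.a_flow_meas w i j

lemma exists_eta_bound (w : Vec d) : ∃ B, 0 ≤ B ∧ ∀ k r, |S.eta w k r| ≤ B := by
  obtain ⟨B, hB⟩ := S.c_loc w
  refine ⟨max B M, le_max_of_le_right S.M_pos.le, fun k r => ?_⟩
  rcases k with i | ⟨i, j⟩
  · exact (abs_coord_le _ i).trans ((hB r).trans (le_max_left _ _))
  · exact (S.a_bdd _ _ _ _).trans (le_max_right _ _)

lemma eta_intervalIntegrable (w : Vec d) (k : Fin d ⊕ Fin d × Fin d) (r r' : ℝ) :
    IntervalIntegrable (S.eta w k) volume r r' := by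
  obtain ⟨B, -, hB⟩ := S.exists_eta_bound w
  exact (intervalIntegrable_const (c := B)).mono_fun' (S.eta_measurable w k).aestronglyMeasurable
    (Filter.Eventually.of_forall fun ρ => hB k ρ)

lemma Hk_eq_sum (ε r : ℝ) (z : Vec d) (u : ℝ) (w : Vec d) :
    S.Hk ε r z u w = ∑ k, (S.bet k r z - S.eta w k r) * gk k (S.Cov ε r u w) (z - S.ζ r w) := by
  rw [sum_gk]
  unfold Hk bet eta
  simp only [Sum.elim_inl, Sum.elim_inr, PiLp.sub_apply]
  rw [add_comm]

lemma gen_ga {C : Matrix (Fin d) (Fin d) ℝ} (hC : 0 < C.det) (hs : C.IsSymm) (ξ : Vec d)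
    (r : ℝ) (z : Vec d) :
    S.gen r (fun z => ga C (z - ξ)) z = ∑ k, S.bet k r z * gk k C (z - ξ) := by
  rw [sum_gk]
  unfold gen bet
  simp only [pd_ga hC hs, pd_ga1 hC hs, Sum.elim_inl, Sum.elim_inr]
  rw [Finset.sum_comm (f := fun i j => S.a r z i j * ga2 C j i (z - ξ))]
  congr 3
  ext i
  congr 1
  ext j
  rw [(S.a_qb r z).symm.apply i j]

lemma ζ_time_continuous (w : Vec d) : Continuous fun r => S.ζ r w := by
  obtain ⟨B, hB⟩ := S.c_loc w
  refine (LipschitzWith.of_dist_le_mul (K := (|B|).toNNReal) fun r r' => ?_).continuous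
  rw [dist_eq_norm, S.ode, Real.coe_toNNReal _ (abs_nonneg B), Real.dist_eq]
  exact intervalIntegral.norm_integral_le_of_norm_le_const fun ρ _ => (hB ρ).trans (le_abs_self B)

lemma ζ_sub_apply (w : Vec d) (r r' : ℝ) (i : Fin d) :
    (S.ζ r' w - S.ζ r w) i = ∫ ρ in r..r', S.eta w (Sum.inl i) ρ := by
  obtain ⟨B, hB⟩ := S.c_loc w
  rw [S.ode]
  have hi : IntervalIntegrable (fun ρ => S.c ρ (S.ζ ρ w)) volume r r' :=
    (intervalIntegrable_const (c := B)).mono_fun'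
      (S.c_meas.comp (measurable_id.prodMk (S.ζ_meas_right w))).aestronglyMeasurable
      (Filter.Eventually.of_forall fun ρ => hB ρ)
  exact ((EuclideanSpace.proj i : Vec d →L[ℝ] ℝ).intervalIntegral_comp_comm hi).symm

lemma Cov_sub_apply (ε : ℝ) (w : Vec d) {r r' u : ℝ} (h1 : r ≤ u) (h2 : r' ≤ u) (i j : Fin d) :
    (S.Cov ε r' u w - S.Cov ε r u w) i j = - ∫ ρ in r..r', S.eta w (Sum.inr (i, j)) ρ := by
  rw [Matrix.sub_apply, Cov_apply, Cov_apply, ← intervalIntegral.integral_of_le h1,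
    ← intervalIntegral.integral_of_le h2]
  have := intervalIntegral.integral_add_adjacent_intervals
    (S.eta_intervalIntegrable w (Sum.inr (i, j)) r r')
    (S.eta_intervalIntegrable w (Sum.inr (i, j)) r' u)
  simp only [eta, Sum.elim_inr] at this ⊢
  linarith

lemma Cov_continuous (ε : ℝ) (w : Vec d) {u : ℝ} {κ : ℝ → ℝ} (hκ : Continuous κ)
    (hu : ∀ r, κ r ≤ u) : Continuous fun r => S.Cov ε (κ r) u w := by
  refine continuous_matrix fun i j => ?_
  have e : (fun r => S.Cov ε (κ r) u w i j) = fun r => S.Cov ε u u w i j +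
      ∫ ρ in (κ r)..u, S.eta w (Sum.inr (i, j)) ρ := by
    ext r
    have := S.Cov_sub_apply ε w (hu r) le_rfl i j
    rw [Matrix.sub_apply] at this
    linarith
  rw [e]
  refine continuous_const.add ?_
  have h1 := intervalIntegral.continuous_primitive
    (fun a b => S.eta_intervalIntegrable w (Sum.inr (i, j)) a b) u
  have h2 : Continuous fun r => -∫ ρ in u..(κ r), S.eta w (Sum.inr (i, j)) ρ := (h1.comp hκ).neg
  refine h2.congr fun r => ?_
  rw [intervalIntegral.integral_symm]; simp

/-- The frozen Gaussian density solves the backward equation of the frozen generator. -/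
lemma pt_backward (S : Setup d α M T) {ε : ℝ} (hε : 0 < ε) (w z : Vec d) {r r' u : ℝ}
    (hr : r ≤ r') (hu : r' ≤ u) :
    S.pt ε r' z u w - S.pt ε r z u w =
      -∫ ρ in r..r', ∑ k, S.eta w k ρ * gk k (S.Cov ε ρ u w) (z - S.ζ ρ w) := by
  set κ : ℝ → ℝ := fun ρ => min u ρ with hκ
  have κc : Continuous κ := by fun_prop
  have κe : ∀ ρ ≤ u, κ ρ = ρ := fun ρ h => min_eq_right h
  have κu : ∀ ρ, κ ρ ≤ u := fun ρ => min_le_left _ _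
  set C : ℝ → Matrix (Fin d) (Fin d) ℝ := fun ρ => S.Cov ε (κ ρ) u w with hC
  set X : ℝ → Vec d := fun ρ => z - S.ζ (κ ρ) w with hX
  have Cc : Continuous C := S.Cov_continuous ε w κc κu
  have Xc : Continuous X := continuous_const.sub ((S.ζ_time_continuous w).comp κc)
  have Cd : ∀ ρ, 0 < (C ρ).det := fun ρ => S.Cov_det_pos hε.le (κu ρ)
    (by linarith [κu ρ]) w
  have Cs : ∀ ρ, (C ρ).IsSymm := fun ρ => (S.Cov_qb hε.le (κu ρ) w).symm
  set g : Fin d ⊕ Fin d × Fin d → ℝ → ℝ := fun k ρ => gk k (C ρ) (X ρ) with hg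
  have gc : ∀ k, Continuous (g k) := fun k => continuous_iff_continuousAt.2 fun ρ =>
    ContinuousAt.comp (g := fun q : Matrix (Fin d) (Fin d) ℝ × Vec d => gk k q.1 q.2)
      (f := fun ρ => (C ρ, X ρ)) (continuousAt_gk (q := (C ρ, X ρ)) (Cd ρ) k)
      (Cc.prodMk Xc).continuousAt
  obtain ⟨B, hB0, hB⟩ := S.exists_eta_bound w
  have ηi := fun k a b => S.eta_intervalIntegrable w k a b
  have ηgi : ∀ k a b, IntervalIntegrable (fun ρ => S.eta w k ρ * g k ρ) volume a b :=
    fun k a b => (ηi k a b).mul_continuousOn (gc k).continuousOn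
  set F : ℝ → ℝ := fun ρ => ga (C ρ) (X ρ) + ∫ x in r..ρ, ∑ k, S.eta w k x * g k x with hF
  have main : F r' = F r := by
    refine eq_of_local_small hr fun r0 hr0 δ hδ => ?_
    set N : ℝ := ((Fintype.card (Fin d ⊕ Fin d × Fin d) : ℕ) : ℝ) with hN
    set e : ℝ := δ / (2 * ((N + 1) * (B + 1))) with he
    have hN0 : 0 ≤ N := Nat.cast_nonneg _
    have he0 : 0 < e := by positivity
    have ev1 : ∀ᶠ q : ℝ × ℝ in nhds (r0, r0), ∀ θ ∈ Icc (0 : ℝ) 1,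
        0 < (C q.1 + θ • (C q.2 - C q.1)).det ∧
        ∀ k, |gk k (C q.1 + θ • (C q.2 - C q.1)) (X q.1 + θ • (X q.2 - X q.1)) - g k r0| < e := by
      refine isCompact_Icc.eventually_forall_of_forall_eventually fun θ _ => ?_
      have c1 : Continuous fun q : (ℝ × ℝ) × ℝ => C q.1.1 + q.2 • (C q.1.2 - C q.1.1) := by
        have a1 : Continuous fun q : (ℝ × ℝ) × ℝ => C q.1.1 := Cc.comp (by fun_prop)
        have a2 : Continuous fun q : (ℝ × ℝ) × ℝ => C q.1.2 := Cc.comp (by fun_prop)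
        exact a1.add (continuous_snd.smul (a2.sub a1))
      have c2 : Continuous fun q : (ℝ × ℝ) × ℝ => X q.1.1 + q.2 • (X q.1.2 - X q.1.1) := by
        have a1 : Continuous fun q : (ℝ × ℝ) × ℝ => X q.1.1 := Xc.comp (by fun_prop)
        have a2 : Continuous fun q : (ℝ × ℝ) × ℝ => X q.1.2 := Xc.comp (by fun_prop)
        exact a1.add (continuous_snd.smul (a2.sub a1))
      refine Filter.Eventually.and ?_ (Filter.eventually_all.2 fun k => ?_)
      · exact continuousAt_const.eventually_lt c1.matrix_det.continuousAt (by simpa using Cd r0)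
      · have h1 : ContinuousAt (fun q : (ℝ × ℝ) × ℝ => gk k (C q.1.1 + q.2 • (C q.1.2 - C q.1.1))
            (X q.1.1 + q.2 • (X q.1.2 - X q.1.1))) ((r0, r0), θ) :=
          ContinuousAt.comp (g := fun q : Matrix (Fin d) (Fin d) ℝ × Vec d => gk k q.1 q.2)
            (f := fun q : (ℝ × ℝ) × ℝ => (C q.1.1 + q.2 • (C q.1.2 - C q.1.1),
              X q.1.1 + q.2 • (X q.1.2 - X q.1.1)))
            (continuousAt_gk (by simpa using Cd r0) k) (c1.prodMk c2).continuousAt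
        exact (h1.sub continuousAt_const).abs.eventually_lt continuousAt_const (by simpa [hg] using he0)
    have ev2 : ∀ᶠ ρ in nhds r0, ∀ k, |g k ρ - g k r0| < e := Filter.eventually_all.2 fun k =>
      ((gc k).sub continuous_const).abs.continuousAt.eventually_lt continuousAt_const
        (by simpa [hg] using he0)
    obtain ⟨δ1, hδ1, hb1⟩ := Metric.eventually_nhds_iff.1 ev1
    obtain ⟨δ2, hδ2, hb2⟩ := Metric.eventually_nhds_iff.1 ev2
    refine ⟨min δ1 δ2, lt_min hδ1 hδ2, fun x hx x' hx' hxx h3 h4 => ?_⟩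
    rw [lt_min_iff] at h3 h4
    have hq := hb1 (y := (x, x')) (by simp [Prod.dist_eq, Real.dist_eq, h3.1, h4.1])
    obtain ⟨θ, hθ, hθe⟩ := ga_segment (Cs x) (Cs x') (X x) (X x') fun θ hθ => (hq θ hθ).1
    set γ : Fin d ⊕ Fin d × Fin d → ℝ := fun k =>
      gk k (C x + θ • (C x' - C x)) (X x + θ • (X x' - X x)) with hγ
    have hxu : x ≤ u := hx.2.trans hu
    have hxu' : x' ≤ u := hx'.2.trans hu
    have e1 : ∀ k, Sum.elim (fun i => (X x' - X x) i) (fun q => (C x' - C x) q.1 q.2) k =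
        - ∫ ρ in x..x', S.eta w k ρ := fun k => by
      rcases k with i | ⟨i, j⟩
      · simp only [Sum.elim_inl, ← S.ζ_sub_apply, hX, κe x hxu, κe x' hxu']
        simp
      · simp only [Sum.elim_inr, hC, κe x hxu, κe x' hxu']
        exact S.Cov_sub_apply ε w hxu hxu' i j
    have e2 : F x' - F x = ∑ k, ∫ ρ in x..x', S.eta w k ρ * (g k ρ - γ k) := by
      have a1 := intervalIntegral.integral_interval_sub_left
        (IntervalIntegrable.sum (μ := volume) (a := r) (b := x') Finset.univ
          (f := fun k ρ => S.eta w k ρ * g k ρ) fun k _ => ηgi k _ _)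
        (IntervalIntegrable.sum (μ := volume) (a := r) (b := x) Finset.univ
          (f := fun k ρ => S.eta w k ρ * g k ρ) fun k _ => ηgi k _ _)
      have a2 : F x' - F x = (ga (C x') (X x') - ga (C x) (X x)) +
          ∫ ρ in x..x', ∑ k, S.eta w k ρ * g k ρ := by
        simp only [Finset.sum_apply] at a1
        rw [← a1]
        simp only [hF]; ring
      rw [a2, hθe, intervalIntegral.integral_finsetSum fun k _ => ηgi k _ _,
        ← Finset.sum_add_distrib]
      refine Finset.sum_congr rfl fun k _ => ?_
      rw [e1 k]
      simp only [mul_sub]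
      rw [intervalIntegral.integral_sub (ηgi k _ _) ((ηi k _ _).mul_const _),
        intervalIntegral.integral_mul_const]
      ring
    rw [e2]
    refine (Finset.abs_sum_le_sum_abs _ _).trans ?_
    have hk : ∀ k, |∫ ρ in x..x', S.eta w k ρ * (g k ρ - γ k)| ≤ B * (2 * e) * (x' - x) := fun k => by
      have := intervalIntegral.norm_integral_le_of_norm_le_const (a := x) (b := x')
        (C := B * (2 * e)) (f := fun ρ => S.eta w k ρ * (g k ρ - γ k)) fun ρ hρ => by
          rw [uIoc_of_le hxx] at hρ
          rw [norm_mul, Real.norm_eq_abs, Real.norm_eq_abs]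
          have d1 : |g k ρ - g k r0| < e := by
            refine hb2 ?_ k
            have p1 := abs_lt.1 h3.2
            have p2 := abs_lt.1 h4.2
            rw [Real.dist_eq, abs_lt]
            constructor <;> linarith [hρ.1, hρ.2]
          have d2 : |γ k - g k r0| < e := (hq θ hθ).2 k
          have d3 : |g k ρ - γ k| ≤ 2 * e := by
            have := abs_sub_le (g k ρ) (g k r0) (γ k)
            rw [abs_sub_comm (g k r0)] at this
            linarith
          exact mul_le_mul (hB k ρ) d3 (abs_nonneg _) hB0
      rwa [abs_of_nonneg (sub_nonneg.2 hxx), Real.norm_eq_abs] at this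
    refine (Finset.sum_le_sum fun k _ => hk k).trans ?_
    rw [Finset.sum_const, nsmul_eq_mul, Finset.card_univ, ← hN, ← mul_assoc]
    gcongr
    rw [he, show N * (B * (2 * (δ / (2 * ((N + 1) * (B + 1)))))) =
      δ * ((N * B) / ((N + 1) * (B + 1))) by field_simp]
    refine mul_le_of_le_one_right hδ.le ((div_le_one (by positivity)).2 ?_)
    nlinarith
  simp only [hF, intervalIntegral.integral_same, add_zero] at main
  have e3 : ∫ x in r..r', ∑ k, S.eta w k x * g k x =
      ∫ ρ in r..r', ∑ k, S.eta w k ρ * gk k (S.Cov ε ρ u w) (z - S.ζ ρ w) := by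
    refine intervalIntegral.integral_congr fun ρ hρ => ?_
    rw [uIcc_of_le hr] at hρ
    simp only [hg, hC, hX, κe ρ (hρ.2.trans hu)]
  rw [← e3]
  simp only [hC, hX, κe r (hr.trans hu), κe r' hu] at main
  unfold pt
  linarith

end Setup

/-- Uniform bounds on a Gaussian density and its derivatives when the covariance is bounded
below. -/
lemma exists_gauss_unif (d : ℕ) {M : ℝ} (hM : 1 ≤ M) {ε : ℝ} (hε : 0 < ε) :
    ∃ B ≥ (0 : ℝ), ∀ τ, ε ≤ τ → ∀ C : Matrix (Fin d) (Fin d) ℝ, QB M τ C → ∀ v : Vec d,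
      |ga C v| ≤ B ∧ (∀ i, (1 + ‖v‖) * |ga1 C i v| ≤ B) ∧ ∀ i j, |ga2 C i j v| ≤ B := by
  obtain ⟨K, hK, h⟩ := exists_gauss_bounds d hM (α := 1) ⟨one_pos, le_rfl⟩
  have hK0 : 0 < K := by linarith
  have hs := Real.sqrt_pos.2 hε
  set A : ℝ := K * (√ε ^ d)⁻¹ with hA
  have A0 : 0 < A := by positivity
  refine ⟨A + (√ε)⁻¹ * A + A + ε⁻¹ * A, by positivity, fun τ hτ C hC v => ?_⟩
  have hτ0 : 0 < τ := hε.trans_le hτ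
  have hs' : √ε ≤ √τ := Real.sqrt_le_sqrt hτ
  have s' : 0 < √τ := Real.sqrt_pos.2 hτ0
  obtain ⟨h0, h1, h2, h3, -⟩ := h τ hτ0 C hC v
  have W0 : 0 ≤ Wk d (1 / (4 * M)) τ ‖v‖ := (Wk_pos hτ0 (norm_nonneg v)).le
  have hW : K * Wk d (1 / (4 * M)) τ ‖v‖ ≤ A := by
    rw [hA]
    refine mul_le_mul_of_nonneg_left ?_ hK0.le
    refine (Wk_le_omg (by positivity) hτ0 (norm_nonneg v)).trans ?_
    unfold omg
    calc √τ / (√τ + ‖v‖) ^ (d + 1) ≤ √τ / √τ ^ (d + 1) := by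
          gcongr; linarith [norm_nonneg v]
      _ = (√τ ^ d)⁻¹ := by rw [pow_succ]; field_simp
      _ ≤ _ := by gcongr
  have i1 : (√τ)⁻¹ ≤ (√ε)⁻¹ := by gcongr
  have i2 : τ⁻¹ ≤ ε⁻¹ := by gcongr
  have j1 : 0 < (√ε)⁻¹ * A := by positivity
  have j2 : 0 < ε⁻¹ * A := by positivity
  refine ⟨?_, fun i => ?_, fun i j => ?_⟩
  · rw [abs_of_nonneg (ga_nonneg C v)]; linarith
  · have a1 : K * (√τ)⁻¹ * Wk d (1 / (4 * M)) τ ‖v‖ ≤ (√ε)⁻¹ * A := by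
      rw [mul_comm K, mul_assoc]
      exact mul_le_mul i1 hW (mul_nonneg hK0.le W0) (by positivity)
    linarith [h1 i, h2 i]
  · have a1 : K * τ⁻¹ * Wk d (1 / (4 * M)) τ ‖v‖ ≤ ε⁻¹ * A := by
      rw [mul_comm K, mul_assoc]
      exact mul_le_mul i2 hW (mul_nonneg hK0.le W0) (by positivity)
    linarith [h3 i j]

namespace Setup
variable {d : ℕ} {α M T : ℝ} {S : Setup d α M T}

/-- Dynkin's formula applied to the regularised frozen density. -/
lemma Dynkin.mollified {Ω : Type*} [MeasurableSpace Ω] {P : Measure Ω} {u t : ℝ}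
    {Y : ℝ → Ω → Vec d} (h : S.Dynkin P u t Y) {ε : ℝ} (hε : 0 < ε) {v : ℝ} (huv : u ≤ v)
    (hvt : v ≤ t) (y : Vec d) :
    (∫ ω, ga (ε • (1 : Matrix (Fin d) (Fin d) ℝ)) (Y v ω - y) ∂P) -
      ∫ ω, S.pt ε u (Y u ω) v (S.π v y) ∂P =
      ∫ ρ in u..v, (∫ ω, S.Hk ε ρ (Y ρ ω) v (S.π v y) ∂P) := by
  have := h.fin
  set w := S.π v y with hw
  obtain ⟨B1, hB1, hb1⟩ := exists_gauss_unif d S.hM hε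
  obtain ⟨B2, hB2, hb2⟩ := S.exists_eta_bound w
  obtain ⟨B3, hB3⟩ := S.growth
  set κ : ℝ → ℝ := fun r => max u (min v r) with hκ
  have κc : Continuous κ := by fun_prop
  have κv : ∀ r, κ r ≤ v := fun r => max_le huv (min_le_left _ _)
  have κu : ∀ r, u ≤ κ r := fun r => le_max_left _ _
  have κe : ∀ r, u ≤ r → r ≤ v → κ r = r := fun r h1 h2 => by
    simp only [hκ, min_eq_right h2, max_eq_right h1]
  have Q : ∀ r, QB M (v - κ r + ε) (S.Cov ε (κ r) v w) := fun r => S.Cov_qb hε.le (κv r) w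
  have Qd : ∀ r, 0 < (S.Cov ε (κ r) v w).det := fun r => S.Cov_det_pos hε.le (κv r)
    (by linarith [κv r]) w
  have ζc := (S.ζ_time_continuous w).comp κc
  obtain ⟨Z, hZ⟩ : ∃ Z, ∀ r, ‖S.ζ (κ r) w‖ ≤ Z := by
    obtain ⟨Z, hZ⟩ := (isCompact_Icc (a := u) (b := v)).exists_bound_of_continuousOn
      (S.ζ_time_continuous w).continuousOn
    exact ⟨Z, fun r => hZ _ ⟨κu r, κv r⟩⟩
  have Z0 : 0 ≤ Z := (norm_nonneg _).trans (hZ 0)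
  have bb := fun r z => hb1 (v - κ r + ε) (by linarith [κv r]) _ (Q r) (z - S.ζ (κ r) w)
  have b1' : ∀ r z i, (1 + ‖z‖) * |ga1 (S.Cov ε (κ r) v w) i (z - S.ζ (κ r) w)| ≤ (1 + Z) * B1 := by
    intro r z i
    have a1 : ‖z‖ ≤ ‖z - S.ζ (κ r) w‖ + Z := by
      have := norm_add_le (z - S.ζ (κ r) w) (S.ζ (κ r) w)
      rw [sub_add_cancel] at this
      linarith [hZ r]
    have a2 : 1 + ‖z‖ ≤ (1 + Z) * (1 + ‖z - S.ζ (κ r) w‖) := by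
      nlinarith [norm_nonneg (z - S.ζ (κ r) w)]
    refine (mul_le_mul_of_nonneg_right a2 (abs_nonneg _)).trans ?_
    rw [mul_assoc]
    exact mul_le_mul_of_nonneg_left ((bb r z).2.1 i) (by positivity)
  set B := (1 + Z) * B1 + B2 + |B3| + M with hBd
  have hM := S.M_pos
  have B1B : B1 ≤ (1 + Z) * B1 := by nlinarith
  have c0 : 0 ≤ (1 + Z) * B1 := by positivity
  have hB : 0 ≤ B := by positivity
  have key := dynkin_time_dependent (P := P) (Y := Y) h.meas h.cont huv (B := B) hB
    (G0 := fun r z => S.pt ε (κ r) z v w)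
    (G := fun k r z => gk k (S.Cov ε (κ r) v w) (z - S.ζ (κ r) w))
    (W := fun k z => Sum.elim (fun _ => 1 + ‖z‖) (fun _ => 1) k)
    (β := S.bet) (η := S.eta w)
    (fun r => S.pt_measurable measurable_const measurable_const measurable_id measurable_const
      measurable_const)
    (fun r z => ((bb r z).1.trans B1B).trans (by rw [hBd]; linarith [abs_nonneg B3]))
    (fun k => continuous_iff_continuousAt.2 fun q =>
      ContinuousAt.comp (g := fun q : Matrix (Fin d) (Fin d) ℝ × Vec d => gk k q.1 q.2)
      (f := fun q : ℝ × Vec d => (S.Cov ε (κ q.1) v w, q.2 - S.ζ (κ q.1) w))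
      (continuousAt_gk (q := (S.Cov ε (κ q.1) v w, q.2 - S.ζ (κ q.1) w)) (Qd _) k)
      (((S.Cov_continuous ε w κc κv).comp continuous_fst).prodMk
        (continuous_snd.sub (ζc.comp continuous_fst))).continuousAt)
    (fun k => by rcases k with i | q <;> simp only [Sum.elim_inl, Sum.elim_inr] <;> fun_prop)
    (fun k z => by rcases k with i | q <;> simp)
    (fun k r z => by
      rcases k with i | ⟨i, j⟩
      · exact (b1' r z i).trans (by rw [hBd]; linarith [abs_nonneg B3])
      · have := (bb r z).2.2 i j
        simp only [gk, Sum.elim_inr, abs_mul, one_mul]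
        rw [abs_of_pos (by norm_num : (0 : ℝ) < 1 / 2)]
        linarith [abs_nonneg B3, abs_nonneg (ga2 (S.Cov ε (κ r) v w) i j (z - S.ζ (κ r) w))])
    S.bet_measurable
    (fun k r z => by
      rcases k with i | ⟨i, j⟩
      · refine (abs_coord_le _ i).trans ((hB3 r z).trans ?_)
        refine mul_le_mul_of_nonneg_right ?_ (by positivity)
        rw [hBd]; linarith [le_abs_self B3]
      · refine (S.a_bdd _ _ _ _).trans ?_
        simp only [Sum.elim_inr, mul_one]
        rw [hBd]; linarith [abs_nonneg B3])
    (S.eta_measurable w)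
    (fun k r => (hb2 k r).trans (by rw [hBd]; linarith [abs_nonneg B3]))
    (fun r r' h1 h2 h3 => by
      have hf : ContDiff ℝ (⊤ : ℕ∞) fun z => ga (S.Cov ε (κ r') v w) (z - S.ζ (κ r') w) :=
        (contDiff_ga _).comp (contDiff_id.sub contDiff_const)
      have e := h.extend hf (B := (1 + Z) * B1) (fun z => (bb r' z).1.trans B1B)
        (fun z i => by rw [pd_ga (Qd r') (Q r').symm]; exact b1' r' z i)
        (fun z i j => by
          rw [pd_ga (Qd r') (Q r').symm, pd_ga1 (Qd r') (Q r').symm]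
          exact ((bb r' z).2.2 j i).trans B1B) h1 h2 (h3.trans hvt)
      simp only [S.gen_ga (Qd r') (Q r').symm] at e
      exact e)
    (fun z r r' h1 h2 h3 => by
      have e := S.pt_backward hε w z h2 h3
      simp only [κe r h1 (h2.trans h3), κe r' (h1.trans h2) h3]
      rw [e]
      congr 1
      refine intervalIntegral.integral_congr fun ρ hρ => ?_
      rw [uIcc_of_le h2] at hρ
      simp only [κe ρ (h1.trans hρ.1) (hρ.2.trans h3)])
  simp only [κe v huv le_rfl, κe u le_rfl huv] at key
  have e1 : ∀ z, S.pt ε v z v w = ga (ε • (1 : Matrix (Fin d) (Fin d) ℝ)) (z - y) := fun z => by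
    unfold pt
    rw [hw, S.ζπ]
    congr 1
    ext i j
    simp [Cov_apply]
  simp only [e1] at key
  rw [key]
  refine intervalIntegral.integral_congr fun ρ hρ => ?_
  rw [uIcc_of_le huv] at hρ
  simp only [κe ρ hρ.1 hρ.2, Hk_eq_sum]

end Setup

lemma integral_mul_swap_of_bdd {X E : Type*} [MeasurableSpace X] [MeasurableSpace E]
    {ν : Measure X} [IsFiniteMeasure ν] {μ : Measure E} [SFinite μ] {f : X → E → ℝ}
    (hf : Measurable fun q : X × E => f q.1 q.2) {B : ℝ} (hB : ∀ᵐ x ∂ν, ∀ y, |f x y| ≤ B)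
    {φ : E → ℝ} (hφ : Integrable φ μ) :
    ∫ y, (∫ x, f x y ∂ν) * φ y ∂μ = ∫ x, (∫ y, f x y * φ y ∂μ) ∂ν := by
  have hi : Integrable (fun q : E × X => f q.2 q.1 * φ q.1) (μ.prod ν) := by
    have h1 : Integrable (fun q : E × X => φ q.1) (μ.prod ν) := hφ.comp_fst ν
    refine h1.bdd_mul (c := B) (hf.comp measurable_swap).aestronglyMeasurable ?_
    filter_upwards [(Measure.quasiMeasurePreserving_snd (μ := μ) (ν := ν)).ae hB] with q hq
    exact hq q.1
  simp only [← integral_mul_const]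
  exact integral_integral_swap hi

namespace Setup
variable {d : ℕ} {α M T : ℝ} (S : Setup d α M T)

lemma Cov_continuous_eps (S : Setup d α M T) (r u : ℝ) (w : Vec d) :
    Continuous fun ε => S.Cov ε r u w := by
  unfold Cov; fun_prop

lemma pt_continuousAt_eps (S : Setup d α M T) {r u : ℝ} (hr : r < u) (z w : Vec d) :
    ContinuousAt (fun ε => S.pt ε r z u w) 0 :=
  ContinuousAt.comp (g := fun q : Matrix (Fin d) (Fin d) ℝ × Vec d => ga q.1 q.2)
    (f := fun ε => (S.Cov ε r u w, z - S.ζ r w))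
    (continuousAt_ga (S.Cov_det_pos le_rfl hr.le (by linarith) w))
    ((S.Cov_continuous_eps r u w).prodMk continuous_const).continuousAt

lemma Hk_continuousAt_eps (S : Setup d α M T) {r u : ℝ} (hr : r < u) (z w : Vec d) :
    ContinuousAt (fun ε => S.Hk ε r z u w) 0 := by
  simp only [Hk_eq_sum]
  refine tendsto_finsetSum _ fun k _ => Filter.Tendsto.const_mul _ ?_
  exact ContinuousAt.comp (g := fun q : Matrix (Fin d) (Fin d) ℝ × Vec d => gk k q.1 q.2)
    (f := fun ε => (S.Cov ε r u w, z - S.ζ r w))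
    (continuousAt_gk (q := (S.Cov 0 r u w, z - S.ζ r w))
      (S.Cov_det_pos le_rfl hr.le (by linarith) w) k)
    ((S.Cov_continuous_eps r u w).prodMk continuous_const).continuousAt

lemma exists_Hk_unif (S : Setup d α M T) {η : ℝ} (hη : 0 < η) : ∃ B ≥ (0 : ℝ), ∀ ε r u : ℝ, 0 ≤ ε →
    r ≤ u → η ≤ u - r + ε → u - r + ε ≤ T → ∀ z w : Vec d, |S.Hk ε r z u w| ≤ B := by
  obtain ⟨K, hK, h⟩ := exists_Hk_bound d (T := T) S.hα S.hM
  have hs := Real.sqrt_pos.2 hη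
  have hM := S.M_pos
  refine ⟨K * η ^ (α / 2 - 1) * (√η ^ d)⁻¹, by positivity, fun ε r u h1 h2 h3 h4 z w => ?_⟩
  have hτ : 0 < u - r + ε := by linarith
  have s' := Real.sqrt_pos.2 hτ
  have ss := Real.sqrt_le_sqrt h3
  refine (h S ε r u h1 h2 hτ h4 z w).2.trans ?_
  have e1 : (u - r + ε) ^ (α / 2 - 1) ≤ η ^ (α / 2 - 1) :=
    Real.rpow_le_rpow_of_nonpos hη h3 (by linarith [S.hα.2])
  have e2 : Wk d (1 / (8 * M)) (u - r + ε) ‖z - S.ζ r w‖ ≤ (√η ^ d)⁻¹ := by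
    refine (Wk_le_omg (by positivity) hτ (norm_nonneg _)).trans ?_
    unfold omg
    calc √(u - r + ε) / (√(u - r + ε) + ‖z - S.ζ r w‖) ^ (d + 1)
        ≤ √(u - r + ε) / √(u - r + ε) ^ (d + 1) := by
          gcongr; linarith [norm_nonneg (z - S.ζ r w)]
      _ = (√(u - r + ε) ^ d)⁻¹ := by rw [pow_succ]; field_simp
      _ ≤ _ := by gcongr
  exact mul_le_mul (mul_le_mul_of_nonneg_left e1 (by linarith)) e2 (Wk_pos hτ (norm_nonneg _)).le
    (by positivity)

lemma exists_lintegral_Hk (S : Setup d α M T) : ∃ C ≥ (0 : ℝ), ∀ ε r u : ℝ, 0 ≤ ε → r < u →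
    u - r + ε ≤ T → ∀ z : Vec d,
    ∫⁻ y, ‖S.Hk ε r z u (S.π u y)‖ₑ ≤ ENNReal.ofReal (C * (u - r) ^ (α / 2 - 1)) := by
  obtain ⟨K, hK, h⟩ := exists_Hk_bound d (T := T) S.hα S.hM
  obtain ⟨C, hC, hc⟩ := exists_lintegral_omg d S.hM
  have hM := S.M_pos
  refine ⟨K * M ^ (d + 1) * C, by positivity, fun ε r u hε hr ht z => ?_⟩
  have hτ : 0 < u - r + ε := by linarith
  have hp : 0 < (u - r) ^ (α / 2 - 1) := Real.rpow_pos_of_pos (by linarith) _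
  calc _ ≤ ∫⁻ y, ENNReal.ofReal (K * (u - r) ^ (α / 2 - 1) * M ^ (d + 1)) *
        ENNReal.ofReal (omg d (u - r + ε) (S.Dm (u, y) (r, z))) := by
        refine lintegral_mono fun y => ?_
        rw [← ENNReal.ofReal_mul (by positivity), ← ofReal_norm, Real.norm_eq_abs]
        refine ENNReal.ofReal_le_ofReal ((h S ε r u hε hr.le hτ ht z _).2.trans ?_)
        have e1 : (u - r + ε) ^ (α / 2 - 1) ≤ (u - r) ^ (α / 2 - 1) :=
          Real.rpow_le_rpow_of_nonpos (by linarith) (by linarith) (by linarith [S.hα.2])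
        have e2 := (Wk_le_omg (d := d) (l := 1 / (8 * M)) (by positivity) hτ
          (norm_nonneg (z - S.ζ r (S.π u y)))).trans
          (omg_scale S.hM hτ (norm_nonneg _) (S.Dm_nonneg (r, z) (u, y)) (S.Dm_le (r, z) (u, y)))
        rw [S.Dm_comm (u, y), mul_assoc (K * (u - r) ^ (α / 2 - 1))]
        exact mul_le_mul (mul_le_mul_of_nonneg_left e1 (by linarith)) e2
          (Wk_pos hτ (norm_nonneg _)).le (by positivity)
    _ ≤ _ := by
        rw [lintegral_const_mul' _ _ ENNReal.ofReal_ne_top]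
        refine (mul_le_mul' le_rfl (hc S _ hτ u (r, z))).trans ?_
        rw [← ENNReal.ofReal_mul (by positivity)]
        refine ENNReal.ofReal_le_ofReal (le_of_eq ?_)
        ring

variable {S}

/-- The regularised Duhamel identity tested against an integrable function. -/
lemma Dynkin.mollified_test {Ω : Type*} [MeasurableSpace Ω] {P : Measure Ω} {u t : ℝ}
    {Y : ℝ → Ω → Vec d} (h : S.Dynkin P u t Y) {ε : ℝ} (hε : 0 < ε) {v : ℝ} (huv : u ≤ v)
    (hvt : v ≤ t) (hT : v - u + ε ≤ T) {φ : Vec d → ℝ} (hφ : Integrable φ) :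
    (∫ ω, (∫ y, ga (ε • (1 : Matrix (Fin d) (Fin d) ℝ)) (Y v ω - y) * φ y) ∂P) -
      ∫ ω, (∫ y, S.pt ε u (Y u ω) v (S.π v y) * φ y) ∂P =
      ∫ q, (∫ y, S.Hk ε q.1 (Y q.1 q.2) v (S.π v y) * φ y)
        ∂((volume.restrict (Ioo u v)).prod P) := by
  have := h.fin
  obtain ⟨B1, hB1, hb1⟩ := exists_gauss_unif d S.hM hε
  obtain ⟨B2, hB2, hb2⟩ := S.exists_Hk_unif hε
  have Ym : ∀ r, Measurable (Y r) := fun r => h.meas.comp (measurable_const.prodMk measurable_id)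
  have πm : Measurable (S.π v) := S.π_meas.comp (measurable_const.prodMk measurable_id)
  have g1 : ∀ z y, |S.pt ε v z v (S.π v y)| ≤ B1 := fun z y =>
    (hb1 _ (by linarith) _ (S.Cov_qb hε.le le_rfl _) _).1
  have m0 : ∀ r, Measurable fun q : Ω × Vec d => S.pt ε r (Y r q.1) v (S.π v q.2) := fun r =>
    S.pt_measurable measurable_const measurable_const ((Ym r).comp measurable_fst)
      measurable_const (πm.comp measurable_snd)
  have e1 : ∀ z y, ga (ε • (1 : Matrix (Fin d) (Fin d) ℝ)) (z - y) = S.pt ε v z v (S.π v y) := by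
    intro z y
    unfold pt
    rw [S.ζπ]
    congr 1
    ext i j
    simp [Cov_apply]
  have key := fun y => h.mollified hε huv hvt y
  simp only [e1] at key ⊢
  rw [← integral_mul_swap_of_bdd (f := fun ω y => S.pt ε v (Y v ω) v (S.π v y)) (m0 v) (Filter.Eventually.of_forall fun ω y => g1 _ y) hφ,
    ← integral_mul_swap_of_bdd (f := fun ω y => S.pt ε u (Y u ω) v (S.π v y)) (m0 u) (B := B1) (Filter.Eventually.of_forall fun ω y =>
      (hb1 _ (by linarith) _ (S.Cov_qb hε.le huv _) _).1) hφ]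
  have m3 : Measurable fun q : (ℝ × Ω) × Vec d =>
      S.Hk ε q.1.1 (Y q.1.1 q.1.2) v (S.π v q.2) :=
    S.Hk_measurable measurable_const (measurable_fst.comp measurable_fst)
      (h.meas.comp measurable_fst) measurable_const (πm.comp measurable_snd)
  have hae : ∀ᵐ q ∂((volume.restrict (Ioo u v)).prod P), q.1 ∈ Ioo u v :=
    Measure.quasiMeasurePreserving_fst.ae (ae_restrict_mem measurableSet_Ioo)
  have b3 : ∀ᵐ q ∂((volume.restrict (Ioo u v)).prod P), ∀ y,
      |S.Hk ε q.1 (Y q.1 q.2) v (S.π v y)| ≤ B2 := by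
    filter_upwards [hae] with q hq y
    exact hb2 _ _ _ hε.le hq.2.le (by linarith [hq.2]) (by linarith [hq.1]) _ _
  rw [← integral_mul_swap_of_bdd (f := fun q : ℝ × Ω => fun y =>
    S.Hk ε q.1 (Y q.1 q.2) v (S.π v y)) m3 b3 hφ]
  have e3 : ∀ y, (∫ q, S.Hk ε q.1 (Y q.1 q.2) v (S.π v y) ∂((volume.restrict (Ioo u v)).prod P)) =
      (∫ ω, S.pt ε v (Y v ω) v (S.π v y) ∂P) - ∫ ω, S.pt ε u (Y u ω) v (S.π v y) ∂P := by
    intro y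
    rw [key y, integral_prod, intervalIntegral.integral_of_le huv, integral_Ioc_eq_integral_Ioo]
    refine Integrable.of_bound (C := B2) (m3.comp (measurable_id.prodMk
      measurable_const)).aestronglyMeasurable ?_
    filter_upwards [b3] with q hq using hq y
  simp only [e3, sub_mul]
  have i1 : ∀ r, (∀ z y, |S.pt ε r z v (S.π v y)| ≤ B1) → Integrable fun y =>
      (∫ ω, S.pt ε r (Y r ω) v (S.π v y) ∂P) * φ y := by
    intro r hr
    refine hφ.bdd_mul (c := B1 * P.real univ) ?_ (Filter.Eventually.of_forall fun y => ?_)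
    · exact (StronglyMeasurable.integral_prod_left' (m0 r).stronglyMeasurable).aestronglyMeasurable
    · exact norm_integral_le_of_norm_le_const (Filter.Eventually.of_forall fun ω => hr _ _)
  exact (integral_sub (i1 v g1) (i1 u fun z y =>
    (hb1 _ (by linarith) _ (S.Cov_qb hε.le huv _) _).1)).symm

end Setup

lemma tendsto_integral_ga_smul_one {d : ℕ} {φ : Vec d → ℝ} (hφ : Continuous φ) {B : ℝ}
    (hB : ∀ y, |φ y| ≤ B) (x : Vec d) :
    Filter.Tendsto (fun ε : ℝ => ∫ y, ga (ε • (1 : Matrix (Fin d) (Fin d) ℝ)) (x - y) * φ y)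
      (nhdsWithin 0 (Ioi 0)) (nhds (φ x)) := by
  have e : ∀ᶠ ε : ℝ in nhdsWithin 0 (Ioi 0),
      ∫ w, ga (1 : Matrix (Fin d) (Fin d) ℝ) w * φ (x - √ε • w) =
      ∫ y, ga (ε • (1 : Matrix (Fin d) (Fin d) ℝ)) (x - y) * φ y := by
    filter_upwards [self_mem_nhdsWithin] with ε hε
    exact (integral_ga_smul_one hε x φ).symm
  refine Filter.Tendsto.congr' e ?_
  have e2 : φ x = ∫ w, ga (1 : Matrix (Fin d) (Fin d) ℝ) w * φ x := by
    rw [integral_mul_const, integral_ga_one, one_mul]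
  rw [e2]
  have gc : Continuous (ga (1 : Matrix (Fin d) (Fin d) ℝ)) := (contDiff_ga 1 (n := 0)).continuous
  refine tendsto_integral_filter_of_dominated_convergence
    (fun w => ga (1 : Matrix (Fin d) (Fin d) ℝ) w * B) ?_ ?_ (integrable_ga_one.mul_const B) ?_
  · exact Filter.Eventually.of_forall fun ε => Continuous.aestronglyMeasurable (by fun_prop)
  · refine Filter.Eventually.of_forall fun ε => Filter.Eventually.of_forall fun w => ?_
    rw [norm_mul, Real.norm_eq_abs, Real.norm_eq_abs, abs_of_nonneg (ga_nonneg _ _)]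
    exact mul_le_mul_of_nonneg_left (hB _) (ga_nonneg _ _)
  · refine Filter.Eventually.of_forall fun w => Filter.Tendsto.const_mul _ ?_
    have c : Continuous fun ε : ℝ => φ (x - √ε • w) := by fun_prop
    have := c.tendsto 0
    simp only [Real.sqrt_zero, zero_smul, sub_zero] at this
    exact this.mono_left nhdsWithin_le_nhds

lemma abs_integral_ga_smul_one_le {d : ℕ} {φ : Vec d → ℝ} {B : ℝ} (hB : ∀ y, |φ y| ≤ B) {ε : ℝ}
    (hε : 0 < ε) (x : Vec d) :
    |∫ y, ga (ε • (1 : Matrix (Fin d) (Fin d) ℝ)) (x - y) * φ y| ≤ B := by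
  rw [integral_ga_smul_one hε]
  have h := norm_integral_le_of_norm_le (μ := volume)
    (f := fun w => ga (1 : Matrix (Fin d) (Fin d) ℝ) w * φ (x - √ε • w))
    (integrable_ga_one.mul_const B) (Filter.Eventually.of_forall fun w => by
      rw [norm_mul, Real.norm_eq_abs, Real.norm_eq_abs, abs_of_nonneg (ga_nonneg _ _)]
      exact mul_le_mul_of_nonneg_left (hB _) (ga_nonneg _ _))
  rwa [integral_mul_const, integral_ga_one, one_mul, Real.norm_eq_abs] at h

lemma tendsto_integral_integral_mul {X E : Type*} [MeasurableSpace X] [MeasurableSpace E]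
    {ν : Measure X} {μ : Measure E} [SFinite μ] {l : Filter ℝ} [l.IsCountablyGenerated]
    {f : ℝ → X → E → ℝ} {f0 : X → E → ℝ} {φ : E → ℝ} (hφ : Integrable φ μ)
    (hφm : Measurable φ) (hf : ∀ ε, Measurable fun q : X × E => f ε q.1 q.2) {D : X → ℝ}
    (hD : Integrable D ν)
    (h1 : ∀ᶠ ε in l, ∀ᵐ x ∂ν, ‖∫ y, f ε x y * φ y ∂μ‖ ≤ D x)
    (h2 : ∀ᵐ x ∂ν, ∃ B, ∀ᶠ ε in l, ∀ y, |f ε x y| ≤ B)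
    (h3 : ∀ᵐ x ∂ν, ∀ y, Filter.Tendsto (fun ε => f ε x y) l (nhds (f0 x y))) :
    Filter.Tendsto (fun ε => ∫ x, (∫ y, f ε x y * φ y ∂μ) ∂ν) l
      (nhds (∫ x, (∫ y, f0 x y * φ y ∂μ) ∂ν)) := by
  have hm : ∀ ε, Measurable fun q : X × E => f ε q.1 q.2 * φ q.2 := fun ε =>
    (hf ε).mul (hφm.comp measurable_snd)
  refine tendsto_integral_filter_of_dominated_convergence D
    (Filter.Eventually.of_forall fun ε => (StronglyMeasurable.integral_prod_right'
      (hm ε).stronglyMeasurable).aestronglyMeasurable) h1 hD ?_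
  filter_upwards [h2, h3] with x ⟨B, hB⟩ hx
  refine tendsto_integral_filter_of_dominated_convergence (fun y => B * |φ y|)
    (Filter.Eventually.of_forall fun ε => ?_) ?_ (hφ.abs.const_mul B)
    (Filter.Eventually.of_forall fun y => (hx y).mul_const _)
  · exact ((hm ε).comp measurable_prodMk_left).aestronglyMeasurable
  · filter_upwards [hB] with ε hε
    refine Filter.Eventually.of_forall fun y => ?_
    rw [norm_mul]
    exact mul_le_mul_of_nonneg_right (hε y) (abs_nonneg _)

namespace Setup
variable {d : ℕ} {α M T : ℝ} {S : Setup d α M T}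

/-- The Duhamel identity tested against a continuous compactly supported function. -/
lemma Dynkin.duhamel_cs {Ω : Type*} [MeasurableSpace Ω] {P : Measure Ω} {u t : ℝ}
    {Y : ℝ → Ω → Vec d} (h : S.Dynkin P u t Y) {v : ℝ} (huv : u < v)
    (hvt : v ≤ t) (hT : v - u < T) {φ : Vec d → ℝ} (hφ : Continuous φ) (hφc : HasCompactSupport φ) :
    (∫ ω, φ (Y v ω) ∂P) - ∫ ω, (∫ y, S.pt 0 u (Y u ω) v (S.π v y) * φ y) ∂P =
      ∫ q, (∫ y, S.Hk 0 q.1 (Y q.1 q.2) v (S.π v y) * φ y)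
        ∂((volume.restrict (Ioo u v)).prod P) := by
  have := h.fin
  have φi : Integrable φ := hφ.integrable_of_hasCompactSupport hφc
  obtain ⟨B, hB⟩ := hφ.bounded_above_of_compact_support hφc
  have hB0 : 0 ≤ B := (norm_nonneg _).trans (hB 0)
  have Ym : ∀ r, Measurable (Y r) := fun r => h.meas.comp (measurable_const.prodMk measurable_id)
  have πm : Measurable (S.π v) := S.π_meas.comp (measurable_const.prodMk measurable_id)
  have ev : ∀ᶠ ε : ℝ in nhdsWithin 0 (Ioi 0), 0 < ε ∧ v - u + ε ≤ T := by
    filter_upwards [Ioo_mem_nhdsGT (show (0 : ℝ) < T - (v - u) by linarith)] with ε hε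
    exact ⟨hε.1, by linarith [hε.2]⟩
  have le0 : nhdsWithin (0 : ℝ) (Ioi 0) ≤ nhds 0 := nhdsWithin_le_nhds
  -- the three limits
  have L1 : Filter.Tendsto (fun ε : ℝ => ∫ ω, (∫ y, ga (ε • (1 : Matrix (Fin d) (Fin d) ℝ))
      (Y v ω - y) * φ y) ∂P) (nhdsWithin 0 (Ioi 0)) (nhds (∫ ω, φ (Y v ω) ∂P)) := by
    refine tendsto_integral_filter_of_dominated_convergence (fun _ => B) ?_ ?_
      (integrable_const B) (Filter.Eventually.of_forall fun ω =>
        tendsto_integral_ga_smul_one hφ hB _)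
    · refine Filter.Eventually.of_forall fun ε => ?_
      have m : Measurable fun q : Ω × Vec d =>
          ga (ε • (1 : Matrix (Fin d) (Fin d) ℝ)) (Y v q.1 - q.2) * φ q.2 :=
        ((contDiff_ga _ (n := 0)).continuous.measurable.comp
          (((Ym v).comp measurable_fst).sub measurable_snd)).mul
          (hφ.measurable.comp measurable_snd)
      exact (StronglyMeasurable.integral_prod_right' m.stronglyMeasurable).aestronglyMeasurable
    · filter_upwards [ev] with ε hε
      exact Filter.Eventually.of_forall fun ω => abs_integral_ga_smul_one_le hB hε.1 _
  obtain ⟨B1, hB1, hb1⟩ := exists_gauss_unif d S.hM (ε := v - u) (by linarith)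
  have pb : ∀ ε, 0 ≤ ε → ∀ z w, |S.pt ε u z v w| ≤ B1 := fun ε hε z w =>
    (hb1 _ (by linarith) _ (S.Cov_qb hε huv.le w) _).1
  have mp : ∀ ε, Measurable fun q : Ω × Vec d => S.pt ε u (Y u q.1) v (S.π v q.2) :=
    fun ε => S.pt_measurable measurable_const measurable_const ((Ym u).comp measurable_fst)
      measurable_const (πm.comp measurable_snd)
  have φai : Integrable fun y => |φ y| := φi.abs
  have L2 : Filter.Tendsto (fun ε : ℝ => ∫ ω, (∫ y, S.pt ε u (Y u ω) v (S.π v y) * φ y) ∂P)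
      (nhdsWithin 0 (Ioi 0)) (nhds (∫ ω, (∫ y, S.pt 0 u (Y u ω) v (S.π v y) * φ y) ∂P)) := by
    refine tendsto_integral_integral_mul (f := fun ε ω y => S.pt ε u (Y u ω) v (S.π v y))
      (f0 := fun ω y => S.pt 0 u (Y u ω) v (S.π v y)) φi hφ.measurable mp
      (D := fun _ => ∫ y, B1 * |φ y|) (integrable_const _) ?_ ?_ ?_
    · filter_upwards [ev] with ε hε
      refine Filter.Eventually.of_forall fun ω => norm_integral_le_of_norm_le (φai.const_mul B1)
        (Filter.Eventually.of_forall fun y => ?_)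
      rw [norm_mul]
      exact mul_le_mul_of_nonneg_right (pb ε hε.1.le _ _) (abs_nonneg _)
    · refine Filter.Eventually.of_forall fun ω => ⟨B1, ?_⟩
      filter_upwards [ev] with ε hε y using pb ε hε.1.le _ _
    · exact Filter.Eventually.of_forall fun ω y =>
        (S.pt_continuousAt_eps huv (Y u ω) (S.π v y)).tendsto.mono_left le0
  have mh : ∀ ε, Measurable fun q : (ℝ × Ω) × Vec d =>
      S.Hk ε q.1.1 (Y q.1.1 q.1.2) v (S.π v q.2) := fun ε =>
    S.Hk_measurable measurable_const (measurable_fst.comp measurable_fst)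
      (h.meas.comp measurable_fst) measurable_const (πm.comp measurable_snd)
  have hae : ∀ᵐ q ∂((volume.restrict (Ioo u v)).prod P), q.1 ∈ Ioo u v :=
    Measure.quasiMeasurePreserving_fst.ae (ae_restrict_mem measurableSet_Ioo)
  obtain ⟨C, hC, hc⟩ := S.exists_lintegral_Hk
  have L3 : Filter.Tendsto (fun ε : ℝ => ∫ q, (∫ y, S.Hk ε q.1 (Y q.1 q.2) v (S.π v y) * φ y)
        ∂((volume.restrict (Ioo u v)).prod P)) (nhdsWithin 0 (Ioi 0))
      (nhds (∫ q, (∫ y, S.Hk 0 q.1 (Y q.1 q.2) v (S.π v y) * φ y)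
        ∂((volume.restrict (Ioo u v)).prod P))) := by
    refine tendsto_integral_integral_mul
      (f := fun ε (q : ℝ × Ω) y => S.Hk ε q.1 (Y q.1 q.2) v (S.π v y))
      (f0 := fun (q : ℝ × Ω) y => S.Hk 0 q.1 (Y q.1 q.2) v (S.π v y)) φi hφ.measurable mh
      (D := fun q : ℝ × Ω => B * (C * (v - q.1) ^ (α / 2 - 1))) ?_ ?_ ?_ ?_
    · have i1 : IntegrableOn (fun r => B * (C * (v - r) ^ (α / 2 - 1))) (Ioo u v) := by
        refine Integrable.const_mul (Integrable.const_mul ?_ _) _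
        have hα := S.hα.1
        refine ⟨(by fun_prop : Measurable fun r : ℝ => (v - r) ^ (α / 2 - 1)).aestronglyMeasurable,
          ?_⟩
        rw [hasFiniteIntegral_iff_enorm]
        calc _ = ∫⁻ r in Ioo u v, ENNReal.ofReal ((v - r) ^ (α / 2 - 1)) := by
              refine setLIntegral_congr_fun measurableSet_Ioo fun r hr => ?_
              rw [← ofReal_norm, Real.norm_of_nonneg (Real.rpow_nonneg (by linarith [hr.2]) _)]
          _ < ⊤ := by
              rw [lintegral_rpow_right (by linarith) huv]
              exact ENNReal.ofReal_lt_top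
      exact i1.comp_fst P
    · filter_upwards [ev] with ε hε
      filter_upwards [hae] with q hq
      have hp : 0 ≤ C * (v - q.1) ^ (α / 2 - 1) :=
        mul_nonneg hC (Real.rpow_nonneg (by linarith [hq.2]) _)
      have a1 : ‖∫ y, S.Hk ε q.1 (Y q.1 q.2) v (S.π v y) * φ y‖ₑ ≤
          ENNReal.ofReal (B * (C * (v - q.1) ^ (α / 2 - 1))) := by
        refine (enorm_integral_le_lintegral_enorm _).trans ?_
        calc _ ≤ ∫⁻ y, ENNReal.ofReal B * ‖S.Hk ε q.1 (Y q.1 q.2) v (S.π v y)‖ₑ := by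
              refine lintegral_mono fun y => ?_
              rw [enorm_mul, mul_comm]
              refine mul_le_mul' ?_ le_rfl
              rw [← ofReal_norm]
              exact ENNReal.ofReal_le_ofReal (hB y)
          _ ≤ _ := by
              rw [lintegral_const_mul' _ _ ENNReal.ofReal_ne_top, ENNReal.ofReal_mul hB0]
              exact mul_le_mul' le_rfl (hc ε q.1 v hε.1.le hq.2 (by linarith [hq.1, hε.2]) _)
      rw [← ofReal_norm] at a1
      exact (ENNReal.ofReal_le_ofReal_iff (mul_nonneg hB0 hp)).1 a1
    · filter_upwards [hae] with q hq
      obtain ⟨B2, hB2, hb2⟩ := S.exists_Hk_unif (η := v - q.1) (by linarith [hq.2])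
      refine ⟨B2, ?_⟩
      filter_upwards [ev] with ε hε y
      exact hb2 _ _ _ hε.1.le hq.2.le (by linarith [hε.1]) (by linarith [hε.2, hq.1]) _ _
    · filter_upwards [hae] with q hq y
      exact (S.Hk_continuousAt_eps hq.2 (Y q.1 q.2) (S.π v y)).tendsto.mono_left le0
  refine tendsto_nhds_unique (Filter.Tendsto.congr' ?_ (L1.sub L2)) L3
  filter_upwards [ev] with ε hε
  exact h.mollified_test hε.1 huv.le hvt hε.2 φi

end Setup

lemma integral_kernel_swap {X E : Type*} [MeasurableSpace X] [MeasurableSpace E]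
    {ν : Measure X} [SFinite ν] {μ : Measure E} [SFinite μ] {f : X → E → ℝ}
    (hf : Measurable fun q : X × E => f q.1 q.2) (hfin : ∫⁻ x, (∫⁻ y, ‖f x y‖ₑ ∂μ) ∂ν < ⊤) :
    Integrable (fun y => ∫ x, f x y ∂ν) μ ∧ ∀ φ : E → ℝ, Measurable φ → (∃ B, ∀ y, |φ y| ≤ B) →
      ∫ y, (∫ x, f x y ∂ν) * φ y ∂μ = ∫ x, (∫ y, f x y * φ y ∂μ) ∂ν := by
  have hi : Integrable (fun q : X × E => f q.1 q.2) (ν.prod μ) := by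
    refine ⟨hf.aestronglyMeasurable, ?_⟩
    rw [hasFiniteIntegral_iff_enorm, lintegral_prod _ hf.enorm.aemeasurable]
    exact hfin
  refine ⟨hi.integral_prod_right, fun φ hφ hB => ?_⟩
  obtain ⟨B, hB⟩ := hB
  have hi' : Integrable (fun q : E × X => f q.2 q.1 * φ q.1) (μ.prod ν) := by
    have := hi.swap.mul_bdd (c := B) (g := fun q => φ q.1)
      (hφ.comp measurable_fst).aestronglyMeasurable (Filter.Eventually.of_forall fun q => hB q.1)
    exact this
  simp only [← integral_mul_const]
  exact integral_integral_swap (f := fun y x => f x y * φ y) hi'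

lemma integral_eq_of_compactlySupported {d : ℕ} {ν : Measure (Vec d)} [IsFiniteMeasure ν]
    {q : Vec d → ℝ} (hq : Integrable q)
    (h : ∀ φ : Vec d → ℝ, Continuous φ → HasCompactSupport φ → ∫ y, φ y ∂ν = ∫ y, q y * φ y)
    {φ : Vec d → ℝ} (hφ : Measurable φ) (hB : ∃ B, ∀ y, |φ y| ≤ B) :
    ∫ y, φ y ∂ν = ∫ y, q y * φ y := by
  obtain ⟨B, hB⟩ := hB
  have hqn : Integrable fun y => -q y := hq.neg
  have fin1 : IsFiniteMeasure (volume.withDensity fun y => ENNReal.ofReal (q y)) :=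
    isFiniteMeasure_withDensity_ofReal hq.2
  have fin2 : IsFiniteMeasure (volume.withDensity fun y => ENNReal.ofReal (-q y)) :=
    isFiniteMeasure_withDensity_ofReal hqn.2
  have key : ∀ φ : Vec d → ℝ, Measurable φ → (∃ B, ∀ y, |φ y| ≤ B) →
      (∫ y, φ y ∂(volume.withDensity fun y => ENNReal.ofReal (q y))) =
      (∫ y, φ y ∂(volume.withDensity fun y => ENNReal.ofReal (-q y))) + ∫ y, q y * φ y := by
    intro φ hφ ⟨B, hB⟩
    have hi : ∀ {r : Vec d → ℝ}, Integrable r → Integrable fun y => (ENNReal.ofReal (r y)).toReal * φ y :=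
      fun hr => (hr.pos_part.congr (Filter.Eventually.of_forall fun y => by
          simp [ENNReal.toReal_ofReal'])).mul_bdd (c := B)
        hφ.aestronglyMeasurable (Filter.Eventually.of_forall hB)
    rw [integral_withDensity_eq_integral_toReal_smul₀ hq.1.aemeasurable.ennreal_ofReal (by simp),
      integral_withDensity_eq_integral_toReal_smul₀ hqn.1.aemeasurable.ennreal_ofReal (by simp)]
    simp only [smul_eq_mul]
    rw [← integral_add (hi hqn) (hq.mul_bdd (c := B)
        hφ.aestronglyMeasurable (Filter.Eventually.of_forall hB))]
    congr 1 with y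
    simp only [ENNReal.toReal_ofReal']
    rcases le_total 0 (q y) with h0 | h0
    · rw [max_eq_left h0, max_eq_right (by linarith)]; ring
    · rw [max_eq_right h0, max_eq_left (by linarith)]; ring
  have bi : ∀ (m : Measure (Vec d)) [IsFiniteMeasure m], ∀ φ : Vec d → ℝ, Measurable φ →
      (∃ B, ∀ y, |φ y| ≤ B) → Integrable φ m := fun m _ φ hφ ⟨B, hB⟩ =>
    Integrable.of_bound hφ.aestronglyMeasurable B (Filter.Eventually.of_forall hB)
  have e : ν + (volume.withDensity fun y => ENNReal.ofReal (-q y)) =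
      volume.withDensity fun y => ENNReal.ofReal (q y) := by
    refine Measure.ext_of_integral_eq_on_compactlySupported fun f => ?_
    change ∫ x, f.toContinuousMap x ∂_ = ∫ x, f.toContinuousMap x ∂_
    have fb := f.continuous.bounded_above_of_compact_support f.hasCompactSupport
    have fm := f.continuous.measurable
    rw [integral_add_measure (bi _ _ fm fb) (bi _ _ fm fb), key _ fm fb,
      h _ f.continuous f.hasCompactSupport, add_comm]
  have k := key φ hφ ⟨B, hB⟩
  rw [← e, integral_add_measure (bi _ _ hφ ⟨B, hB⟩) (bi _ _ hφ ⟨B, hB⟩)] at k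
  linarith

namespace Setup
variable {d : ℕ} {α M T : ℝ} {S : Setup d α M T}

lemma Dynkin.duh {Ω : Type*} [MeasurableSpace Ω] {P : Measure Ω} {u t : ℝ}
    {Y : ℝ → Ω → Vec d} (h : S.Dynkin P u t Y) (su : S.s0 ≤ u) (ut : u < t)
    (tT : t ≤ S.s0 + T) (hT : t - u < T) : S.Duh P u t Y := by
  have hfin := h.fin
  refine ⟨h.fin, h.meas, su, ut, tT, ?_⟩
  intro v hv φ hφ hB
  have Ym : ∀ r, Measurable (Y r) := fun r => h.meas.comp (measurable_const.prodMk measurable_id)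
  obtain ⟨K, hK, hb⟩ := exists_kernel_bounds d T S.hα S.hM
  obtain ⟨C, hC, hc⟩ := exists_lintegral_kk d S.hM
  have hα := S.hα.1
  have b1 : ∀ e : ℝ × Vec d, ∫⁻ y, ‖S.pk e (v, y)‖ₑ ≤ ENNReal.ofReal K * ENNReal.ofReal C := by
    intro e
    calc _ ≤ ∫⁻ y, ENNReal.ofReal K * S.kk 1 e (v, y) := lintegral_mono fun y => (hb S _ _).1
      _ ≤ _ := by
        rw [lintegral_const_mul' _ _ ENNReal.ofReal_ne_top]
        refine mul_le_mul' le_rfl ((hc S _ _ _).trans ?_)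
        rw [sub_self, Real.rpow_zero, mul_one]
  have b2 : ∀ e : ℝ × Vec d, ∫⁻ y, ‖S.hk e (v, y)‖ₑ ≤
      ENNReal.ofReal K * (ENNReal.ofReal C * ENNReal.ofReal ((v - e.1) ^ (α / 2 - 1))) := by
    intro e
    calc _ ≤ ∫⁻ y, ENNReal.ofReal K * S.kk (α / 2) e (v, y) := lintegral_mono fun y => (hb S _ _).2
      _ ≤ _ := by
        rw [lintegral_const_mul' _ _ ENNReal.ofReal_ne_top, ← ENNReal.ofReal_mul hC.le]
        exact mul_le_mul' le_rfl (hc S _ _ _)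
  have f1 : ∫⁻ ω, (∫⁻ y, ‖S.pk (u, Y u ω) (v, y)‖ₑ) ∂P < ⊤ := by
    refine (lintegral_mono fun ω => b1 _).trans_lt ?_
    rw [lintegral_const]
    exact ENNReal.mul_lt_top (ENNReal.mul_lt_top ENNReal.ofReal_lt_top ENNReal.ofReal_lt_top)
      (measure_lt_top _ _)
  have f2 : ∫⁻ q, (∫⁻ y, ‖S.hk (q.1, Y q.1 q.2) (v, y)‖ₑ)
      ∂((volume.restrict (Ioo u v)).prod P) < ⊤ := by
    refine (lintegral_mono fun q => b2 _).trans_lt ?_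
    simp only
    have m1 : Measurable fun q : ℝ × Ω => ENNReal.ofReal ((v - q.1) ^ (α / 2 - 1)) := by fun_prop
    rw [lintegral_const_mul' _ _ ENNReal.ofReal_ne_top,
      lintegral_const_mul' _ _ ENNReal.ofReal_ne_top, lintegral_prod _ m1.aemeasurable]
    simp only [lintegral_const]
    rw [lintegral_mul_const' _ _ (measure_ne_top _ _), lintegral_rpow_right (by linarith) hv.1]
    exact ENNReal.mul_lt_top ENNReal.ofReal_lt_top (ENNReal.mul_lt_top ENNReal.ofReal_lt_top
      (ENNReal.mul_lt_top ENNReal.ofReal_lt_top (measure_lt_top _ _)))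
  obtain ⟨i1, s1⟩ := integral_kernel_swap (f := fun ω y => S.pk (u, Y u ω) (v, y))
    (S.pk_measurable (measurable_const.prodMk ((Ym u).comp measurable_fst))
      (measurable_const.prodMk measurable_snd)) f1
  obtain ⟨i2, s2⟩ := integral_kernel_swap
    (f := fun (q : ℝ × Ω) y => S.hk (q.1, Y q.1 q.2) (v, y))
    (S.hk_measurable ((measurable_fst.comp measurable_fst).prodMk (h.meas.comp measurable_fst))
      (measurable_const.prodMk measurable_snd)) f2
  have restr : ∀ φ : Vec d → ℝ,
      ∫ q, (∫ y, S.hk (q.1, Y q.1 q.2) (v, y) * φ y) ∂((volume.restrict (Ioo u t)).prod P) =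
      ∫ q, (∫ y, S.hk (q.1, Y q.1 q.2) (v, y) * φ y) ∂((volume.restrict (Ioo u v)).prod P) := by
    intro φ
    have e : ∀ w : ℝ, (volume.restrict (Ioo u w)).prod P =
        ((volume : Measure ℝ).prod P).restrict (Ioo u w ×ˢ univ) := by
      intro w
      rw [← Measure.prod_restrict, Measure.restrict_univ]
    rw [e, e]
    refine setIntegral_eq_of_subset_of_forall_sdiff_eq_zero
      (measurableSet_Ioo.prod MeasurableSet.univ)
      (prod_mono (Ioo_subset_Ioo_right hv.2) le_rfl) ?_
    rintro q ⟨h1, h2⟩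
    have hq : v ≤ q.1 := by
      by_contra hlt
      exact h2 ⟨⟨h1.1.1, not_le.1 hlt⟩, mem_univ _⟩
    have : ∀ y, ¬ S.Ok (q.1, Y q.1 q.2) (v, y) := fun y hy => absurd hy.2.1 (not_lt.2 hq)
    simp [hk, this]
  rw [restr φ]
  have main := integral_eq_of_compactlySupported (ν := P.map (Y v)) (i1.add i2) ?_ hφ hB
  · rw [integral_map (Ym v).aemeasurable hφ.aestronglyMeasurable] at main
    rw [main, ← s1 φ hφ hB, ← s2 φ hφ hB]
    simp only [Pi.add_apply, add_mul]
    obtain ⟨B, hB⟩ := hB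
    exact integral_add
      (i1.mul_bdd (c := B) hφ.aestronglyMeasurable (Filter.Eventually.of_forall hB))
      (i2.mul_bdd (c := B) hφ.aestronglyMeasurable (Filter.Eventually.of_forall hB))
  · intro ψ hψ hψc
    have hψb := hψ.bounded_above_of_compact_support hψc
    have hd := h.duhamel_cs hv.1 hv.2 (by linarith [hv.2]) hψ hψc
    rw [integral_map (Ym v).aemeasurable hψ.aestronglyMeasurable]
    simp only [Pi.add_apply, add_mul]
    obtain ⟨B, hB⟩ := id hψb
    rw [integral_add
      (i1.mul_bdd (c := B) hψ.aestronglyMeasurable (Filter.Eventually.of_forall hB))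
      (i2.mul_bdd (c := B) hψ.aestronglyMeasurable (Filter.Eventually.of_forall hB)),
      s1 ψ hψ.measurable hψb, s2 ψ hψ.measurable hψb]
    have hae : ∀ᵐ q ∂((volume.restrict (Ioo u v)).prod P), q.1 ∈ Ioo u v :=
      Measure.quasiMeasurePreserving_fst.ae (ae_restrict_mem measurableSet_Ioo)
    have e1 : ∀ ω y, S.pk (u, Y u ω) (v, y) = S.pt 0 u (Y u ω) v (S.π v y) := fun ω y =>
      if_pos ⟨su, hv.1, hv.2.trans tT⟩
    have e2 : ∫ q, (∫ y, S.hk (q.1, Y q.1 q.2) (v, y) * ψ y) ∂((volume.restrict (Ioo u v)).prod P)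
        = ∫ q, (∫ y, S.Hk 0 q.1 (Y q.1 q.2) v (S.π v y) * ψ y)
          ∂((volume.restrict (Ioo u v)).prod P) := by
      refine integral_congr_ae ?_
      filter_upwards [hae] with q hq
      have : ∀ y, S.hk (q.1, Y q.1 q.2) (v, y) = S.Hk 0 q.1 (Y q.1 q.2) v (S.π v y) := fun y =>
        if_pos ⟨su.trans hq.1.le, hq.2, hv.2.trans tT⟩
      simp only [this]
    rw [e2]
    simp only [e1]
    linarith

end Setup

lemma gronwall_integral {u : ℝ → ℝ} {a K L : ℝ} (hK : 0 < K) (ha : 0 ≤ a)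
    (hu : ContinuousOn u (Icc 0 L))
    (h : ∀ τ ∈ Icc 0 L, u τ ≤ a + K * ∫ r in 0..τ, u r) :
    ∀ τ ∈ Icc 0 L, u τ ≤ 2 * a * Real.exp (2 * K * τ) := by
  intro τ hτ
  have hc : ContinuousOn (fun r => u r * Real.exp (-(2 * K * r))) (Icc 0 L) :=
    hu.mul (by fun_prop)
  obtain ⟨τ0, h0, hmax⟩ := isCompact_Icc.exists_isMaxOn ⟨τ, hτ⟩ hc
  set W := u τ0 * Real.exp (-(2 * K * τ0)) with hW
  have hle : ∀ r ∈ Icc 0 L, u r ≤ W * Real.exp (2 * K * r) := by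
    intro r hr
    have h1 : u r * Real.exp (-(2 * K * r)) ≤ W := hmax hr
    have h2 := mul_le_mul_of_nonneg_right h1 (Real.exp_pos (2 * K * r)).le
    rwa [mul_assoc, ← Real.exp_add, neg_add_cancel, Real.exp_zero, mul_one] at h2
  have sub : uIcc 0 τ0 ⊆ Icc 0 L := by
    rw [uIcc_of_le h0.1]
    exact Icc_subset_Icc le_rfl h0.2
  have i1 : ∫ r in 0..τ0, u r ≤ ∫ r in 0..τ0, W * Real.exp (2 * K * r) := by
    refine intervalIntegral.integral_mono_on h0.1 (hu.mono sub).intervalIntegrable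
      (Continuous.intervalIntegrable (by fun_prop) _ _) fun r hr => hle r ?_
    exact ⟨hr.1, hr.2.trans h0.2⟩
  have i2 : ∫ r in 0..τ0, W * Real.exp (2 * K * r) =
      W * ((Real.exp (2 * K * τ0) - 1) / (2 * K)) := by
    rw [intervalIntegral.integral_const_mul,
      intervalIntegral.integral_comp_mul_left Real.exp (by positivity), integral_exp, mul_zero,
      Real.exp_zero, smul_eq_mul]
    ring
  have e := Real.exp_pos (2 * K * τ0)
  have e1 : 1 ≤ Real.exp (2 * K * τ0) := Real.one_le_exp (by have := h0.1; positivity)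
  have hu0 : u τ0 = W * Real.exp (2 * K * τ0) := by
    rw [hW, mul_assoc, ← Real.exp_add, neg_add_cancel, Real.exp_zero, mul_one]
  have hWa : W ≤ 2 * a := by
    have h3 := h τ0 h0
    rw [hu0] at h3
    have h4 : K * ∫ r in 0..τ0, u r ≤ W * (Real.exp (2 * K * τ0) - 1) / 2 := by
      refine (mul_le_mul_of_nonneg_left (i1.trans_eq i2) hK.le).trans_eq ?_
      field_simp
    by_contra hn
    rw [not_le] at hn
    nlinarith
  exact (hle τ hτ).trans (mul_le_mul_of_nonneg_right hWa (Real.exp_pos _).le)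

/-- A measurable vector field on `[0, L]`, bounded at the origin and Lipschitz in space. -/
structure LipField (d : ℕ) (K L B : ℝ) (F : ℝ → Vec d → Vec d) : Prop where
  meas : Measurable fun p : ℝ × Vec d => F p.1 p.2
  lip : ∀ r ∈ Icc 0 L, ∀ z z', ‖F r z - F r z'‖ ≤ K * ‖z - z'‖
  bdd : ∀ r ∈ Icc 0 L, ‖F r 0‖ ≤ B

/-- Integral curves of a vector field on `[0, L]`. -/
def IsCurve {d : ℕ} (L : ℝ) (F : ℝ → Vec d → Vec d) (x : Vec d) (θ : ℝ → Vec d) : Prop :=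
  ∀ τ ∈ Icc 0 L, θ τ = x + ∫ r in 0..τ, F r (θ r)

namespace LipField
variable {d : ℕ} {K L B : ℝ} {F : ℝ → Vec d → Vec d} {x x' : Vec d} {θ θ' : ℝ → Vec d}

lemma integrable_curve (hF : LipField d K L B F) (hK : 0 < K) (hB : 0 ≤ B) (hL : 0 ≤ L)
    (h : IsCurve L F x θ) :
    IntervalIntegrable (fun r => F r (θ r)) volume 0 L := by
  set g := fun r => F r (θ r) with hg
  set B' := B + K * ‖x‖ with hB'
  have hB'0 : 0 ≤ B' := by positivity
  have gb : ∀ r ∈ Icc 0 L, ‖g r‖ ≤ B' + K * ‖θ r - x‖ := by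
    intro r hr
    have h1 := hF.lip r hr (θ r) x
    have h2 := hF.lip r hr x 0
    have h3 := hF.bdd r hr
    rw [sub_zero] at h2
    have h4 := norm_add_le (F r (θ r) - F r x) (F r x)
    have h5 := norm_add_le (F r x - F r 0) (F r 0)
    rw [sub_add_cancel] at h4 h5
    simp only [hg, hB']
    linarith
  set N := {τ | τ ∈ Icc 0 L ∧ IntervalIntegrable g volume 0 τ} with hN
  have down : ∀ τ ∈ N, ∀ r ∈ Icc 0 τ, r ∈ N := by
    rintro τ ⟨h1, h2⟩ r hr
    refine ⟨⟨hr.1, hr.2.trans h1.2⟩, h2.mono_set ?_⟩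
    rw [uIcc_of_le hr.1, uIcc_of_le h1.1]
    exact Icc_subset_Icc le_rfl hr.2
  have contI : ∀ τ ∈ N, ContinuousOn θ (Icc 0 τ) := by
    rintro τ ⟨h1, h2⟩
    have h3 : ContinuousOn (fun r => x + ∫ ρ in 0..r, g ρ) (Icc 0 τ) := by
      refine continuousOn_const.add ?_
      have := intervalIntegral.continuousOn_primitive_interval' h2 (left_mem_uIcc)
      rwa [uIcc_of_le h1.1] at this
    exact h3.congr fun r hr => h r ⟨hr.1, hr.2.trans h1.2⟩
  set R := 2 * (B' * L) * Real.exp (2 * K * L) with hR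
  have hR0 : 0 ≤ R := by positivity
  have bN : ∀ τ ∈ N, ‖θ τ - x‖ ≤ R := by
    intro τ hτ
    have hτ0 := hτ.1.1
    have uc : ContinuousOn (fun r => ‖θ r - x‖) (Icc 0 τ) :=
      ((contI τ hτ).sub continuousOn_const).norm
    have := gronwall_integral (a := B' * L) (L := τ) hK (by positivity) uc ?_ τ ⟨hτ0, le_rfl⟩
    · refine this.trans ?_
      have := hτ.1.2
      simp only [hR]
      gcongr
    · intro r hr
      have ui : IntervalIntegrable (fun r => ‖θ r - x‖) volume 0 r := by
        refine (uc.mono ?_).intervalIntegrable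
        rw [uIcc_of_le hr.1]
        exact Icc_subset_Icc le_rfl hr.2
      have hrL := hr.2.trans hτ.1.2
      have e : θ r - x = ∫ ρ in 0..r, g ρ := by
        rw [h r ⟨hr.1, hrL⟩, add_sub_cancel_left]
      calc ‖θ r - x‖ = ‖∫ ρ in 0..r, g ρ‖ := by rw [e]
        _ ≤ ∫ ρ in 0..r, (B' + K * ‖θ ρ - x‖) := by
            refine intervalIntegral.norm_integral_le_of_norm_le hr.1 ?_ ?_
            · refine Filter.Eventually.of_forall fun ρ hρ => gb ρ ⟨hρ.1.le, hρ.2.trans hrL⟩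
            · exact intervalIntegrable_const.add (ui.const_mul K)
        _ = B' * r + K * ∫ ρ in 0..r, ‖θ ρ - x‖ := by
            rw [intervalIntegral.integral_add intervalIntegrable_const (ui.const_mul K),
              intervalIntegral.integral_const_mul, intervalIntegral.integral_const, sub_zero,
              smul_eq_mul, mul_comm r]
        _ ≤ _ := by gcongr
  have cN : ContinuousOn θ N := by
    intro τ hτ
    by_cases hex : ∃ τ1 ∈ N, τ < τ1
    · obtain ⟨τ1, h1, h2⟩ := hex
      refine ((contI τ1 h1) τ ⟨hτ.1.1, h2.le⟩).mono_of_mem_nhdsWithin ?_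
      filter_upwards [self_mem_nhdsWithin, mem_nhdsWithin_of_mem_nhds (Iio_mem_nhds h2)]
        with r hr hr'
      exact ⟨hr.1.1, le_of_lt hr'⟩
    · refine ((contI τ hτ) τ ⟨hτ.1.1, le_rfl⟩).mono fun r hr => ⟨hr.1.1, ?_⟩
      by_contra hn
      exact hex ⟨r, hr, not_le.1 hn⟩
  have mN : MeasurableSet N := by
    refine OrdConnected.measurableSet ⟨fun r hr τ hτ w hw => ?_⟩
    exact down τ hτ w ⟨hr.1.1.trans hw.1, hw.2⟩
  have θx : ∀ r ∈ Icc 0 L, r ∉ N → θ r = x := by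
    intro r hr hn
    have : ¬ IntervalIntegrable g volume 0 r := fun hi => hn ⟨hr, hi⟩
    rw [h r hr, intervalIntegral.integral_undef this, add_zero]
  rw [intervalIntegrable_iff_integrableOn_Icc_of_le hL]
  have m1 : AEStronglyMeasurable g (volume.restrict N) :=
    (hF.meas.comp_aemeasurable (aemeasurable_id.prodMk (cN.aemeasurable mN))).aestronglyMeasurable
  have m2 : AEStronglyMeasurable g (volume.restrict (Icc 0 L \ N)) := by
    have : AEStronglyMeasurable (fun r => F r x) (volume.restrict (Icc 0 L \ N)) :=
      (hF.meas.comp (measurable_id.prodMk measurable_const)).aestronglyMeasurable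
    refine this.congr ?_
    filter_upwards [ae_restrict_mem (measurableSet_Icc.diff mN)] with r hr
    simp only [hg, θx r hr.1 hr.2]
  refine Integrable.of_bound ?_ (B' + K * R) ?_
  · have hU : Icc 0 L = N ∪ (Icc 0 L \ N) := by
      rw [union_sdiff_cancel]; exact fun r hr => hr.1
    rw [hU]
    exact aestronglyMeasurable_union_iff.2 ⟨m1, m2⟩
  · filter_upwards [ae_restrict_mem measurableSet_Icc] with r hr
    refine (gb r hr).trans ?_
    by_cases hn : r ∈ N
    · gcongr
      exact bN r hn
    · rw [θx r hr hn, sub_self, norm_zero]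
      gcongr

lemma continuousOn_curve (hF : LipField d K L B F) (hK : 0 < K) (hB : 0 ≤ B) (hL : 0 ≤ L)
    (h : IsCurve L F x θ) : ContinuousOn θ (Icc 0 L) := by
  have h3 : ContinuousOn (fun r => x + ∫ ρ in 0..r, F ρ (θ ρ)) (Icc 0 L) := by
    refine continuousOn_const.add ?_
    have := intervalIntegral.continuousOn_primitive_interval'
      (hF.integrable_curve hK hB hL h) (left_mem_uIcc)
    rwa [uIcc_of_le hL] at this
  exact h3.congr fun r hr => h r hr

lemma curve_stability (hF : LipField d K L B F) (hK : 0 < K) (hB : 0 ≤ B) (hL : 0 ≤ L)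
    (h : IsCurve L F x θ) (h' : IsCurve L F x' θ') :
    ∀ τ ∈ Icc 0 L, ‖θ τ - θ' τ‖ ≤ 2 * ‖x - x'‖ * Real.exp (2 * K * τ) := by
  have c := hF.continuousOn_curve hK hB hL h
  have c' := hF.continuousOn_curve hK hB hL h'
  have uc := (c.sub c').norm
  refine gronwall_integral hK (norm_nonneg _) uc fun τ hτ => ?_
  have sub : uIcc 0 τ ⊆ uIcc 0 L := by
    rw [uIcc_of_le hτ.1, uIcc_of_le hL]
    exact Icc_subset_Icc le_rfl hτ.2
  have i := (hF.integrable_curve hK hB hL h).mono_set sub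
  have i' := (hF.integrable_curve hK hB hL h').mono_set sub
  have ui : IntervalIntegrable (fun r => ‖θ r - θ' r‖) volume 0 τ := by
    refine (uc.mono ?_).intervalIntegrable
    rwa [uIcc_of_le hL] at sub
  rw [h τ hτ, h' τ hτ, add_sub_add_comm, ← intervalIntegral.integral_sub i i']
  refine (norm_add_le _ _).trans ?_
  gcongr
  rw [← intervalIntegral.integral_const_mul]
  refine intervalIntegral.norm_integral_le_of_norm_le hτ.1 ?_ (ui.const_mul K)
  exact Filter.Eventually.of_forall fun ρ hρ => hF.lip ρ ⟨hρ.1.le, hρ.2.trans hτ.2⟩ _ _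

end LipField

section Drift
variable {d : ℕ} {β κ₁ : ℝ} {ρ : Vec d → ℝ} {b : ℝ → Vec d → Vec d}

lemma HolderDrift.growth_diff (hβ : β ∈ Icc (0 : ℝ) 1) (hκ : 0 < κ₁) (hb : HolderDrift d b κ₁ β)
    {t : ℝ} (ht : 0 ≤ t) (z z' : Vec d) : ‖b t z - b t z'‖ ≤ κ₁ * (1 + ‖z - z'‖) := by
  refine (hb.2.2 t ht z z').trans (mul_le_mul_of_nonneg_left (max_le ?_ (by linarith)) hκ.le)
  have h0 := norm_nonneg (z - z')
  rcases le_total ‖z - z'‖ 1 with h | h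
  · linarith [Real.rpow_le_one h0 h hβ.1]
  · have := Real.rpow_le_rpow_of_exponent_le h hβ.2
    rw [Real.rpow_one] at this
    linarith

lemma HolderDrift.lip_far (hβ : β ∈ Icc (0 : ℝ) 1) (hb : HolderDrift d b κ₁ β)
    {t : ℝ} (ht : 0 ≤ t) {z z' : Vec d} (hz : 1 ≤ ‖z - z'‖) :
    ‖b t z - b t z'‖ ≤ κ₁ * ‖z - z'‖ := by
  have := Real.rpow_le_rpow_of_exponent_le hz hβ.2
  rw [Real.rpow_one] at this
  exact (hb.2.2 t ht z z').trans_eq (by rw [max_eq_right this])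

lemma IsMollifier.integrable (hρ : IsMollifier d ρ) : Integrable ρ := by
  by_contra h
  have := hρ.integral_eq_one
  rw [integral_undef h] at this
  norm_num at this

lemma IsMollifier.eq_zero (hρ : IsMollifier d ρ) {w : Vec d} (hw : 1 < ‖w‖) : ρ w = 0 := by
  by_contra h
  have := hρ.support_subset h
  rw [mem_closedBall_zero_iff] at this
  linarith

lemma mollifiedDrift_one (t : ℝ) (x : Vec d) :
    mollifiedDrift d ρ 1 b t x = ∫ y, ρ (x - y) • b t y := by
  simp [mollifiedDrift]

lemma mollifiedDrift_eq (t : ℝ) (x : Vec d) :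
    mollifiedDrift d ρ 1 b t x = ∫ w, ρ w • b t (x - w) := by
  rw [mollifiedDrift_one, ← integral_sub_left_eq_self _ volume x]
  simp

/-- A mollifier averages functions of locally bounded size. -/
lemma IsMollifier.norm_integral_le (hρ : IsMollifier d ρ) {f : Vec d → Vec d} {B : ℝ}
    (hB : ∀ w, ‖w‖ ≤ 1 → ‖f w‖ ≤ B) : ‖∫ w, ρ w • f w‖ ≤ B := by
  have h1 : ∀ w, ‖ρ w • f w‖ ≤ ρ w * B := by
    intro w
    rw [norm_smul, Real.norm_of_nonneg (hρ.nonneg w)]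
    rcases le_or_gt ‖w‖ 1 with h | h
    · exact mul_le_mul_of_nonneg_left (hB w h) (hρ.nonneg w)
    · rw [hρ.eq_zero h, zero_mul, zero_mul]
  refine (norm_integral_le_of_norm_le (hρ.integrable.mul_const B)
    (Filter.Eventually.of_forall h1)).trans_eq ?_
  rw [integral_mul_const, hρ.integral_eq_one, one_mul]

lemma IsMollifier.integrable_smul (hρ : IsMollifier d ρ) {f : Vec d → Vec d} (hf : Measurable f)
    {B : ℝ} (hB : ∀ w, ‖w‖ ≤ 1 → ‖f w‖ ≤ B) : Integrable fun w => ρ w • f w := by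
  refine Integrable.mono' (hρ.integrable.mul_const B)
    (hρ.integrable.1.smul hf.aestronglyMeasurable) (Filter.Eventually.of_forall fun w => ?_)
  rw [norm_smul, Real.norm_of_nonneg (hρ.nonneg w)]
  rcases le_or_gt ‖w‖ 1 with h | h
  · exact mul_le_mul_of_nonneg_left (hB w h) (hρ.nonneg w)
  · rw [hρ.eq_zero h, zero_mul, zero_mul]

lemma exists_mollifiedDrift_bounds (hβ : β ∈ Icc (0 : ℝ) 1) (hκ : 0 < κ₁)
    (hρ : IsMollifier d ρ) : ∃ K > (0 : ℝ), ∀ b : ℝ → Vec d → Vec d, HolderDrift d b κ₁ β →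
      (Measurable fun p : ℝ × Vec d => mollifiedDrift d ρ 1 b p.1 p.2) ∧
      ∀ t, 0 ≤ t → ‖mollifiedDrift d ρ 1 b t 0‖ ≤ K ∧ ∀ z z',
        ‖b t z - mollifiedDrift d ρ 1 b t z'‖ ≤ K * (1 + ‖z - z'‖) ∧
        ‖mollifiedDrift d ρ 1 b t z - mollifiedDrift d ρ 1 b t z'‖ ≤ K * ‖z - z'‖ ∧
        ‖b t z‖ ≤ K * (1 + ‖z‖) := by
  have hcs : HasCompactSupport ρ :=
    HasCompactSupport.of_support_subset_isCompact (isCompact_closedBall 0 1) hρ.support_subset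
  obtain ⟨L, hL⟩ := ContDiff.lipschitzWith_of_hasCompactSupport hcs hρ.smooth (by simp)
  set V := (volume : Measure (Vec d)).real (Metric.closedBall 0 2) with hV
  have hV0 : 0 ≤ V := measureReal_nonneg
  refine ⟨3 * κ₁ + L * (κ₁ * 3) * V, by positivity, fun b hb => ?_⟩
  have hX : 0 ≤ L * (κ₁ * 3) * V := by positivity
  have bm : ∀ t, Measurable (b t) := fun t => hb.1.comp (measurable_const.prodMk measurable_id)
  have hloc : ∀ t, 0 ≤ t → ∀ x : Vec d, ∀ w : Vec d, ‖w‖ ≤ 1 →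
      ‖b t (x - w)‖ ≤ ‖b t x‖ + κ₁ * 2 := by
    intro t ht x w hw
    have h1 := hb.growth_diff hβ hκ ht (x - w) x
    rw [sub_sub_cancel_left, norm_neg] at h1
    have h2 := norm_add_le (b t (x - w) - b t x) (b t x)
    rw [sub_add_cancel] at h2
    nlinarith
  have integ : ∀ t, 0 ≤ t → ∀ x, Integrable fun w => ρ w • b t (x - w) := fun t ht x =>
    hρ.integrable_smul ((bm t).comp (measurable_const.sub measurable_id)) (hloc t ht x)
  have const : ∀ v : Vec d, v = ∫ w, ρ w • v := fun v => by
    rw [integral_smul_const, hρ.integral_eq_one, one_smul]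
  have bc : ∀ t, 0 ≤ t → ∀ z z', ‖b t z - mollifiedDrift d ρ 1 b t z'‖ ≤ 2 * κ₁ * (1 + ‖z - z'‖) := by
    intro t ht z z'
    rw [mollifiedDrift_eq]
    nth_rewrite 1 [const (b t z)]
    rw [← integral_sub (hρ.integrable.smul_const _) (integ t ht z')]
    simp only [← smul_sub]
    refine hρ.norm_integral_le fun w hw => (hb.growth_diff hβ hκ ht _ _).trans ?_
    have : ‖z - (z' - w)‖ ≤ ‖z - z'‖ + ‖w‖ := by
      rw [← sub_add]; exact norm_add_le _ _
    have h0 := norm_nonneg (z - z')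
    nlinarith
  refine ⟨?_, fun t ht => ⟨?_, fun z z' => ⟨?_, ?_, ?_⟩⟩⟩
  · simp only [mollifiedDrift_eq]
    have hm : Measurable fun q : (ℝ × Vec d) × Vec d => ρ q.2 • b q.1.1 (q.1.2 - q.2) := by
      refine (hρ.smooth.continuous.measurable.comp measurable_snd).smul ?_
      exact hb.1.comp ((measurable_fst.comp measurable_fst).prodMk
        ((measurable_snd.comp measurable_fst).sub measurable_snd))
    exact hm.stronglyMeasurable.integral_prod_right'.measurable
  · have h1 := bc t ht 0 0
    have h2 := norm_sub_norm_le (mollifiedDrift d ρ 1 b t 0) (b t 0)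
    rw [norm_sub_rev] at h2
    rw [sub_self, norm_zero] at h1
    have := hb.2.1 t ht
    linarith
  · refine (bc t ht z z').trans (mul_le_mul_of_nonneg_right ?_ (by positivity))
    linarith
  · rcases le_total 1 ‖z - z'‖ with h | h
    · rw [mollifiedDrift_eq, mollifiedDrift_eq, ← integral_sub (integ t ht z) (integ t ht z')]
      simp only [← smul_sub]
      refine (hρ.norm_integral_le (B := κ₁ * ‖z - z'‖) fun w hw => ?_).trans ?_
      · have := hb.lip_far hβ ht (z := z - w) (z' := z' - w) (by simpa using h)
        simpa using this
      · exact mul_le_mul_of_nonneg_right (by linarith) (norm_nonneg _)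
    · have integ' : ∀ x, Integrable fun y => ρ (x - y) • b t y := fun x => by
        have := (integ t ht x).comp_sub_left x
        simpa using this
      have hρi : ∀ x, Integrable fun y => ρ (x - y) := fun x => hρ.integrable.comp_sub_left x
      have e : mollifiedDrift d ρ 1 b t z - mollifiedDrift d ρ 1 b t z' =
          ∫ y, (ρ (z - y) - ρ (z' - y)) • (b t y - b t z) := by
        have h1 : ∀ x, ∫ y, ρ (x - y) • (b t y - b t z) =
            mollifiedDrift d ρ 1 b t x - b t z := by
          intro x
          simp only [smul_sub]
          rw [integral_sub (integ' x) ((hρi x).smul_const _), ← mollifiedDrift_one,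
            integral_smul_const, integral_sub_left_eq_self, hρ.integral_eq_one, one_smul]
        have h2 : ∀ x, Integrable fun y => ρ (x - y) • (b t y - b t z) := fun x => by
          simp only [smul_sub]
          exact (integ' x).sub ((hρi x).smul_const _)
        simp only [sub_smul]
        rw [integral_sub (h2 z) (h2 z'), h1, h1, sub_sub_sub_cancel_right]
      rw [e]
      have zero : ∀ y, y ∉ Metric.closedBall z 2 →
          (ρ (z - y) - ρ (z' - y)) • (b t y - b t z) = 0 := by
        intro y hy
        rw [Metric.mem_closedBall, dist_eq_norm, norm_sub_rev, not_le] at hy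
        have h3 : 1 < ‖z' - y‖ := by
          have := norm_add_le (z - z') (z' - y)
          rw [sub_add_sub_cancel] at this
          linarith
        rw [hρ.eq_zero (by linarith), hρ.eq_zero h3, sub_self, zero_smul]
      rw [← setIntegral_eq_integral_of_forall_compl_eq_zero zero]
      refine (norm_setIntegral_le_of_norm_le_const (C := L * ‖z - z'‖ * (κ₁ * 3))
        measure_closedBall_lt_top fun y hy => ?_).trans ?_
      · rw [norm_smul]
        have h4 := hL.dist_le_mul (z - y) (z' - y)
        rw [dist_eq_norm, dist_eq_norm, sub_sub_sub_cancel_right] at h4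
        rw [Metric.mem_closedBall, dist_eq_norm] at hy
        have h5 := hb.growth_diff hβ hκ ht y z
        gcongr
        nlinarith
      · have : (volume : Measure (Vec d)).real (Metric.closedBall z 2) = V := by
          rw [hV, measureReal_def, measureReal_def, Measure.addHaar_closedBall_center]
        rw [this]
        have := norm_nonneg (z - z')
        nlinarith [mul_nonneg hκ.le this]
  · have h1 := hb.growth_diff hβ hκ ht z 0
    have h2 := norm_add_le (b t z - b t 0) (b t 0)
    have h3 := hb.2.1 t ht
    have h4 := norm_nonneg z
    rw [sub_zero] at h1
    rw [sub_add_cancel] at h2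
    nlinarith [mul_nonneg hκ.le h4, mul_nonneg hX h4]

end Drift

section Flow
variable {d : ℕ} {K : ℝ} {f : ℝ → Vec d → Vec d} {θ : ℝ → ℝ → Vec d → Vec d}

/-- A measurable vector field on `[0, ∞)` with linear bounds in space, uniform in time. -/
structure LipFieldOn (d : ℕ) (K : ℝ) (f : ℝ → Vec d → Vec d) : Prop where
  pos : 0 < K
  meas : Measurable fun p : ℝ × Vec d => f p.1 p.2
  lip : ∀ r, 0 ≤ r → ∀ z z', ‖f r z - f r z'‖ ≤ K * ‖z - z'‖
  bdd : ∀ r, 0 ≤ r → ‖f r 0‖ ≤ K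

namespace LipFieldOn

lemma forward (hf : LipFieldOn d K f) {s : ℝ} (hs : 0 ≤ s) (L : ℝ) :
    LipField d K L K fun r z => f (s + r) z where
  meas := hf.meas.comp ((measurable_const.add measurable_fst).prodMk measurable_snd)
  lip _ hr := hf.lip _ (add_nonneg hs hr.1)
  bdd _ hr := hf.bdd _ (add_nonneg hs hr.1)

lemma backward (hf : LipFieldOn d K f) {s L : ℝ} (hs : L ≤ s) :
    LipField d K L K fun r z => -f (s - r) z where
  meas := (hf.meas.comp ((measurable_const.sub measurable_fst).prodMk measurable_snd)).neg
  lip r hr z z' := by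
    rw [neg_sub_neg, norm_sub_rev]
    exact hf.lip _ (by linarith [hr.2]) z z'
  bdd r hr := by
    rw [norm_neg]
    exact hf.bdd _ (by linarith [hr.2])

lemma flow_self (hθ : IsFlow d f θ) {s : ℝ} (hs : 0 ≤ s) (x : Vec d) : θ s s x = x := by
  rw [hθ s s hs hs x, intervalIntegral.integral_same, add_zero]

lemma flow_integrable (hf : LipFieldOn d K f) (hθ : IsFlow d f θ) {s t : ℝ} (hs : 0 ≤ s)
    (ht : 0 ≤ t) (x : Vec d) : IntervalIntegrable (fun r => f r (θ r s x)) volume s t := by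
  rcases le_total s t with h | h
  · have hc : IsCurve (t - s) (fun r z => f (s + r) z) x fun τ => θ (s + τ) s x := by
      intro τ hτ
      rw [intervalIntegral.integral_comp_add_left (fun r => f r (θ r s x)), add_zero]
      exact hθ s (s + τ) hs (add_nonneg hs hτ.1) x
    have hi := (hf.forward hs (t - s)).integrable_curve hf.pos hf.pos.le (by linarith) hc
    have := hi.comp_sub_right s
    simpa using this
  · have hc : IsCurve (s - t) (fun r z => -f (s - r) z) x fun τ => θ (s - τ) s x := by
      intro τ hτ
      rw [intervalIntegral.integral_neg,
        intervalIntegral.integral_comp_sub_left (fun r => f r (θ r s x)), sub_zero,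
        ← intervalIntegral.integral_symm]
      exact hθ s (s - τ) hs (by linarith [hτ.2]) x
    have hi := (hf.backward (s := s) (L := s - t) (by linarith)).integrable_curve hf.pos hf.pos.le
      (by linarith) hc
    have h2 : IntervalIntegrable (fun r => -f r (θ r s x)) volume s t := by
      simpa using hi.comp_sub_left s
    simpa only [Pi.neg_def, neg_neg] using h2.neg

lemma flow_diff (hf : LipFieldOn d K f) (hθ : IsFlow d f θ) {s t t' : ℝ} (hs : 0 ≤ s)
    (ht : 0 ≤ t) (ht' : 0 ≤ t') (x : Vec d) :
    θ t' s x - θ t s x = ∫ r in t..t', f r (θ r s x) := by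
  rw [hθ s t hs ht, hθ s t' hs ht', add_sub_add_left_eq_sub,
    intervalIntegral.integral_interval_sub_left (hf.flow_integrable hθ hs ht' x)
      (hf.flow_integrable hθ hs ht x)]

lemma curve_forward (hf : LipFieldOn d K f) (hθ : IsFlow d f θ) {s t : ℝ} (hs : 0 ≤ s)
    (ht : 0 ≤ t) (x : Vec d) (L : ℝ) :
    IsCurve L (fun r z => f (t + r) z) (θ t s x) fun τ => θ (t + τ) s x := by
  intro τ hτ
  rw [intervalIntegral.integral_comp_add_left (fun r => f r (θ r s x)), add_zero,
    ← hf.flow_diff hθ hs ht (add_nonneg ht hτ.1), add_sub_cancel]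

lemma curve_backward (hf : LipFieldOn d K f) (hθ : IsFlow d f θ) {s t : ℝ} (hs : 0 ≤ s)
    (ht : 0 ≤ t) (x : Vec d) {L : ℝ} (hL : L ≤ t) :
    IsCurve L (fun r z => -f (t - r) z) (θ t s x) fun τ => θ (t - τ) s x := by
  intro τ hτ
  rw [intervalIntegral.integral_neg,
    intervalIntegral.integral_comp_sub_left (fun r => f r (θ r s x)), sub_zero,
    ← intervalIntegral.integral_symm, ← hf.flow_diff hθ hs ht (by linarith [hτ.2]), add_sub_cancel]

lemma flow_forward_lip (hf : LipFieldOn d K f) (hθ : IsFlow d f θ) {s u t t' : ℝ} (hs : 0 ≤ s)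
    (hu : 0 ≤ u) (ht : 0 ≤ t) (htt : t ≤ t') (x x' : Vec d) :
    ‖θ t' s x - θ t' u x'‖ ≤ 2 * ‖θ t s x - θ t u x'‖ * Real.exp (2 * K * (t' - t)) := by
  have := (hf.forward ht (t' - t)).curve_stability hf.pos hf.pos.le (by linarith)
    (hf.curve_forward hθ hs ht x (t' - t)) (hf.curve_forward hθ hu ht x' (t' - t)) (t' - t)
    ⟨by linarith, le_rfl⟩
  simpa using this

lemma flow_backward_lip (hf : LipFieldOn d K f) (hθ : IsFlow d f θ) {s u t t' : ℝ} (hs : 0 ≤ s)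
    (hu : 0 ≤ u) (ht : 0 ≤ t) (htt : t ≤ t') (x x' : Vec d) :
    ‖θ t s x - θ t u x'‖ ≤ 2 * ‖θ t' s x - θ t' u x'‖ * Real.exp (2 * K * (t' - t)) := by
  have hL : t' - t ≤ t' := by linarith
  have ht' := ht.trans htt
  have := (hf.backward hL).curve_stability hf.pos hf.pos.le (by linarith)
    (hf.curve_backward hθ hs ht' x hL) (hf.curve_backward hθ hu ht' x' hL) (t' - t)
    ⟨by linarith, le_rfl⟩
  simpa using this

lemma flow_inv_left (hf : LipFieldOn d K f) (hθ : IsFlow d f θ) {s r : ℝ} (hs : 0 ≤ s)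
    (hr : s ≤ r) (w : Vec d) : θ s r (θ r s w) = w := by
  have h := hf.flow_backward_lip hθ (hs.trans hr) hs hs hr (θ r s w) w
  rw [flow_self hθ (hs.trans hr), flow_self hθ hs, sub_self, norm_zero, mul_zero, zero_mul] at h
  exact sub_eq_zero.1 (norm_le_zero_iff.1 h)

lemma flow_inv_right (hf : LipFieldOn d K f) (hθ : IsFlow d f θ) {s r : ℝ} (hs : 0 ≤ s)
    (hr : s ≤ r) (z : Vec d) : θ r s (θ s r z) = z := by
  have h := hf.flow_forward_lip hθ hs (hs.trans hr) hs hr (θ s r z) z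
  rw [flow_self hθ (hs.trans hr), flow_self hθ hs, sub_self, norm_zero, mul_zero, zero_mul] at h
  exact sub_eq_zero.1 (norm_le_zero_iff.1 h)

lemma flow_continuousOn (hf : LipFieldOn d K f) (hθ : IsFlow d f θ) {s t : ℝ} (hs : 0 ≤ s)
    (hst : s ≤ t) (x : Vec d) : ContinuousOn (fun r => θ r s x) (Icc s t) := by
  have h : ContinuousOn (fun r => x + ∫ ρ in s..r, f ρ (θ ρ s x)) (Icc s t) := by
    refine continuousOn_const.add ?_
    have := intervalIntegral.continuousOn_primitive_interval'
      (hf.flow_integrable hθ hs (hs.trans hst) x) (left_mem_uIcc)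
    rwa [uIcc_of_le hst] at this
  exact h.congr fun r hr => hθ s r hs (hs.trans hr.1) x

end LipFieldOn
end Flow

/-- Projection of time onto `[s, s + T]`. -/
def tclamp (s T r : ℝ) : ℝ := max s (min r (s + T))

lemma tclamp_mem {s T : ℝ} (hT : 0 < T) (r : ℝ) : tclamp s T r ∈ Icc s (s + T) :=
  ⟨le_max_left _ _, max_le (by linarith) (min_le_right _ _)⟩

lemma tclamp_eq {s T r : ℝ} (hr : r ∈ Icc s (s + T)) : tclamp s T r = r := by
  rw [tclamp, min_eq_left hr.2, max_eq_right hr.1]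

lemma tclamp_continuous (s T : ℝ) : Continuous (tclamp s T) := by
  unfold tclamp; fun_prop

lemma tclamp_mono (s T : ℝ) {r r' : ℝ} (h : r ≤ r') : tclamp s T r ≤ tclamp s T r' := by
  unfold tclamp; gcongr

lemma integral_tclamp {E : Type*} [NormedAddCommGroup E] [NormedSpace ℝ E] {s T : ℝ} (g : ℝ → E)
    (r r' : ℝ) : ∫ ρ in tclamp s T r..tclamp s T r', g ρ =
      ∫ ρ in r..r', (Ioc s (s + T)).indicator g ρ := by
  have key : ∀ r r' : ℝ, r ≤ r' → ∫ ρ in tclamp s T r..tclamp s T r', g ρ =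
      ∫ ρ in r..r', (Ioc s (s + T)).indicator g ρ := by
    intro r r' h
    rw [intervalIntegral.integral_of_le (tclamp_mono s T h), intervalIntegral.integral_of_le h,
      setIntegral_indicator measurableSet_Ioc]
    congr 2
    ext x
    simp only [tclamp, mem_Ioc, mem_inter_iff]
    grind
  rcases le_total r r' with h | h
  · exact key r r' h
  · rw [intervalIntegral.integral_symm, key r' r h, ← intervalIntegral.integral_symm]

section Elliptic
variable {d : ℕ} {κ₀ α : ℝ} {σ : ℝ → Vec d → Matrix (Fin d) (Fin d) ℝ}

lemma sqMat_apply (t : ℝ) (x : Vec d) (i j : Fin d) :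
    sqMat d σ t x i j = ∑ k, σ t x i k * σ t x j k := by
  simp [sqMat, Matrix.mul_apply]

lemma EllipticHolder.abs_le (hκ : 1 ≤ κ₀) (h : EllipticHolder d σ κ₀ α) {t : ℝ} (ht : 0 ≤ t)
    (x : Vec d) (i j : Fin d) : |σ t x i j| ≤ κ₀ := by
  have h1 := (h.2.1 t ht x (Pi.single i 1)).2
  have h2 : (sqMat d σ t x).mulVec (Pi.single i 1) ⬝ᵥ Pi.single i 1 = sqMat d σ t x i i := by
    simp
  rw [h2, single_one_dotProduct, Pi.single_eq_same, mul_one, sqMat_apply] at h1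
  have h3 : σ t x i j * σ t x i j ≤ κ₀ :=
    (Finset.single_le_sum (f := fun k => σ t x i k * σ t x i k)
      (fun k _ => mul_self_nonneg _) (Finset.mem_univ j)).trans h1
  exact abs_le_of_sq_le_sq (by nlinarith) (by linarith)

lemma EllipticHolder.sqMat_abs_le (hκ : 1 ≤ κ₀) (h : EllipticHolder d σ κ₀ α) {t : ℝ}
    (ht : 0 ≤ t) (x : Vec d) (i j : Fin d) : |sqMat d σ t x i j| ≤ d * (κ₀ * κ₀) := by
  rw [sqMat_apply]
  refine (Finset.abs_sum_le_sum_abs _ _).trans ?_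
  refine (Finset.sum_le_sum fun k _ => (abs_mul _ _).trans_le (mul_le_mul (h.abs_le hκ ht x i k)
    (h.abs_le hκ ht x j k) (abs_nonneg _) (by linarith))).trans_eq ?_
  simp

lemma EllipticHolder.sqMat_holder (hκ : 1 ≤ κ₀) (h : EllipticHolder d σ κ₀ α) {t : ℝ}
    (ht : 0 ≤ t) (x y : Vec d) (i j : Fin d) :
    |sqMat d σ t x i j - sqMat d σ t y i j| ≤ d * (2 * (κ₀ * κ₀)) * ‖x - y‖ ^ α := by
  rw [sqMat_apply, sqMat_apply, ← Finset.sum_sub_distrib]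
  have hb : ∀ k ∈ Finset.univ, |σ t x i k * σ t x j k - σ t y i k * σ t y j k| ≤
      2 * (κ₀ * κ₀) * ‖x - y‖ ^ α := by
    intro k _
    have e : σ t x i k * σ t x j k - σ t y i k * σ t y j k =
        σ t x i k * (σ t x j k - σ t y j k) + (σ t x i k - σ t y i k) * σ t y j k := by ring
    rw [e]
    refine (abs_add_le _ _).trans ?_
    rw [abs_mul, abs_mul]
    have h1 := h.abs_le hκ ht x i k
    have h2 := h.abs_le hκ ht y j k
    have h3 := h.2.2 t ht x y j k
    have h4 := h.2.2 t ht x y i k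
    have h5 := mul_le_mul h1 h3 (abs_nonneg _) (by linarith)
    have h6 := mul_le_mul h4 h2 (abs_nonneg _) (by positivity)
    linarith
  refine (Finset.abs_sum_le_sum_abs _ _).trans ((Finset.sum_le_sum hb).trans_eq ?_)
  simp
  ring

end Elliptic

lemma measurable_of_continuous_time {d : ℕ} {g : ℝ → Vec d → Vec d}
    (h1 : ∀ w, Continuous fun r => g r w) (h2 : ∀ r, Continuous (g r)) :
    Measurable fun p : ℝ × Vec d => g p.1 p.2 :=
  measurable_uncurry_of_continuous_of_measurable h1 fun r => (h2 r).measurable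

lemma exists_setup (d : ℕ) (T α β κ₀ κ₁ : ℝ) (hT : 0 < T) (hα : α ∈ Ioc (0 : ℝ) 1)
    (hβ : β ∈ Icc (0 : ℝ) 1) (hκ₀ : 1 ≤ κ₀) (hκ₁ : 0 < κ₁) (ρ : Vec d → ℝ)
    (hρ : IsMollifier d ρ) : ∃ M ≥ (1 : ℝ), ∀ (b : ℝ → Vec d → Vec d)
      (σ : ℝ → Vec d → Matrix (Fin d) (Fin d) ℝ) (θ1 : ℝ → ℝ → Vec d → Vec d),
      EllipticHolder d σ κ₀ α → HolderDrift d b κ₁ β →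
      IsFlow d (mollifiedDrift d ρ 1 b) θ1 → ∀ s, 0 ≤ s → ∃ S : Setup d α M T, S.s0 = s ∧
      (∀ r ∈ Ioc s (s + T), ∀ z, S.a r z = sqMat d σ r z ∧ S.b r z = b r z) ∧
      ∀ r ∈ Icc s (s + T), ∀ z, S.ζ r z = θ1 r s z := by
  obtain ⟨K, hK, hKb⟩ := exists_mollifiedDrift_bounds hβ hκ₁ hρ
  set E := 2 * Real.exp (2 * K * T) with hE
  have hE0 : 0 ≤ E := by positivity
  have hd : (0 : ℝ) ≤ d * (κ₀ * κ₀) := by positivity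
  set M := κ₀ + d * (2 * (κ₀ * κ₀)) + K + E with hM
  have M1 : κ₀ ≤ M := by linarith
  have M2 : d * (κ₀ * κ₀) ≤ M := by linarith
  have M3 : d * (2 * (κ₀ * κ₀)) ≤ M := by linarith
  have M4 : K ≤ M := by linarith
  have M5 : E ≤ M := by linarith
  have M0 : 0 ≤ M := by linarith
  refine ⟨M, by linarith, fun b σ θ hσ hb hθ s hs => ?_⟩
  obtain ⟨fm, hbd⟩ := hKb b hb
  set f := mollifiedDrift d ρ 1 b with hf
  have F : LipFieldOn d K f := ⟨hK, fm, fun r hr z z' => ((hbd r hr).2 z z').2.1,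
    fun r hr => (hbd r hr).1⟩
  have cm : ∀ r, tclamp s T r ∈ Icc s (s + T) := tclamp_mem hT
  have c0 : ∀ r, 0 ≤ tclamp s T r := fun r => hs.trans (cm r).1
  have cmeas : Measurable (tclamp s T) := (tclamp_continuous s T).measurable
  have expb : ∀ r, Real.exp (2 * K * (tclamp s T r - s)) ≤ Real.exp (2 * K * T) := by
    intro r
    have := (cm r).2
    gcongr
    linarith
  have ζlip : ∀ r w w', ‖θ (tclamp s T r) s w - θ (tclamp s T r) s w'‖ ≤ E * ‖w - w'‖ := by
    intro r w w'
    have h := F.flow_forward_lip hθ hs hs hs (cm r).1 w w'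
    rw [LipFieldOn.flow_self hθ hs, LipFieldOn.flow_self hθ hs] at h
    refine h.trans ?_
    rw [hE, mul_right_comm]
    have := expb r
    gcongr
  have πlip : ∀ r z z', ‖θ s (tclamp s T r) z - θ s (tclamp s T r) z'‖ ≤ E * ‖z - z'‖ := by
    intro r z z'
    have h := F.flow_backward_lip hθ (c0 r) (c0 r) hs (cm r).1 z z'
    rw [LipFieldOn.flow_self hθ (c0 r), LipFieldOn.flow_self hθ (c0 r)] at h
    refine h.trans ?_
    rw [hE, mul_right_comm]
    have := expb r
    gcongr
  have ζcont : ∀ w, Continuous fun r => θ (tclamp s T r) s w := fun w =>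
    (F.flow_continuousOn hθ hs (by linarith : s ≤ s + T) w).comp_continuous
      (tclamp_continuous s T) cm
  have lipc : ∀ {g : Vec d → Vec d}, (∀ w w', ‖g w - g w'‖ ≤ E * ‖w - w'‖) → Continuous g :=
    fun hg => (LipschitzWith.of_dist_le_mul (K := ⟨E, hE0⟩) fun w w' => by
      rw [dist_eq_norm, dist_eq_norm]; exact hg w w').continuous
  have πcont : ∀ z, Continuous fun r => θ s (tclamp s T r) z := by
    intro z
    rw [continuous_iff_continuousAt]
    intro r
    set w := θ s (tclamp s T r) z with hw
    have hz : θ (tclamp s T r) s w = z := F.flow_inv_right hθ hs (cm r).1 z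
    have hlim : Filter.Tendsto (fun r' => E * ‖z - θ (tclamp s T r') s w‖) (nhds r) (nhds 0) := by
      have h1 : Continuous fun r' => E * ‖z - θ (tclamp s T r') s w‖ :=
        continuous_const.mul (continuous_const.sub (ζcont w)).norm
      have := h1.tendsto r
      rwa [hz, sub_self, norm_zero, mul_zero] at this
    refine tendsto_iff_norm_sub_tendsto_zero.2
      (squeeze_zero (fun _ => norm_nonneg _) (fun r' => ?_) hlim)
    have h2 := πlip r' z (θ (tclamp s T r') s w)
    rwa [F.flow_inv_left hθ hs (cm r').1] at h2
  let S : Setup d α M T :=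
    { s0 := s
      a := fun r z => sqMat d σ (tclamp s T r) z
      b := fun r z => (Ioc s (s + T)).indicator (fun r => b r z) r
      c := fun r z => (Ioc s (s + T)).indicator (fun r => f r z) r
      ζ := fun r w => θ (tclamp s T r) s w
      π := fun r z => θ s (tclamp s T r) z
      hα := hα
      hM := by linarith
      hT := hT
      a_meas := fun i j => by
        simp only [sqMat_apply]
        have hp : Measurable fun p : ℝ × Vec d => (tclamp s T p.1, p.2) :=
          (cmeas.comp measurable_fst).prodMk measurable_snd
        exact Finset.measurable_fun_sum _ fun k _ =>
          ((hσ.1 i k).comp hp).mul ((hσ.1 j k).comp hp)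
      b_meas := by
        have : Measurable fun p : ℝ × Vec d => (Prod.fst ⁻¹' Ioc s (s + T)).indicator
          (fun p : ℝ × Vec d => b p.1 p.2) p := hb.1.indicator (measurable_fst measurableSet_Ioc)
        exact this
      c_meas := by
        have : Measurable fun p : ℝ × Vec d => (Prod.fst ⁻¹' Ioc s (s + T)).indicator
          (fun p : ℝ × Vec d => f p.1 p.2) p := fm.indicator (measurable_fst measurableSet_Ioc)
        exact this
      ζ_meas := measurable_of_continuous_time ζcont fun r => lipc (ζlip r)
      π_meas := measurable_of_continuous_time πcont fun r => lipc (πlip r)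
      a_qb := fun r z => by
        refine ⟨?_, fun ξ => ?_, fun ξ => ?_⟩
        · exact Matrix.isSymm_mul_transpose_self _
        · refine le_trans ?_ (hσ.2.1 _ (c0 r) z ξ).1
          rw [mul_one]
          exact mul_le_mul_of_nonneg_right (inv_anti₀ (by linarith) M1) (dot_self_nonneg' ξ)
        · refine (hσ.2.1 _ (c0 r) z ξ).2.trans ?_
          rw [mul_one]
          exact mul_le_mul_of_nonneg_right M1 (dot_self_nonneg' ξ)
      a_bdd := fun r z i j => (hσ.sqMat_abs_le hκ₀ (c0 r) z i j).trans M2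
      a_holder := fun r z z' i j => (hσ.sqMat_holder hκ₀ (c0 r) z z' i j).trans
        (mul_le_mul_of_nonneg_right M3 (by positivity))
      bc := fun r z z' => by
        by_cases hr : r ∈ Ioc s (s + T)
        · simp only [indicator_of_mem hr]
          exact ((hbd r (hs.trans hr.1.le)).2 z z').1.trans
            (mul_le_mul_of_nonneg_right M4 (by positivity))
        · simp only [indicator_of_notMem hr, sub_self, norm_zero]
          positivity
      ζπ := fun r z => F.flow_inv_right hθ hs (cm r).1 z
      πζ := fun r w => F.flow_inv_left hθ hs (cm r).1 w
      ζ_lip := fun r w w' => (ζlip r w w').trans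
        (mul_le_mul_of_nonneg_right M5 (norm_nonneg _))
      π_lip := fun r z z' => (πlip r z z').trans
        (mul_le_mul_of_nonneg_right M5 (norm_nonneg _))
      c_loc := fun w => by
        obtain ⟨R, hR⟩ := isCompact_Icc.exists_bound_of_continuousOn
          (F.flow_continuousOn hθ hs (by linarith : s ≤ s + T) w)
        have hR0 : 0 ≤ R := (norm_nonneg _).trans (hR s ⟨le_rfl, by linarith⟩)
        refine ⟨K + K * R, fun r => ?_⟩
        by_cases hr : r ∈ Ioc s (s + T)
        · simp only [indicator_of_mem hr]
          have h0 := hs.trans hr.1.le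
          have h1 := F.lip r h0 (θ (tclamp s T r) s w) 0
          have h2 := F.bdd r h0
          have h3 := norm_add_le (f r (θ (tclamp s T r) s w) - f r 0) (f r 0)
          have h4 := mul_le_mul_of_nonneg_left (hR _ (cm r)) hK.le
          rw [sub_zero] at h1
          rw [sub_add_cancel] at h3
          linarith
        · simp only [indicator_of_notMem hr, norm_zero]
          positivity
      ode := fun w r r' => by
        rw [F.flow_diff hθ hs (c0 r) (c0 r') w, integral_tclamp]
        congr 1 with x
        by_cases hx : x ∈ Ioc s (s + T)
        · simp only [indicator_of_mem hx, tclamp_eq (Ioc_subset_Icc_self hx)]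
        · simp only [indicator_of_notMem hx]
      growth := ⟨K, fun r z => by
        by_cases hr : r ∈ Ioc s (s + T)
        · simp only [indicator_of_mem hr]
          exact ((hbd r (hs.trans hr.1.le)).2 z z).2.2
        · simp only [indicator_of_notMem hr, norm_zero]
          positivity⟩ }
  refine ⟨S, rfl, fun r hr z => ⟨?_, ?_⟩, fun r hr z => ?_⟩
  · change sqMat d σ (tclamp s T r) z = _
    rw [tclamp_eq (Ioc_subset_Icc_self hr)]
  · exact indicator_of_mem hr fun r => b r z
  · change θ (tclamp s T r) s z = _
    rw [tclamp_eq hr]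

section
variable {d : ℕ} {Ω : Type*} [mΩ : MeasurableSpace Ω] {X : ℝ → Ω → Vec d}

lemma pathSigma_le (hX : ∀ t, Measurable (X t)) (s u : ℝ) : pathSigma d X s u ≤ mΩ :=
  iSup₂_le fun r _ => (hX r).comap_le

lemma pathSigma_mono (s : ℝ) {u v : ℝ} (h : u ≤ v) : pathSigma d X s u ≤ pathSigma d X s v :=
  biSup_mono fun _ hr => Icc_subset_Icc_right h hr

lemma measurableSet_pathSigma {s u r : ℝ} (hr : r ∈ Icc s u) {B : Set (Vec d)}
    (hB : MeasurableSet B) : MeasurableSet[pathSigma d X s u] (X r ⁻¹' B) :=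
  (le_iSup₂_of_le (f := fun r (_ : r ∈ Icc s u) => MeasurableSpace.comap (X r) inferInstance)
    r hr le_rfl) _ ⟨B, hB, rfl⟩

end

lemma Setup.gen_eq_genApply {d : ℕ} {α M T : ℝ} (S : Setup d α M T) {b : ℝ → Vec d → Vec d}
    {σ : ℝ → Vec d → Matrix (Fin d) (Fin d) ℝ} {r : ℝ}
    (h : ∀ z, S.a r z = sqMat d σ r z ∧ S.b r z = b r z) {f : Vec d → ℝ}
    (hf : ContDiff ℝ (⊤ : ℕ∞) f) (z : Vec d) : genApply d b σ r f z = S.gen r f z := by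
  unfold genApply gen
  rw [(h z).1, (h z).2]
  congr 2
  refine Finset.sum_congr rfl fun i _ => Finset.sum_congr rfl fun j _ => ?_
  congr 1
  rw [iteratedFDeriv_two_apply]
  unfold pd
  have := (hf.fderiv_right (m := (⊤ : ℕ∞)) (by simp)).differentiable (by simp) z
  rw [fderiv_clm_apply this (differentiableAt_const _)]
  simp

/-- A solution of the martingale problem satisfies Dynkin's formula on events of the past. -/
lemma MartingaleProblemSolution.dynkin {d : ℕ} {α M T : ℝ} {b : ℝ → Vec d → Vec d}
    {σ : ℝ → Vec d → Matrix (Fin d) (Fin d) ℝ} {s : ℝ} {x : Vec d}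
    {Ω : Type*} [mΩ : MeasurableSpace Ω] {P : Measure Ω} {X : ℝ → Ω → Vec d}
    (h : MartingaleProblemSolution d b σ s x P X) (S : Setup d α M T)
    (hS : ∀ r ∈ Ioc s (s + T), ∀ z, S.a r z = sqMat d σ r z ∧ S.b r z = b r z)
    {u t : ℝ} (hu : s ≤ u) (ht : t ≤ s + T) {A : Set Ω}
    (hA : MeasurableSet[pathSigma d X s u] A) :
    S.Dynkin (P.restrict A) u t (fun r ω => X (max s r) ω) := by
  have := h.isProb
  have cont : ∀ ω, Continuous fun r => X (max s r) ω := fun ω =>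
    (h.cont_paths ω).comp_continuous (by fun_prop) fun r => le_max_left s r
  have meas : Measurable fun q : ℝ × Ω => X (max s q.1) q.2 := by
    have := measurable_uncurry_of_continuous_of_measurable
      (u := fun (r : ℝ) (ω : Ω) => X (max s r) ω) cont fun r => h.measurable_X _
    exact this
  refine ⟨inferInstance, meas, cont, fun f hf hc v w huv hvw hwt => ?_⟩
  have hsv : s ≤ v := hu.trans huv
  have hA' : MeasurableSet A := pathSigma_le h.measurable_X _ _ _ hA
  obtain ⟨B, hB⟩ : ∃ B, ∀ r z, |S.gen r f z| ≤ B := by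
    obtain ⟨B0, hB0⟩ := S.growth
    choose K1 hK1 using fun i => exists_bound_of_cs (pd_contDiff i hf).continuous
      (pd_hasCompactSupport i hc)
    choose K2 hK2 using fun i j => exists_bound_of_cs (pd_contDiff i (pd_contDiff j hf)).continuous
      (pd_hasCompactSupport i (pd_hasCompactSupport j hc))
    refine ⟨_, fun r z => S.gen_bound hB0 (B1 := ∑ i, |K1 i|) (B2 := ∑ i, ∑ j, |K2 i j|)
      (fun z i => ?_) (fun z i j => ?_) r z⟩
    · exact (hK1 i z).trans ((le_abs_self _).trans (Finset.single_le_sum (f := fun i => |K1 i|)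
        (fun i _ => abs_nonneg _) (Finset.mem_univ i)))
    · have a2 := Finset.single_le_sum (f := fun i => ∑ j, |K2 i j|)
        (fun i _ => Finset.sum_nonneg fun j _ => abs_nonneg _) (Finset.mem_univ i)
      have a3 := Finset.single_le_sum (f := fun j => |K2 i j|)
        (fun j _ => abs_nonneg _) (Finset.mem_univ j)
      have a4 := hK2 i j z
      have a5 : |pd i (pd j f) z| ≤ (1 + ‖z‖) * |pd i (pd j f) z| :=
        le_mul_of_one_le_left (abs_nonneg _) (by linarith [norm_nonneg z])
      linarith [le_abs_self (K2 i j)]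
  have gm : Measurable fun q : ℝ × Ω => S.gen q.1 f (X (max s q.1) q.2) :=
    (S.gen_measurable hf).comp (measurable_fst.prodMk meas)
  have gi : ∀ (Q : Measure Ω) [IsFiniteMeasure Q] (v' w' : ℝ),
      Integrable (fun q : ℝ × Ω => S.gen q.1 f (X (max s q.1) q.2))
        ((volume.restrict (Ioc v' w')).prod Q) := fun Q _ v' w' =>
    Integrable.of_bound gm.aestronglyMeasurable B
      (Filter.Eventually.of_forall fun q => hB _ _)
  have gen_eq : ∀ w', s ≤ w' → w' ≤ t → ∀ ω, (∫ r in s..w', genApply d b σ r f (X r ω)) =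
      ∫ r in s..w', S.gen r f (X (max s r) ω) := fun w' h1 h2 ω => by
    rw [intervalIntegral.integral_of_le h1, intervalIntegral.integral_of_le h1]
    refine setIntegral_congr_fun measurableSet_Ioc fun r hr => ?_
    rw [S.gen_eq_genApply (hS r ⟨hr.1, hr.2.trans (h2.trans ht)⟩) hf, max_eq_right hr.1.le]
  have ii : ∀ (ω : Ω) (v' w' : ℝ),
      IntervalIntegrable (fun r => S.gen r f (X (max s r) ω)) volume v' w' := fun ω v' w' =>
    intervalIntegrable_iff.2 (Measure.integrableOn_of_bounded (M := B)
      (by simp) (gm.comp (measurable_id.prodMk measurable_const)).aestronglyMeasurable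
      (Filter.Eventually.of_forall fun r => hB _ _))
  have fi : ∀ r, Integrable (fun ω => f (X r ω)) (P.restrict A) := fun r => by
    obtain ⟨C, hC⟩ := hf.continuous.bounded_above_of_compact_support hc
    exact Integrable.of_bound (hf.continuous.measurable.comp (h.measurable_X r)).aestronglyMeasurable
      C (Filter.Eventually.of_forall fun ω => hC _)
  have Ii : ∀ v' w' : ℝ, v' ≤ w' → Integrable (fun ω => ∫ r in v'..w', S.gen r f (X (max s r) ω))
      (P.restrict A) := fun v' w' hvw' => by
    simp only [intervalIntegral.integral_of_le hvw']
    exact (gi _ v' w').integral_prod_right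
  have key := h.martingale f hf hc v w hsv hvw A (pathSigma_mono s huv _ hA)
  simp only [gen_eq w (hsv.trans hvw) hwt, gen_eq v hsv (hvw.trans hwt)] at key
  rw [integral_sub (fi w) (Ii s w (hsv.trans hvw)), integral_sub (fi v) (Ii s v hsv)] at key
  have e1 : (∫ ω in A, (∫ r in s..w, S.gen r f (X (max s r) ω)) ∂P) -
      ∫ ω in A, (∫ r in s..v, S.gen r f (X (max s r) ω)) ∂P =
      ∫ ω in A, (∫ r in v..w, S.gen r f (X (max s r) ω)) ∂P := by
    rw [← integral_sub (Ii s w (hsv.trans hvw)) (Ii s v hsv)]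
    congr 1 with ω
    exact intervalIntegral.integral_interval_sub_left (ii ω _ _) (ii ω _ _)
  have e2 : ∫ ω in A, (∫ r in v..w, S.gen r f (X (max s r) ω)) ∂P =
      ∫ r in v..w, (∫ ω in A, S.gen r f (X (max s r) ω) ∂P) := by
    simp only [intervalIntegral.integral_of_le hvw]
    exact (integral_integral_swap (f := fun r ω => S.gen r f (X (max s r) ω)) (gi _ v w)).symm
  rw [max_eq_right (hsv.trans hvw), max_eq_right hsv, ← e2, ← e1]
  linarith

lemma omg_le_inv_pow {d : ℕ} {τ D : ℝ} (hτ : 0 < τ) (hD : 0 ≤ D) : omg d τ D ≤ (√τ ^ d)⁻¹ := by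
  have s := Real.sqrt_pos.2 hτ
  unfold omg
  rw [inv_eq_one_div, div_le_div_iff₀ (by positivity) (by positivity), one_mul, ← pow_succ']
  gcongr
  linarith

namespace Setup
variable {d : ℕ} {α M T : ℝ}

/-- Over short times, the mass put on a set close to the (transported) starting point is
positive. -/
lemma exists_pos_step (d : ℕ) {α M T R : ℝ} (hα : α ∈ Ioc (0 : ℝ) 1) (hM : 1 ≤ M) :
    ∃ δ > (0 : ℝ), ∀ S : Setup d α M T, ∀ {Ω : Type*} [MeasurableSpace Ω] (P : Measure Ω)
      (Y : ℝ → Ω → Vec d) (u v : ℝ), S.Duh P u v Y → v - u ≤ δ → P ≠ 0 →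
      ∀ A : Set (Vec d), MeasurableSet A → volume A ≠ 0 → volume A ≠ ∞ →
      (∀ᵐ ω ∂P, ∀ y ∈ A, S.Dm (u, Y u ω) (v, y) ≤ R * √(v - u)) → P (Y v ⁻¹' A) ≠ 0 := by
  obtain ⟨K, hK, hk⟩ := exists_kernel_bounds d T hα hM
  obtain ⟨C, hC, hG⟩ := exists_lintegral_kk_G d (T := T) hα hM one_pos le_rfl
  obtain ⟨c, hc, hl⟩ := exists_ga_lower d (R := M * R) hM
  have hM0 : 0 < M := by linarith
  have hK0 : 0 < K := by linarith
  have hα0 : 0 < α / 2 := half_pos hα.1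
  refine ⟨(c / (4 * (K * C))) ^ (α / 2)⁻¹, by positivity,
    fun S Ω _ P Y u v h hδ hP A hA hA0 hA1 hY => ?_⟩
  have := h.fin
  have hτ : 0 < v - u := sub_pos.2 h.ut
  have hs := Real.sqrt_pos.2 hτ
  set V := (volume A).toReal with hV
  have hV0 : 0 < V := ENNReal.toReal_pos hA0 hA1
  have hp : (v - u) ^ (α / 2) ≤ c / (4 * (K * C)) := by
    refine (Real.rpow_le_rpow hτ.le hδ hα0.le).trans ?_
    rw [← Real.rpow_mul (by positivity), inv_mul_cancel₀ hα0.ne', Real.rpow_one]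
  set L := (√(v - u) ^ d)⁻¹ with hL
  have hL0 : 0 < L := by positivity
  have hYu : Measurable (Y u) := h.meas.comp (measurable_const.prodMk measurable_id)
  -- correction terms
  have corr : ∀ n x, ‖∫ e, S.pk (u, x) e * S.G v A n e‖ ≤ c / 4 * (1 / 2) ^ n * (L * V) := by
    intro n x
    have e1 : ∫⁻ y in A, S.kk (1 + α / 2) (u, x) (v, y) ≤
        ENNReal.ofReal ((v - u) ^ (α / 2) * (L * V)) := by
      calc _ ≤ ∫⁻ _ in A, ENNReal.ofReal ((v - u) ^ (α / 2) * L) := by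
            refine lintegral_mono fun y => ?_
            unfold kk
            split_ifs
            · apply ENNReal.ofReal_le_ofReal
              rw [add_sub_cancel_left]
              gcongr
              exact (Wk_le_omg S.rt_pos.le hτ (S.Dm_nonneg _ _)).trans
                (omg_le_inv_pow hτ (S.Dm_nonneg _ _))
            · exact zero_le
        _ = _ := by
            rw [setLIntegral_const, ← mul_assoc, ENNReal.ofReal_mul (by positivity : 0 ≤ (v - u) ^ (α / 2) * L),
              hV, ENNReal.ofReal_toReal hA1]
    have e2 : ‖∫ e, S.pk (u, x) e * S.G v A n e‖ₑ ≤
        ENNReal.ofReal (K * (C * (1 / 2) ^ n * ((v - u) ^ (α / 2) * (L * V)))) := by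
      calc _ ≤ ∫⁻ e, ‖S.pk (u, x) e * S.G v A n e‖ₑ := enorm_integral_le_lintegral_enorm _
        _ ≤ ∫⁻ e, ENNReal.ofReal K * (S.kk 1 (u, x) e * ‖S.G v A n e‖ₑ) := by
            refine lintegral_mono fun e => ?_
            rw [enorm_mul, ← mul_assoc]
            exact mul_le_mul' (hk S _ _).1 le_rfl
        _ = ENNReal.ofReal K * ∫⁻ e, (S.kk 1 (u, x) e * ‖S.G v A n e‖ₑ) :=
            lintegral_const_mul' _ _ ENNReal.ofReal_ne_top
        _ ≤ _ := by
            rw [ENNReal.ofReal_mul hK0.le, ENNReal.ofReal_mul (by positivity : 0 ≤ C * (1 / 2) ^ n)]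
            exact mul_le_mul' le_rfl ((hG S v A n (u, x)).trans (mul_le_mul' le_rfl e1))
    rw [← ofReal_norm, ENNReal.ofReal_le_ofReal_iff (by positivity)] at e2
    refine e2.trans ?_
    calc _ = K * C * (v - u) ^ (α / 2) * ((1 / 2) ^ n * (L * V)) := by ring
      _ ≤ K * C * (c / (4 * (K * C))) * ((1 / 2) ^ n * (L * V)) := by gcongr
      _ = _ := by field_simp
  -- main term
  have main : ∀ᵐ ω ∂P, c * (L * V) ≤ ∫ y in A, S.pk (u, Y u ω) (v, y) := by
    filter_upwards [hY] with ω hω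
    calc c * (L * V) = ∫ _ in A, c * L := by
          rw [setIntegral_const, smul_eq_mul, Measure.real]; ring
      _ ≤ _ := by
          refine setIntegral_mono_on (integrableOn_const hA1) (S.pk_integrable u v _).integrableOn hA
            fun y hy => ?_
          have ho : S.Ok (u, Y u ω) (v, y) := ⟨h.su, h.ut, h.tT⟩
          rw [pk, if_pos ho]
          have q := S.Cov_qb le_rfl h.ut.le (S.π v y)
          rw [add_zero] at q
          refine hl _ hτ _ q _ ((S.le_Dm (u, Y u ω) (v, y)).trans ?_)
          rw [mul_assoc]
          gcongr
          exact hω y hy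
  set p := P.real univ with hp'
  have hp0 : 0 < p := by
    rw [hp', measureReal_def]
    exact ENNReal.toReal_pos (by simpa using hP) (measure_ne_top _ _)
  have i1 : Integrable (fun ω => ∫ y in A, S.pk (u, Y u ω) (v, y)) P := by
    obtain ⟨C', hC', hc'⟩ := exists_lintegral_kk d hM
    refine Integrable.of_bound (C := K * C') ?_ (Filter.Eventually.of_forall fun ω => ?_)
    · exact (StronglyMeasurable.integral_prod_right' (f := fun q : Ω × Vec d =>
        S.pk (u, Y u q.1) (v, q.2)) (S.pk_measurable
          (measurable_const.prodMk (hYu.comp measurable_fst))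
          (measurable_const.prodMk measurable_snd)).stronglyMeasurable).aestronglyMeasurable
    · have : ‖∫ y in A, S.pk (u, Y u ω) (v, y)‖ₑ ≤ ENNReal.ofReal (K * C') := by
        calc _ ≤ ∫⁻ y in A, ‖S.pk (u, Y u ω) (v, y)‖ₑ := enorm_integral_le_lintegral_enorm _
          _ ≤ ∫⁻ y, ‖S.pk (u, Y u ω) (v, y)‖ₑ := setLIntegral_le_lintegral _ _
          _ ≤ ∫⁻ y, ENNReal.ofReal K * S.kk 1 (u, Y u ω) (v, y) :=
              lintegral_mono fun y => (hk S _ _).1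
          _ = ENNReal.ofReal K * ∫⁻ y, S.kk 1 (u, Y u ω) (v, y) :=
              lintegral_const_mul' _ _ ENNReal.ofReal_ne_top
          _ ≤ _ := by
              rw [ENNReal.ofReal_mul hK0.le]
              refine mul_le_mul' le_rfl ((hc' S _ _ _).trans ?_)
              simp
      rwa [← ofReal_norm, ENNReal.ofReal_le_ofReal_iff (by positivity)] at this
  have b1 : c * (L * V) * p ≤ ∫ ω, (∫ y in A, S.pk (u, Y u ω) (v, y)) ∂P := by
    calc _ = ∫ _, c * (L * V) ∂P := by rw [integral_const, smul_eq_mul]; ring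
      _ ≤ _ := integral_mono_ae (integrable_const _) i1 main
  have b2 : ∀ N : ℕ, |∑ n ∈ Finset.range N, ∫ ω, (∫ e, S.pk (u, Y u ω) e * S.G v A n e) ∂P| ≤
      c / 2 * (L * V) * p := by
    intro N
    have g : ∑ n ∈ Finset.range N, ((1 : ℝ) / 2) ^ n ≤ 2 := by
      have := Summable.sum_le_tsum (Finset.range N) (fun n _ => by positivity)
        summable_geometric_two
      rwa [tsum_geometric_two] at this
    calc _ ≤ ∑ n ∈ Finset.range N, |∫ ω, (∫ e, S.pk (u, Y u ω) e * S.G v A n e) ∂P| :=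
          Finset.abs_sum_le_sum_abs _ _
      _ ≤ ∑ n ∈ Finset.range N, (c / 4 * (1 / 2) ^ n * (L * V)) * p := by
          refine Finset.sum_le_sum fun n _ => ?_
          exact norm_integral_le_of_norm_le_const (Filter.Eventually.of_forall fun ω => corr n _)
      _ = c / 4 * (L * V) * p * ∑ n ∈ Finset.range N, ((1 : ℝ) / 2) ^ n := by
          rw [Finset.mul_sum]
          exact Finset.sum_congr rfl fun n _ => by ring
      _ ≤ c / 4 * (L * V) * p * 2 := by gcongr
      _ = _ := by ring
  have lim := ge_of_tendsto' (b := c / 2 * (L * V) * p) (h.tendsto_series hA) fun N => by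
    have := (abs_le.1 (b2 N)).1
    linarith
  have : 0 < P.real (Y v ⁻¹' A) := lt_of_lt_of_le (by positivity) lim
  intro h0
  rw [measureReal_def, h0] at this
  simp at this

end Setup

/-- The law at time `t` of a solution of the martingale problem charges every open set. -/
lemma MartingaleProblemSolution.measure_preimage_ne_zero {d : ℕ} {α M T : ℝ}
    {b : ℝ → Vec d → Vec d} {σ : ℝ → Vec d → Matrix (Fin d) (Fin d) ℝ} {s : ℝ} {x : Vec d}
    {Ω : Type*} [mΩ : MeasurableSpace Ω] {P : Measure Ω} {X : ℝ → Ω → Vec d}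
    (h : MartingaleProblemSolution d b σ s x P X) (S : Setup d α M T) (hs : S.s0 = s)
    (hS : ∀ r ∈ Ioc s (s + T), ∀ z, S.a r z = sqMat d σ r z ∧ S.b r z = b r z)
    {t : ℝ} (hst : s < t) (htT : t - s < T) {U : Set (Vec d)} (hU : IsOpen U) {y : Vec d}
    (hy : y ∈ U) : P (X t ⁻¹' U) ≠ 0 := by
  have := h.isProb
  obtain ⟨δ, hδ, step⟩ := Setup.exists_pos_step d (R := 3) (T := T) S.hα S.hM
  set E := S.π t y - S.π s x with hE
  -- number of steps
  obtain ⟨N, hN⟩ := exists_nat_ge (max ((t - s) / δ) (‖E‖ ^ 2 / (t - s)) + 1)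
  have hts : 0 < t - s := sub_pos.2 hst
  have hN0 : (0 : ℝ) < N := by
    have : (t - s) / δ ≤ max ((t - s) / δ) (‖E‖ ^ 2 / (t - s)) := le_max_left _ _
    have : 0 < (t - s) / δ := by positivity
    linarith
  set η := (t - s) / N with hη
  have hη0 : 0 < η := by positivity
  have hηδ : η ≤ δ := by
    rw [hη, div_le_iff₀ hN0, mul_comm, ← div_le_iff₀ hδ]
    have : (t - s) / δ ≤ max ((t - s) / δ) (‖E‖ ^ 2 / (t - s)) := le_max_left _ _
    linarith
  have hNη : N * η = t - s := by rw [hη]; field_simp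
  have hηE : (N : ℝ)⁻¹ * ‖E‖ ≤ √η := by
    apply Real.le_sqrt_of_sq_le
    have : ‖E‖ ^ 2 / (t - s) ≤ max ((t - s) / δ) (‖E‖ ^ 2 / (t - s)) := le_max_right _ _
    have h2 : ‖E‖ ^ 2 ≤ N * (t - s) := by
      rw [← div_le_iff₀ hts]; linarith
    rw [hη, mul_pow, inv_pow, inv_mul_le_iff₀ (by positivity)]
    calc _ ≤ _ := h2
      _ = _ := by field_simp
  have hsη := Real.sqrt_pos.2 hη0
  set τ : ℕ → ℝ := fun k => s + k * η with hτ
  have τ0 : τ 0 = s := by simp [hτ]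
  have τN : τ N = t := by simp only [hτ, hNη]; ring
  have τs : ∀ k, τ (k + 1) = τ k + η := fun k => by simp only [hτ]; push_cast; ring
  have τge : ∀ k, s ≤ τ k := fun k => by simp only [hτ]; nlinarith [k.cast_nonneg (α := ℝ)]
  have τle : ∀ k, k ≤ N → τ k ≤ t := fun k hk => by
    rw [← τN]
    simp only [hτ]
    gcongr
  set w : ℕ → Vec d := fun k => S.π s x + ((k : ℝ) * (N : ℝ)⁻¹) • E with hw
  have ws : ∀ k, w (k + 1) - w k = (N : ℝ)⁻¹ • E := fun k => by
    simp only [hw, add_sub_add_left_eq_sub, ← sub_smul]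
    congr 1
    push_cast
    ring
  set Bl : ℕ → Set (Vec d) := fun k => {z | ‖S.π (τ k) z - w k‖ < √η} with hBl
  have Blo : ∀ k, IsOpen (Bl k) := fun k =>
    isOpen_lt ((S.π_cont _).sub continuous_const).norm continuous_const
  have Blne : ∀ k, S.ζ (τ k) (w k) ∈ Bl k := fun k => by
    simp only [hBl, mem_ofPred_eq, S.πζ, sub_self, norm_zero]
    exact hsη
  have Blfin : ∀ k, volume (Bl k) ≠ ∞ := fun k => by
    refine ((measure_mono (t := Metric.closedBall (S.ζ (τ k) (w k)) (M * √η)) ?_).trans_lt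
      measure_closedBall_lt_top).ne
    intro z hz
    rw [mem_closedBall_iff_norm]
    have := S.ζ_lip (τ k) (S.π (τ k) z) (w k)
    rw [S.ζπ] at this
    exact this.trans (mul_le_mul_of_nonneg_left (le_of_lt hz) S.M_pos.le)
  -- one step of the chain
  set Y : ℝ → Ω → Vec d := fun r ω => X (max s r) ω with hY
  have one : ∀ k, k + 1 ≤ N → ∀ A : Set Ω, MeasurableSet[pathSigma d X s (τ k)] A → P A ≠ 0 →
      (∀ᵐ ω ∂P.restrict A, Y (τ k) ω ∈ Bl k) → ∀ U' : Set (Vec d), IsOpen U' →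
      U' ⊆ Bl (k + 1) → U'.Nonempty → P (Y (τ (k + 1)) ⁻¹' U' ∩ A) ≠ 0 := by
    intro k hk A hA hPA hAB U' hU' hsub hne
    have ht' : τ (k + 1) ≤ s + T := by linarith [τle (k + 1) hk]
    have hD := h.dynkin S hS (τge k) ht' hA
    have hdk : τ (k + 1) - τ k = η := by rw [τs]; ring
    have hduh : S.Duh (P.restrict A) (τ k) (τ (k + 1)) Y :=
      hD.duh (hs.le.trans (τge k)) (by rw [τs]; linarith) (by rw [hs]; exact ht')
        (by linarith [τge k, τle (k + 1) hk])
    have hYm : Measurable (Y (τ (k + 1))) := h.measurable_X _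
    rw [← Measure.restrict_apply (hYm hU'.measurableSet)]
    refine step S _ _ _ _ hduh (by rw [hdk]; exact hηδ) ?_ U' hU'.measurableSet
      (hU'.measure_ne_zero volume hne) (measure_ne_top_of_subset hsub (Blfin _)) ?_
    · rwa [Ne, Measure.restrict_eq_zero]
    · filter_upwards [hAB] with ω hω y' hy'
      have h1 : ‖S.π (τ k) (Y (τ k) ω) - w k‖ < √η := hω
      have h2 : ‖S.π (τ (k + 1)) y' - w (k + 1)‖ < √η := hsub hy'
      have h3 : ‖w (k + 1) - w k‖ ≤ √η := by
        rw [ws, norm_smul, Real.norm_of_nonneg (by positivity)]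
        exact hηE
      rw [hdk]
      have e : S.π (τ k) (Y (τ k) ω) - S.π (τ (k + 1)) y' =
          (S.π (τ k) (Y (τ k) ω) - w k) - (w (k + 1) - w k) - (S.π (τ (k + 1)) y' - w (k + 1)) := by
        abel
      change ‖S.π (τ k) (Y (τ k) ω) - S.π (τ (k + 1)) y'‖ ≤ _
      rw [e]
      have h4 := norm_sub_le (S.π (τ k) (Y (τ k) ω) - w k - (w (k + 1) - w k))
        (S.π (τ (k + 1)) y' - w (k + 1))
      have h5 := norm_sub_le (S.π (τ k) (Y (τ k) ω) - w k) (w (k + 1) - w k)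
      linarith
  have chain : ∀ k, k ≤ N → ∃ A : Set Ω, MeasurableSet[pathSigma d X s (τ k)] A ∧ P A ≠ 0 ∧
      ∀ᵐ ω ∂P.restrict A, Y (τ k) ω ∈ Bl k := by
    intro k
    induction k with
    | zero =>
      intro _
      refine ⟨univ, MeasurableSet.univ, by simp, ?_⟩
      rw [Measure.restrict_univ]
      filter_upwards [h.start] with ω hω
      have : Y (τ 0) ω = x := by simp only [hY, τ0, max_self, hω]
      rw [this]
      simp only [hBl, hw, mem_ofPred_eq, τ0]
      simpa using hη0
    | succ k ih =>
      intro hk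
      obtain ⟨A, hA, hPA, hAB⟩ := ih (by omega)
      have hA' : MeasurableSet A := pathSigma_le h.measurable_X _ _ _ hA
      have hYm : Measurable (Y (τ (k + 1))) := h.measurable_X _
      refine ⟨Y (τ (k + 1)) ⁻¹' Bl (k + 1) ∩ A, ?_,
        one k hk A hA hPA hAB _ (Blo _) le_rfl ⟨_, Blne _⟩, ?_⟩
      · refine MeasurableSet.inter ?_ (pathSigma_mono s (by rw [τs]; linarith) _ hA)
        have : Y (τ (k + 1)) = X (τ (k + 1)) := by
          ext1 ω
          simp only [hY, max_eq_right (τge (k + 1))]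
        rw [this]
        exact measurableSet_pathSigma ⟨τge _, le_rfl⟩ (Blo _).measurableSet
      · filter_upwards [ae_restrict_mem ((hYm (Blo _).measurableSet).inter hA')] with ω hω
        exact hω.1
  obtain ⟨n, rfl⟩ : ∃ n, N = n + 1 := Nat.exists_eq_succ_of_ne_zero (by
    rintro rfl; simp at hN0)
  obtain ⟨A, hA, hPA, hAB⟩ := chain n (by omega)
  have fin := one n le_rfl A hA hPA hAB (U ∩ Bl (n + 1)) (hU.inter (Blo _)) inter_subset_right
    ⟨y, hy, by
      simp only [hBl, hw, mem_ofPred_eq, τN]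
      rw [mul_inv_cancel₀ hN0.ne', one_smul, hE]
      simpa using hη0⟩
  intro h0
  refine fin (measure_mono_null ?_ h0)
  rintro ω ⟨h1, -⟩
  have h2 : Y (τ (n + 1)) ω ∈ U := h1.1
  simp only [hY, τN, max_eq_right hst.le] at h2
  exact h2

lemma Wk_le_gaussk {d : ℕ} {M τ D : ℝ} (hM : 1 ≤ M) (hτ : 0 < τ) {v : Vec d} (hv : ‖v‖ ≤ M * D) :
    Wk d (rt M) τ D ≤ gaussk d (rt M / M ^ 2) τ v := by
  have hM0 : 0 < M := by linarith
  have hD : 0 ≤ D := nonneg_of_mul_nonneg_right ((norm_nonneg v).trans hv) hM0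
  have hrt : 0 < rt M := by unfold rt; positivity
  unfold Wk gaussk
  have e : (√τ ^ d)⁻¹ = τ ^ (-(d : ℝ) / 2) := by
    rw [Real.sqrt_eq_rpow, ← Real.rpow_natCast, ← Real.rpow_mul hτ.le, ← Real.rpow_neg hτ.le]
    congr 1
    ring
  refine mul_le_mul ((omg_le_inv_pow hτ hD).trans e.le) (Real.exp_le_exp.2 ?_)
    (Real.exp_pos _).le (Real.rpow_nonneg hτ.le _)
  rw [neg_mul, neg_mul, neg_div, neg_div, neg_le_neg_iff, div_le_div_iff_of_pos_right hτ]
  calc rt M / M ^ 2 * ‖v‖ ^ 2 ≤ rt M / M ^ 2 * (M * D) ^ 2 := by gcongr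
    _ = _ := by field_simp

lemma MartingaleProblemSolution.density_nonneg {d : ℕ} {α M T : ℝ}
    {b : ℝ → Vec d → Vec d} {σ : ℝ → Vec d → Matrix (Fin d) (Fin d) ℝ} {s : ℝ} {x : Vec d}
    {Ω : Type*} [mΩ : MeasurableSpace Ω] {P : Measure Ω} {X : ℝ → Ω → Vec d}
    (h : MartingaleProblemSolution d b σ s x P X) (S : Setup d α M T) (hs : S.s0 = s)
    (hS : ∀ r ∈ Ioc s (s + T), ∀ z, S.a r z = sqMat d σ r z ∧ S.b r z = b r z)
    {t : ℝ} (hst : s < t) (htT : t - s < T) {q : Vec d → ℝ} (hq : Continuous q)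
    (hlaw : P.map (X t) = volume.withDensity fun y => ENNReal.ofReal (q y)) (y : Vec d) :
    0 ≤ q y := by
  by_contra! hy
  have hU : IsOpen {z | q z < 0} := isOpen_lt hq continuous_const
  refine h.measure_preimage_ne_zero S hs hS hst htT hU hy ?_
  rw [← Measure.map_apply (h.measurable_X t) hU.measurableSet, hlaw,
    withDensity_apply _ hU.measurableSet]
  refine (setLIntegral_congr_fun (g := fun _ => 0) hU.measurableSet fun z hz => ?_).trans (by simp)
  exact ENNReal.ofReal_of_nonpos (le_of_lt hz)

lemma MartingaleProblemSolution.tendsto_partialSeries {d : ℕ} {α M T : ℝ}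
    {b : ℝ → Vec d → Vec d} {σ : ℝ → Vec d → Matrix (Fin d) (Fin d) ℝ} {s : ℝ} {x : Vec d}
    {Ω : Type*} [mΩ : MeasurableSpace Ω] {P : Measure Ω} {X : ℝ → Ω → Vec d}
    (h : MartingaleProblemSolution d b σ s x P X) (S : Setup d α M T) (hs : S.s0 = s)
    (hS : ∀ r ∈ Ioc s (s + T), ∀ z, S.a r z = sqMat d σ r z ∧ S.b r z = b r z)
    {t : ℝ} (hst : s < t) (htT : t - s < T) {q : Vec d → ℝ} (hq : Continuous q)
    (hlaw : P.map (X t) = volume.withDensity fun y => ENNReal.ofReal (q y)) {A : Set (Vec d)}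
    (hA : MeasurableSet A) :
    Filter.Tendsto (fun N => S.partialSeries s t A N x) Filter.atTop (nhds (∫ y in A, q y)) := by
  have := h.isProb
  have hD := h.dynkin S hS le_rfl (by linarith : t ≤ s + T)
    (MeasurableSet.univ : MeasurableSet[pathSigma d X s s] univ)
  rw [Measure.restrict_univ] at hD
  have lim := (hD.duh hs.le hst (by rw [hs]; linarith) htT).tendsto_series hA
  have e1 : P.real ((fun ω => X (max s t) ω) ⁻¹' A) = ∫ y in A, q y := by
    rw [integral_eq_lintegral_of_nonneg_ae
      (Filter.Eventually.of_forall (h.density_nonneg S hs hS hst htT hq hlaw))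
      hq.aestronglyMeasurable, ← withDensity_apply _ hA, ← hlaw,
      Measure.map_apply (h.measurable_X t) hA, max_eq_right hst.le]
    rfl
  rw [e1] at lim
  convert lim using 2 with N
  have start : ∀ᵐ ω ∂P, X (max s s) ω = x := by rw [max_self]; exact h.start
  have const : ∀ F : Vec d → ℝ, ∫ ω, F (X (max s s) ω) ∂P = F x := fun F => by
    have : (fun ω => F (X (max s s) ω)) =ᵐ[P] fun _ => F x := by
      filter_upwards [start] with ω hω
      rw [hω]
    rw [integral_congr_ae this]
    simp
  unfold Setup.partialSeries
  rw [const fun z => ∫ y in A, S.pk (s, z) (t, y)]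
  congr 1
  exact Finset.sum_congr rfl fun n _ => (const fun z => ∫ e, S.pk (s, z) e * S.G t A n e).symm

/-- **Hölder continuity of the gradient in the backward variable.** Under
(H^σ_α) and (H^b_β), for `T > 0`, `γ₁ ∈ (0,1)`, `(s,t) ∈ 𝔻^T_0` and any family of
martingale-problem solutions with jointly continuous density `p(s,·,t,·)` which is `C¹` in
`x`, there are `C, λ > 0` depending only on `Θ = (T,α,β,κ₀,κ₁,d)` and `γ₁` with
`|∇_x p(s,x,t,y) − ∇_x p(s,x',t,y)| ≤
  C |x−x'|^{γ₁} (t−s)^{−(1+γ₁)/2} (g_λ(t−s, θ^{(1)}_{t,s}(x)−y) + g_λ(t−s, θ^{(1)}_{t,s}(x')−y))`. -/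
theorem gradient_holder_continuity_backward
    (d : ℕ) (T α β κ₀ κ₁ γ₁ : ℝ) (hT : 0 < T) (hα : α ∈ Set.Ioc (0 : ℝ) 1)
    (hβ : β ∈ Set.Icc (0 : ℝ) 1) (hκ₀ : 1 ≤ κ₀) (hκ₁ : 0 < κ₁)
    (hγ₁ : γ₁ ∈ Set.Ioo (0 : ℝ) 1) (ρ : Vec d → ℝ) (hρ : IsMollifier d ρ) :
    ∃ C > (0 : ℝ), ∃ l > (0 : ℝ),
      ∀ (b : ℝ → Vec d → Vec d) (σ : ℝ → Vec d → Matrix (Fin d) (Fin d) ℝ)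
        (θ1 : ℝ → ℝ → Vec d → Vec d),
        EllipticHolder d σ κ₀ α → HolderDrift d b κ₁ β →
        IsFlow d (mollifiedDrift d ρ 1 b) θ1 →
      ∀ s t : ℝ, 0 ≤ s → s < t → t - s < T →
      ∀ (Ω : Type) (mΩ : MeasurableSpace Ω)
        (P : Vec d → MeasureTheory.Measure Ω) (X : ℝ → Ω → Vec d),
        (∀ x : Vec d, MartingaleProblemSolution d b σ s x (P x) X) →
      ∀ p : Vec d → Vec d → ℝ,
        Continuous (fun q : Vec d × Vec d => p q.1 q.2) →
        (∀ y : Vec d, ContDiff ℝ 1 fun x => p x y) →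
        (∀ x : Vec d,
          MeasureTheory.Measure.map (X t) (P x) =
            MeasureTheory.volume.withDensity fun y => ENNReal.ofReal (p x y)) →
        ∀ x x' y : Vec d,
          ‖fderiv ℝ (fun z => p z y) x - fderiv ℝ (fun z => p z y) x'‖ ≤
            C * ‖x - x'‖ ^ γ₁ * (t - s) ^ (-(1 + γ₁) / 2) *
              (gaussk d l (t - s) (θ1 t s x - y) + gaussk d l (t - s) (θ1 t s x' - y)) := by
  obtain ⟨M, hM, setup⟩ := exists_setup d T α β κ₀ κ₁ hT hα hβ hκ₀ hκ₁ ρ hρ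
  have hM0 : 0 < M := by linarith
  obtain ⟨C, hC, key⟩ := Setup.exists_fderiv_holder d (α := α) (M := M) (T := T) hα hM hT hγ₁
  refine ⟨C, hC, rt M / M ^ 2, by unfold rt; positivity, ?_⟩
  intro b σ θ1 hσ hb hθ s t hs hst htT Ω mΩ P X hP p hp hpd hlaw x x' y
  obtain ⟨S, hs0, hS, hζ⟩ := setup b σ θ1 hσ hb hθ s hs
  have ht : t ∈ Icc s (s + T) := ⟨hst.le, by linarith⟩
  have ζs : ∀ z, S.ζ s z = z := fun z => by
    rw [hζ s ⟨le_rfl, by linarith⟩, hθ s s hs hs z, intervalIntegral.integral_same, add_zero]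
  have πs : ∀ z, S.π s z = z := fun z => by
    have := S.πζ s z
    rwa [ζs] at this
  have near : ∀ z, ‖θ1 t s z - y‖ ≤ M * S.Dm (s, z) (t, y) := fun z => by
    have := S.ζ_lip t (S.π s z) (S.π t y)
    rw [S.ζπ, πs, hζ t ht] at this
    simpa only [Setup.Dm, πs] using this
  refine (key S s t hs0.le hst (by rw [hs0]; exact ht.2) p hp
    (fun y => (hpd y).differentiable (by simp))
    (fun x A hA => (hP x).tendsto_partialSeries S hs0 hS hst htT
      (hp.comp (Continuous.prodMk_right x)) (hlaw x) hA) x x' y).trans ?_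
  have hτ : 0 < t - s := sub_pos.2 hst
  gcongr
  · exact Wk_le_gaussk hM hτ (near x)
  · exact Wk_le_gaussk hM hτ (near x')
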